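/- For every integer m ≥ 1, T(y; m) tends to a finite limit as y → ∞, and there exist constants c > 0 and C > 0 such that for all m ≥ 1 and all real y ≥ 3, |T(y; m) − lim_{y'→∞} T(y'; m)| ≤ C/(𝓛(y)^c · √ψ(m)). -/

import Mathlib

open Finset MeasureTheory Filter

/-- `M(n, z) := ∑_{d ∣ n, d ≤ z} μ(d)`. -/
noncomputable def mobM (n : ℕ) (z : ℝ) : ℤ :=
  ∑ d ∈ n.divisors.filter (fun d : ℕ => (d : ℝ) ≤ z), ArithmeticFunction.moebius d

/-- `S(x, z) := ∑_{n ≤ x} M(n, z)²`. -/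
noncomputable def Ssum (x z : ℝ) : ℝ :=
  ∑ n ∈ Finset.Icc 1 ⌊x⌋₊, ((mobM n z : ℝ)) ^ 2

/-- `S(z) := ∑_{m, n ≤ z} μ(m) μ(n) / [m, n]`. -/
noncomputable def Sz (z : ℝ) : ℝ :=
  ∑ m ∈ Finset.Icc 1 ⌊z⌋₊, ∑ n ∈ Finset.Icc 1 ⌊z⌋₊,
    ((ArithmeticFunction.moebius m : ℝ) * (ArithmeticFunction.moebius n : ℝ)) / (Nat.lcm m n : ℝ)

/-- `f(n; iτ) := ∏_{p ∣ n} |1 - p^{-iτ}|²`. -/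
noncomputable def fI (n : ℕ) (τ : ℝ) : ℝ :=
  ∏ p ∈ n.primeFactors, ‖(1 : ℂ) - (p : ℂ) ^ (-(τ * Complex.I))‖ ^ 2

/-- `f(n; s) := ∏_{p ∣ n} |1 - p^{-s}|²` for complex `s`. -/
noncomputable def fC (n : ℕ) (s : ℂ) : ℝ :=
  ∏ p ∈ n.primeFactors, ‖(1 : ℂ) - (p : ℂ) ^ (-s)‖ ^ 2

/-- The constant `L`. -/
noncomputable def Lconst : ℝ :=
  (1 / (2 * Real.pi)) *
    ∫ τ : ℝ,
      (∏' p : Nat.Primes,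
        (1 - 1 / ((p : ℕ) : ℝ)) * (1 + (fI (p : ℕ) τ - 1) / ((p : ℕ) : ℝ))) / τ ^ 2

/-- `𝓛(y) := exp{(log y)^{3/5} / (log log y)^{1/5}}`. -/
noncomputable def curlyL (y : ℝ) : ℝ :=
  Real.exp ((Real.log y) ^ ((3 : ℝ) / 5) / (Real.log (Real.log y)) ^ ((1 : ℝ) / 5))

/-- `ψ(n) := ∏_{p ∣ n} (p + 1)`. -/
def psi (n : ℕ) : ℕ := ∏ p ∈ n.primeFactors, (p + 1)

/-- `ψ_m(n) := ∏_{p ∣ n, p ∤ m} (p + 1)`. -/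
def psiM (m n : ℕ) : ℕ := ∏ p ∈ n.primeFactors.filter (fun p : ℕ => ¬ p ∣ m), (p + 1)

/-- `r(n) := ∏_{p ∣ n} (1 + 2/√p)`. -/
noncomputable def rfun (n : ℕ) : ℝ := ∏ p ∈ n.primeFactors, (1 + 2 / Real.sqrt p)

/-- `k(n)`, the squarefree kernel of `n`. -/
def ker (n : ℕ) : ℕ := ∏ p ∈ n.primeFactors, p

/-- `T(y; m) := (6/π²) ∑_{d, t ≤ y} μ(d) μ(t) / ψ([d, t, m])`. -/
noncomputable def T (y : ℝ) (m : ℕ) : ℝ :=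
  (6 / Real.pi ^ 2) *
    ∑ d ∈ Finset.Icc 1 ⌊y⌋₊, ∑ t ∈ Finset.Icc 1 ⌊y⌋₊,
      ((ArithmeticFunction.moebius d : ℝ) * (ArithmeticFunction.moebius t : ℝ)) /
        (psi (Nat.lcm (Nat.lcm d t) m) : ℝ)

/-- The constant `L(m)`. -/
noncomputable def Lm (m : ℕ) : ℝ :=
  ((Nat.totient m : ℝ) ^ 2 / (2 * Real.pi * (m : ℝ) ^ 2 * (ker m : ℝ))) *
    ∫ τ : ℝ,
      (fI m τ *
        ∏' p : {p : Nat.Primes // ¬ ((p : ℕ) ∣ m)},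
          (1 - 1 / ((p.1 : ℕ) : ℝ)) ^ 2 * (1 + fI (p.1 : ℕ) τ / ((p.1 : ℕ) : ℝ))) / τ ^ 2

/-- `B := ∏_p (1 - (3p + 1)/(p (p + 1)²))`. -/
noncomputable def Bconst : ℝ :=
  ∏' p : Nat.Primes,
    (1 - (3 * ((p : ℕ) : ℝ) + 1) / (((p : ℕ) : ℝ) * (((p : ℕ) : ℝ) + 1) ^ 2))

/-- `α(n) := ∏_{p ∣ n} (1 - p/(p² + 3p + 1))`. -/
noncomputable def alpha (n : ℕ) : ℝ :=
  ∏ p ∈ n.primeFactors, (1 - (p : ℝ) / ((p : ℝ) ^ 2 + 3 * (p : ℝ) + 1))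

namespace VK

/-- The additive energy of a map on a finite set: the number of pairs with the same value. -/
noncomputable def en {τ H : Type*} (S : Finset τ) (w : τ → H) : ℕ := by
  classical exact ((S ×ˢ S).filter (fun q => w q.1 = w q.2)).card

lemma en_eq_sum {τ H : Type*} [DecidableEq H] (S : Finset τ) (w : τ → H) (B : Finset H)
    (hB : ∀ x ∈ S, w x ∈ B) :
    en S w = ∑ h ∈ B, ((S.filter (fun x => w x = h)).card) ^ 2 := by
  classical
  unfold en
  rw [Finset.card_eq_sum_card_fiberwise (f := fun q : τ × τ => w q.1) (t := B)]
  · refine Finset.sum_congr rfl fun h _ => ?_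
    rw [sq, ← Finset.card_product]
    congr 1
    ext ⟨x, y⟩
    simp only [mem_filter, mem_product]
    constructor
    · rintro ⟨⟨⟨hx, hy⟩, h1⟩, h2⟩
      exact ⟨⟨hx, h2⟩, hy, h1 ▸ h2⟩
    · rintro ⟨⟨hx, h2⟩, hy, h1⟩
      exact ⟨⟨⟨hx, hy⟩, h2.trans h1.symm⟩, h2⟩
  · intro q hq
    simp only [coe_filter, mem_product, Set.mem_ofPred_eq] at hq
    exact hB _ hq.1.1

lemma en_union {τ H κ : Type*} (S : Finset τ) (w : τ → H) (I : Finset κ) (F : κ → Finset τ)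
    (hS : ∀ x ∈ S, ∃ i ∈ I, x ∈ F i) :
    en S w ≤ I.card * ∑ i ∈ I, en (F i) w := by
  classical
  set B : Finset H := S.image w ∪ I.biUnion (fun i => (F i).image w)
  rw [en_eq_sum S w B (fun x hx => mem_union_left _ (mem_image_of_mem _ hx))]
  have h2 : ∀ i ∈ I, en (F i) w = ∑ h ∈ B, (((F i).filter (fun x => w x = h)).card) ^ 2 := by
    intro i hi
    exact en_eq_sum _ w B (fun x hx => mem_union_right _
      (mem_biUnion.2 ⟨i, hi, mem_image_of_mem _ hx⟩))
  rw [Finset.sum_congr rfl h2, Finset.sum_comm, Finset.mul_sum]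
  refine Finset.sum_le_sum fun h _ => ?_
  refine le_trans (Nat.pow_le_pow_left ?_ 2) (sq_sum_le_card_mul_sum_sq (s := I)
    (f := fun i => ((F i).filter (fun x => w x = h)).card))
  refine le_trans (Finset.card_le_card (t := I.biUnion fun i => (F i).filter (fun x => w x = h)) ?_)
    Finset.card_biUnion_le
  intro x hx
  simp only [mem_filter] at hx
  obtain ⟨i, hi, hxi⟩ := hS x hx.1
  exact mem_biUnion.2 ⟨i, hi, mem_filter.2 ⟨hxi, hx.2⟩⟩

/-- Energies can be compared along a map that is injective and reflects coincidences. -/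
lemma en_le_of_map {τ τ' H H' : Type*} (S : Finset τ) (S' : Finset τ') (w : τ → H) (w' : τ' → H')
    (f : τ → τ') (hf : ∀ x ∈ S, f x ∈ S') (hinj : ∀ x ∈ S, ∀ y ∈ S, f x = f y → x = y)
    (h : ∀ x ∈ S, ∀ y ∈ S, w x = w y → w' (f x) = w' (f y)) : en S w ≤ en S' w' := by
  classical
  unfold en
  refine Finset.card_le_card_of_injOn (fun q => (f q.1, f q.2)) ?_ ?_
  · intro q hq
    simp only [coe_filter, mem_product, Set.mem_ofPred_eq] at hq ⊢
    exact ⟨⟨hf _ hq.1.1, hf _ hq.1.2⟩, h _ hq.1.1 _ hq.1.2 hq.2⟩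
  · intro q hq r hr hqr
    simp only [coe_filter, mem_product, Set.mem_ofPred_eq, Prod.mk.injEq] at hq hr hqr
    exact Prod.ext (hinj _ hq.1.1 _ hr.1.1 hqr.1) (hinj _ hq.1.2 _ hr.1.2 hqr.2)

lemma en_le_card_sq {τ H : Type*} (S : Finset τ) (w : τ → H) : en S w ≤ S.card ^ 2 := by
  classical
  unfold en
  refine (Finset.card_filter_le _ _).trans ?_
  rw [card_product, sq]

lemma card_mul_en {τ G : Type*} [AddCommGroup G] [Fintype G] (S : Finset τ) (w : τ → G) :
    (Fintype.card G : ℝ) * en S w = ∑ ψ : AddChar G ℂ, ‖∑ x ∈ S, ψ (w x)‖ ^ 2 := by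
  classical
  have key : ∀ ψ : AddChar G ℂ, ((‖∑ x ∈ S, ψ (w x)‖ ^ 2 : ℝ) : ℂ)
      = ∑ q ∈ S ×ˢ S, ψ (w q.1 - w q.2) := by
    intro ψ
    rw [Complex.ofReal_pow, ← Complex.mul_conj', map_sum, Finset.sum_mul_sum, Finset.sum_product]
    refine Finset.sum_congr rfl fun x _ => Finset.sum_congr rfl fun y _ => ?_
    rw [sub_eq_add_neg, AddChar.map_add_eq_mul, ← AddChar.map_neg_eq_conj]
  have : ((Fintype.card G : ℝ) * en S w : ℂ) = ((∑ ψ : AddChar G ℂ, ‖∑ x ∈ S, ψ (w x)‖ ^ 2 : ℝ) : ℂ) := by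
    rw [Complex.ofReal_sum, Finset.sum_congr rfl (fun ψ _ => key ψ), Finset.sum_comm]
    simp_rw [AddChar.sum_apply_eq_ite, sub_eq_zero]
    rw [← Finset.sum_filter, Finset.sum_const]
    unfold en
    simp only [nsmul_eq_mul, Complex.ofReal_natCast]
    rw [mul_comm]
  exact_mod_cast this

lemma addChar_sum {G ι : Type*} [AddCommGroup G] (ψ : AddChar G ℂ) (S : Finset ι) (f : ι → G) :
    ψ (∑ i ∈ S, f i) = ∏ i ∈ S, ψ (f i) := by
  classical
  induction S using Finset.induction_on with
  | empty => simp
  | insert a S ha ih => rw [sum_insert ha, prod_insert ha, AddChar.map_add_eq_mul, ih]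

lemma hoelder_finite {τ ι κ G : Type*} [AddCommGroup G] [Fintype G] [DecidableEq κ]
    (T : Finset τ) (z : τ → G) (A : Finset ι) (v : ι → G) (c : ι → κ) (K : Finset κ)
    (hc : ∀ x ∈ A, c x ∈ K) (s : ℕ) (hs : 1 ≤ s) :
    en (T ×ˢ Fintype.piFinset (fun _ : Fin s => A)) (fun q => z q.1 + ∑ i, v (q.2 i)) ≤
      K.card ^ (2 * s - 1) * ∑ a ∈ K,
        en (T ×ˢ Fintype.piFinset (fun _ : Fin s => A.filter (fun x => c x = a)))
          (fun q => z q.1 + ∑ i, v (q.2 i)) := by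
  classical
  have fac : ∀ (B : Finset ι) (ψ : AddChar G ℂ),
      ∑ q ∈ T ×ˢ Fintype.piFinset (fun _ : Fin s => B), ψ (z q.1 + ∑ i, v (q.2 i))
        = (∑ g ∈ T, ψ (z g)) * (∑ x ∈ B, ψ (v x)) ^ s := by
    intro B ψ
    rw [Finset.sum_product]
    have : (∑ x ∈ B, ψ (v x)) ^ s = ∑ y ∈ Fintype.piFinset (fun _ : Fin s => B), ∏ i, ψ (v (y i)) := by
      rw [← Finset.prod_univ_sum (fun _ : Fin s => B) (fun _ x => ψ (v x))]
      simp
    rw [this, Finset.sum_mul_sum]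
    refine Finset.sum_congr rfl fun x _ => Finset.sum_congr rfl fun y _ => ?_
    rw [AddChar.map_add_eq_mul]
    congr 1
    exact addChar_sum ψ _ _
  have hcard : (0 : ℝ) < Fintype.card G := by exact_mod_cast Fintype.card_pos
  have : (Fintype.card G : ℝ) * en (T ×ˢ Fintype.piFinset (fun _ : Fin s => A))
      (fun q => z q.1 + ∑ i, v (q.2 i)) ≤ (Fintype.card G : ℝ) * ((K.card ^ (2 * s - 1) * ∑ a ∈ K,
        en (T ×ˢ Fintype.piFinset (fun _ : Fin s => A.filter (fun x => c x = a)))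
          (fun q => z q.1 + ∑ i, v (q.2 i)) : ℕ) : ℝ) := by
    push_cast
    rw [mul_left_comm, Finset.mul_sum]
    simp_rw [card_mul_en, fac]
    rw [Finset.sum_comm, Finset.mul_sum]
    refine Finset.sum_le_sum fun ψ _ => ?_
    have h1 : ∑ x ∈ A, ψ (v x) = ∑ a ∈ K, ∑ x ∈ A.filter (fun x => c x = a), ψ (v x) :=
      (Finset.sum_fiberwise_of_maps_to hc _).symm
    have h2 : ‖∑ x ∈ A, ψ (v x)‖ ^ (2 * s) ≤ (K.card : ℝ) ^ (2 * s - 1) *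
        ∑ a ∈ K, ‖∑ x ∈ A.filter (fun x => c x = a), ψ (v x)‖ ^ (2 * s) := by
      obtain ⟨r, hr⟩ : ∃ r, 2 * s = r + 1 := ⟨2 * s - 1, by omega⟩
      rw [h1, hr, Nat.add_sub_cancel]
      refine (pow_le_pow_left₀ (norm_nonneg _) (norm_sum_le _ _) _).trans ?_
      rcases K.eq_empty_or_nonempty with rfl | hK
      · simp
      have := pow_sum_div_card_le_sum_pow (s := K)
        (f := fun a => ‖∑ x ∈ A.filter (fun x => c x = a), ψ (v x)‖) (fun _ _ => norm_nonneg _) r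
      rw [div_le_iff₀ (by have := hK.card_pos; positivity)] at this
      linarith
    simp_rw [norm_mul, mul_pow, norm_pow, ← pow_mul, ← Finset.mul_sum]
    simp_rw [mul_comm s 2]
    calc _ ≤ ‖∑ g ∈ T, ψ (z g)‖ ^ 2 * ((K.card : ℝ) ^ (2 * s - 1) *
        ∑ a ∈ K, ‖∑ x ∈ A.filter (fun x => c x = a), ψ (v x)‖ ^ (2 * s)) := by gcongr
      _ = _ := by ring
  exact_mod_cast le_of_mul_le_mul_left this hcard

/-- A finite set of integer vectors embeds into `(ℤ/Q)ⁿ` for some `Q`. -/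
lemma exists_modulus {n : ℕ} (B : Finset (Fin n → ℤ)) : ∃ Q : ℕ, 0 < Q ∧
    ∀ x ∈ B, ∀ y ∈ B, (fun j => (x j : ZMod Q)) = (fun j => (y j : ZMod Q)) → x = y := by
  classical
  set M : ℕ := ∑ x ∈ B, ∑ j, (x j).natAbs
  refine ⟨2 * M + 1, by omega, fun x hx y hy h => funext fun j => ?_⟩
  have bd : ∀ x ∈ B, (x j).natAbs ≤ M := fun x hx =>
    (Finset.single_le_sum (f := fun j => (x j).natAbs) (fun _ _ => Nat.zero_le _) (mem_univ j)).trans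
    (Finset.single_le_sum (f := fun x : Fin n → ℤ => ∑ j, (x j).natAbs) (fun _ _ => Nat.zero_le _) hx)
  have h1 := congrFun h j
  rw [ZMod.intCast_eq_intCast_iff_dvd_sub] at h1
  have b1 := bd x hx
  have b2 := bd y hy
  have := Int.eq_zero_of_abs_lt_dvd h1 (by rw [abs_lt]; constructor <;> push_cast <;> omega)
  omega

lemma hoelder_int {τ ι κ : Type*} [DecidableEq κ] {n : ℕ}
    (T : Finset τ) (z : τ → Fin n → ℤ) (A : Finset ι) (v : ι → Fin n → ℤ) (c : ι → κ) (K : Finset κ)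
    (hc : ∀ x ∈ A, c x ∈ K) (s : ℕ) (hs : 1 ≤ s) :
    en (T ×ˢ Fintype.piFinset (fun _ : Fin s => A)) (fun q => z q.1 + ∑ i, v (q.2 i)) ≤
      K.card ^ (2 * s - 1) * ∑ a ∈ K,
        en (T ×ˢ Fintype.piFinset (fun _ : Fin s => A.filter (fun x => c x = a)))
          (fun q => z q.1 + ∑ i, v (q.2 i)) := by
  classical
  obtain ⟨Q, hQ, hinj⟩ := exists_modulus
    ((T ×ˢ Fintype.piFinset (fun _ : Fin s => A)).image (fun q => z q.1 + ∑ i, v (q.2 i)))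
  have : NeZero Q := ⟨hQ.ne'⟩
  set φ : (Fin n → ℤ) → (Fin n → ZMod Q) := fun x j => (x j : ZMod Q)
  have hφ : ∀ (q : τ × (Fin s → ι)), φ (z q.1 + ∑ i, v (q.2 i)) = φ (z q.1) + ∑ i, φ (v (q.2 i)) := by
    intro q
    funext j
    simp [φ, Finset.sum_apply]
  have H := hoelder_finite T (fun g => φ (z g)) A (fun x => φ (v x)) c K hc s hs
  have e1 : en (T ×ˢ Fintype.piFinset (fun _ : Fin s => A)) (fun q => z q.1 + ∑ i, v (q.2 i)) ≤
      en (T ×ˢ Fintype.piFinset (fun _ : Fin s => A)) (fun q => φ (z q.1) + ∑ i, φ (v (q.2 i))) := by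
    refine en_le_of_map _ _ _ _ id (fun x hx => hx) (fun _ _ _ _ h => h) (fun x _ y _ h => ?_)
    simp only [id, ← hφ]
    rw [h]
  refine e1.trans (H.trans ?_)
  refine Nat.mul_le_mul le_rfl (Finset.sum_le_sum fun a _ => ?_)
  have sub : ∀ x ∈ (T ×ˢ Fintype.piFinset (fun _ : Fin s => A.filter (fun x => c x = a))),
      x ∈ (T ×ˢ Fintype.piFinset (fun _ : Fin s => A)) := by
    intro x hx
    simp only [mem_product, Fintype.mem_piFinset, mem_filter] at hx ⊢
    exact ⟨hx.1, fun i => (hx.2 i).1⟩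
  refine en_le_of_map _ _ _ _ id (fun x hx => hx) (fun _ _ _ _ h => h) (fun x hx y hy h => ?_)
  simp only [← hφ] at h
  exact hinj _ (mem_image_of_mem _ (sub x hx)) _ (mem_image_of_mem _ (sub y hy)) h

lemma multiset_esymm_eq {R : Type*} [CommRing R] {n : ℕ} (f g : Fin n → R)
    (hu : ∀ k : ℕ, 1 ≤ k → k ≤ n → IsUnit (k : R))
    (h : ∀ j : ℕ, 1 ≤ j → j ≤ n → ∑ i, f i ^ j = ∑ i, g i ^ j) (k : ℕ) (hk : k ≤ n) :
    (univ.val.map f).esymm k = (univ.val.map g).esymm k := by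
  have key : ∀ u : Fin n → R, ∀ k : ℕ, (k : R) * (univ.val.map u).esymm k = (-1) ^ (k + 1) *
      ∑ a ∈ (antidiagonal k).filter (fun a => a.1 < k),
        (-1) ^ a.1 * (univ.val.map u).esymm a.1 * ∑ i, u i ^ a.2 := by
    intro u k
    have := congrArg (MvPolynomial.aeval u) (MvPolynomial.mul_esymm_eq_sum (Fin n) R k)
    simp only [map_mul, map_sum, map_pow, map_neg, map_one, map_natCast,
      MvPolynomial.aeval_esymm_eq_multiset_esymm, MvPolynomial.psum, MvPolynomial.aeval_X] at this
    exact this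
  induction k using Nat.strong_induction_on with
  | _ k ih =>
    rcases Nat.eq_zero_or_pos k with rfl | hk0
    · simp [Multiset.esymm]
    · refine (hu k hk0 hk).mul_left_cancel ?_
      rw [key f, key g]
      congr 1
      refine Finset.sum_congr rfl fun a ha => ?_
      simp only [mem_filter, HasAntidiagonal.mem_antidiagonal] at ha
      rw [ih a.1 ha.2 (by omega), h a.2 (by omega) (by omega)]

lemma prod_sub_eq {R : Type*} [CommRing R] {n : ℕ} (f g : Fin n → R)
    (hu : ∀ k : ℕ, 1 ≤ k → k ≤ n → IsUnit (k : R))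
    (h : ∀ j : ℕ, 1 ≤ j → j ≤ n → ∑ i, f i ^ j = ∑ i, g i ^ j) (z : R) :
    ∏ i, (z - f i) = ∏ i, (z - g i) := by
  have key : ∀ u : Fin n → R, ∏ i, (z - u i) = ∑ j ∈ Finset.range (n + 1),
      (-1) ^ j * ((univ.val.map u).esymm j * z ^ (n - j)) := by
    intro u
    have := congrArg (Polynomial.eval z) (Multiset.prod_X_sub_X_eq_sum_esymm (univ.val.map u))
    rw [Polynomial.eval_multiset_prod, Polynomial.eval_finsetSum] at this
    simpa [Multiset.map_map, Function.comp_def, Finset.prod] using this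
  rw [key f, key g]
  refine Finset.sum_congr rfl fun j hj => ?_
  rw [multiset_esymm_eq f g hu h j (by simpa [Nat.lt_succ_iff] using hj)]

lemma isUnit_intCast_of_not_dvd {p n : ℕ} (hp : p.Prime) {z : ℤ} (hz : ¬ (p : ℤ) ∣ z) :
    IsUnit (z : ZMod (p ^ n)) := by
  have h2 : IsCoprime z ((p ^ n : ℕ) : ℤ) := by
    push_cast
    refine IsCoprime.pow_right (IsCoprime.symm ?_)
    exact (Prime.coprime_iff_not_dvd (Nat.prime_iff_prime_int.1 hp)).2 hz
  obtain ⟨a, b, hab⟩ := h2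
  refine IsUnit.of_mul_eq_one_right (a : ZMod (p ^ n)) ?_
  have := congrArg (fun t : ℤ => (t : ZMod (p ^ n))) hab
  push_cast at this
  have h0 : ((p : ZMod (p ^ n))) ^ n = 0 := by exact_mod_cast ZMod.natCast_self (p ^ n)
  simpa [h0] using this

lemma exists_perm_of_powerSums {p n : ℕ} (hp : p.Prime) (hn : n < p) (x y : Fin n → ℤ)
    (hx : ∀ i j, (p : ℤ) ∣ x i - x j → i = j) (hy : ∀ i j, (p : ℤ) ∣ y i - y j → i = j)
    (h : ∀ j : ℕ, 1 ≤ j → j ≤ n → ((p ^ n : ℕ) : ℤ) ∣ ∑ i, x i ^ j - ∑ i, y i ^ j) :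
    ∃ σ : Equiv.Perm (Fin n), ∀ i, ((p ^ n : ℕ) : ℤ) ∣ y i - x (σ i) := by
  have hex : ∀ k, ∃ i, ((p ^ n : ℕ) : ℤ) ∣ y k - x i := by
    intro k
    have hprod : ∏ i, (((y k - x i : ℤ)) : ZMod (p ^ n)) = 0 := by
      have := prod_sub_eq (fun i => (x i : ZMod (p ^ n))) (fun i => (y i : ZMod (p ^ n))) ?_ ?_
        (y k : ZMod (p ^ n))
      · push_cast
        rw [this]
        exact Finset.prod_eq_zero (mem_univ k) (sub_self _)
      · intro m hm hmn
        have := isUnit_intCast_of_not_dvd (n := n) hp (z := (m : ℤ)) (by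
          intro hd
          have := Nat.le_of_dvd (by omega) (Int.natCast_dvd_natCast.1 hd)
          omega)
        simpa using this
      · intro j hj hjn
        have := h j hj hjn
        rw [← sub_eq_zero]
        have h3 := (ZMod.intCast_zmod_eq_zero_iff_dvd _ (p ^ n)).2 this
        push_cast at h3 ⊢
        exact h3
    by_cases hall : ∃ i, (p : ℤ) ∣ y k - x i
    · obtain ⟨i, hi⟩ := hall
      refine ⟨i, ?_⟩
      rw [← Finset.mul_prod_erase _ _ (mem_univ i)] at hprod
      have hu : IsUnit (∏ j ∈ univ.erase i, (((y k - x j : ℤ)) : ZMod (p ^ n))) := by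
        rw [IsUnit.prod_iff]
        intro j hj
        refine isUnit_intCast_of_not_dvd hp fun hd => ?_
        have : (p : ℤ) ∣ x j - x i := by
          have := dvd_sub hi hd
          simpa using this
        exact (mem_erase.1 hj).1 (hx j i this)
      rw [hu.mul_left_eq_zero] at hprod
      exact (ZMod.intCast_zmod_eq_zero_iff_dvd _ _).1 hprod
    · push Not at hall
      have hu : IsUnit (∏ j, (((y k - x j : ℤ)) : ZMod (p ^ n))) := by
        rw [IsUnit.prod_iff]
        exact fun j _ => isUnit_intCast_of_not_dvd hp (hall j)
      rw [hprod] at hu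
      refine ⟨k, ?_⟩
      rw [← ZMod.intCast_zmod_eq_zero_iff_dvd]
      have := isUnit_zero_iff.1 hu
      have e : ∀ a : ZMod (p ^ n), a = 0 := fun a => by rw [← mul_one a, ← this, mul_zero]
      exact e _
  choose σ hσ using hex
  have hpn : n ≠ 0 → (p : ℤ) ∣ ((p ^ n : ℕ) : ℤ) := fun h0 => by
    push_cast; exact dvd_pow_self _ h0
  have hinj : Function.Injective σ := by
    intro i j hij
    have hn0 : n ≠ 0 := by rintro rfl; exact i.elim0
    refine hy i j ?_
    have h1 := (hpn hn0).trans (hσ i)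
    have h2 := (hpn hn0).trans (hσ j)
    rw [hij] at h1
    have := dvd_sub h1 h2
    simpa using this
  exact ⟨Equiv.ofBijective σ (Finite.injective_iff_bijective.1 hinj), hσ⟩

/-- Linnik's lemma: a system of congruences modulo increasing powers of a prime has few solutions
with entries distinct modulo the prime. -/
lemma card_congruence_system_le {p n : ℕ} (hp : p.Prime) (hn : n < p) (A : Finset ℤ)
    (hA : ∀ x ∈ A, ∀ y ∈ A, ((p ^ n : ℕ) : ℤ) ∣ x - y → x = y) (a : ℤ) (h : Fin n → ℤ)
    (S : Finset (Fin n → ℤ)) (hSA : ∀ x ∈ S, ∀ i, x i ∈ A)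
    (hSp : ∀ x ∈ S, ∀ i j, (p : ℤ) ∣ x i - x j → i = j)
    (hS : ∀ x ∈ S, ∀ j : Fin n, ((p ^ (j.1 + 1) : ℕ) : ℤ) ∣ ∑ i, (x i - a) ^ (j.1 + 1) - h j) :
    S.card ≤ n.factorial * p ^ (n * (n - 1) / 2) := by
  classical
  have hp0 : 0 < p := hp.pos
  set P : (Fin n → ℤ) → Fin n → ℤ := fun x j => (∑ i, (x i - a) ^ (j.1 + 1)) % ((p ^ n : ℕ) : ℤ)
  set code : (Fin n → ℤ) → Fin n → ℕ := fun x j => (P x j / ((p ^ (j.1 + 1) : ℕ) : ℤ)).toNat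
  have hpn : ∀ m : ℕ, (0 : ℤ) < ((p ^ m : ℕ) : ℤ) := fun m => by exact_mod_cast pow_pos hp0 m
  have P0 : ∀ x j, 0 ≤ P x j := fun x j => Int.emod_nonneg _ (hpn n).ne'
  have Plt : ∀ x j, P x j < ((p ^ n : ℕ) : ℤ) := fun x j => Int.emod_lt_of_pos _ (hpn n)
  have hmaps : ∀ x ∈ S, code x ∈ Fintype.piFinset (fun j : Fin n => Finset.range (p ^ (n - 1 - j.1))) := by
    intro x _
    rw [Fintype.mem_piFinset]
    intro j
    rw [mem_range]
    have : P x j / ((p ^ (j.1 + 1) : ℕ) : ℤ) < ((p ^ (n - 1 - j.1) : ℕ) : ℤ) := by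
      refine Int.ediv_lt_of_lt_mul (hpn _) ?_
      rw [← Nat.cast_mul, ← pow_add, show n - 1 - j.1 + (j.1 + 1) = n by omega]
      exact Plt x j
    have h0 : 0 ≤ P x j / ((p ^ (j.1 + 1) : ℕ) : ℤ) := Int.ediv_nonneg (P0 x j) (hpn _).le
    change (P x j / ((p ^ (j.1 + 1) : ℕ) : ℤ)).toNat < _
    omega
  have hfib : ∀ c ∈ Fintype.piFinset (fun j : Fin n => Finset.range (p ^ (n - 1 - j.1))),
      (S.filter (fun x => code x = c)).card ≤ n.factorial := by
    intro c _
    rcases (S.filter (fun x => code x = c)).eq_empty_or_nonempty with h0 | ⟨x, hx⟩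
    · rw [h0]; simp
    rw [mem_filter] at hx
    have : S.filter (fun x => code x = c) ⊆
        (univ : Finset (Equiv.Perm (Fin n))).image (fun σ => fun i => x (σ i)) := by
      intro y hy
      rw [mem_filter] at hy
      have hP : ∀ j, P x j = P y j := by
        intro j
        have h1 : (P x j / ((p ^ (j.1 + 1) : ℕ) : ℤ)).toNat
            = (P y j / ((p ^ (j.1 + 1) : ℕ) : ℤ)).toNat := congrFun (hx.2.trans hy.2.symm) j
        have h2 := Int.ediv_nonneg (P0 x j) (hpn (j.1 + 1)).le
        have h3 := Int.ediv_nonneg (P0 y j) (hpn (j.1 + 1)).le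
        have h4 : P x j / ((p ^ (j.1 + 1) : ℕ) : ℤ) = P y j / ((p ^ (j.1 + 1) : ℕ) : ℤ) := by omega
        have dv : ((p ^ (j.1 + 1) : ℕ) : ℤ) ∣ ((p ^ n : ℕ) : ℤ) :=
          Int.natCast_dvd_natCast.2 (pow_dvd_pow _ (by omega))
        have h5 : P x j % ((p ^ (j.1 + 1) : ℕ) : ℤ) = P y j % ((p ^ (j.1 + 1) : ℕ) : ℤ) := by
          simp only [P]
          rw [Int.emod_emod_of_dvd _ dv, Int.emod_emod_of_dvd _ dv]
          have := dvd_sub (hS x hx.1 j) (hS y hy.1 j)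
          rw [sub_sub_sub_cancel_right] at this
          exact Int.emod_eq_emod_iff_emod_sub_eq_zero.2 (Int.emod_eq_zero_of_dvd this)
        rw [← Int.mul_ediv_add_emod (P x j) ((p ^ (j.1 + 1) : ℕ) : ℤ), h4, h5,
          Int.mul_ediv_add_emod]
      obtain ⟨σ, hσ⟩ := exists_perm_of_powerSums hp hn (fun i => x i - a) (fun i => y i - a)
        (fun i j hij => hSp x hx.1 i j (by simpa using hij))
        (fun i j hij => hSp y hy.1 i j (by simpa using hij)) (by
          intro j hj hjn
          have := hP ⟨j - 1, by omega⟩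
          simp only [P] at this
          rw [show j - 1 + 1 = j by omega] at this
          exact Int.dvd_of_emod_eq_zero (Int.emod_eq_emod_iff_emod_sub_eq_zero.1 this))
      rw [mem_image]
      refine ⟨σ, mem_univ _, funext fun i => ?_⟩
      refine (hA _ (hSA y hy.1 i) _ (hSA x hx.1 (σ i)) ?_).symm
      simpa using hσ i
    refine (Finset.card_le_card this).trans (Finset.card_image_le.trans ?_)
    rw [Finset.card_univ, Fintype.card_perm, Fintype.card_fin]
  rw [Finset.card_eq_sum_card_fiberwise hmaps]
  refine (Finset.sum_le_sum hfib).trans ?_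
  rw [Finset.sum_const, smul_eq_mul, Fintype.card_piFinset, mul_comm]
  refine Nat.mul_le_mul le_rfl (le_of_eq ?_)
  simp only [card_range]
  rw [Finset.prod_pow_eq_pow_sum, Fin.sum_univ_eq_sum_range (fun j => n - 1 - j), Finset.sum_range_reflect (fun j => j),
    Finset.sum_range_id]

lemma en_def {τ H : Type*} [DecidableEq H] (S : Finset τ) (w : τ → H) :
    en S w = ((S ×ˢ S).filter (fun q => w q.1 = w q.2)).card := by
  unfold en
  congr

/-- The moment curve. -/
def pv (n : ℕ) (x : ℤ) : Fin n → ℤ := fun j => x ^ (j.1 + 1)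

/-- Vinogradov's mean value over a finite set of integers. -/
noncomputable def JA (n s : ℕ) (A : Finset ℤ) : ℕ :=
  en (Fintype.piFinset (fun _ : Fin s => A)) (fun x => ∑ i, pv n (x i))

/-- Vinogradov's mean value over `[1, X]`. -/
noncomputable def J (n s X : ℕ) : ℕ := JA n s (Icc 1 (X : ℤ))

lemma powerSums_affine {ι : Type*} [Fintype ι] {n : ℕ} (x y : ι → ℤ)
    (h : ∑ i, pv n (x i) = ∑ i, pv n (y i)) (p a : ℤ) :
    ∑ i, pv n (p * x i + a) = ∑ i, pv n (p * y i + a) := by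
  have h' : ∀ k ≤ n, ∑ i, x i ^ k = ∑ i, y i ^ k := by
    intro k hk
    rcases Nat.eq_zero_or_pos k with rfl | hk0
    · simp
    · have := congrFun h ⟨k - 1, by omega⟩
      simp only [Finset.sum_apply, pv] at this
      rwa [show k - 1 + 1 = k by omega] at this
  funext j
  simp only [Finset.sum_apply, pv, add_pow, mul_pow]
  rw [Finset.sum_comm, Finset.sum_comm (s := univ (α := ι))]
  refine Finset.sum_congr rfl fun k hk => ?_
  rw [← Finset.sum_mul, ← Finset.sum_mul, ← Finset.sum_mul, ← Finset.sum_mul, ← Finset.mul_sum,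
    ← Finset.mul_sum, h' k (by have := mem_range.1 hk; omega)]

lemma powerSums_of_affine {ι : Type*} [Fintype ι] {n : ℕ} (x y : ι → ℤ) (p a : ℤ) (hp : p ≠ 0)
    (h : ∑ i, pv n (p * x i + a) = ∑ i, pv n (p * y i + a)) :
    ∑ i, pv n (x i) = ∑ i, pv n (y i) := by
  have h2 := powerSums_affine _ _ h 1 (-a)
  simp only [one_mul, add_neg_cancel_right] at h2
  funext j
  have h3 := congrFun h2 j
  simp only [Finset.sum_apply, pv, mul_pow, ← Finset.mul_sum] at h3 ⊢
  exact mul_left_cancel₀ (pow_ne_zero _ hp) h3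

lemma JA_residue_le (n s X p : ℕ) (hp : 0 < p) (a : ZMod p) :
    JA n s ((Icc 1 (X : ℤ)).filter (fun x : ℤ => (x : ZMod p) = a)) ≤ J n s (X / p + 1) := by
  rcases Nat.eq_zero_or_pos p with h | _
  · omega
  have : NeZero p := ⟨hp.ne'⟩
  have hpz : (p : ℤ) ≠ 0 := by exact_mod_cast hp.ne'
  have hx : ∀ x ∈ (Icc 1 (X : ℤ)).filter (fun x : ℤ => (x : ZMod p) = a),
      (p : ℤ) * (x / p + 1) + ((a.val : ℤ) - p) = x := by
    intro x hx
    have h1 := (mem_filter.1 hx).2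
    have h2 : x % p = (a.val : ℤ) := by rw [← h1, ZMod.val_intCast]
    have := Int.mul_ediv_add_emod x p
    rw [← h2]; linarith
  unfold J JA
  refine en_le_of_map _ _ _ _ (fun (x : Fin s → ℤ) i => x i / (p : ℤ) + 1) ?_ ?_ ?_
  · intro x hxx
    rw [Fintype.mem_piFinset] at hxx ⊢
    intro i
    have := mem_Icc.1 (mem_filter.1 (hxx i)).1
    rw [mem_Icc]
    constructor
    · have := Int.ediv_nonneg (a := x i) (b := p) (by linarith) (by positivity)
      linarith
    · push_cast
      have := Int.ediv_le_ediv (c := (p : ℤ)) (by positivity) this.2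
      linarith
  · intro x hxx y hyy h
    rw [Fintype.mem_piFinset] at hxx hyy
    funext i
    have := congrFun h i
    rw [← hx _ (hxx i), ← hx _ (hyy i), this]
  · intro x hxx y hyy h
    rw [Fintype.mem_piFinset] at hxx hyy
    refine powerSums_of_affine _ _ (p : ℤ) ((a.val : ℤ) - p) hpz ?_
    simp only [hx _ (hxx _), hx _ (hyy _)]
    exact h

lemma card_shift_le {τ H : Type*} [AddCommGroup H] [DecidableEq H] (S : Finset τ) (w : τ → H) (c : H) :
    ((S ×ˢ S).filter (fun q => w q.1 = w q.2 + c)).card ≤ en S w := by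
  classical
  set B : Finset H := S.image w ∪ S.image (fun x => w x + c) ∪ S.image (fun x => w x - c)
  rw [en_eq_sum S w (S.image w) (fun x hx => mem_image_of_mem _ hx)]
  set r : H → ℕ := fun h => (S.filter (fun x => w x = h)).card
  have r0 : ∀ h, h ∉ S.image w → r h = 0 := by
    intro h hh
    refine Finset.card_eq_zero.2 (Finset.filter_eq_empty_iff.2 fun x hx hxx => hh ?_)
    exact hxx ▸ mem_image_of_mem _ hx
  have h1 : ((S ×ˢ S).filter (fun q => w q.1 = w q.2 + c)).card
      = ∑ h ∈ S.image w, r (h + c) * r h := by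
    rw [Finset.card_eq_sum_card_fiberwise (f := fun q : τ × τ => w q.2) (t := S.image w)]
    · refine Finset.sum_congr rfl fun h _ => ?_
      rw [← Finset.card_product]
      congr 1
      ext ⟨x, y⟩
      simp only [mem_filter, mem_product]
      constructor
      · rintro ⟨⟨⟨hx, hy⟩, h1⟩, h2⟩
        exact ⟨⟨hx, h2 ▸ h1⟩, hy, h2⟩
      · rintro ⟨⟨hx, h2⟩, hy, h1⟩
        exact ⟨⟨⟨hx, hy⟩, h1 ▸ h2⟩, h1⟩
    · intro q hq
      simp only [coe_filter, mem_product, Set.mem_ofPred_eq] at hq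
      exact mem_image_of_mem _ hq.1.2
  rw [h1]
  have h2 : ∑ h ∈ S.image w, (r (h + c)) ^ 2 ≤ ∑ h ∈ S.image w, (r h) ^ 2 := by
    have e1 : ∑ h ∈ S.image w, (r (h + c)) ^ 2
        = ∑ g ∈ (S.image w).image (fun h => h + c), (r g) ^ 2 := by
      refine (Finset.sum_image (f := fun g => (r g) ^ 2) ?_).symm
      intro a _ b _ hab
      exact add_right_cancel hab
    rw [e1, ← Finset.sum_subset (Finset.inter_subset_left (s₂ := S.image w))]
    · exact Finset.sum_le_sum_of_subset inter_subset_right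
    · intro g hg hg2
      rw [r0 g (fun h => hg2 (mem_inter.2 ⟨hg, h⟩))]; rfl
  have h3 : 2 * ∑ h ∈ S.image w, r (h + c) * r h
      ≤ ∑ h ∈ S.image w, (r (h + c)) ^ 2 + ∑ h ∈ S.image w, (r h) ^ 2 := by
    rw [← Finset.sum_add_distrib, Finset.mul_sum]
    refine Finset.sum_le_sum fun h _ => ?_
    have := two_mul_le_add_sq (r (h + c)) (r h)
    linarith
  change _ ≤ ∑ h ∈ S.image w, (r h) ^ 2
  omega

lemma en_distinct_le {n s X p : ℕ} (hp : p.Prime) (hn : n < p) (hX : X ≤ p ^ n) (a : ZMod p)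
    (T : Finset (Fin n → ℤ)) (hTA : ∀ x ∈ T, ∀ i, x i ∈ Icc 1 (X : ℤ))
    (hTp : ∀ x ∈ T, ∀ i j, (p : ℤ) ∣ x i - x j → i = j) :
    en (T ×ˢ Fintype.piFinset
        (fun _ : Fin s => (Icc 1 (X : ℤ)).filter (fun x : ℤ => (x : ZMod p) = a)))
      (fun q => ∑ i, pv n (q.1 i) + ∑ i, pv n (q.2 i)) ≤
      X ^ n * (n.factorial * p ^ (n * (n - 1) / 2)) * J n s (X / p + 1) := by
  classical
  have : NeZero p := ⟨hp.ne_zero⟩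
  set A := (Icc 1 (X : ℤ)).filter (fun x : ℤ => (x : ZMod p) = a) with hA
  set D : Finset ((Fin n → ℤ) × (Fin n → ℤ)) := (T ×ˢ T).filter (fun g => ∀ j : Fin n,
    ((p ^ (j.1 + 1) : ℕ) : ℤ) ∣ ∑ i, (g.1 i - a.val) ^ (j.1 + 1) - ∑ i, (g.2 i - a.val) ^ (j.1 + 1))
  have hDcard : D.card ≤ X ^ n * (n.factorial * p ^ (n * (n - 1) / 2)) := by
    have hmaps : ∀ g ∈ D, g.2 ∈ T := fun g hg => (mem_product.1 (mem_filter.1 hg).1).2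
    rw [Finset.card_eq_sum_card_fiberwise hmaps]
    have hT : T.card ≤ X ^ n := by
      refine (Finset.card_le_card (t := Fintype.piFinset (fun _ : Fin n => Icc 1 (X : ℤ)))
        (fun x hx => Fintype.mem_piFinset.2 (hTA x hx))).trans ?_
      simp
    refine (Finset.sum_le_card_nsmul _ _ (n.factorial * p ^ (n * (n - 1) / 2)) ?_).trans ?_
    · intro y _
      set S := (D.filter (fun g => g.2 = y)).image Prod.fst
      have : (D.filter (fun g => g.2 = y)).card = S.card := by
        rw [Finset.card_image_of_injOn]
        intro g hg g' hg' h
        have h1 := (mem_filter.1 hg).2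
        have h2 := (mem_filter.1 hg').2
        exact Prod.ext h (h1.trans h2.symm)
      rw [this]
      have hS : ∀ x ∈ S, (x, y) ∈ D := by
        intro x hx
        obtain ⟨g, hg, rfl⟩ := mem_image.1 hx
        obtain ⟨h1, h2⟩ := mem_filter.1 hg
        rw [← h2]; exact h1
      refine card_congruence_system_le hp hn (Icc 1 (X : ℤ)) ?_ (a.val : ℤ)
        (fun j => ∑ i, (y i - a.val) ^ (j.1 + 1)) S ?_ ?_ ?_
      · intro u hu v hv huv
        rw [mem_Icc] at hu hv
        have hX' : (X : ℤ) ≤ ((p ^ n : ℕ) : ℤ) := by exact_mod_cast hX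
        have := Int.eq_zero_of_abs_lt_dvd huv (by rw [abs_lt]; constructor <;> linarith)
        linarith
      · exact fun x hx => hTA x (mem_product.1 (mem_filter.1 (hS x hx)).1).1
      · exact fun x hx => hTp x (mem_product.1 (mem_filter.1 (hS x hx)).1).1
      · exact fun x hx => (mem_filter.1 (hS x hx)).2
    · rw [smul_eq_mul]
      exact Nat.mul_le_mul hT le_rfl
  refine le_trans ?_ (Nat.mul_le_mul hDcard (JA_residue_le n s X p hp.pos a))
  rw [en_def]
  set P := Fintype.piFinset (fun _ : Fin s => A)
  have hmaps : ∀ q ∈ (((T ×ˢ P) ×ˢ (T ×ˢ P)).filter (fun q => ∑ i, pv n (q.1.1 i) + ∑ i, pv n (q.1.2 i)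
      = ∑ i, pv n (q.2.1 i) + ∑ i, pv n (q.2.2 i))), (q.1.1, q.2.1) ∈ D := by
    intro q hq
    simp only [mem_filter, mem_product] at hq
    refine mem_filter.2 ⟨mem_product.2 ⟨hq.1.1.1, hq.1.2.1⟩, fun j => ?_⟩
    have h1 := powerSums_affine (Sum.elim q.1.1 q.1.2) (Sum.elim q.2.1 q.2.2)
      (by simpa [Fintype.sum_sum_type] using hq.2) 1 (-(a.val : ℤ))
    have h2 := congrFun h1 j
    simp only [Fintype.sum_sum_type, Sum.elim_inl, Sum.elim_inr, Finset.sum_apply, pv,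
      one_mul, ← sub_eq_add_neg] at h2
    have hd : ∀ x ∈ P, ((p ^ (j.1 + 1) : ℕ) : ℤ) ∣ ∑ i, (x i - a.val) ^ (j.1 + 1) := by
      intro x hx
      refine Finset.dvd_sum fun i _ => ?_
      push_cast
      refine pow_dvd_pow_of_dvd ?_ _
      have := (mem_filter.1 (Fintype.mem_piFinset.1 hx i)).2
      rw [← ZMod.intCast_zmod_eq_zero_iff_dvd]
      push_cast
      rw [this, ZMod.natCast_zmod_val, sub_self]
    have := dvd_sub (hd _ hq.1.2.2) (hd _ hq.1.1.2)
    have e : ∑ i, (q.1.1 i - (a.val : ℤ)) ^ (j.1 + 1) - ∑ i, (q.2.1 i - (a.val : ℤ)) ^ (j.1 + 1)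
        = ∑ i, (q.2.2 i - (a.val : ℤ)) ^ (j.1 + 1) - ∑ i, (q.1.2 i - (a.val : ℤ)) ^ (j.1 + 1) := by
      linarith
    simp only [e]
    exact this
  rw [Finset.card_eq_sum_card_fiberwise hmaps]
  refine (Finset.sum_le_card_nsmul _ _ (JA n s A) ?_).trans (le_of_eq (smul_eq_mul _ _))
  intro g _
  refine le_trans ?_ (card_shift_le P (fun x => ∑ i, pv n (x i)) (∑ i, pv n (g.2 i) - ∑ i, pv n (g.1 i)))
  refine Finset.card_le_card_of_injOn (fun q => (q.1.2, q.2.2)) ?_ ?_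
  · intro q hq
    simp only [coe_filter, mem_filter, mem_product, Set.mem_ofPred_eq] at hq ⊢
    obtain ⟨⟨hq1, hq2⟩, rfl⟩ := hq
    refine ⟨⟨hq1.1.2, hq1.2.2⟩, ?_⟩
    rw [add_sub, eq_sub_iff_add_eq, add_comm, hq2, add_comm]
  · intro q hq r hr hqr
    simp only [coe_filter, mem_filter, mem_product, Set.mem_ofPred_eq] at hq hr
    simp only [Prod.mk.injEq] at hqr
    have h1 := hq.2.trans hr.2.symm
    simp only [Prod.mk.injEq] at h1
    exact Prod.ext (Prod.ext h1.1 hqr.1) (Prod.ext h1.2 hqr.2)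

lemma en_distinct_tuple_le {n s X p : ℕ} (hp : p.Prime) (hn : n < p) (hX : X ≤ p ^ n) (hs : 1 ≤ s)
    (e : Fin n ↪ Fin (n + s)) :
    en ((Fintype.piFinset (fun _ : Fin (n + s) => Icc 1 (X : ℤ))).filter
      (fun x => ∀ i j, (p : ℤ) ∣ x (e i) - x (e j) → i = j)) (fun x => ∑ i, pv n (x i)) ≤
    p ^ (2 * s) * (X ^ n * (n.factorial * p ^ (n * (n - 1) / 2)) * J n s (X / p + 1)) := by
  classical
  have : NeZero p := ⟨hp.ne_zero⟩
  have hcard : Fintype.card (Fin s) = Fintype.card ((Set.range e)ᶜ : Set (Fin (n + s))) := by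
    rw [Fintype.card_compl_set, Set.card_range_of_injective e.injective]
    simp
  set σ : Fin n ⊕ Fin s ≃ Fin (n + s) :=
    ((Equiv.ofInjective e e.injective).sumCongr (Fintype.equivOfCardEq hcard)).trans
      (Equiv.Set.sumCompl (Set.range e))
  have hσ : ∀ i, σ (Sum.inl i) = e i := by
    intro i
    simp [σ]
  set T : Finset (Fin n → ℤ) := (Fintype.piFinset (fun _ : Fin n => Icc 1 (X : ℤ))).filter
    (fun x => ∀ i j, (p : ℤ) ∣ x i - x j → i = j)
  have hsum : ∀ x : Fin (n + s) → ℤ, ∑ i, pv n (x i)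
      = ∑ i, pv n (x (e i)) + ∑ i, pv n (x (σ (Sum.inr i))) := by
    intro x
    rw [← Equiv.sum_comp σ, Fintype.sum_sum_type]
    simp only [hσ]
  have h1 := en_le_of_map ((Fintype.piFinset (fun _ : Fin (n + s) => Icc 1 (X : ℤ))).filter
      (fun x => ∀ i j, (p : ℤ) ∣ x (e i) - x (e j) → i = j))
      (T ×ˢ Fintype.piFinset (fun _ : Fin s => Icc 1 (X : ℤ)))
      (fun x => ∑ i, pv n (x i)) (fun q => ∑ i, pv n (q.1 i) + ∑ i, pv n (q.2 i))
      (fun x => (fun i => x (e i), fun i => x (σ (Sum.inr i)))) ?_ ?_ ?_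
  · refine h1.trans ?_
    have h2 := hoelder_int T (fun x => ∑ i, pv n (x i)) (Icc 1 (X : ℤ)) (pv n)
      (fun x : ℤ => (x : ZMod p)) univ (fun _ _ => mem_univ _) s hs
    refine h2.trans ?_
    refine (Nat.mul_le_mul le_rfl (Finset.sum_le_card_nsmul _ _
      (X ^ n * (n.factorial * p ^ (n * (n - 1) / 2)) * J n s (X / p + 1)) fun a _ => ?_)).trans
      (le_of_eq ?_)
    · refine en_distinct_le hp hn hX a T (fun x hx => Fintype.mem_piFinset.1 (mem_filter.1 hx).1)
        (fun x hx => (mem_filter.1 hx).2)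
    · rw [smul_eq_mul, ← mul_assoc, ← pow_succ, Finset.card_univ, ZMod.card,
        show 2 * s - 1 + 1 = 2 * s by omega]
  · intro x hx
    rw [mem_filter, Fintype.mem_piFinset] at hx
    simp only [T, mem_product, mem_filter, Fintype.mem_piFinset]
    exact ⟨⟨fun i => hx.1 _, hx.2⟩, fun i => hx.1 _⟩
  · intro x _ y _ h
    simp only [Prod.mk.injEq] at h
    funext k
    obtain ⟨k, rfl⟩ := σ.surjective k
    rcases k with k | k
    · rw [hσ]; exact congrFun h.1 k
    · exact congrFun h.2 k
  · intro x _ y _ h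
    rw [hsum, hsum] at h
    exact h

lemma en_few_residues_le {n b X p : ℕ} (hp : 0 < p) (hb : 1 ≤ b) (R : Finset (ZMod p)) :
    en (Fintype.piFinset (fun _ : Fin b =>
      (Icc 1 (X : ℤ)).filter (fun x : ℤ => (x : ZMod p) ∈ R))) (fun x => ∑ i, pv n (x i)) ≤
    R.card ^ (2 * b) * J n b (X / p + 1) := by
  classical
  set A := (Icc 1 (X : ℤ)).filter (fun x : ℤ => (x : ZMod p) ∈ R)
  have h1 := en_le_of_map (Fintype.piFinset (fun _ : Fin b => A))
    (({()} : Finset Unit) ×ˢ Fintype.piFinset (fun _ : Fin b => A))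
    (fun x => ∑ i, pv n (x i)) (fun q => (0 : Fin n → ℤ) + ∑ i, pv n (q.2 i)) (fun x => ((), x))
    (by simp) (by simp) (by simp)
  refine h1.trans ?_
  have h2 := hoelder_int ({()} : Finset Unit) (fun _ => 0) A (pv n)
      (fun x : ℤ => (x : ZMod p)) R (fun x hx => (mem_filter.1 hx).2) b hb
  refine h2.trans ?_
  refine (Nat.mul_le_mul le_rfl (Finset.sum_le_card_nsmul _ _ (J n b (X / p + 1)) fun a ha => ?_)).trans
      (le_of_eq ?_)
  · refine le_trans ?_ (JA_residue_le n b X p hp a)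
    refine en_le_of_map _ _ _ _ (fun q => q.2) ?_ ?_ ?_
    · intro q hq
      have := (mem_product.1 hq).2
      rw [Fintype.mem_piFinset] at this ⊢
      intro i
      have h3 := mem_filter.1 (this i)
      exact mem_filter.2 ⟨(mem_filter.1 h3.1).1, h3.2⟩
    · intro q _ r _ h
      exact Prod.ext rfl h
    · intro q _ r _ h
      simpa using h
  · rw [smul_eq_mul, ← mul_assoc, ← pow_succ, show 2 * b - 1 + 1 = 2 * b by omega]

/-- The recursion for Vinogradov's mean value. -/
theorem J_recursion {n s X p : ℕ} (hp : p.Prime) (hn : n < p) (hn1 : 1 ≤ n) (hX : X ≤ p ^ n)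
    (hs : 1 ≤ s) :
    J n (n + s) X ≤ 2 * (((n + s) ^ n) ^ 2 * (p ^ (2 * s) *
      (X ^ n * (n.factorial * p ^ (n * (n - 1) / 2)) * J n s (X / p + 1)))) +
      2 * ((p ^ (n - 1)) ^ 2 * (n ^ (2 * (n + s)) * J n (n + s) (X / p + 1))) := by
  classical
  have : NeZero p := ⟨hp.ne_zero⟩
  set S := Fintype.piFinset (fun _ : Fin (n + s) => Icc 1 (X : ℤ)) with hS
  set G := S.filter (fun x => ∃ e : Fin n ↪ Fin (n + s), ∀ i j, (p : ℤ) ∣ x (e i) - x (e j) → i = j)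
  set B := S.filter (fun x => ¬ ∃ e : Fin n ↪ Fin (n + s), ∀ i j, (p : ℤ) ∣ x (e i) - x (e j) → i = j)
  have hGB := en_union S (fun x => ∑ i, pv n (x i)) (univ : Finset Bool)
    (fun b => if b then G else B) (by
      intro x hx
      by_cases h : ∃ e : Fin n ↪ Fin (n + s), ∀ i j, (p : ℤ) ∣ x (e i) - x (e j) → i = j
      · exact ⟨true, mem_univ _, by simpa [G] using ⟨hx, h⟩⟩
      · exact ⟨false, mem_univ _, by simpa [B] using ⟨hx, by simpa using h⟩⟩)
  have hG := en_union G (fun x => ∑ i, pv n (x i)) (univ : Finset (Fin n ↪ Fin (n + s)))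
    (fun e => S.filter (fun x => ∀ i j, (p : ℤ) ∣ x (e i) - x (e j) → i = j)) (by
      intro x hx
      obtain ⟨h1, e, he⟩ := mem_filter.1 hx
      exact ⟨e, mem_univ _, mem_filter.2 ⟨h1, he⟩⟩)
  have hB := en_union B (fun x => ∑ i, pv n (x i)) (powersetCard (n - 1) (univ : Finset (ZMod p)))
    (fun R => Fintype.piFinset (fun _ : Fin (n + s) =>
      (Icc 1 (X : ℤ)).filter (fun x : ℤ => (x : ZMod p) ∈ R))) (by
      intro x hx
      obtain ⟨h1, h2⟩ := mem_filter.1 hx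
      set R0 := univ.image (fun i => (x i : ZMod p))
      have hR0 : R0.card ≤ n - 1 := by
        by_contra hcon
        have hcon : n ≤ R0.card := by omega
        obtain ⟨R1, hR1, hc⟩ := exists_subset_card_eq hcon
        let f := (R1.equivFinOfCardEq hc).symm
        have hf : ∀ i, ∃ k, (x k : ZMod p) = f i := by
          intro i
          have := hR1 (f i).2
          simpa [R0] using this
        choose g hg using hf
        have hginj : ∀ i j, (p : ℤ) ∣ x (g i) - x (g j) → i = j := by
          intro i j hij
          have : (x (g i) : ZMod p) = x (g j) := by
            have := (ZMod.intCast_zmod_eq_zero_iff_dvd _ p).2 hij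
            push_cast at this
            exact sub_eq_zero.1 this
          rw [hg, hg] at this
          exact f.injective (Subtype.ext this)
        refine h2 ⟨⟨g, fun i j hij => hginj i j (by rw [hij]; simp)⟩, hginj⟩
      obtain ⟨R, hR, hc⟩ := exists_superset_card_eq hR0 (by rw [ZMod.card]; omega)
      refine ⟨R, by simpa [mem_powersetCard] using hc, ?_⟩
      rw [Fintype.mem_piFinset] at h1 ⊢
      exact fun i => mem_filter.2 ⟨h1 i, hR (mem_image_of_mem _ (mem_univ i))⟩)
  have hcardE : (univ : Finset (Fin n ↪ Fin (n + s))).card ≤ (n + s) ^ n := by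
    rw [Finset.card_univ, Fintype.card_embedding_eq, Fintype.card_fin, Fintype.card_fin]
    exact Nat.descFactorial_le_pow _ _
  have hcardP : (powersetCard (n - 1) (univ : Finset (ZMod p))).card ≤ p ^ (n - 1) := by
    rw [card_powersetCard, Finset.card_univ, ZMod.card]
    exact Nat.choose_le_pow _ _
  have hG2 : en G (fun x => ∑ i, pv n (x i)) ≤ ((n + s) ^ n) ^ 2 * (p ^ (2 * s) *
      (X ^ n * (n.factorial * p ^ (n * (n - 1) / 2)) * J n s (X / p + 1))) := by
    refine hG.trans ?_
    rw [sq, mul_assoc]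
    refine Nat.mul_le_mul hcardE ((Finset.sum_le_card_nsmul _ _ _ fun e _ =>
      en_distinct_tuple_le hp hn hX hs e).trans ?_)
    rw [smul_eq_mul]
    exact Nat.mul_le_mul hcardE le_rfl
  have hB2 : en B (fun x => ∑ i, pv n (x i)) ≤
      (p ^ (n - 1)) ^ 2 * (n ^ (2 * (n + s)) * J n (n + s) (X / p + 1)) := by
    refine hB.trans ?_
    rw [sq, mul_assoc]
    refine Nat.mul_le_mul hcardP ((Finset.sum_le_card_nsmul _ _
      (n ^ (2 * (n + s)) * J n (n + s) (X / p + 1)) fun R hR => ?_).trans ?_)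
    · refine (en_few_residues_le hp.pos (by omega) R).trans ?_
      rw [(mem_powersetCard.1 hR).2]
      exact Nat.mul_le_mul (Nat.pow_le_pow_left (by omega) _) le_rfl
    rw [smul_eq_mul]
    exact Nat.mul_le_mul hcardP le_rfl
  have h3 : J n (n + s) X = en S (fun x => ∑ i, pv n (x i)) := rfl
  rw [h3]
  refine hGB.trans ?_
  simp only [Fintype.sum_bool, Finset.card_univ, Fintype.card_bool, if_true, mul_add]
  refine add_le_add (Nat.mul_le_mul le_rfl hG2) (Nat.mul_le_mul le_rfl ?_)
  rw [← mul_add]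
  simpa using hB2

/-- The excess in the exponent of Vinogradov's mean value theorem after `l` iterations. -/
noncomputable def eta (n l : ℕ) : ℝ := (n : ℝ) * (n + 1) / 2 * (1 - 1 / (n : ℝ)) ^ (l - 1)

/-- The exponent in Vinogradov's mean value theorem after `l` iterations. -/
noncomputable def ex (n l : ℕ) : ℝ := 2 * l * n - n * (n + 1) / 2 + eta n l

lemma J_trivial (n b X : ℕ) : J n b X ≤ X ^ (2 * b) := by
  unfold J JA
  refine (en_le_card_sq _ _).trans ?_
  rw [Fintype.card_piFinset]
  simp [← pow_mul, mul_comm]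

lemma eta_nonneg (n l : ℕ) (hn : 2 ≤ n) : 0 ≤ eta n l := by
  have h : (2 : ℝ) ≤ n := by exact_mod_cast hn
  have h1 : 1 / (n : ℝ) ≤ 1 := by rw [div_le_one (by linarith)]; linarith
  unfold eta
  have := pow_nonneg (sub_nonneg.2 h1) (l - 1)
  positivity

lemma eta_le (n l : ℕ) (hn : 2 ≤ n) : eta n l ≤ (n : ℝ) * (n + 1) / 2 := by
  have h : (2 : ℝ) ≤ n := by exact_mod_cast hn
  have h1 : 1 / (n : ℝ) ≤ 1 := by rw [div_le_one (by linarith)]; linarith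
  have h2 : (0 : ℝ) ≤ 1 / n := by positivity
  unfold eta
  refine mul_le_of_le_one_right (by positivity) (pow_le_one₀ (sub_nonneg.2 h1) (by linarith))

lemma eta_ge (n l : ℕ) (hn : 2 ≤ n) (hl : 1 ≤ l) :
    (n : ℝ) * (n + 1) / 2 - (l - 1) * ((n + 1) / 2) ≤ eta n l := by
  have h : (2 : ℝ) ≤ n := by exact_mod_cast hn
  have h1 : 1 / (n : ℝ) ≤ 1 := by rw [div_le_one (by linarith)]; linarith
  have h2 := one_add_mul_le_pow (a := -(1 / (n : ℝ))) (by linarith) (l - 1)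
  have h3 : ((l - 1 : ℕ) : ℝ) = l - 1 := by push_cast [hl]; ring
  rw [h3, ← sub_eq_add_neg] at h2
  have h4 := mul_le_mul_of_nonneg_left h2 (show (0 : ℝ) ≤ (n : ℝ) * (n + 1) / 2 by positivity)
  refine le_trans (le_of_eq ?_) h4
  field_simp
  ring

lemma eta_succ (n l : ℕ) (hl : 1 ≤ l) : eta n (l + 1) = eta n l - eta n l / n := by
  unfold eta
  obtain ⟨k, rfl⟩ := Nat.exists_eq_add_of_le' hl
  simp only [Nat.add_sub_cancel, pow_succ]
  ring

lemma eta_le_sq (n l : ℕ) (hn : 2 ≤ n) : eta n l ≤ (n : ℝ) ^ 2 := by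
  have h : (2 : ℝ) ≤ n := by exact_mod_cast hn
  have := eta_le n l hn
  nlinarith

lemma succ_mul_le_four_mul {n l L : ℕ} (hL : l + 1 ≤ L) : (l + 1) * n ≤ 4 * n * L := by
  have := Nat.mul_le_mul_right n hL
  linarith [Nat.zero_le (n * L), mul_comm n L]

lemma iterate_exponent_le {n l L : ℕ} (hn : 2 ≤ n) (hL : l + 1 ≤ L) :
    1 + (n * 2 + (n + (n ^ 2 + 2 * l * n))) ≤ 5 * n ^ 2 + 2 * n * L := by
  have h1 := Nat.mul_le_mul_left (2 * n) hL
  have h2 := Nat.mul_le_mul_left n hn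
  nlinarith

/-- Bertrand-type choice of the auxiliary prime. -/
lemma exists_aux_prime {n X : ℕ} (hn : 2 ≤ n) (hX : (4 * n) ^ (4 * n) ≤ X) :
    ∃ p : ℕ, p.Prime ∧ X ≤ p ^ n ∧ (4 * n) ^ 4 ≤ p ∧ (p : ℝ) ≤ 4 * (X : ℝ) ^ (1 / (n : ℝ)) ∧ p ≤ X := by
  set y : ℝ := (X : ℝ) ^ (1 / (n : ℝ)) with hy
  have hn0 : n ≠ 0 := by omega
  have hy0 : 0 ≤ y := by positivity
  have hyn : y ^ n = X := by
    rw [hy, one_div]; exact Real.rpow_inv_natCast_pow (by positivity) hn0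
  have hy4 : ((4 * n : ℕ) : ℝ) ^ 4 ≤ y := by
    refine le_of_pow_le_pow_left₀ hn0 hy0 ?_
    rw [hyn, ← pow_mul]; exact_mod_cast hX
  have hbase : (8 : ℝ) ≤ ((4 * n : ℕ) : ℝ) := by exact_mod_cast (by omega : 8 ≤ 4 * n)
  have hy8 : (8 : ℝ) ≤ y := by
    refine (hbase.trans ?_).trans hy4
    exact le_self_pow₀ (by linarith) (by norm_num)
  set m := ⌈y⌉₊
  have hm1 : y ≤ m := Nat.le_ceil y
  have hm2 : (m : ℝ) < y + 1 := Nat.ceil_lt_add_one hy0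
  have hm0 : m ≠ 0 := by
    intro h
    rw [h] at hm1
    norm_num at hm1
    linarith
  obtain ⟨p, hp, hp1, hp2⟩ := Nat.exists_prime_lt_and_le_two_mul m hm0
  have hp1' : (m : ℝ) < p := by exact_mod_cast hp1
  have hp2' : (p : ℝ) ≤ 2 * m := by exact_mod_cast hp2
  refine ⟨p, hp, ?_, ?_, by linarith, ?_⟩
  · have : (X : ℝ) ≤ (p : ℝ) ^ n := by
      rw [← hyn]; exact pow_le_pow_left₀ hy0 (by linarith) n
    exact_mod_cast this
  · have : ((4 * n : ℕ) : ℝ) ^ 4 ≤ p := by linarith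
    exact_mod_cast this
  · have h1 : y ^ 2 ≤ y ^ n := pow_le_pow_right₀ (by linarith) hn
    have : (p : ℝ) ≤ X := by rw [← hyn]; nlinarith
    exact_mod_cast this

set_option maxHeartbeats 2000000 in
lemma J_iterate {n l L : ℕ} (hn : 2 ≤ n) (hl : 1 ≤ l) (hL : l + 1 ≤ L) (D : ℝ)
    (hD : ∀ X : ℕ, 1 ≤ X → (J n (l * n) X : ℝ) ≤ D * (X : ℝ) ^ ex n l) (D' : ℝ) (hD0 : 0 ≤ D)
    (hD1 : ((4 * n * L : ℕ) : ℝ) ^ (4 * n ^ 3) ≤ D')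
    (hD2 : ((4 * n * L : ℕ) : ℝ) ^ (5 * n ^ 2 + 2 * n * L) * D ≤ D') :
    ∀ X : ℕ, 1 ≤ X → (J n ((l + 1) * n) X : ℝ) ≤ D' * (X : ℝ) ^ ex n (l + 1) := by
  have hnR : (2 : ℝ) ≤ n := by exact_mod_cast hn
  have hlR : (1 : ℝ) ≤ l := by exact_mod_cast hl
  have hLR : (l : ℝ) + 1 ≤ L := by exact_mod_cast hL
  set R : ℝ := ((4 * n * L : ℕ) : ℝ) with hR
  have hRn : ((4 * n : ℕ) : ℝ) ≤ R := by
    rw [hR]; push_cast; nlinarith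
  have hR4 : (4 : ℝ) ≤ R := by
    refine le_trans ?_ hRn; push_cast; linarith
  have hη0 := eta_nonneg n l hn
  have hη1 := eta_le n l hn
  have hη0' := eta_nonneg n (l + 1) hn
  have hη1' := eta_le n (l + 1) hn
  have hηg := eta_ge n l hn hl
  have hηg' := eta_ge n (l + 1) hn (by omega)
  have hηs := eta_succ n l hl
  have hD'0 : 0 ≤ D' := le_trans (by positivity) hD1
  have hex0 : 0 ≤ ex n l := by unfold ex; nlinarith
  have hexle : ex n l ≤ (2 * l * n : ℕ) := by unfold ex; push_cast; linarith
  have hex' : ex n (l + 1) ≤ (2 * ((l + 1) * n) : ℕ) := by unfold ex; push_cast; linarith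
  have hex'0 : (l : ℝ) * n + 2 * (n - 1 : ℕ) ≤ ex n (l + 1) := by
    unfold ex; push_cast [show 1 ≤ n by omega] at hηg' ⊢; nlinarith
  have hex2 : ((2 * ((l + 1) * n) : ℕ) : ℝ) - ex n (l + 1) ≤ (n ^ 2 : ℕ) := by
    unfold ex; push_cast; nlinarith
  have hexstep : ex n (l + 1) = ex n l + 2 * n - eta n l / n := by
    unfold ex; rw [hηs]; push_cast; ring
  set e := ex n l with he
  set e' := ex n (l + 1)
  have hnn : (0 : ℝ) ≤ (n - 1 : ℕ) := Nat.cast_nonneg _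
  have he'0 : 0 ≤ e' := le_trans (by positivity) hex'0
  intro X
  induction X using Nat.strong_induction_on with
  | _ X ih =>
  intro hX1
  have hX1R : (1 : ℝ) ≤ X := by exact_mod_cast hX1
  by_cases hX : (4 * n) ^ (4 * n) ≤ X
  swap
  · push Not at hX
    have hXR : (X : ℝ) ≤ R ^ (4 * n) := by
      refine le_trans ?_ (pow_le_pow_left₀ (by positivity) hRn _)
      exact_mod_cast hX.le
    calc (J n ((l + 1) * n) X : ℝ) ≤ (X : ℝ) ^ (2 * ((l + 1) * n)) := by
          exact_mod_cast J_trivial n _ X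
      _ = (X : ℝ) ^ (((2 * ((l + 1) * n) : ℕ) : ℝ) - e') * (X : ℝ) ^ e' := by
          rw [← Real.rpow_add (by linarith), sub_add_cancel, Real.rpow_natCast]
      _ ≤ (X : ℝ) ^ ((n ^ 2 : ℕ) : ℝ) * (X : ℝ) ^ e' := by
          gcongr
      _ ≤ D' * (X : ℝ) ^ e' := by
          gcongr
          rw [Real.rpow_natCast]
          refine (pow_le_pow_left₀ (by positivity) hXR _).trans ?_
          rw [← pow_mul]
          refine le_trans (le_of_eq ?_) hD1
          congr 1; ring
  obtain ⟨p, hp, hpX, hp4, hpy, hple⟩ := exists_aux_prime hn hX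
  have hnp : n < p := by
    refine lt_of_lt_of_le ?_ hp4
    calc n < (4 * n) ^ 1 := by rw [pow_one]; omega
      _ ≤ (4 * n) ^ 4 := Nat.pow_le_pow_right (by omega) (by norm_num)
  have hp0 : (0 : ℝ) < p := by exact_mod_cast hp.pos
  have hp1 : (1 : ℝ) ≤ p := by exact_mod_cast hp.pos
  have hp4R : ((4 * n : ℕ) : ℝ) ^ 4 ≤ p := by exact_mod_cast hp4
  set Y := X / p + 1 with hY
  have hYle : (Y : ℝ) ≤ 2 * X / p := by
    have h1 : ((X / p : ℕ) : ℝ) ≤ X / p := Nat.cast_div_le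
    have h2 : (1 : ℝ) ≤ X / p := by rw [one_le_div hp0]; exact_mod_cast hple
    rw [hY]; push_cast
    rw [mul_div_assoc]; linarith
  have hYX : Y < X := by
    have h16 : (4 : ℝ) ≤ p := by
      refine le_trans ?_ hp4R
      refine le_trans ?_ (le_self_pow₀ (a := ((4 * n : ℕ) : ℝ)) ?_ (by norm_num : (4 : ℕ) ≠ 0))
      · push_cast; linarith
      · push_cast; linarith
    have : (Y : ℝ) < X := by
      refine lt_of_le_of_lt hYle ?_
      rw [div_lt_iff₀ hp0]
      calc 2 * (X : ℝ) < X * 4 := by linarith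
        _ ≤ X * p := by gcongr
    exact_mod_cast this
  have hln : 1 ≤ l * n := Nat.mul_pos (by omega) (by omega)
  have hn1 : 1 ≤ n := by omega
  have hrec := J_recursion (s := l * n) hp hnp hn1 hpX hln
  rw [show n + l * n = (l + 1) * n by ring] at hrec
  have hb1 := hD Y (Nat.le_add_left 1 _)
  have hb2 := ih Y hYX (Nat.le_add_left 1 _)
  have hrecR : (J n ((l + 1) * n) X : ℝ) ≤ 2 * ((((((l + 1) * n : ℕ) : ℝ)) ^ n) ^ 2 *
      ((p : ℝ) ^ (2 * (l * n)) *
      ((X : ℝ) ^ n * ((n.factorial : ℝ) * (p : ℝ) ^ (n * (n - 1) / 2)) * J n (l * n) Y))) +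
      2 * (((p : ℝ) ^ (n - 1)) ^ 2 * ((n : ℝ) ^ (2 * ((l + 1) * n)) * J n ((l + 1) * n) Y)) := by
    exact_mod_cast hrec
  have hpow : ∀ E : ℝ, (2 * (X : ℝ) / p) ^ E = 2 ^ E * (X : ℝ) ^ E * (p : ℝ) ^ (-E) := by
    intro E
    rw [Real.div_rpow (by positivity) hp0.le, Real.mul_rpow (by norm_num) (by positivity),
      Real.rpow_neg hp0.le, div_eq_mul_inv]
  have hJ1 : (J n (l * n) Y : ℝ) ≤ D * (2 ^ e * (X : ℝ) ^ e * (p : ℝ) ^ (-e)) := by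
    rw [← hpow]
    refine hb1.trans ?_
    gcongr
  have hJ2 : (J n ((l + 1) * n) Y : ℝ) ≤ D' * (2 ^ e' * (X : ℝ) ^ e' * (p : ℝ) ^ (-e')) := by
    rw [← hpow]
    refine hb2.trans ?_
    gcongr
  -- the main part
  have hmain : 2 * ((((((l + 1) * n : ℕ) : ℝ)) ^ n) ^ 2 * ((p : ℝ) ^ (2 * (l * n)) *
      ((X : ℝ) ^ n * ((n.factorial : ℝ) * (p : ℝ) ^ (n * (n - 1) / 2)) * J n (l * n) Y)))
      ≤ D' / 2 * (X : ℝ) ^ e' := by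
    have hppow : (p : ℝ) ^ (2 * (l * n)) * (p : ℝ) ^ (n * (n - 1) / 2) * (p : ℝ) ^ (-e) =
        (p : ℝ) ^ ((n : ℝ) ^ 2 - eta n l) := by
      rw [← Real.rpow_natCast, ← Real.rpow_natCast, ← Real.rpow_add hp0, ← Real.rpow_add hp0]
      congr 1
      have h2 : ((n * (n - 1) / 2 : ℕ) : ℝ) = (n : ℝ) * (n - 1) / 2 := by
        rw [Nat.cast_div (Nat.even_mul_pred_self n).two_dvd (by norm_num)]
        push_cast [show 1 ≤ n by omega]; ring
      rw [h2, he]; unfold ex; push_cast; ring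
    have hpbd : (p : ℝ) ^ ((n : ℝ) ^ 2 - eta n l) ≤ R ^ (n ^ 2) * (X : ℝ) ^ (n - eta n l / n) := by
      have hE : 0 ≤ (n : ℝ) ^ 2 - eta n l := sub_nonneg.2 (eta_le_sq n l hn)
      refine (Real.rpow_le_rpow hp0.le hpy hE).trans ?_
      rw [Real.mul_rpow (by norm_num) (by positivity), ← Real.rpow_mul (by positivity)]
      have h3 : 1 / (n : ℝ) * ((n : ℝ) ^ 2 - eta n l) = n - eta n l / n := by
        field_simp
      rw [h3]
      gcongr
      calc (4 : ℝ) ^ ((n : ℝ) ^ 2 - eta n l) ≤ 4 ^ ((n ^ 2 : ℕ) : ℝ) := by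
            apply Real.rpow_le_rpow_of_exponent_le (by norm_num)
            push_cast; linarith
        _ ≤ R ^ (n ^ 2) := by
            rw [Real.rpow_natCast]; exact pow_le_pow_left₀ (by norm_num) hR4 _
    have hXe : (X : ℝ) ^ n * ((X : ℝ) ^ (n - eta n l / n) * (X : ℝ) ^ e) = (X : ℝ) ^ e' := by
      rw [← Real.rpow_natCast, ← Real.rpow_add (by linarith), ← Real.rpow_add (by linarith), hexstep]
      congr 1; ring
    have hbR : (((l + 1) * n : ℕ) : ℝ) ≤ R := by
      rw [hR]; exact_mod_cast succ_mul_le_four_mul hL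
    have hfac : (n.factorial : ℝ) ≤ R ^ n := by
      have h1 : (n.factorial : ℝ) ≤ (n : ℝ) ^ n := by exact_mod_cast Nat.factorial_le_pow n
      refine h1.trans (pow_le_pow_left₀ (by positivity) ?_ _)
      refine le_trans ?_ hRn; push_cast; linarith
    have h2e : (2 : ℝ) ^ e ≤ R ^ (2 * l * n) := by
      calc (2 : ℝ) ^ e ≤ 2 ^ ((2 * l * n : ℕ) : ℝ) := by
            exact Real.rpow_le_rpow_of_exponent_le (by norm_num) hexle
        _ ≤ R ^ (2 * l * n) := by
            rw [Real.rpow_natCast]; exact pow_le_pow_left₀ (by norm_num) (by linarith) _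
    have hconst : 4 * ((R ^ n) ^ 2 * (R ^ n * (R ^ (n ^ 2) * R ^ (2 * l * n)))) * D ≤ D' := by
      refine le_trans ?_ hD2
      gcongr
      calc 4 * ((R ^ n) ^ 2 * (R ^ n * (R ^ (n ^ 2) * R ^ (2 * l * n))))
          ≤ R ^ 1 * ((R ^ n) ^ 2 * (R ^ n * (R ^ (n ^ 2) * R ^ (2 * l * n)))) := by
            gcongr; rw [pow_one]; exact hR4
        _ = R ^ (1 + (n * 2 + (n + (n ^ 2 + 2 * l * n)))) := by
            rw [← pow_mul, ← pow_add, ← pow_add, ← pow_add, ← pow_add]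
        _ ≤ R ^ (5 * n ^ 2 + 2 * n * L) := by
            exact pow_le_pow_right₀ (by linarith) (iterate_exponent_le hn hL)
    calc _ ≤ 2 * ((R ^ n) ^ 2 * ((p : ℝ) ^ (2 * (l * n)) *
      ((X : ℝ) ^ n * (R ^ n * (p : ℝ) ^ (n * (n - 1) / 2)) *
        (D * (2 ^ e * (X : ℝ) ^ e * (p : ℝ) ^ (-e)))))) := by gcongr
      _ = 2 * ((R ^ n) ^ 2 * (R ^ n * (((p : ℝ) ^ (2 * (l * n)) * (p : ℝ) ^ (n * (n - 1) / 2) *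
          (p : ℝ) ^ (-e)) * 2 ^ e))) * D * ((X : ℝ) ^ n * (X : ℝ) ^ e) := by ring
      _ ≤ 2 * ((R ^ n) ^ 2 * (R ^ n * ((R ^ (n ^ 2) * (X : ℝ) ^ (n - eta n l / n)) *
          R ^ (2 * l * n)))) * D * ((X : ℝ) ^ n * (X : ℝ) ^ e) := by
          rw [hppow]; gcongr
      _ = (4 * ((R ^ n) ^ 2 * (R ^ n * (R ^ (n ^ 2) * R ^ (2 * l * n)))) * D) / 2 *
          ((X : ℝ) ^ n * ((X : ℝ) ^ (n - eta n l / n) * (X : ℝ) ^ e)) := by ring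
      _ ≤ _ := by
          rw [hXe]; gcongr
  have hbad : 2 * (((p : ℝ) ^ (n - 1)) ^ 2 * ((n : ℝ) ^ (2 * ((l + 1) * n)) *
      J n ((l + 1) * n) Y)) ≤ D' / 2 * (X : ℝ) ^ e' := by
    set b := (l + 1) * n with hb
    have hppow : ((p : ℝ) ^ (n - 1)) ^ 2 * (p : ℝ) ^ (-e') ≤ ((p : ℝ) ^ (l * n))⁻¹ := by
      rw [← pow_mul, ← Real.rpow_natCast, ← Real.rpow_natCast, ← Real.rpow_add hp0,
        ← Real.rpow_neg hp0.le]
      refine Real.rpow_le_rpow_of_exponent_le hp1 ?_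
      push_cast at hex'0 ⊢
      linarith
    have h2e : (2 : ℝ) ^ e' ≤ 2 ^ (2 * b) := by
      rw [← Real.rpow_natCast]
      exact Real.rpow_le_rpow_of_exponent_le (by norm_num) hex'
    have hb2' : 2 ≤ 2 * b := by
      have : 1 ≤ b := Nat.mul_pos (Nat.succ_pos l) hn1
      omega
    have hsmall : 4 * ((n : ℝ) ^ (2 * b) * 2 ^ (2 * b)) ≤ (p : ℝ) ^ (l * n) := by
      have h4 : (4 : ℝ) ≤ 2 ^ (2 * b) := by
        calc (4 : ℝ) = 2 ^ 2 := by norm_num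
          _ ≤ 2 ^ (2 * b) := pow_le_pow_right₀ (by norm_num) hb2'
      calc 4 * ((n : ℝ) ^ (2 * b) * 2 ^ (2 * b)) ≤ 2 ^ (2 * b) * ((n : ℝ) ^ (2 * b) * 2 ^ (2 * b)) := by
            gcongr
        _ = ((4 * n : ℕ) : ℝ) ^ (2 * b) := by
            rw [← mul_pow, ← mul_pow]; push_cast; ring
        _ ≤ ((4 * n : ℕ) : ℝ) ^ (4 * (l * n)) := by
            refine pow_le_pow_right₀ (by push_cast; linarith) ?_
            have : (l + 1) * n ≤ (2 * l) * n := Nat.mul_le_mul_right n (by omega)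
            linarith
        _ ≤ (p : ℝ) ^ (l * n) := by
            rw [pow_mul]; exact pow_le_pow_left₀ (by positivity) hp4R _
    have hq : (0 : ℝ) < (p : ℝ) ^ (l * n) := by positivity
    calc _ ≤ 2 * (((p : ℝ) ^ (n - 1)) ^ 2 * ((n : ℝ) ^ (2 * b) *
          (D' * (2 ^ e' * (X : ℝ) ^ e' * (p : ℝ) ^ (-e'))))) := by gcongr
      _ = (4 * ((n : ℝ) ^ (2 * b) * 2 ^ e')) * (((p : ℝ) ^ (n - 1)) ^ 2 * (p : ℝ) ^ (-e')) *
          (D' / 2 * (X : ℝ) ^ e') := by ring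
      _ ≤ (p : ℝ) ^ (l * n) * ((p : ℝ) ^ (l * n))⁻¹ * (D' / 2 * (X : ℝ) ^ e') := by
          gcongr
          refine le_trans ?_ hsmall
          gcongr
      _ = D' / 2 * (X : ℝ) ^ e' := by rw [mul_inv_cancel₀ hq.ne', one_mul]
  calc _ ≤ _ := hrecR
    _ ≤ D' / 2 * (X : ℝ) ^ e' + D' / 2 * (X : ℝ) ^ e' := add_le_add hmain hbad
    _ = _ := by ring

/-- Vinogradov's mean value theorem. -/
theorem vinogradov_mean_value {n l L : ℕ} (hn : 2 ≤ n) (hl : 1 ≤ l) (hL : l ≤ L) (X : ℕ)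
    (hX : 1 ≤ X) :
    (J n (l * n) X : ℝ) ≤
      ((4 * n * L : ℕ) : ℝ) ^ (4 * n ^ 3 + l * (5 * n ^ 2 + 2 * n * L)) * (X : ℝ) ^ ex n l := by
  have hR1 : (1 : ℝ) ≤ ((4 * n * L : ℕ) : ℝ) := by
    exact_mod_cast (Nat.mul_pos (by omega) (by omega) : 1 ≤ 4 * n * L)
  induction l, hl using Nat.le_induction generalizing X with
  | base =>
    have h1 : ex n 1 = ((2 * (1 * n) : ℕ) : ℝ) := by
      unfold ex eta; push_cast; simp
    rw [h1, Real.rpow_natCast]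
    calc (J n (1 * n) X : ℝ) ≤ 1 * (X : ℝ) ^ (2 * (1 * n)) := by
          have := J_trivial n (1 * n) X
          rw [one_mul ((X : ℝ) ^ _)]; exact_mod_cast this
      _ ≤ _ := by
          gcongr
          exact one_le_pow₀ hR1
  | succ l hl ih =>
    refine J_iterate hn hl hL _ (fun X hX => ih (by omega) X hX) _ (by positivity) ?_ ?_ X hX
    · exact pow_le_pow_right₀ hR1 (by omega)
    · rw [← pow_add]
      exact pow_le_pow_right₀ hR1 (by nlinarith)

/-- The additive character `x ↦ e^{ix}`. -/
noncomputable def ee (x : ℝ) : ℂ := Complex.exp (x * Complex.I)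

lemma ee_add (x y : ℝ) : ee (x + y) = ee x * ee y := by
  unfold ee; rw [← Complex.exp_add]; push_cast; ring_nf

lemma ee_sum {ι : Type*} (S : Finset ι) (f : ι → ℝ) : ee (∑ i ∈ S, f i) = ∏ i ∈ S, ee (f i) := by
  unfold ee; rw [← Complex.exp_sum]; push_cast; rw [Finset.sum_mul]

lemma norm_ee (x : ℝ) : ‖ee x‖ = 1 := Complex.norm_exp_ofReal_mul_I x

lemma ee_neg (x : ℝ) : ee (-x) = (starRingEnd ℂ) (ee x) := by
  unfold ee
  rw [← Complex.exp_conj]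
  simp

/-- The weighted pairing on `ℤⁿ`. -/
noncomputable def Bf {n : ℕ} (α : Fin n → ℝ) (w z : Fin n → ℤ) : ℝ := ∑ j, α j * w j * z j

lemma Bf_add {n : ℕ} (α : Fin n → ℝ) (w z z' : Fin n → ℤ) :
    Bf α w (z + z') = Bf α w z + Bf α w z' := by
  unfold Bf; rw [← Finset.sum_add_distrib]
  refine Finset.sum_congr rfl fun j _ => ?_
  push_cast [Pi.add_apply]; ring

lemma Bf_sub {n : ℕ} (α : Fin n → ℝ) (w z z' : Fin n → ℤ) :
    Bf α w (z - z') = Bf α w z - Bf α w z' := by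
  unfold Bf; rw [← Finset.sum_sub_distrib]
  refine Finset.sum_congr rfl fun j _ => ?_
  push_cast [Pi.sub_apply]; ring

lemma Bf_comm {n : ℕ} (α : Fin n → ℝ) (w z : Fin n → ℤ) : Bf α w z = Bf α z w := by
  unfold Bf
  exact Finset.sum_congr rfl fun j _ => by ring

lemma Bf_sum {n : ℕ} {ι : Type*} (α : Fin n → ℝ) (w : Fin n → ℤ) (S : Finset ι) (z : ι → Fin n → ℤ) :
    Bf α w (∑ i ∈ S, z i) = ∑ i ∈ S, Bf α w (z i) := by
  classical
  induction S using Finset.induction_on with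
  | empty => simp [Bf]
  | insert a S ha ih => rw [sum_insert ha, sum_insert ha, Bf_add, ih]

/-- Tuples in `[1,a]`. -/
noncomputable def tup (s a : ℕ) : Finset (Fin s → ℤ) := Fintype.piFinset (fun _ : Fin s => Icc 1 (a : ℤ))

/-- Power sum difference of a pair of tuples. -/
def dif (n s : ℕ) (q : (Fin s → ℤ) × (Fin s → ℤ)) : Fin n → ℤ :=
  ∑ i, pv n (q.1 i) - ∑ i, pv n (q.2 i)

/-- The box containing all power sum differences. -/
noncomputable def box (n s a : ℕ) : Finset (Fin n → ℤ) :=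
  Fintype.piFinset (fun j : Fin n => Icc (-((s * a ^ (j.1 + 1) : ℕ) : ℤ)) ((s * a ^ (j.1 + 1) : ℕ) : ℤ))

lemma dif_mem_box {n s a : ℕ} {q} (hq : q ∈ tup s a ×ˢ tup s a) : dif n s q ∈ box n s a := by
  rw [mem_product] at hq
  have key : ∀ x ∈ tup s a, ∀ j : Fin n, 0 ≤ ∑ i, pv n (x i) j ∧
      ∑ i, pv n (x i) j ≤ ((s * a ^ (j.1 + 1) : ℕ) : ℤ) := by
    intro x hx j
    have hx' := fun i => mem_Icc.1 (Fintype.mem_piFinset.1 hx i)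
    constructor
    · exact Finset.sum_nonneg fun i _ => pow_nonneg (by linarith [(hx' i).1]) _
    · refine (Finset.sum_le_card_nsmul _ _ ((a : ℤ) ^ (j.1 + 1)) fun i _ =>
        pow_le_pow_left₀ (by linarith [(hx' i).1]) (hx' i).2 _).trans (le_of_eq ?_)
      simp
  refine Fintype.mem_piFinset.2 fun j => mem_Icc.2 ?_
  have h1 := key _ hq.1 j
  have h2 := key _ hq.2 j
  simp only [dif, Pi.sub_apply, Finset.sum_apply]
  constructor <;> linarith [h1.1, h1.2, h2.1, h2.2]

lemma sum_dif_le {n s a : ℕ} (F : (Fin n → ℤ) → ℝ) (hF : ∀ μ, 0 ≤ F μ) :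
    ∑ q ∈ tup s a ×ˢ tup s a, F (dif n s q) ≤ J n s a * ∑ μ ∈ box n s a, F μ := by
  classical
  rw [← Finset.sum_fiberwise_of_maps_to (fun q hq => dif_mem_box (n := n) hq), Finset.mul_sum]
  refine Finset.sum_le_sum fun μ _ => ?_
  rw [Finset.sum_congr rfl (g := fun _ => F μ) (fun q hq => by rw [(mem_filter.1 hq).2]),
    Finset.sum_const, nsmul_eq_mul]
  refine mul_le_mul_of_nonneg_right ?_ (hF μ)
  have := card_shift_le (tup s a) (fun x => ∑ i, pv n (x i)) μ
  refine le_trans ?_ (Nat.cast_le.2 this)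
  refine Nat.cast_le.2 (Finset.card_le_card fun q hq => ?_)
  rw [mem_filter] at hq ⊢
  refine ⟨hq.1, ?_⟩
  rw [← hq.2, dif, add_sub_cancel]

lemma norm_sum_pow_eq {n : ℕ} (s a : ℕ) (α : Fin n → ℝ) (w : Fin n → ℤ) :
    ((‖∑ v ∈ Icc 1 (a : ℤ), ee (Bf α w (pv n v))‖ ^ (2 * s) : ℝ) : ℂ) =
      ∑ q ∈ tup s a ×ˢ tup s a, ee (Bf α w (dif n s q)) := by
  have h1 : (∑ v ∈ Icc 1 (a : ℤ), ee (Bf α w (pv n v))) ^ s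
      = ∑ x ∈ tup s a, ee (Bf α w (∑ i, pv n (x i))) := by
    have := Finset.sum_pow' (Icc 1 (a : ℤ)) (fun v => ee (Bf α w (pv n v))) s
    rw [this]
    refine Finset.sum_congr rfl fun x _ => ?_
    rw [Bf_sum, ee_sum]
  rw [pow_mul, pow_right_comm, ← norm_pow, h1, Complex.ofReal_pow, ← Complex.mul_conj', map_sum,
    Finset.sum_mul_sum, Finset.sum_product]
  refine Finset.sum_congr rfl fun x _ => Finset.sum_congr rfl fun y _ => ?_
  rw [dif, Bf_sub, sub_eq_add_neg, ee_add, ee_neg]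

lemma sum_norm_pow_le {n : ℕ} (s a : ℕ) {κ : Type*} (α : Fin n → ℝ) (K : Finset κ) (w : κ → Fin n → ℤ) :
    ∑ k ∈ K, ‖∑ v ∈ Icc 1 (a : ℤ), ee (Bf α (w k) (pv n v))‖ ^ (2 * s) ≤
      ∑ q ∈ tup s a ×ˢ tup s a, ‖∑ k ∈ K, ee (Bf α (w k) (dif n s q))‖ := by
  have h : ((∑ k ∈ K, ‖∑ v ∈ Icc 1 (a : ℤ), ee (Bf α (w k) (pv n v))‖ ^ (2 * s) : ℝ) : ℂ) =
      ∑ q ∈ tup s a ×ˢ tup s a, ∑ k ∈ K, ee (Bf α (w k) (dif n s q)) := by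
    rw [Finset.sum_comm, Complex.ofReal_sum]
    exact Finset.sum_congr rfl fun k _ => norm_sum_pow_eq s a α (w k)
  have h0 : 0 ≤ ∑ k ∈ K, ‖∑ v ∈ Icc 1 (a : ℤ), ee (Bf α (w k) (pv n v))‖ ^ (2 * s) := by positivity
  rw [← abs_of_nonneg h0, ← Real.norm_eq_abs, ← Complex.norm_real, h]
  exact norm_sum_le _ _

lemma pow_sum_le {ι : Type*} (S : Finset ι) (f : ι → ℝ) (hf : ∀ i ∈ S, 0 ≤ f i) (k : ℕ) (hk : 1 ≤ k) :
    (∑ i ∈ S, f i) ^ k ≤ (S.card : ℝ) ^ (k - 1) * ∑ i ∈ S, f i ^ k := by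
  rcases S.eq_empty_or_nonempty with rfl | hS
  · simp [show k ≠ 0 by omega]
  obtain ⟨m, rfl⟩ := Nat.exists_eq_add_of_le' hk
  have := pow_sum_div_card_le_sum_pow (s := S) (f := f) hf m
  have hc : (0 : ℝ) < S.card := by exact_mod_cast hS.card_pos
  rw [div_le_iff₀ (by positivity)] at this
  simpa [mul_comm] using this

/-- One-dimensional factor in the bilinear estimate. -/
noncomputable def Efac (α : ℝ) (M : ℕ) : ℝ :=
  ∑ μ ∈ Icc (-(M : ℤ)) M, ‖∑ l ∈ Icc (-(M : ℤ)) M, ee (α * l * μ)‖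

lemma sum_box_eq {n : ℕ} (s a : ℕ) (α : Fin n → ℝ) :
    ∑ μ ∈ box n s a, ‖∑ w ∈ box n s a, ee (Bf α w μ)‖ = ∏ j : Fin n, Efac (α j) (s * a ^ (j.1 + 1)) := by
  unfold Efac
  rw [Finset.prod_univ_sum]
  refine Finset.sum_congr rfl fun μ _ => ?_
  rw [← norm_prod, Finset.prod_univ_sum]
  congr 1
  refine Finset.sum_congr rfl fun w _ => ?_
  rw [Bf, ee_sum]

/-- Vinogradov's bilinear estimate. -/
theorem bilinear_le {n : ℕ} (s a : ℕ) (hs : 1 ≤ s) (α : Fin n → ℝ) :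
    ‖∑ u ∈ Icc 1 (a : ℤ), ∑ v ∈ Icc 1 (a : ℤ), ee (Bf α (pv n u) (pv n v))‖ ^ (4 * s ^ 2) ≤
      (a : ℝ) ^ (8 * s ^ 2 - 4 * s) * (J n s a : ℝ) ^ 2 *
        ∏ j : Fin n, Efac (α j) (s * a ^ (j.1 + 1)) := by
  set V : (Fin n → ℤ) → ℝ := fun μ => ‖∑ u ∈ Icc 1 (a : ℤ), ee (Bf α (pv n u) μ)‖
  have hJ : (0 : ℝ) ≤ J n s a := Nat.cast_nonneg _
  have h1 : ‖∑ u ∈ Icc 1 (a : ℤ), ∑ v ∈ Icc 1 (a : ℤ), ee (Bf α (pv n u) (pv n v))‖ ^ (2 * s) ≤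
      (a : ℝ) ^ (2 * s - 1) * ∑ q ∈ tup s a ×ˢ tup s a, V (dif n s q) := by
    refine (pow_le_pow_left₀ (norm_nonneg _) (norm_sum_le _ _) _).trans ?_
    refine (pow_sum_le _ _ (fun _ _ => norm_nonneg _) _ (by omega)).trans ?_
    rw [Int.card_Icc]
    simp only [add_sub_cancel_right, Int.toNat_natCast]
    gcongr
    exact sum_norm_pow_le s a α _ _
  have hcard : ((tup s a ×ˢ tup s a).card : ℝ) = (a : ℝ) ^ (2 * s) := by
    rw [card_product, tup, Fintype.card_piFinset]
    simp [two_mul, pow_add]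
  have h2 : (∑ q ∈ tup s a ×ˢ tup s a, V (dif n s q)) ^ (2 * s) ≤
      ((a : ℝ) ^ (2 * s)) ^ (2 * s - 1) * (J n s a * (J n s a *
        ∏ j : Fin n, Efac (α j) (s * a ^ (j.1 + 1)))) := by
    refine (pow_sum_le _ _ (fun _ _ => norm_nonneg _) _ (by omega)).trans ?_
    rw [hcard]
    gcongr
    refine (sum_dif_le (fun μ => V μ ^ (2 * s)) (fun μ => by positivity)).trans ?_
    gcongr
    have := sum_norm_pow_le s a α (box n s a) id
    simp only [id] at this
    rw [← sum_box_eq]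
    refine le_trans (le_of_eq ?_) (this.trans (sum_dif_le (n := n)
      (fun μ => ‖∑ k ∈ box n s a, ee (Bf α k μ)‖) (fun μ => norm_nonneg _)))
    refine Finset.sum_congr rfl fun μ _ => ?_
    simp only [V, Bf_comm α μ]
  have h3 := pow_le_pow_left₀ (by positivity) h1 (2 * s)
  rw [← pow_mul, mul_pow] at h3
  rw [show 4 * s ^ 2 = 2 * s * (2 * s) by ring]
  refine (h3.trans (mul_le_mul_of_nonneg_left h2 (by positivity))).trans (le_of_eq ?_)
  have : (a : ℝ) ^ (8 * s ^ 2 - 4 * s) = ((a : ℝ) ^ (2 * s - 1)) ^ (2 * s) * ((a : ℝ) ^ (2 * s)) ^ (2 * s - 1) := by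
    rw [← pow_mul, ← pow_mul, ← pow_add]
    congr 1
    obtain ⟨k, rfl⟩ := Nat.exists_eq_add_of_le' hs
    have e1 : 2 * (k + 1) - 1 = 2 * k + 1 := by omega
    rw [e1, Nat.sub_eq_iff_eq_add (by nlinarith)]
    ring
  rw [this]; ring

lemma sum_Icc_neg {G : Type*} [AddCommMonoid G] (g : ℤ → G) (M : ℕ) :
    ∑ μ ∈ Icc (-(M : ℤ)) M, g μ = g 0 + ∑ k ∈ range M, (g (k + 1) + g (-(k + 1))) := by
  induction M with
  | zero => simp
  | succ M ih =>
    have h : Icc (-((M + 1 : ℕ) : ℤ)) ((M + 1 : ℕ) : ℤ) =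
        insert ((M : ℤ) + 1) (insert (-((M : ℤ) + 1)) (Icc (-(M : ℤ)) M)) := by
      ext x; simp only [mem_Icc, mem_insert]; push_cast; omega
    rw [h, sum_insert, sum_insert, ih, sum_range_succ]
    · rw [add_comm (∑ k ∈ range M, _), ← add_assoc, ← add_assoc, ← add_assoc, ← add_assoc,
        add_comm _ (g 0), ← add_assoc]
    · simp only [mem_Icc]; omega
    · simp only [mem_Icc, mem_insert]; omega

lemma geom_sum_ee (x : ℝ) (M : ℕ) :
    (ee x - 1) * ∑ l ∈ Icc (-(M : ℤ)) M, ee (l * x) = ee ((M + 1) * x) - ee (-(M * x)) := by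
  rw [sum_Icc_neg]
  induction M with
  | zero => simp [ee]
  | succ M ih =>
    rw [sum_range_succ, ← add_assoc, mul_add, ih]
    have e1 : ee ((M + 1 + 1) * x) = ee ((M + 1) * x) * ee x := by rw [← ee_add]; congr 1; ring
    have e2 : ee (-(M * x)) = ee (-((M + 1) * x)) * ee x := by rw [← ee_add]; congr 1; ring
    push_cast
    rw [e1, e2, neg_mul]
    ring

lemma norm_geom_sum_ee_le (x : ℝ) (hx : x ≠ 0) (hx2 : |x| ≤ Real.pi) (M : ℕ) :
    ‖∑ l ∈ Icc (-(M : ℤ)) M, ee (l * x)‖ ≤ Real.pi / |x| := by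
  have h1 : 2 / Real.pi * |x| ≤ ‖ee x - 1‖ := by
    unfold ee
    rw [mul_comm (x:ℂ) Complex.I, Complex.norm_exp_I_mul_ofReal_sub_one, norm_mul, Real.norm_eq_abs, Real.norm_eq_abs]
    have := Real.mul_abs_le_abs_sin (x := x / 2) (by rw [abs_div]; norm_num; linarith)
    rw [abs_div] at this
    norm_num at this ⊢
    have e : 2 / Real.pi * |x| = 2 * (|x| / Real.pi) := by ring
    linarith
  have h2 := congrArg norm (geom_sum_ee x M)
  rw [norm_mul] at h2
  have h3 : ‖ee ((M + 1) * x) - ee (-(M * x))‖ ≤ 2 := by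
    refine (norm_sub_le _ _).trans ?_
    rw [norm_ee, norm_ee]; norm_num
  have hx0 : 0 < |x| := abs_pos.2 hx
  have hpi := Real.pi_pos
  rw [le_div_iff₀ hx0]
  set A := ‖∑ l ∈ Icc (-(M : ℤ)) M, ee (l * x)‖
  have h4 : 2 / Real.pi * |x| * A ≤ 2 := (mul_le_mul_of_nonneg_right h1 (norm_nonneg _)).trans (h2.le.trans h3)
  rw [div_mul_eq_mul_div, div_mul_eq_mul_div, div_le_iff₀ hpi] at h4
  linarith

lemma norm_sum_ee_le_card (M : ℕ) (f : ℤ → ℝ) :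
    ‖∑ l ∈ Icc (-(M : ℤ)) M, ee (f l)‖ ≤ 2 * M + 1 := by
  refine (norm_sum_le _ _).trans ?_
  simp only [norm_ee, sum_const, Int.card_Icc, nsmul_eq_mul, mul_one]
  have : ((M : ℤ) + 1 - -(M : ℤ)).toNat = 2 * M + 1 := by omega
  rw [this]; push_cast; exact le_rfl

lemma Efac_nonneg (α : ℝ) (M : ℕ) : 0 ≤ Efac α M := Finset.sum_nonneg fun _ _ => norm_nonneg _

lemma Efac_le_trivial (α : ℝ) (M : ℕ) (hM : 1 ≤ M) : Efac α M ≤ (3 * M) ^ 2 := by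
  unfold Efac
  refine (Finset.sum_le_card_nsmul _ _ (2 * (M : ℝ) + 1) fun μ _ => norm_sum_ee_le_card M _).trans ?_
  have : ((M : ℤ) + 1 - -(M : ℤ)).toNat = 2 * M + 1 := by omega
  rw [Int.card_Icc, this, nsmul_eq_mul]
  have h : (1 : ℝ) ≤ M := by exact_mod_cast hM
  push_cast; nlinarith

lemma Efac_le_small (α : ℝ) (M : ℕ) (hM : 1 ≤ M) (hα : α ≠ 0) (h : |α| * M ≤ Real.pi) :
    Efac α M ≤ 3 * M + 2 * Real.pi / |α| * (1 + Real.log M) := by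
  have hM' : (1 : ℝ) ≤ M := by exact_mod_cast hM
  have hα0 : 0 < |α| := abs_pos.2 hα
  unfold Efac
  rw [sum_Icc_neg]
  refine add_le_add ((norm_sum_ee_le_card M _).trans (by linarith)) ?_
  have key : ∀ k ∈ range M, ∀ ε : ℝ, |ε| = 1 →
      ‖∑ l ∈ Icc (-(M : ℤ)) M, ee (α * l * (ε * (k + 1)))‖ ≤ Real.pi / |α| * ((k : ℝ) + 1)⁻¹ := by
    intro k hk ε hε
    have hk' : (k : ℝ) + 1 ≤ M := by exact_mod_cast Finset.mem_range.1 hk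
    have hk0 : (0 : ℝ) < k + 1 := by positivity
    have hab : |α * (ε * (k + 1))| = |α| * (k + 1) := by
      rw [abs_mul, abs_mul, hε, one_mul, abs_of_pos hk0]
    have := norm_geom_sum_ee_le (α * (ε * (k + 1))) (by rw [← abs_pos, hab]; positivity)
      (by rw [hab]; exact (mul_le_mul_of_nonneg_left hk' hα0.le).trans h) M
    rw [hab, ← div_div, div_eq_mul_inv (Real.pi / |α|)] at this
    refine le_trans (le_of_eq ?_) this
    congr 1
    refine Finset.sum_congr rfl fun l _ => ?_
    congr 1; ring
  have hh : ∑ k ∈ range M, ((k : ℝ) + 1)⁻¹ ≤ 1 + Real.log M := by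
    have := harmonic_le_one_add_log M
    simpa [harmonic] using this
  calc _ ≤ ∑ k ∈ range M, 2 * (Real.pi / |α|) * ((k : ℝ) + 1)⁻¹ := by
        refine Finset.sum_le_sum fun k hk => ?_
        have h1 := key k hk 1 (by simp)
        have h2 := key k hk (-1) (by simp)
        push_cast
        rw [one_mul] at h1
        rw [neg_one_mul] at h2
        linarith
    _ = 2 * Real.pi / |α| * ∑ k ∈ range M, ((k : ℝ) + 1)⁻¹ := by
        rw [← Finset.mul_sum]; ring
    _ ≤ _ := by gcongr

/-- Power saving in one factor of the bilinear estimate. -/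
lemma Efac_saving {N t lam m : ℝ} {a s j : ℕ} (hN : 1 < N) (hlam : 1 / 2 ≤ lam) (ht : t = N ^ lam)
    (hm1 : N ≤ m) (hm2 : m ≤ 2 * N) (ha1 : N ^ (2 / 5 : ℝ) / 2 ≤ a) (ha2 : a ≤ N ^ (2 / 5 : ℝ))
    (hj1 : 2 * lam ≤ j) (hj2 : (j : ℝ) ≤ 4 * lam) (hjs : j ≤ s)
    (hN8 : 8 ≤ N ^ (1 / 100 : ℝ)) (hNl : 2 * (1 + Real.log N) ≤ N ^ (1 / 50 : ℝ))
    (hs : (s : ℝ) ≤ N ^ (1 / 10 : ℝ)) (α : ℝ) (hα : |α| = t / (j * m ^ j)) :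
    Efac α (s * a ^ j) ≤ (3 * (s * a ^ j : ℕ)) ^ 2 * N ^ (-(j / 50 : ℝ)) := by
  have hN0 : 0 < N := by linarith
  have hm0 : 0 < m := by linarith
  have hj1' : 1 ≤ j := by
    have : (0 : ℝ) < j := by linarith
    exact_mod_cast this
  have hjR : (1 : ℝ) ≤ j := by exact_mod_cast hj1'
  have hjsR : (j : ℝ) ≤ s := by exact_mod_cast hjs
  have ht0 : 0 < t := by rw [ht]; positivity
  have ha0 : (0 : ℝ) < a := lt_of_lt_of_le (by positivity) ha1
  have ha0' : 1 ≤ a := by exact_mod_cast ha0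
  have ha1R : (1 : ℝ) ≤ a := by exact_mod_cast ha0'
  set M := s * a ^ j with hM
  have hM1 : 1 ≤ M := Nat.mul_pos (by omega) (pow_pos (by omega) _)
  have hMR : (M : ℝ) = s * (a : ℝ) ^ j := by rw [hM]; push_cast; ring
  have hM0 : (1 : ℝ) ≤ M := by exact_mod_cast hM1
  have hs0 : (1 : ℝ) ≤ s := by linarith
  have hα0 : 0 < |α| := by rw [hα]; positivity
  have pw : ∀ x : ℝ, (N ^ x) ^ j = N ^ (x * j) := fun x => by rw [Real.rpow_mul_natCast hN0.le]
  have hNj : N ^ j = N ^ (j : ℝ) := (Real.rpow_natCast _ _).symm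
  -- the angle is small
  have hang : |α| * M ≤ Real.pi := by
    have h1 : |α| * M ≤ N ^ lam * (N ^ (1 / 10 : ℝ) * N ^ (2 / 5 * (j : ℝ))) / N ^ (j : ℝ) := by
      rw [hα, hMR, ht, div_mul_eq_mul_div, ← pw, ← hNj]
      gcongr
      calc N ^ j = 1 * N ^ j := (one_mul _).symm
        _ ≤ j * m ^ j := by gcongr
    refine h1.trans ?_
    rw [← Real.rpow_add hN0, ← Real.rpow_add hN0, ← Real.rpow_sub hN0]
    refine (Real.rpow_le_one_of_one_le_of_nonpos hN.le (by linarith)).trans ?_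
    linarith [Real.pi_gt_three]
  have h := Efac_le_small α M hM1 (abs_pos.1 hα0) hang
  refine h.trans ?_
  have h8j : (8 : ℝ) ^ j ≤ N ^ (1 / 100 * (j : ℝ)) := by
    rw [← pw]; exact pow_le_pow_left₀ (by norm_num) hN8 _
  have haj : N ^ (2 / 5 * (j : ℝ)) ≤ 2 ^ j * (a : ℝ) ^ j := by
    rw [← pw, ← mul_pow]; exact pow_le_pow_left₀ (by positivity) (by linarith) _
  have hNlog : 0 ≤ Real.log N := Real.log_nonneg hN.le
  have hpi4 := Real.pi_le_four
  -- first term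
  have hA : 3 * (M : ℝ) ≤ (3 * M) ^ 2 * (N ^ (-(j / 50 : ℝ)) / 2) := by
    have h2 : 1 ≤ (3 * (M : ℝ)) * (N ^ (-(j / 50 : ℝ)) / 2) := by
      have h3 : N ^ ((j : ℝ) / 50) ≤ (a : ℝ) ^ j := by
        have h4 : (2 : ℝ) ^ j * N ^ ((j : ℝ) / 50) ≤ 2 ^ j * (a : ℝ) ^ j := by
          refine le_trans ?_ haj
          calc (2 : ℝ) ^ j * N ^ ((j : ℝ) / 50) ≤ N ^ (1 / 100 * (j : ℝ)) * N ^ ((j : ℝ) / 50) := by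
                gcongr
                refine le_trans ?_ h8j
                exact pow_le_pow_left₀ (by norm_num) (by norm_num) _
            _ = N ^ (3 / 100 * (j : ℝ)) := by rw [← Real.rpow_add hN0]; congr 1; ring
            _ ≤ _ := Real.rpow_le_rpow_of_exponent_le hN.le (by linarith)
        exact le_of_mul_le_mul_left h4 (by positivity)
      have h5 : (a : ℝ) ^ j ≤ M := by rw [hMR]; exact le_mul_of_one_le_left (by positivity) hs0
      rw [Real.rpow_neg hN0.le]
      have h6 : 0 < N ^ ((j : ℝ) / 50) := by positivity
      rw [mul_div_assoc', ← div_eq_mul_inv, div_div, le_div_iff₀ (by positivity)]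
      linarith
    nlinarith
  have hB : 2 * Real.pi / |α| * (1 + Real.log M) ≤ (3 * M) ^ 2 * (N ^ (-(j / 50 : ℝ)) / 2) := by
    have hlogM : 1 + Real.log M ≤ s * (1 + Real.log N) := by
      have h1 : Real.log M = Real.log s + j * Real.log a := by
        rw [hMR, Real.log_mul (by positivity) (by positivity), Real.log_pow]
      have h2 : Real.log s ≤ s - 1 := Real.log_le_sub_one_of_pos (by positivity)
      have h3 : Real.log a ≤ Real.log N := by
        refine Real.log_le_log ha0 (ha2.trans ?_)
        calc N ^ (2 / 5 : ℝ) ≤ N ^ (1 : ℝ) := Real.rpow_le_rpow_of_exponent_le hN.le (by norm_num)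
          _ = N := Real.rpow_one N
      have h4 : (j : ℝ) * Real.log a ≤ s * Real.log N :=
        mul_le_mul hjsR h3 (Real.log_nonneg ha1R) (by positivity)
      rw [h1]; linarith
    have hlog2 : 1 + Real.log M ≤ s * (N ^ (1 / 50 : ℝ) / 2) :=
      hlogM.trans (mul_le_mul_of_nonneg_left (by linarith) (by positivity))
    have hinv : 1 / |α| ≤ s * (2 ^ j * N ^ (j : ℝ)) / N ^ lam := by
      rw [hα, one_div_div, ht, ← hNj, ← mul_pow]
      gcongr
    have hkey : s * (2 ^ j * N ^ (j : ℝ)) / N ^ lam * (s * (N ^ (1 / 50 : ℝ) / 2)) ≤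
        (M : ℝ) ^ 2 * (N ^ (-(j / 50 : ℝ)) / 2) := by
      have e1 : (M : ℝ) ^ 2 = s ^ 2 * ((a : ℝ) ^ j) ^ 2 := by rw [hMR]; ring
      have h4 : N ^ (4 / 5 * (j : ℝ)) ≤ 4 ^ j * ((a : ℝ) ^ j) ^ 2 := by
        have := pow_le_pow_left₀ (by positivity) haj 2
        rw [mul_pow, ← pow_mul, mul_comm j 2, pow_mul, ← Real.rpow_mul_natCast hN0.le] at this
        norm_num at this
        refine le_trans (le_of_eq ?_) this
        congr 1; ring
      have h5 : 2 ^ j * N ^ (j : ℝ) / N ^ lam * N ^ (1 / 50 : ℝ) * 4 ^ j ≤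
          N ^ (4 / 5 * (j : ℝ)) * N ^ (-(j / 50 : ℝ)) := by
        calc 2 ^ j * N ^ (j : ℝ) / N ^ lam * N ^ (1 / 50 : ℝ) * 4 ^ j
            = 8 ^ j * (N ^ (j : ℝ) / N ^ lam * N ^ (1 / 50 : ℝ)) := by
              rw [show (8 : ℝ) = 2 * 4 by norm_num, mul_pow]; ring
          _ ≤ N ^ (1 / 100 * (j : ℝ)) * (N ^ (j : ℝ) / N ^ lam * N ^ (1 / 50 : ℝ)) := by gcongr
          _ = N ^ (1 / 100 * (j : ℝ) + (j - lam + 1 / 50)) := by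
              rw [← Real.rpow_sub hN0, ← Real.rpow_add hN0, ← Real.rpow_add hN0]
          _ ≤ N ^ (4 / 5 * (j : ℝ) + -(j / 50 : ℝ)) :=
              Real.rpow_le_rpow_of_exponent_le hN.le (by linarith)
          _ = _ := Real.rpow_add hN0 _ _
      have h6 : 2 ^ j * N ^ (j : ℝ) / N ^ lam * N ^ (1 / 50 : ℝ) ≤ ((a : ℝ) ^ j) ^ 2 * N ^ (-(j / 50 : ℝ)) := by
        have h7 := h5.trans (mul_le_mul_of_nonneg_right h4 (by positivity))
        have h8 : (0 : ℝ) < 4 ^ j := by positivity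
        refine le_of_mul_le_mul_right (h7.trans (le_of_eq ?_)) h8
        ring
      rw [e1]
      calc _ = (s : ℝ) ^ 2 / 2 * (2 ^ j * N ^ (j : ℝ) / N ^ lam * N ^ (1 / 50 : ℝ)) := by ring
        _ ≤ (s : ℝ) ^ 2 / 2 * (((a : ℝ) ^ j) ^ 2 * N ^ (-(j / 50 : ℝ))) := by gcongr
        _ = _ := by ring
    have hl0 : 0 ≤ 1 + Real.log M := by linarith [Real.log_nonneg hM0]
    calc 2 * Real.pi / |α| * (1 + Real.log M) = 2 * Real.pi * (1 / |α| * (1 + Real.log M)) := by ring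
      _ ≤ 9 * (s * (2 ^ j * N ^ (j : ℝ)) / N ^ lam * (s * (N ^ (1 / 50 : ℝ) / 2))) := by
          gcongr
          linarith
      _ ≤ 9 * ((M : ℝ) ^ 2 * (N ^ (-(j / 50 : ℝ)) / 2)) := by gcongr
      _ = _ := by ring
  calc _ ≤ (3 * (M : ℝ)) ^ 2 * (N ^ (-(j / 50 : ℝ)) / 2) + (3 * M) ^ 2 * (N ^ (-(j / 50 : ℝ)) / 2) :=
        add_le_add hA hB
    _ = _ := by ring

lemma natCeil_five_mul {lam : ℝ} {n : ℕ} (hlam : 1 / 2 ≤ lam) (hn : n = ⌈5 * lam⌉₊) :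
    3 ≤ n ∧ 5 * lam ≤ n ∧ (n : ℝ) ≤ 7 * lam := by
  have h1 : 5 * lam ≤ n := by rw [hn]; exact Nat.le_ceil _
  have h2 : (n : ℝ) < 5 * lam + 1 := by rw [hn]; exact Nat.ceil_lt_add_one (by linarith)
  refine ⟨?_, h1, by linarith⟩
  have : (2 : ℝ) < n := by linarith
  exact_mod_cast this

lemma lam_le_card {lam : ℝ} (hlam : 1 / 2 ≤ lam) :
    lam ≤ ((Icc ⌈2 * lam⌉₊ ⌊4 * lam⌋₊).card : ℝ) := by
  have h1 := Nat.ceil_lt_add_one (a := 2 * lam) (by linarith)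
  have h2 := Nat.lt_floor_add_one (4 * lam)
  have h3 : 2 * lam - 1 < ((⌊4 * lam⌋₊ + 1 - ⌈2 * lam⌉₊ : ℕ) : ℝ) := by
    have := Nat.le_sub_iff_add_le (n := ⌊4 * lam⌋₊ + 1) (m := ⌈2 * lam⌉₊) (k := ⌈2 * lam⌉₊)
    have h : ((⌊4 * lam⌋₊ + 1 : ℕ) : ℝ) - (⌈2 * lam⌉₊ : ℝ) ≤
        ((⌊4 * lam⌋₊ + 1 - ⌈2 * lam⌉₊ : ℕ) : ℝ) := by
      rw [sub_le_iff_le_add]; norm_cast; omega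
    push_cast at h
    linarith
  rw [Nat.card_Icc]
  rcases le_or_gt 1 lam with h | h
  · linarith
  · have h4 : (0 : ℝ) < ((⌊4 * lam⌋₊ + 1 - ⌈2 * lam⌉₊ : ℕ) : ℝ) := by linarith
    have h5 : (1 : ℝ) ≤ ((⌊4 * lam⌋₊ + 1 - ⌈2 * lam⌉₊ : ℕ) : ℝ) := by
      exact_mod_cast h4
    linarith

lemma eta_final {n : ℕ} (hn : 3 ≤ n) : eta n (9 * n + 1) ≤ (n : ℝ) ^ 2 / 7000 := by
  have hnR : (3 : ℝ) ≤ n := by exact_mod_cast hn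
  unfold eta
  have h1 : (1 - 1 / (n : ℝ)) ^ (9 * n + 1 - 1) ≤ 1 / 7000 := by
    have h2 : 1 - 1 / (n : ℝ) ≤ Real.exp (-(1 / n)) := by
      have := Real.add_one_le_exp (-(1 / (n : ℝ))); linarith
    have h0 : 0 ≤ 1 - 1 / (n : ℝ) := by
      rw [sub_nonneg, div_le_one (by linarith)]; linarith
    refine (pow_le_pow_left₀ h0 h2 _).trans ?_
    rw [← Real.exp_nat_mul, Nat.add_sub_cancel]
    have h3 : ((9 * n : ℕ) : ℝ) * -(1 / n) = -9 := by push_cast; field_simp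
    rw [h3, Real.exp_neg, one_div]
    apply inv_anti₀ (by norm_num)
    have h4 : Real.exp 9 = Real.exp 1 ^ 9 := by rw [← Real.exp_nat_mul]; norm_num
    rw [h4]
    calc (7000 : ℝ) ≤ 2.7 ^ 9 := by norm_num
      _ ≤ _ := pow_le_pow_left₀ (by norm_num) (by linarith [Real.exp_one_gt_d9]) _
  calc (n : ℝ) * (n + 1) / 2 * (1 - 1 / (n : ℝ)) ^ (9 * n + 1 - 1)
      ≤ (n : ℝ) * (n + 1) / 2 * (1 / 7000) := by gcongr
    _ ≤ _ := by nlinarith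

lemma mvt_const_le {n : ℕ} (hn : 3 ≤ n) :
    ((((4 * n * (9 * n + 1) : ℕ) : ℝ) ^
      (4 * n ^ 3 + (9 * n + 1) * (5 * n ^ 2 + 2 * n * (9 * n + 1)))) ^ 2) *
      (3 * (((9 * n + 1) * n : ℕ) : ℝ)) ^ (2 * n) ≤ ((40 * n ^ 2 : ℕ) : ℝ) ^ (512 * n ^ 3) := by
  have h1 : 4 * n * (9 * n + 1) ≤ 40 * n ^ 2 := by nlinarith
  have h2 : 3 * ((9 * n + 1) * n) ≤ 40 * n ^ 2 := by nlinarith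
  have h3 : (4 * n ^ 3 + (9 * n + 1) * (5 * n ^ 2 + 2 * n * (9 * n + 1))) ≤ 254 * n ^ 3 := by
    nlinarith [Nat.mul_le_mul_left (n ^ 2) hn]
  have h4 : 1 ≤ 40 * n ^ 2 := by nlinarith
  have h5 : 254 * n ^ 3 * 2 + 2 * n ≤ 512 * n ^ 3 := by
    have : n * 1 ≤ n * n ^ 2 := Nat.mul_le_mul_left _ (by nlinarith)
    nlinarith
  have : ((4 * n * (9 * n + 1)) ^ (4 * n ^ 3 + (9 * n + 1) * (5 * n ^ 2 + 2 * n * (9 * n + 1)))) ^ 2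
      * (3 * ((9 * n + 1) * n)) ^ (2 * n) ≤ (40 * n ^ 2) ^ (512 * n ^ 3) := by
    calc _ ≤ ((40 * n ^ 2) ^ (254 * n ^ 3)) ^ 2 * (40 * n ^ 2) ^ (2 * n) := by
          gcongr
      _ = (40 * n ^ 2) ^ (254 * n ^ 3 * 2 + 2 * n) := by rw [← pow_mul, ← pow_add]
      _ ≤ _ := Nat.pow_le_pow_right h4 h5
  exact_mod_cast this

lemma large_N {N : ℝ} {n : ℕ} (hn : 3 ≤ n) (h : ((40 * n ^ 2 : ℕ) : ℝ) ^ (2000000 * n) ≤ N) :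
    1 < N ∧ 360 ≤ N ^ (1 / 100 : ℝ) ∧ 2 * (1 + Real.log N) ≤ N ^ (1 / 50 : ℝ) ∧
      ((40 * n ^ 2 : ℕ) : ℝ) ≤ N ^ (1 / 10 : ℝ) ∧
      ((40 * n ^ 2 : ℕ) : ℝ) ^ (512 * n ^ 3) ≤ N ^ ((n : ℝ) ^ 2 * (512 / 2000000)) := by
  set R := ((40 * n ^ 2 : ℕ) : ℝ) with hR
  have hR1 : (360 : ℝ) ≤ R := by
    rw [hR]; exact_mod_cast (by nlinarith : 360 ≤ 40 * n ^ 2)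
  have hR0 : (0 : ℝ) < R := by linarith
  have hnR : (3 : ℝ) ≤ n := by exact_mod_cast hn
  have h' : R ^ ((2000000 * n : ℝ)) ≤ N := by
    refine le_trans (le_of_eq ?_) h
    rw [← Real.rpow_natCast]; push_cast; rfl
  have h1 : 1 < N := by
    refine lt_of_lt_of_le ?_ h
    exact one_lt_pow₀ (by linarith) (by omega)
  have hpow : ∀ x : ℝ, 0 ≤ x → R ^ (2000000 * n * x) ≤ N ^ x := fun x hx => by
    rw [Real.rpow_mul hR0.le]
    exact Real.rpow_le_rpow (by positivity) h' hx
  have hge : ∀ x : ℝ, 1 ≤ 2000000 * n * x → 0 ≤ x → R ≤ N ^ x := fun x hx hx0 => by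
    refine le_trans ?_ (hpow x hx0)
    calc R = R ^ (1 : ℝ) := (Real.rpow_one R).symm
      _ ≤ _ := Real.rpow_le_rpow_of_exponent_le (by linarith) hx
  have h100 : R ≤ N ^ (1 / 100 : ℝ) := hge _ (by linarith) (by norm_num)
  refine ⟨h1, hR1.trans h100, ?_, hge _ (by linarith) (by norm_num), ?_⟩
  · have h2 : Real.log N = 100 * Real.log (N ^ (1 / 100 : ℝ)) := by
      rw [Real.log_rpow (by linarith)]; ring
    have h3 := Real.log_le_sub_one_of_pos (show (0 : ℝ) < N ^ (1 / 100 : ℝ) by linarith)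
    have h4 : N ^ (1 / 50 : ℝ) = N ^ (1 / 100 : ℝ) * N ^ (1 / 100 : ℝ) := by
      rw [← Real.rpow_add (by linarith)]; norm_num
    rw [h4]; nlinarith
  · have := hpow ((n : ℝ) ^ 2 * (512 / 2000000)) (by positivity)
    refine le_trans (le_of_eq ?_) this
    rw [← Real.rpow_natCast]; congr 1; push_cast; ring

lemma prod_Efac_le {N t lam m : ℝ} {a n s : ℕ} (hN : 1 < N) (hlam : 1 / 2 ≤ lam) (ht : t = N ^ lam)
    (hm1 : N ≤ m) (hm2 : m ≤ 2 * N) (ha1 : N ^ (2 / 5 : ℝ) / 2 ≤ a) (ha2 : a ≤ N ^ (2 / 5 : ℝ))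
    (hn : 5 * lam ≤ n) (hns : n ≤ s)
    (hN8 : 8 ≤ N ^ (1 / 100 : ℝ)) (hNl : 2 * (1 + Real.log N) ≤ N ^ (1 / 50 : ℝ))
    (hs : (s : ℝ) ≤ N ^ (1 / 10 : ℝ)) (α : Fin n → ℝ)
    (hα : ∀ j : Fin n, |α j| = t / (((j.1 + 1 : ℕ) : ℝ) * m ^ (j.1 + 1))) :
    ∏ j, Efac (α j) (s * a ^ (j.1 + 1)) ≤
      (3 * (s : ℝ)) ^ (2 * n) * (a : ℝ) ^ (n * (n + 1)) * N ^ (-(lam ^ 2 / 25)) := by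
  have hN0 : 0 < N := by linarith
  have ha0 : (0 : ℝ) < a := lt_of_lt_of_le (by positivity) ha1
  have ha0' : 0 < a := by exact_mod_cast ha0
  have hn0 : (0 : ℝ) < n := by linarith
  have hs0 : 0 < s := lt_of_lt_of_le (by exact_mod_cast hn0) hns
  let g : ℕ → ℝ := fun k => if k ∈ Icc ⌈2 * lam⌉₊ ⌊4 * lam⌋₊ then (k : ℝ) / 50 else 0
  have h1 : ∀ j : Fin n, Efac (α j) (s * a ^ (j.1 + 1)) ≤
      (3 * (s * a ^ (j.1 + 1) : ℕ)) ^ 2 * N ^ (-(g (j.1 + 1))) := by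
    intro j
    simp only [g]
    split_ifs with h
    · rw [mem_Icc, Nat.ceil_le, Nat.le_floor_iff (by linarith)] at h
      refine Efac_saving hN hlam ht hm1 hm2 ha1 ha2 h.1 h.2 (by have := j.2; omega) hN8 hNl hs _ (hα j)
    · rw [neg_zero, Real.rpow_zero, mul_one]
      exact Efac_le_trivial _ _ (Nat.mul_pos hs0 (pow_pos ha0' _))
  refine (Finset.prod_le_prod (fun j _ => Efac_nonneg _ _) fun j _ => h1 j).trans ?_
  rw [Finset.prod_mul_distrib]
  have e1 : ∏ j : Fin n, (3 * ((s * a ^ (j.1 + 1) : ℕ) : ℝ)) ^ 2 =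
      (3 * (s : ℝ)) ^ (2 * n) * (a : ℝ) ^ (n * (n + 1)) := by
    rw [Finset.prod_pow]
    have : ∀ j : Fin n, (3 * ((s * a ^ (j.1 + 1) : ℕ) : ℝ)) = (3 * (s : ℝ)) * (a : ℝ) ^ (j.1 + 1) := by
      intro j; push_cast; ring
    simp only [this]
    rw [Finset.prod_mul_distrib, Finset.prod_const, Finset.card_univ, Fintype.card_fin,
      Finset.prod_pow_eq_pow_sum, mul_pow, ← pow_mul, ← pow_mul, mul_comm n 2]
    congr 2
    rw [Fin.sum_univ_eq_sum_range (fun j => j + 1) n]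
    have := Finset.sum_range_id_mul_two (n + 1)
    rw [Finset.sum_range_succ'] at this
    rw [add_zero] at this
    rw [this]; simp [mul_comm]
  rw [e1]
  gcongr
  rw [← Real.rpow_sum_of_pos hN0]
  apply Real.rpow_le_rpow_of_exponent_le hN.le
  rw [Finset.sum_neg_distrib, neg_le_neg_iff]
  rw [Fin.sum_univ_eq_sum_range (fun j => g (j + 1)) n]
  have h2 : ∑ k ∈ Icc ⌈2 * lam⌉₊ ⌊4 * lam⌋₊, (k : ℝ) / 50 ≤ ∑ j ∈ range n, g (j + 1) := by
    have h3 : ∑ j ∈ range n, g (j + 1) = ∑ j ∈ Icc 1 n, g j := by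
      rw [Finset.range_eq_Ico, Finset.sum_Ico_add' g 0 n 1]; rfl
    rw [h3]
    have hsub : Icc ⌈2 * lam⌉₊ ⌊4 * lam⌋₊ ⊆ Icc 1 n := by
      apply Icc_subset_Icc
      · exact Nat.one_le_ceil_iff.2 (by linarith)
      · have : (⌊4 * lam⌋₊ : ℝ) ≤ n := (Nat.floor_le (by linarith)).trans (by linarith)
        exact_mod_cast this
    calc _ = ∑ k ∈ Icc ⌈2 * lam⌉₊ ⌊4 * lam⌋₊, g k := Finset.sum_congr rfl fun k hk => by
            simp only [g]; rw [if_pos hk]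
      _ ≤ _ := Finset.sum_le_sum_of_subset_of_nonneg hsub fun k _ _ => by
            simp only [g]; split_ifs
            all_goals positivity
  refine le_trans ?_ h2
  have h4 : ((Icc ⌈2 * lam⌉₊ ⌊4 * lam⌋₊).card : ℝ) * (2 * lam / 50) ≤
      ∑ k ∈ Icc ⌈2 * lam⌉₊ ⌊4 * lam⌋₊, (k : ℝ) / 50 := by
    rw [← nsmul_eq_mul]
    refine Finset.card_nsmul_le_sum _ _ _ fun k hk => ?_
    rw [mem_Icc, Nat.ceil_le] at hk
    linarith [hk.1]
  refine le_trans ?_ h4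
  calc lam ^ 2 / 25 = lam * (2 * lam / 50) := by ring
    _ ≤ _ := by
      apply mul_le_mul_of_nonneg_right (lam_le_card hlam); linarith

lemma root_saving {W A N lam : ℝ} {s : ℕ} (hA : 0 ≤ A) (hN : 1 < N) (hs1 : 1 ≤ s)
    (hlam : 1 / 2 ≤ lam) (hs : (s : ℝ) ≤ 490 * lam ^ 2)
    (h : W ^ (4 * s ^ 2) ≤ A ^ (4 * s ^ 2) * N ^ (-(lam ^ 2 / 50))) :
    W ≤ A * N ^ (-(1 / 100000000) / lam ^ 2) := by
  have hl0 : 0 < lam := by linarith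
  have hs0 : 4 * s ^ 2 ≠ 0 := by positivity
  refine le_of_pow_le_pow_left₀ hs0 (by positivity) (h.trans ?_)
  rw [mul_pow]
  gcongr
  rw [← Real.rpow_mul_natCast (by linarith)]
  apply Real.rpow_le_rpow_of_exponent_le hN.le
  have h1 : (s : ℝ) ^ 2 ≤ (490 * lam ^ 2) ^ 2 := pow_le_pow_left₀ (by positivity) hs 2
  rw [neg_div, neg_mul, neg_le_neg_iff, div_mul_eq_mul_div, div_le_iff₀ (by positivity)]
  push_cast
  nlinarith [pow_pos hl0 4]

set_option maxHeartbeats 800000 in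
theorem weyl_inner {N t lam m : ℝ} {a n : ℕ} (hlam : 1 / 2 ≤ lam) (ht : t = N ^ lam)
    (hm1 : N ≤ m) (hm2 : m ≤ 2 * N) (ha1 : N ^ (2 / 5 : ℝ) / 2 ≤ a) (ha2 : a ≤ N ^ (2 / 5 : ℝ))
    (hn : n = ⌈5 * lam⌉₊) (hbig : ((40 * n ^ 2 : ℕ) : ℝ) ^ (2000000 * n) ≤ N)
    (α : Fin n → ℝ)
    (hα : ∀ j : Fin n, |α j| = t / (((j.1 + 1 : ℕ) : ℝ) * m ^ (j.1 + 1))) :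
    ‖∑ u ∈ Icc 1 (a : ℤ), ∑ v ∈ Icc 1 (a : ℤ), ee (Bf α (pv n u) (pv n v))‖ ≤
      (a : ℝ) ^ 2 * N ^ (-(1 / 100000000) / lam ^ 2) := by
  obtain ⟨hn3, hn5, hn7⟩ := natCeil_five_mul hlam hn
  obtain ⟨hN, hN8, hNl, hN10, hND⟩ := large_N hn3 hbig
  clear hbig
  have hN0 : 0 < N := by linarith
  have hnR : (3 : ℝ) ≤ n := by exact_mod_cast hn3
  have ha0 : (0 : ℝ) < a := lt_of_lt_of_le (by positivity) ha1
  have ha0' : 0 < a := by exact_mod_cast ha0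
  have hn49 : (n : ℝ) ^ 2 ≤ 49 * lam ^ 2 := by
    have h2 : (n : ℝ) ^ 2 ≤ (7 * lam) ^ 2 := pow_le_pow_left₀ (by positivity) hn7 2
    rw [mul_pow] at h2; linarith
  set s := (9 * n + 1) * n with hsdef
  have hs40 : s ≤ 10 * n ^ 2 := by rw [hsdef]; nlinarith
  have hns : n ≤ s := by rw [hsdef]; nlinarith
  have hs490 : (s : ℝ) ≤ 490 * lam ^ 2 := by
    have h1 : (s : ℝ) ≤ 10 * (n : ℝ) ^ 2 := by exact_mod_cast hs40
    linarith
  have hs10 : (s : ℝ) ≤ N ^ (1 / 10 : ℝ) := by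
    refine le_trans ?_ hN10
    exact_mod_cast hs40.trans (by omega)
  apply root_saving (s := s) (by positivity) hN (by omega) hlam hs490
  refine (bilinear_le s a (by omega) α).trans ?_
  have hmvt := vinogradov_mean_value (n := n) (l := 9 * n + 1) (L := 9 * n + 1) (by omega)
    (by omega) le_rfl a ha0'
  have hprod := prod_Efac_le hN hlam ht hm1 hm2 ha1 ha2 hn5 hns (by linarith) hNl hs10 α hα
  have hconst := mvt_const_le hn3
  rw [← hsdef] at hmvt hconst
  set D := (((4 * n * (9 * n + 1) : ℕ) : ℝ) ^
      (4 * n ^ 3 + (9 * n + 1) * (5 * n ^ 2 + 2 * n * (9 * n + 1)))) with hD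
  have hD0 : 0 ≤ D := by positivity
  have hex : ex n (9 * n + 1) * 2 + (n * (n + 1) : ℕ) = (4 * s : ℕ) + 2 * eta n (9 * n + 1) := by
    unfold ex; rw [hsdef]; push_cast; ring
  have hetaN : (a : ℝ) ^ (2 * eta n (9 * n + 1)) ≤ N ^ (lam ^ 2 * (49 * 4 / 5 / 7000)) := by
    have h0 : 0 ≤ 2 * eta n (9 * n + 1) := by
      have := eta_nonneg n (9 * n + 1) (by omega); linarith
    refine (Real.rpow_le_rpow ha0.le ha2 h0).trans ?_
    rw [← Real.rpow_mul hN0.le]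
    apply Real.rpow_le_rpow_of_exponent_le hN.le
    have h1 := eta_final hn3
    linarith
  have hDN : D ^ 2 * (3 * (s : ℝ)) ^ (2 * n) ≤ N ^ (lam ^ 2 * (49 * 512 / 2000000)) := by
    refine (hconst.trans hND).trans ?_
    apply Real.rpow_le_rpow_of_exponent_le hN.le
    linarith
  have hJ0 : (0 : ℝ) ≤ (J n s a : ℝ) := Nat.cast_nonneg _
  have hprod0 : 0 ≤ ∏ j, Efac (α j) (s * a ^ (j.1 + 1)) :=
    Finset.prod_nonneg fun _ _ => Efac_nonneg _ _
  have hsub : 8 * s ^ 2 - 4 * s + 4 * s = 8 * s ^ 2 := by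
    have : s * 1 ≤ s * s := Nat.mul_le_mul_left _ (by omega)
    have : 4 * s ≤ 8 * s ^ 2 := by nlinarith
    omega
  have hpa : (a : ℝ) ^ (8 * s ^ 2) = (a : ℝ) ^ (8 * s ^ 2 - 4 * s) * (a : ℝ) ^ (4 * s) := by
    rw [← pow_add, hsub]
  calc (a : ℝ) ^ (8 * s ^ 2 - 4 * s) * (J n s a : ℝ) ^ 2 * ∏ j, Efac (α j) (s * a ^ (j.1 + 1))
      ≤ (a : ℝ) ^ (8 * s ^ 2 - 4 * s) * (D * (a : ℝ) ^ ex n (9 * n + 1)) ^ 2 *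
        ((3 * (s : ℝ)) ^ (2 * n) * (a : ℝ) ^ (n * (n + 1)) * N ^ (-(lam ^ 2 / 25))) := by
        gcongr
    _ = (a : ℝ) ^ (8 * s ^ 2 - 4 * s) * ((a : ℝ) ^ (ex n (9 * n + 1) * 2) * (a : ℝ) ^ (n * (n + 1)))
        * ((D ^ 2 * (3 * (s : ℝ)) ^ (2 * n)) * N ^ (-(lam ^ 2 / 25))) := by
        have : (a : ℝ) ^ (ex n (9 * n + 1) * 2) = ((a : ℝ) ^ ex n (9 * n + 1)) ^ 2 := by
          rw [← Real.rpow_mul_natCast ha0.le]; norm_num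
        rw [this]; ring
    _ = (a : ℝ) ^ (8 * s ^ 2 - 4 * s) * ((a : ℝ) ^ (4 * s) * (a : ℝ) ^ (2 * eta n (9 * n + 1)))
        * ((D ^ 2 * (3 * (s : ℝ)) ^ (2 * n)) * N ^ (-(lam ^ 2 / 25))) := by
        congr 2
        rw [← Real.rpow_natCast, ← Real.rpow_natCast, ← Real.rpow_add ha0, ← Real.rpow_add ha0, hex]
    _ = (a : ℝ) ^ (8 * s ^ 2) * (a : ℝ) ^ (2 * eta n (9 * n + 1))
        * ((D ^ 2 * (3 * (s : ℝ)) ^ (2 * n)) * N ^ (-(lam ^ 2 / 25))) := by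
        rw [hpa]; simp only [mul_assoc]
    _ ≤ (a : ℝ) ^ (8 * s ^ 2) * N ^ (lam ^ 2 * (49 * 4 / 5 / 7000))
        * (N ^ (lam ^ 2 * (49 * 512 / 2000000)) * N ^ (-(lam ^ 2 / 25))) := by gcongr
    _ = (a : ℝ) ^ (8 * s ^ 2) * N ^ (lam ^ 2 * (49 * 4 / 5 / 7000) +
        (lam ^ 2 * (49 * 512 / 2000000) + -(lam ^ 2 / 25))) := by
        rw [Real.rpow_add hN0, Real.rpow_add hN0]; ring
    _ ≤ (a : ℝ) ^ (8 * s ^ 2) * N ^ (-(lam ^ 2 / 50)) := by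
        gcongr
        · exact hN.le
        · linarith [sq_nonneg lam]
    _ = _ := by rw [← pow_mul]; congr 2; ring

lemma norm_ee_sub_le (x y : ℝ) : ‖ee x - ee y‖ ≤ |x - y| := by
  have h : ee x - ee y = ee y * (ee (x - y) - 1) := by
    rw [mul_sub, ← ee_add, mul_one]; congr 2; ring
  rw [h, norm_mul, norm_ee, one_mul]
  unfold ee
  rw [mul_comm]
  exact (Real.norm_exp_I_mul_ofReal_sub_one_le).trans (le_of_eq (Real.norm_eq_abs _))

lemma norm_sum_shift_le (f : ℕ → ℂ) (hf : ∀ k, ‖f k‖ ≤ 1) (N N' h : ℕ) (hN : N ≤ N') :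
    ‖∑ m ∈ Ioc N N', f m - ∑ m ∈ Ioc N N', f (m + h)‖ ≤ 2 * h := by
  induction h with
  | zero => simp
  | succ h ih =>
    have h1 : ∑ m ∈ Ioc N N', f (m + h) - ∑ m ∈ Ioc N N', f (m + (h + 1)) =
        f (N + 1 + h) - f (N' + 1 + h) := by
      rw [← Finset.sum_sub_distrib]
      have e := Finset.sum_Ico_sub (fun k => f (k + h)) (show N + 1 ≤ N' + 1 by omega)
      have e2 : Ioc N N' = Ico (N + 1) (N' + 1) := by ext x; rw [Finset.mem_Ioc, Finset.mem_Ico]; omega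
      rw [e2]
      calc _ = -∑ k ∈ Ico (N + 1) (N' + 1), (f (k + 1 + h) - f (k + h)) := by
            rw [← Finset.sum_neg_distrib]
            refine Finset.sum_congr rfl fun k _ => ?_
            rw [neg_sub, show k + (h + 1) = k + 1 + h by ring]
        _ = _ := by rw [e, neg_sub]
    calc _ = ‖(∑ m ∈ Ioc N N', f m - ∑ m ∈ Ioc N N', f (m + h)) +
          (f (N + 1 + h) - f (N' + 1 + h))‖ := by rw [← h1]; congr 1; ring
      _ ≤ 2 * h + (1 + 1) := by
        refine (norm_add_le _ _).trans (add_le_add ih ((norm_sub_le _ _).trans (add_le_add (hf _) (hf _))))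
      _ = _ := by push_cast; ring

/-- Taylor expansion of the phase. -/
lemma phase_taylor {t m x : ℝ} (n : ℕ) (ht : 0 ≤ t) (hm : 0 < m) (hx0 : 0 ≤ x) (hx : x / m ≤ 1 / 2) :
    |-(t * Real.log (m + x)) - (-(t * Real.log m) +
      ∑ j ∈ range n, -(t * (-1) ^ j / (((j + 1 : ℕ) : ℝ) * m ^ (j + 1))) * x ^ (j + 1))| ≤
      t * (2 * (x / m) ^ (n + 1)) := by
  have hxm : 0 ≤ x / m := by positivity
  have h1 := Real.abs_log_sub_add_sum_range_le (x := -(x / m)) (by rw [abs_neg, abs_of_nonneg hxm]; linarith) n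
  rw [abs_neg, abs_of_nonneg hxm, sub_neg_eq_add] at h1
  have h2 : Real.log (m + x) = Real.log m + Real.log (1 + x / m) := by
    rw [← Real.log_mul hm.ne' (by positivity)]; congr 1; field_simp
  have h3 : ∑ j ∈ range n, -(t * (-1) ^ j / (((j + 1 : ℕ) : ℝ) * m ^ (j + 1))) * x ^ (j + 1) =
      t * ∑ i ∈ range n, (-(x / m)) ^ (i + 1) / ((i : ℝ) + 1) := by
    rw [Finset.mul_sum]
    refine Finset.sum_congr rfl fun j _ => ?_
    rw [neg_pow (x / m), div_pow]
    push_cast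
    field_simp
    ring
  rw [h2, h3]
  set S := ∑ i ∈ range n, (-(x / m)) ^ (i + 1) / ((i : ℝ) + 1)
  have e : -(t * (Real.log m + Real.log (1 + x / m))) - (-(t * Real.log m) + t * S) =
      -(t * (S + Real.log (1 + x / m))) := by ring
  rw [e, abs_neg, abs_mul, abs_of_nonneg ht]
  refine mul_le_mul_of_nonneg_left (h1.trans ?_) ht
  rw [div_le_iff₀ (by linarith)]
  have : 0 ≤ (x / m) ^ (n + 1) := by positivity
  nlinarith

lemma sum_Icc_int_eq (a : ℕ) (F : ℤ → ℂ) : ∑ u ∈ Icc 1 (a : ℤ), F u = ∑ u ∈ Icc 1 a, F (u : ℕ) := by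
  have : Icc 1 (a : ℤ) = (Icc 1 a).map Nat.castEmbedding := by
    ext x; simp only [Finset.mem_Icc, Finset.mem_map, Nat.castEmbedding_apply]
    constructor
    · intro h; exact ⟨x.toNat, by omega, by omega⟩
    · rintro ⟨y, h, rfl⟩; omega
  rw [this, Finset.sum_map]; rfl

theorem weyl_shifted {N t lam : ℝ} {m a n : ℕ} (hlam : 1 / 2 ≤ lam) (ht : t = N ^ lam)
    (hm1 : N ≤ m) (hm2 : m ≤ 2 * N) (ha1 : N ^ (2 / 5 : ℝ) / 2 ≤ a) (ha2 : a ≤ N ^ (2 / 5 : ℝ))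
    (hn : n = ⌈5 * lam⌉₊) (hbig : ((40 * n ^ 2 : ℕ) : ℝ) ^ (2000000 * n) ≤ N) :
    ‖∑ u ∈ Icc 1 a, ∑ v ∈ Icc 1 a, ee (-(t * Real.log ((m + u * v : ℕ) : ℝ)))‖ ≤
      (a : ℝ) ^ 2 * (N ^ (-(1 / 100000000) / lam ^ 2) + 2 * N ^ (-(1 / 5) : ℝ)) := by
  obtain ⟨hn3, hn5, hn7⟩ := natCeil_five_mul hlam hn
  obtain ⟨hN, hN8, -, -, -⟩ := large_N hn3 hbig
  have hN0 : 0 < N := by linarith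
  have hm0 : (0 : ℝ) < m := by linarith
  have ht0 : 0 ≤ t := by rw [ht]; positivity
  let α : Fin n → ℝ := fun j => -(t * (-1) ^ j.1 / (((j.1 + 1 : ℕ) : ℝ) * (m : ℝ) ^ (j.1 + 1)))
  have hα : ∀ j : Fin n, |α j| = t / (((j.1 + 1 : ℕ) : ℝ) * (m : ℝ) ^ (j.1 + 1)) := by
    intro j
    simp only [α]
    rw [abs_neg, abs_div, abs_mul, abs_pow, abs_neg, abs_one, one_pow, mul_one, abs_of_nonneg ht0,
      abs_of_pos (by positivity)]
  have hW := weyl_inner hlam ht hm1 hm2 ha1 ha2 hn hbig α hα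
  clear hbig
  rw [sum_Icc_int_eq] at hW
  simp only [sum_Icc_int_eq] at hW
  have hx2 : (a : ℝ) * a / m ≤ N ^ (-(1 / 5) : ℝ) := by
    rw [div_le_iff₀ hm0]
    calc (a : ℝ) * a ≤ N ^ (2 / 5 : ℝ) * N ^ (2 / 5 : ℝ) := by gcongr
      _ = N ^ (-(1 / 5) : ℝ) * N := by
        rw [← Real.rpow_add hN0]; nth_rw 3 [← Real.rpow_one N]; rw [← Real.rpow_add hN0]; norm_num
      _ ≤ _ := by gcongr
  have hhalf : N ^ (-(1 / 5) : ℝ) ≤ 1 / 2 := by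
    rw [Real.rpow_neg hN0.le, one_div, one_div]
    apply inv_anti₀ (by norm_num)
    calc (2 : ℝ) ≤ N ^ (1 / 100 : ℝ) := by linarith
      _ ≤ N ^ (5 : ℝ)⁻¹ := Real.rpow_le_rpow_of_exponent_le hN.le (by norm_num)
  have hterm : ∀ u ∈ Icc 1 a, ∀ v ∈ Icc 1 a,
      ‖ee (-(t * Real.log ((m + u * v : ℕ) : ℝ))) -
        ee (-(t * Real.log m)) * ee (Bf α (pv n (u : ℤ)) (pv n (v : ℤ)))‖ ≤ 2 * N ^ (-(1 / 5) : ℝ) := by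
    intro u hu v hv
    rw [← ee_add]
    refine (norm_ee_sub_le _ _).trans ?_
    have hu' : (u : ℝ) ≤ a := by exact_mod_cast (mem_Icc.1 hu).2
    have hv' : (v : ℝ) ≤ a := by exact_mod_cast (mem_Icc.1 hv).2
    have hxx : (u : ℝ) * v / m ≤ N ^ (-(1 / 5) : ℝ) := by
      refine le_trans ?_ hx2; gcongr
    have h1 := phase_taylor (t := t) (m := m) (x := u * v) n ht0 hm0 (by positivity) (by linarith)
    have h2 : Bf α (pv n (u : ℤ)) (pv n (v : ℤ)) =
        ∑ j ∈ range n, -(t * (-1) ^ j / (((j + 1 : ℕ) : ℝ) * (m : ℝ) ^ (j + 1))) *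
          ((u : ℝ) * v) ^ (j + 1) := by
      unfold Bf pv
      rw [← Fin.sum_univ_eq_sum_range (fun j => -(t * (-1) ^ j / (((j + 1 : ℕ) : ℝ) * (m : ℝ) ^ (j + 1))) *
          ((u : ℝ) * v) ^ (j + 1)) n]
      refine Finset.sum_congr rfl fun j _ => ?_
      simp only [α]
      push_cast; rw [mul_pow]; ring
    rw [h2]
    push_cast at h1 ⊢
    refine h1.trans ?_
    have h3 : ((u : ℝ) * v / m) ^ (n + 1) ≤ N ^ (-lam + -(1 / 5)) := by
      calc ((u : ℝ) * v / m) ^ (n + 1) ≤ (N ^ (-(1 / 5) : ℝ)) ^ (n + 1) := by gcongr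
        _ = N ^ (-(1 / 5) * ((n + 1 : ℕ) : ℝ)) := by rw [← Real.rpow_mul_natCast hN0.le]
        _ ≤ _ := Real.rpow_le_rpow_of_exponent_le hN.le (by push_cast; linarith)
    calc t * (2 * ((u : ℝ) * v / m) ^ (n + 1)) ≤ N ^ lam * (2 * N ^ (-lam + -(1 / 5))) := by
          rw [ht]; gcongr
      _ = 2 * (N ^ lam * N ^ (-lam + -(1 / 5))) := by ring
      _ = _ := by rw [← Real.rpow_add hN0]; congr 2; ring
  set E := ∑ u ∈ Icc 1 a, ∑ v ∈ Icc 1 a, ee (-(t * Real.log ((m + u * v : ℕ) : ℝ))) with hE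
  set B := ∑ u ∈ Icc 1 a, ∑ v ∈ Icc 1 a, ee (Bf α (pv n (u : ℤ)) (pv n (v : ℤ))) with hB
  have hdiff : ‖E - ee (-(t * Real.log m)) * B‖ ≤ (a : ℝ) ^ 2 * (2 * N ^ (-(1 / 5) : ℝ)) := by
    rw [hE, hB, Finset.mul_sum, ← Finset.sum_sub_distrib]
    simp only [Finset.mul_sum, ← Finset.sum_sub_distrib]
    refine (norm_sum_le _ _).trans ?_
    have : ∀ u ∈ Icc 1 a, ‖∑ v ∈ Icc 1 a, (ee (-(t * Real.log ((m + u * v : ℕ) : ℝ))) -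
        ee (-(t * Real.log m)) * ee (Bf α (pv n (u : ℤ)) (pv n (v : ℤ))))‖ ≤
        a * (2 * N ^ (-(1 / 5) : ℝ)) := by
      intro u hu
      refine (norm_sum_le _ _).trans ((Finset.sum_le_card_nsmul _ _ _ fun v hv => hterm u hu v hv).trans ?_)
      rw [Nat.card_Icc, nsmul_eq_mul, Nat.add_sub_cancel]
    refine (Finset.sum_le_card_nsmul _ _ _ this).trans (le_of_eq ?_)
    rw [Nat.card_Icc, nsmul_eq_mul, Nat.add_sub_cancel]; ring
  calc ‖E‖ = ‖ee (-(t * Real.log m)) * B + (E - ee (-(t * Real.log m)) * B)‖ := by congr 1; ring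
    _ ≤ ‖ee (-(t * Real.log m)) * B‖ + ‖E - ee (-(t * Real.log m)) * B‖ := norm_add_le _ _
    _ ≤ (a : ℝ) ^ 2 * N ^ (-(1 / 100000000) / lam ^ 2) + (a : ℝ) ^ 2 * (2 * N ^ (-(1 / 5) : ℝ)) := by
        rw [norm_mul, norm_ee, one_mul]; exact add_le_add hW hdiff
    _ = _ := by ring

/-- Vinogradov's estimate for zeta sums. -/
theorem zeta_sum_le {N N' n : ℕ} {t lam : ℝ} (hlam : 1 / 2 ≤ lam) (ht : t = (N : ℝ) ^ lam)
    (hn : n = ⌈5 * lam⌉₊) (hbig : ((40 * n ^ 2 : ℕ) : ℝ) ^ (2000000 * n) ≤ N)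
    (hNN : N ≤ N') (hN' : N' ≤ 2 * N) :
    ‖∑ m ∈ Ioc N N', ee (-(t * Real.log m))‖ ≤ 5 * (N : ℝ) ^ (1 - 1 / 100000000 / lam ^ 2) := by
  obtain ⟨hn3, -, -⟩ := natCeil_five_mul hlam hn
  obtain ⟨hN, hN8, -, -, -⟩ := large_N hn3 hbig
  have hN0 : 0 < (N : ℝ) := by linarith
  set a := ⌊(N : ℝ) ^ (2 / 5 : ℝ)⌋₊ with ha
  have ha2 : (a : ℝ) ≤ (N : ℝ) ^ (2 / 5 : ℝ) := Nat.floor_le (by positivity)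
  have h1N : 1 ≤ (N : ℝ) ^ (2 / 5 : ℝ) := Real.one_le_rpow hN.le (by norm_num)
  have ha1 : (N : ℝ) ^ (2 / 5 : ℝ) / 2 ≤ a := by
    have h1 := Nat.lt_floor_add_one ((N : ℝ) ^ (2 / 5 : ℝ))
    have h2 : 1 ≤ a := Nat.le_floor (by exact_mod_cast h1N)
    have h2' : (1 : ℝ) ≤ a := by exact_mod_cast h2
    rw [← ha] at h1; linarith
  have ha0 : (0 : ℝ) < a := lt_of_lt_of_le (by positivity) ha1
  have hm : ∀ m ∈ Ioc N N', ‖∑ u ∈ Icc 1 a, ∑ v ∈ Icc 1 a, ee (-(t * Real.log ((m + u * v : ℕ) : ℝ)))‖ ≤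
      (a : ℝ) ^ 2 * ((N : ℝ) ^ (-(1 / 100000000) / lam ^ 2) + 2 * (N : ℝ) ^ (-(1 / 5) : ℝ)) := by
    intro m hm
    rw [mem_Ioc] at hm
    exact weyl_shifted hlam ht (by exact_mod_cast hm.1.le) (by exact_mod_cast hm.2.trans hN') ha1 ha2 hn hbig
  clear hbig
  set S := ∑ m ∈ Ioc N N', ee (-(t * Real.log m)) with hS
  set P := (N : ℝ) ^ (-(1 / 100000000) / lam ^ 2) + 2 * (N : ℝ) ^ (-(1 / 5) : ℝ) with hP
  have hP0 : 0 ≤ P := by positivity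
  have hsh : ∀ u ∈ Icc 1 a, ∀ v ∈ Icc 1 a,
      ‖S - ∑ m ∈ Ioc N N', ee (-(t * Real.log ((m + u * v : ℕ) : ℝ)))‖ ≤ 2 * (a : ℝ) ^ 2 := by
    intro u hu v hv
    refine (norm_sum_shift_le (fun m : ℕ => ee (-(t * Real.log m))) (fun k => (norm_ee _).le) N N'
      (u * v) hNN).trans ?_
    have : u * v ≤ a * a := Nat.mul_le_mul (mem_Icc.1 hu).2 (mem_Icc.1 hv).2
    have : ((u * v : ℕ) : ℝ) ≤ ((a * a : ℕ) : ℝ) := by exact_mod_cast this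
    push_cast at this ⊢
    nlinarith
  have htot : ‖(a : ℂ) ^ 2 * S - ∑ u ∈ Icc 1 a, ∑ v ∈ Icc 1 a, ∑ m ∈ Ioc N N',
      ee (-(t * Real.log ((m + u * v : ℕ) : ℝ)))‖ ≤ (a : ℝ) ^ 2 * (2 * (a : ℝ) ^ 2) := by
    have e : (a : ℂ) ^ 2 * S = ∑ u ∈ Icc 1 a, ∑ v ∈ Icc 1 a, S := by
      simp only [Finset.sum_const, Nat.card_Icc, nsmul_eq_mul, Nat.add_sub_cancel]; ring
    rw [e, ← Finset.sum_sub_distrib]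
    simp only [← Finset.sum_sub_distrib]
    refine (norm_sum_le _ _).trans ?_
    refine (Finset.sum_le_card_nsmul _ _ (a * (2 * (a : ℝ) ^ 2)) fun u hu => ?_).trans (le_of_eq ?_)
    · refine (norm_sum_le _ _).trans ((Finset.sum_le_card_nsmul _ _ _ fun v hv => hsh u hu v hv).trans ?_)
      rw [Nat.card_Icc, nsmul_eq_mul, Nat.add_sub_cancel]
    · rw [Nat.card_Icc, nsmul_eq_mul, Nat.add_sub_cancel]; ring
  have hsw : ∑ u ∈ Icc 1 a, ∑ v ∈ Icc 1 a, ∑ m ∈ Ioc N N', ee (-(t * Real.log ((m + u * v : ℕ) : ℝ))) =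
      ∑ m ∈ Ioc N N', ∑ u ∈ Icc 1 a, ∑ v ∈ Icc 1 a, ee (-(t * Real.log ((m + u * v : ℕ) : ℝ))) := by
    rw [Finset.sum_comm]
    rw [Finset.sum_comm]
    rw [Finset.sum_comm (s := Ioc N N')]
    exact Finset.sum_congr rfl fun u _ => Finset.sum_comm
  rw [hsw] at htot
  set Q := ∑ m ∈ Ioc N N', ∑ u ∈ Icc 1 a, ∑ v ∈ Icc 1 a, ee (-(t * Real.log ((m + u * v : ℕ) : ℝ)))
    with hQ
  have hQ1 : ‖Q‖ ≤ N * ((a : ℝ) ^ 2 * P) := by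
    rw [hQ]
    refine (norm_sum_le _ _).trans ((Finset.sum_le_card_nsmul _ _ _ hm).trans ?_)
    rw [Nat.card_Ioc, nsmul_eq_mul]
    have : ((N' - N : ℕ) : ℝ) ≤ N := by exact_mod_cast (by omega : N' - N ≤ N)
    gcongr
  have h1 : (a : ℝ) ^ 2 * ‖S‖ ≤ (a : ℝ) ^ 2 * (2 * (a : ℝ) ^ 2 + N * P) := by
    have e : (a : ℝ) ^ 2 * ‖S‖ = ‖(a : ℂ) ^ 2 * S‖ := by
      rw [norm_mul, norm_pow, Complex.norm_natCast]
    rw [e]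
    calc ‖(a : ℂ) ^ 2 * S‖ = ‖((a : ℂ) ^ 2 * S - Q) + Q‖ := by congr 1; ring
      _ ≤ _ := (norm_add_le _ _).trans (add_le_add htot hQ1)
      _ = _ := by ring
  have h2 : ‖S‖ ≤ 2 * (a : ℝ) ^ 2 + N * P := le_of_mul_le_mul_left h1 (by positivity)
  have h3 : (a : ℝ) ^ 2 ≤ (N : ℝ) ^ (1 - 1 / 5 : ℝ) := by
    calc (a : ℝ) ^ 2 ≤ ((N : ℝ) ^ (2 / 5 : ℝ)) ^ 2 := by gcongr
      _ = _ := by rw [← Real.rpow_mul_natCast hN0.le]; norm_num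
  have h4 : (N : ℝ) ^ (1 - 1 / 5 : ℝ) ≤ (N : ℝ) ^ (1 - 1 / 100000000 / lam ^ 2) := by
    apply Real.rpow_le_rpow_of_exponent_le hN.le
    have : 1 / 100000000 / lam ^ 2 ≤ 1 / 5 := by
      rw [div_le_iff₀ (by positivity)]; nlinarith
    linarith
  have h5 : N * P = (N : ℝ) ^ (1 - 1 / 100000000 / lam ^ 2) + 2 * (N : ℝ) ^ (1 - 1 / 5 : ℝ) := by
    rw [hP, mul_add, sub_eq_add_neg, sub_eq_add_neg, Real.rpow_add hN0, Real.rpow_add hN0,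
      Real.rpow_one, neg_div]; ring
  rw [h5] at h2
  linarith

/-- Summand in the approximation of `(s-1) ζ(s)`. -/
noncomputable def vterm (n : ℕ) (s : ℂ) : ℂ :=
  (s - 1) * ((n : ℂ) + 2) ^ (-s) + ((n : ℂ) + 2) ^ (1 - s) - ((n : ℂ) + 1) ^ (1 - s)

/-- Partial approximation of `(s-1) ζ(s)`. -/
noncomputable def zapp (N : ℕ) (s : ℂ) : ℂ :=
  (s - 1) * ∑ k ∈ range (N + 1), ((k : ℂ) + 1) ^ (-s) + ((N : ℂ) + 1) ^ (1 - s)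

lemma zapp_succ (N : ℕ) (s : ℂ) : zapp (N + 1) s = zapp N s + vterm N s := by
  unfold zapp vterm
  rw [sum_range_succ _ (N + 1)]
  push_cast
  rw [show (N : ℂ) + 1 + 1 = N + 2 by ring]
  ring

lemma zapp_zero (s : ℂ) : zapp 0 s = s := by simp [zapp]

lemma zapp_eq (N : ℕ) (s : ℂ) : zapp N s = s + ∑ n ∈ range N, vterm n s := by
  induction N with
  | zero => simp [zapp_zero]
  | succ N ih => rw [zapp_succ, ih, sum_range_succ, add_assoc]

lemma hasDerivAt_ofReal_cpow' {x : ℝ} (hx : 0 < x) (s : ℂ) :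
    HasDerivAt (fun y : ℝ => (y : ℂ) ^ s) (s * (x : ℂ) ^ (s - 1)) x := by
  have h := (hasDerivAt_id (x : ℂ)).cpow_const (c := s) (Or.inl (by simpa using hx))
  have := h.comp_ofReal
  simpa using this

lemma norm_cpow_sub_le {a x y : ℝ} (ha : 0 < a) (hx : x ∈ Set.Icc a (a + 1))
    (hy : y ∈ Set.Icc a (a + 1)) (s : ℂ) (hs : 0 ≤ s.re) :
    ‖(y : ℂ) ^ (-s) - (x : ℂ) ^ (-s)‖ ≤ ‖s‖ * a ^ (-s.re - 1) := by
  have := Convex.norm_image_sub_le_of_norm_hasDerivWithin_le (f := fun y : ℝ => (y : ℂ) ^ (-s))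
    (f' := fun x : ℝ => -s * (x : ℂ) ^ (-s - 1)) (s := Set.Icc a (a + 1)) (C := ‖s‖ * a ^ (-s.re - 1))
    (fun x hx => (hasDerivAt_ofReal_cpow' (lt_of_lt_of_le ha hx.1) (-s)).hasDerivWithinAt)
    (fun x hx => by
      rw [norm_mul, norm_neg, Complex.norm_cpow_eq_rpow_re_of_pos (lt_of_lt_of_le ha hx.1)]
      refine mul_le_mul_of_nonneg_left ?_ (norm_nonneg _)
      simp only [Complex.sub_re, Complex.neg_re, Complex.one_re]
      exact Real.rpow_le_rpow_of_nonpos ha hx.1 (by linarith)) (convex_Icc _ _) hx hy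
  refine this.trans ?_
  have h1 : ‖y - x‖ ≤ 1 := by
    rw [Real.norm_eq_abs, abs_le]; constructor <;> linarith [hx.1, hx.2, hy.1, hy.2]
  exact mul_le_of_le_one_right (by positivity) h1

lemma norm_vterm_le (n : ℕ) (s : ℂ) (hs : 1 / 2 ≤ s.re) :
    ‖vterm n s‖ ≤ ‖s‖ * ‖s - 1‖ * ((n : ℝ) + 1) ^ (-(3 / 2) : ℝ) := by
  have ha : (0 : ℝ) < n + 1 := by positivity
  have ha1 : (1 : ℝ) ≤ n + 1 := by have : (0 : ℝ) ≤ n := Nat.cast_nonneg _; linarith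
  set a : ℝ := n + 1 with hadef
  have hmem1 : a ∈ Set.Icc a (a + 1) := ⟨le_rfl, by linarith⟩
  have hmem2 : a + 1 ∈ Set.Icc a (a + 1) := ⟨by linarith, le_rfl⟩
  have := Convex.norm_image_sub_le_of_norm_hasDerivWithin_le
    (f := fun y : ℝ => (y : ℂ) ^ (1 - s) + (s - 1) * ((a + 1 : ℝ) : ℂ) ^ (-s) * y)
    (f' := fun x : ℝ => (s - 1) * (((a + 1 : ℝ) : ℂ) ^ (-s) - (x : ℂ) ^ (-s)))
    (s := Set.Icc a (a + 1)) (C := ‖s - 1‖ * (‖s‖ * a ^ (-s.re - 1)))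
    (fun x hx => by
      have h1 := hasDerivAt_ofReal_cpow' (lt_of_lt_of_le ha hx.1) (1 - s)
      have h2 := ((hasDerivAt_id (x : ℝ)).ofReal_comp).const_mul ((s - 1) * ((a + 1 : ℝ) : ℂ) ^ (-s))
      have h3 := (h1.add h2).hasDerivWithinAt (s := Set.Icc a (a + 1))
      refine h3.congr_deriv ?_
      rw [show (1 - s - 1) = -s by ring]; push_cast; ring)
    (fun x hx => by
      rw [norm_mul]
      exact mul_le_mul_of_nonneg_left (norm_cpow_sub_le ha hx hmem2 s (by linarith)) (norm_nonneg _))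
    (convex_Icc _ _) hmem1 hmem2
  have e : (((a + 1 : ℝ) : ℂ) ^ (1 - s) + (s - 1) * ((a + 1 : ℝ) : ℂ) ^ (-s) * ((a + 1 : ℝ) : ℂ)) -
      ((a : ℂ) ^ (1 - s) + (s - 1) * ((a + 1 : ℝ) : ℂ) ^ (-s) * (a : ℂ)) = vterm n s := by
    unfold vterm
    rw [hadef]; push_cast
    rw [show (n : ℂ) + 1 + 1 = n + 2 by ring]
    ring
  rw [e] at this
  refine this.trans ?_
  rw [add_sub_cancel_left, norm_one, mul_one]
  have h3 : a ^ (-s.re - 1) ≤ a ^ (-(3 / 2) : ℝ) :=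
    Real.rpow_le_rpow_of_exponent_le ha1 (by linarith)
  calc ‖s - 1‖ * (‖s‖ * a ^ (-s.re - 1)) = ‖s‖ * ‖s - 1‖ * a ^ (-s.re - 1) := by ring
    _ ≤ _ := by gcongr

lemma rpow_three_halves_le (n : ℕ) : ((n : ℝ) + 1) ^ (-(3 / 2) : ℝ) ≤
    4 * (1 / Real.sqrt (n + 1) - 1 / Real.sqrt (n + 2)) := by
  have ha : (1 : ℝ) ≤ n + 1 := by have : (0 : ℝ) ≤ n := Nat.cast_nonneg _; linarith
  have h2 : (n : ℝ) + 2 = (n + 1) + 1 := by ring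
  rw [h2]
  set a : ℝ := n + 1
  have ha0 : 0 < a := by linarith
  set p := Real.sqrt a with hp
  set q := Real.sqrt (a + 1) with hq
  have hp0 : 0 < p := Real.sqrt_pos.2 ha0
  have hq0 : 0 < q := Real.sqrt_pos.2 (by linarith)
  have hpp : p ^ 2 = a := Real.sq_sqrt ha0.le
  have hqq : q ^ 2 = a + 1 := Real.sq_sqrt (by linarith)
  have hq32 : q ≤ 3 / 2 * p := by
    apply le_of_sq_le_sq _ (by positivity)
    rw [mul_pow, hpp, hqq]; linarith
  have e : a ^ (-(3 / 2) : ℝ) = 1 / p ^ 3 := by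
    rw [Real.rpow_neg ha0.le, one_div, hp, Real.sqrt_eq_rpow, ← Real.rpow_mul_natCast ha0.le]
    norm_num
  have e2 : 1 / p - 1 / q = 1 / (p * q * (p + q)) := by
    have : (q - p) * (p + q) = 1 := by nlinarith
    field_simp
    linarith
  rw [e, e2, mul_one_div, div_le_div_iff₀ (by positivity) (by positivity)]
  have : p * q * (p + q) ≤ p * (3 / 2 * p) * (p + 3 / 2 * p) := by gcongr
  nlinarith [pow_pos hp0 3]

lemma sum_vterm_le (N M : ℕ) (hNM : N ≤ M) (s : ℂ) (hs : 1 / 2 ≤ s.re) :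
    ‖zapp M s - zapp N s‖ ≤ ‖s‖ * ‖s - 1‖ * (4 * (1 / Real.sqrt (N + 1) - 1 / Real.sqrt (M + 1))) := by
  induction M, hNM using Nat.le_induction with
  | base => simp
  | succ M hM ih =>
    rw [zapp_succ]
    have h1 := (norm_vterm_le M s hs).trans
      (mul_le_mul_of_nonneg_left (rpow_three_halves_le M) (by positivity))
    calc _ = ‖(zapp M s - zapp N s) + vterm M s‖ := by congr 1; ring
      _ ≤ _ := (norm_add_le _ _).trans (add_le_add ih h1)
      _ = _ := by push_cast; rw [show (M : ℝ) + 1 + 1 = M + 2 by ring]; ring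

lemma summable_rpow_three_halves : Summable fun n : ℕ => ((n : ℝ) + 1) ^ (-(3 / 2) : ℝ) := by
  have := (summable_nat_add_iff 1).2 (Real.summable_nat_rpow.2 (show (-(3 / 2) : ℝ) < -1 by norm_num))
  simpa using this

lemma differentiable_vterm (n : ℕ) : Differentiable ℂ (vterm n) := by
  unfold vterm
  have h1 : ((n : ℂ) + 1) ≠ 0 := by exact_mod_cast Nat.succ_ne_zero n
  have h2 : ((n : ℂ) + 2) ≠ 0 := by exact_mod_cast Nat.succ_ne_zero (n + 1)
  intro s
  have d1 : DifferentiableAt ℂ (fun s : ℂ => ((n : ℂ) + 2) ^ (-s)) s :=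
    (differentiableAt_id.neg).const_cpow (Or.inl h2)
  have d2 : DifferentiableAt ℂ (fun s : ℂ => ((n : ℂ) + 2) ^ (1 - s)) s :=
    (differentiableAt_id.const_sub 1).const_cpow (Or.inl h2)
  have d3 : DifferentiableAt ℂ (fun s : ℂ => ((n : ℂ) + 1) ^ (1 - s)) s :=
    (differentiableAt_id.const_sub 1).const_cpow (Or.inl h1)
  exact (((differentiableAt_id.sub_const 1).mul d1).add d2).sub d3

lemma summable_vterm (s : ℂ) (hs : 1 / 2 ≤ s.re) : Summable fun n => vterm n s :=
  Summable.of_norm_bounded (summable_rpow_three_halves.mul_left _) fun n => norm_vterm_le n s hs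

lemma zapp_tendsto_of_one_lt {s : ℂ} (hs : 1 < s.re) :
    Tendsto (fun N => zapp N s) atTop (nhds ((s - 1) * riemannZeta s)) := by
  have h1 : Tendsto (fun N : ℕ => ∑ k ∈ range N, ((k : ℂ) + 1) ^ (-s)) atTop (nhds (riemannZeta s)) := by
    rw [zeta_eq_tsum_one_div_nat_add_one_cpow hs]
    have hsum : Summable fun n : ℕ => 1 / ((n : ℂ) + 1) ^ s := by
      have := (summable_nat_add_iff 1).2 (Complex.summable_one_div_nat_cpow.2 hs)
      simpa using this
    have := hsum.hasSum.tendsto_sum_nat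
    simpa only [Complex.cpow_neg, one_div] using this
  have h2 : Tendsto (fun N : ℕ => ((N : ℂ) + 1) ^ (1 - s)) atTop (nhds 0) := by
    rw [tendsto_zero_iff_norm_tendsto_zero]
    have h3 : Tendsto (fun N : ℕ => ((N : ℝ) + 1) ^ (-(s.re - 1))) atTop (nhds 0) :=
      (tendsto_rpow_neg_atTop (by linarith)).comp
        (tendsto_atTop_add_const_right _ _ tendsto_natCast_atTop_atTop)
    refine h3.congr fun N => ?_
    have : ((N : ℂ) + 1) = ((N + 1 : ℝ) : ℂ) := by push_cast; rfl
    rw [this, Complex.norm_cpow_eq_rpow_re_of_pos (by positivity)]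
    simp
  have h4 := ((h1.comp (tendsto_add_atTop_nat 1)).const_mul (s - 1)).add h2
  rw [add_zero] at h4
  exact h4

lemma riemannZeta₁_eq (s : ℂ) (hs : s ≠ 1) : riemannZeta₁ s = (s - 1) * riemannZeta s := by
  rw [riemannZeta_eq_inv_sub_mul hs, ← mul_assoc, mul_inv_cancel₀ (sub_ne_zero.2 hs), one_mul]

lemma riemannZeta₁_eq_tsum {s : ℂ} (hs : 1 / 2 < s.re) :
    riemannZeta₁ s = s + ∑' n, vterm n s := by
  have hopen : IsOpen {z : ℂ | 1 / 2 < z.re} := isOpen_lt continuous_const Complex.continuous_re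
  have hconv : Convex ℝ {z : ℂ | 1 / 2 < z.re} := convex_halfSpace_re_gt _
  have hd : DifferentiableOn ℂ (fun s => s + ∑' n, vterm n s) {z : ℂ | 1 / 2 < z.re} := by
    intro z hz
    have hU : IsOpen ({z : ℂ | 1 / 2 < z.re} ∩ Metric.ball 0 (‖z‖ + 1)) :=
      hopen.inter Metric.isOpen_ball
    have := Complex.differentiableOn_tsum_of_summable_norm (F := vterm)
      (u := fun n => (‖z‖ + 1) * (‖z‖ + 1 + 1) * ((n : ℝ) + 1) ^ (-(3 / 2) : ℝ))
      (summable_rpow_three_halves.mul_left _) (fun n => (differentiable_vterm n).differentiableOn) hU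
      (fun n w hw => by
        refine (norm_vterm_le n w hw.1.le).trans ?_
        have hw2 : ‖w‖ ≤ ‖z‖ + 1 := by simpa using (mem_ball_zero_iff.1 hw.2).le
        have hw3 : ‖w - 1‖ ≤ ‖z‖ + 1 + 1 := (norm_sub_le _ _).trans (by rw [norm_one]; linarith)
        gcongr)
    have hz' : z ∈ {z : ℂ | 1 / 2 < z.re} ∩ Metric.ball 0 (‖z‖ + 1) := ⟨hz, by simp⟩
    exact (differentiableAt_id.add (this.differentiableAt (hU.mem_nhds hz'))).differentiableWithinAt
  have ha := hd.analyticOnNhd hopen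
  have hb : AnalyticOnNhd ℂ riemannZeta₁ {z : ℂ | 1 / 2 < z.re} :=
    differentiable_riemannZeta₁.differentiableOn.analyticOnNhd hopen
  have h2mem : (2 : ℂ) ∈ {z : ℂ | 1 / 2 < z.re} := by
    change (1 / 2 : ℝ) < (2 : ℂ).re; norm_num
  refine hb.eqOn_of_preconnected_of_eventuallyEq ha hconv.isPreconnected h2mem ?_ hs
  have hop1 : IsOpen {z : ℂ | 1 < z.re} := isOpen_lt continuous_const Complex.continuous_re
  filter_upwards [hop1.mem_nhds (show (2 : ℂ) ∈ {z : ℂ | 1 < z.re} by change (1 : ℝ) < (2 : ℂ).re; norm_num)] with z hz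
  have hz' : 1 < z.re := hz
  have hz1 : z ≠ 1 := by rintro rfl; simp at hz'
  rw [riemannZeta₁_eq z hz1]
  have h1 := zapp_tendsto_of_one_lt hz'
  have h2 := ((summable_vterm z (by linarith)).hasSum.tendsto_sum_nat).const_add z
  simp only [zapp_eq] at h1
  exact tendsto_nhds_unique h1 h2

/-- Approximation of zeta by partial sums. -/
theorem norm_zeta_sub_le (N : ℕ) {s : ℂ} (hs : 1 / 2 < s.re) :
    ‖riemannZeta₁ s - zapp N s‖ ≤ 4 * ‖s‖ * ‖s - 1‖ / Real.sqrt (N + 1) := by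
  have h1 : Tendsto (fun M => zapp M s) atTop (nhds (riemannZeta₁ s)) := by
    rw [riemannZeta₁_eq_tsum hs]
    simp only [zapp_eq]
    exact ((summable_vterm s hs.le).hasSum.tendsto_sum_nat).const_add s
  have h2 := (h1.sub_const (zapp N s)).norm
  refine le_of_tendsto h2 ?_
  filter_upwards [eventually_ge_atTop N] with M hM
  refine (sum_vterm_le N M hM s hs.le).trans ?_
  have h3 : 0 ≤ 1 / Real.sqrt ((M : ℝ) + 1) := by positivity
  calc ‖s‖ * ‖s - 1‖ * (4 * (1 / Real.sqrt (N + 1) - 1 / Real.sqrt (M + 1))) ≤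
      ‖s‖ * ‖s - 1‖ * (4 * (1 / Real.sqrt (N + 1))) := by gcongr; linarith
    _ = _ := by ring

lemma abel_sum_le (f : ℕ → ℂ) (g : ℕ → ℝ) (N N' : ℕ) (B : ℝ) (hN : N ≤ N')
    (hg0 : ∀ m, N ≤ m → 0 ≤ g m) (hg : ∀ m, N ≤ m → g (m + 1) ≤ g m)
    (hF : ∀ M, N ≤ M → M ≤ N' → ‖∑ m ∈ Ioc N M, f m‖ ≤ B) :
    ‖∑ m ∈ Ioc N N', (g m : ℂ) * f m‖ ≤ g N * B := by
  have key : ∀ M, N ≤ M → M ≤ N' →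
      ‖∑ m ∈ Ioc N M, (g m : ℂ) * f m - g M * ∑ m ∈ Ioc N M, f m‖ ≤ (g N - g M) * B := by
    intro M hM
    induction M, hM using Nat.le_induction with
    | base => simp
    | succ M hM ih =>
      intro hM'
      have e1 : ∀ h : ℕ → ℂ, ∑ m ∈ Ioc N (M + 1), h m = ∑ m ∈ Ioc N M, h m + h (M + 1) := fun h =>
        Finset.sum_Ioc_succ_top (by omega) h
      rw [e1, e1]
      have e2 : ∑ m ∈ Ioc N M, (g m : ℂ) * f m + g (M + 1) * f (M + 1) -
          g (M + 1) * (∑ m ∈ Ioc N M, f m + f (M + 1)) =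
          (∑ m ∈ Ioc N M, (g m : ℂ) * f m - g M * ∑ m ∈ Ioc N M, f m) +
          ((g M - g (M + 1) : ℝ) : ℂ) * ∑ m ∈ Ioc N M, f m := by push_cast; ring
      rw [e2]
      refine (norm_add_le _ _).trans ?_
      rw [norm_mul, Complex.norm_real, Real.norm_eq_abs, abs_of_nonneg (sub_nonneg.2 (hg M hM))]
      have h1 := ih (by omega)
      have h2 := mul_le_mul_of_nonneg_left (hF M hM (by omega)) (sub_nonneg.2 (hg M hM))
      linarith
  have h1 := key N' hN le_rfl
  have h2 := mul_le_mul_of_nonneg_left (hF N' hN le_rfl) (hg0 N' hN)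
  calc _ = ‖(∑ m ∈ Ioc N N', (g m : ℂ) * f m - g N' * ∑ m ∈ Ioc N N', f m) +
        g N' * ∑ m ∈ Ioc N N', f m‖ := by congr 1; ring
    _ ≤ (g N - g N') * B + g N' * B := by
      refine (norm_add_le _ _).trans (add_le_add h1 ?_)
      rw [norm_mul, Complex.norm_real, Real.norm_eq_abs, abs_of_nonneg (hg0 N' hN)]
      exact h2
    _ = _ := by ring

/-- The large-parameter condition used for the Vinogradov–Korobov region. -/
def Big (L : ℝ) : Prop := 1 ≤ Real.log L ∧ (10 : ℝ) ^ 54 ≤ L / Real.log L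

/-- The width of the region in which zeta is bounded. -/
noncomputable def theta (L : ℝ) : ℝ := 1 / 100000000 * (Real.log L / L) ^ (2 / 3 : ℝ)

/-- The logarithm of the threshold below which sums are estimated trivially. -/
noncomputable def Xtriv (L : ℝ) : ℝ := L ^ (2 / 3 : ℝ) * Real.log L ^ (1 / 3 : ℝ)

lemma Big.pos {L : ℝ} (h : Big L) : 0 < L ∧ (10 : ℝ) ^ 54 ≤ L ∧ Real.log L ≤ L := by
  have h1 : 0 < Real.log L := by linarith [h.1]
  have h2 : (10 : ℝ) ^ 54 * Real.log L ≤ L := (le_div_iff₀ h1).1 h.2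
  have h3 : (10 : ℝ) ^ 54 ≤ L := le_trans (le_mul_of_one_le_right (by norm_num) h.1) h2
  have h4 : 0 < L := lt_of_lt_of_le (by norm_num) h3
  exact ⟨h4, h3, by linarith [Real.log_le_sub_one_of_pos h4]⟩

lemma Big.theta_mul_X {L : ℝ} (h : Big L) : theta L * Xtriv L = 1 / 100000000 * Real.log L := by
  obtain ⟨h0, -, -⟩ := h.pos
  have h1 : 0 < Real.log L := by linarith [h.1]
  unfold theta Xtriv
  rw [Real.div_rpow h1.le h0.le]
  have e : Real.log L ^ (2 / 3 : ℝ) * Real.log L ^ (1 / 3 : ℝ) = Real.log L := by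
    rw [← Real.rpow_add h1]; norm_num
  have : L ^ (2 / 3 : ℝ) ≠ 0 := by positivity
  field_simp
  rw [e]

lemma Big.theta_bounds {L : ℝ} (h : Big L) : 0 < theta L ∧ theta L ≤ 1 / 100000000 := by
  obtain ⟨h0, -, h2⟩ := h.pos
  have h1 : 0 < Real.log L := by linarith [h.1]
  unfold theta
  constructor
  · positivity
  · have : (Real.log L / L) ^ (2 / 3 : ℝ) ≤ 1 :=
      Real.rpow_le_one (by positivity) ((div_le_one h0).2 h2) (by norm_num)
    linarith

lemma Big.X_bounds {L : ℝ} (h : Big L) : 1 ≤ Xtriv L ∧ Xtriv L ≤ L := by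
  obtain ⟨h0, h54, h2⟩ := h.pos
  have h1 : 0 < Real.log L := by linarith [h.1]
  have hL1 : 1 ≤ L := le_trans (by norm_num) h54
  unfold Xtriv
  constructor
  · exact one_le_mul_of_one_le_of_one_le (Real.one_le_rpow hL1 (by norm_num))
      (Real.one_le_rpow h.1 (by norm_num))
  · calc L ^ (2 / 3 : ℝ) * Real.log L ^ (1 / 3 : ℝ) ≤ L ^ (2 / 3 : ℝ) * L ^ (1 / 3 : ℝ) := by gcongr
      _ = L := by rw [← Real.rpow_add h0]; norm_num

lemma Big.div_X {L : ℝ} (h : Big L) : L / Xtriv L = (L / Real.log L) ^ (1 / 3 : ℝ) := by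
  obtain ⟨h0, -, -⟩ := h.pos
  have h1 : 0 < Real.log L := by linarith [h.1]
  unfold Xtriv
  rw [Real.div_rpow h0.le h1.le, ← div_div]
  congr 1
  rw [div_eq_iff (by positivity), ← Real.rpow_add h0]; norm_num

lemma Big.X_eq {L : ℝ} (h : Big L) : Xtriv L = (L / Xtriv L) ^ 2 * Real.log L := by
  obtain ⟨h0, -, -⟩ := h.pos
  have h1 : 0 < Real.log L := by linarith [h.1]
  rw [h.div_X, ← Real.rpow_mul_natCast (by positivity), Real.div_rpow h0.le h1.le, Xtriv]
  norm_num
  rw [div_mul_eq_mul_div, mul_div_assoc]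
  congr 1
  rw [eq_div_iff (by positivity), ← Real.rpow_add h1]; norm_num

lemma Big.hbig {L lam : ℝ} {n : ℕ} (h : Big L) (hlam : 1 / 2 ≤ lam) (hl : lam ≤ L / Xtriv L)
    (hn : n = ⌈5 * lam⌉₊) :
    ((40 * n ^ 2 : ℕ) : ℝ) ^ (2000000 * n) ≤ Real.exp (Xtriv L) := by
  obtain ⟨hn3, -, hn7⟩ := natCeil_five_mul hlam hn
  set Λ := L / Xtriv L with hΛ
  have hΛ18 : (10 : ℝ) ^ 18 ≤ Λ := by
    rw [hΛ, h.div_X]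
    calc (10 : ℝ) ^ 18 = ((10 : ℝ) ^ 54) ^ (1 / 3 : ℝ) := by
          rw [← Real.rpow_natCast, ← Real.rpow_natCast, ← Real.rpow_mul (by norm_num)]; norm_num
      _ ≤ _ := Real.rpow_le_rpow (by norm_num) h.2 (by norm_num)
  have hΛ0 : 0 < Λ := lt_of_lt_of_le (by norm_num) hΛ18
  have hnΛ : (n : ℝ) ≤ 7 * Λ := by linarith
  have hn0 : (0 : ℝ) < n := by
    have : (3 : ℝ) ≤ n := by exact_mod_cast hn3
    linarith
  have hR0 : (0 : ℝ) < ((40 * n ^ 2 : ℕ) : ℝ) := by push_cast; positivity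
  have hlogR : Real.log ((40 * n ^ 2 : ℕ) : ℝ) ≤ 4 * Real.sqrt (45 * Λ) := by
    have h1 : ((40 * n ^ 2 : ℕ) : ℝ) ≤ Real.sqrt (45 * Λ) ^ 4 := by
      have : Real.sqrt (45 * Λ) ^ 4 = (45 * Λ) ^ 2 := by
        rw [show (4 : ℕ) = 2 * 2 by norm_num, pow_mul, Real.sq_sqrt (by positivity)]
      rw [this]; push_cast
      have h2 : (n : ℝ) ^ 2 ≤ (7 * Λ) ^ 2 := pow_le_pow_left₀ hn0.le hnΛ 2
      rw [mul_pow] at h2 ⊢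
      have := sq_nonneg Λ
      linarith
    refine (Real.log_le_log hR0 h1).trans ?_
    rw [Real.log_pow]
    have hs : 0 < Real.sqrt (45 * Λ) := Real.sqrt_pos.2 (by positivity)
    have := Real.log_le_sub_one_of_pos hs
    push_cast; linarith
  rw [← Real.log_le_iff_le_exp (by positivity), Real.log_pow, h.X_eq]
  have hsq : Real.sqrt (45 * Λ) * 56000000 ≤ Λ := by
    have h1 : 45 * Λ ≤ (Λ / 56000000) ^ 2 := by
      have : Λ * 10 ^ 18 ≤ Λ * Λ := mul_le_mul_of_nonneg_left hΛ18 hΛ0.le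
      rw [div_pow, le_div_iff₀ (by norm_num)]; nlinarith
    have h2 := Real.sqrt_le_sqrt h1
    rw [Real.sqrt_sq (by positivity)] at h2
    linarith
  calc ((2000000 * n : ℕ) : ℝ) * Real.log ((40 * n ^ 2 : ℕ) : ℝ)
      ≤ (2000000 * (7 * Λ)) * (4 * Real.sqrt (45 * Λ)) := by
        push_cast at hlogR ⊢
        gcongr
        rw [← Nat.cast_ofNat, ← Nat.cast_pow, ← Nat.cast_mul]
        exact Real.log_natCast_nonneg _
    _ = Λ * (Real.sqrt (45 * Λ) * 56000000) := by ring
    _ ≤ Λ * Λ := by gcongr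
    _ = Λ ^ 2 * 1 := by ring
    _ ≤ _ := by gcongr; exact h.1

lemma natCast_cpow_eq {m : ℕ} (hm : 0 < m) (σ t : ℝ) :
    (m : ℂ) ^ (-((σ : ℂ) + t * Complex.I)) = (((m : ℝ) ^ (-σ) : ℝ) : ℂ) * ee (-(t * Real.log m)) := by
  have hm0 : (m : ℂ) ≠ 0 := by exact_mod_cast hm.ne'
  have hmR : (0 : ℝ) < m := by exact_mod_cast hm
  rw [neg_add, Complex.cpow_add _ _ hm0]
  congr 1
  · rw [Complex.ofReal_cpow hmR.le]; push_cast; rfl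
  · rw [Complex.cpow_def_of_ne_zero hm0, ee, Complex.natCast_log.symm]
    congr 1; push_cast; ring

lemma block_le {L σ t : ℝ} {N N' : ℕ} (h : Big L) (ht1 : 1 ≤ t) (htL : t ≤ Real.exp L)
    (hσ : 1 - theta L ≤ σ) (hN : Real.exp (Xtriv L) ≤ N) (hNt : (N : ℝ) ≤ t ^ 2) (hNN : N ≤ N')
    (hN' : N' ≤ 2 * N) :
    ‖∑ m ∈ Ioc N N', (m : ℂ) ^ (-((σ : ℂ) + t * Complex.I))‖ ≤ 5 := by
  obtain ⟨hX1, hXL⟩ := h.X_bounds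
  obtain ⟨hth0, hth1⟩ := h.theta_bounds
  have hN1 : 1 < (N : ℝ) := lt_of_lt_of_le (Real.one_lt_exp_iff.2 (by linarith)) hN
  have hN0 : 0 < (N : ℝ) := by linarith
  have hNn : 0 < N := by exact_mod_cast hN0
  have hlogN : Xtriv L ≤ Real.log N := (Real.le_log_iff_exp_le hN0).2 hN
  have hlogN0 : 0 < Real.log N := by linarith
  have hlogt : Real.log t ≤ L := (Real.log_le_iff_le_exp (by linarith)).2 htL
  set lam := Real.log t / Real.log N with hlamdef
  have ht : t = (N : ℝ) ^ lam := by
    rw [Real.rpow_def_of_pos hN0, hlamdef, mul_div_cancel₀ _ hlogN0.ne', Real.exp_log (by linarith)]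
  have hlam : 1 / 2 ≤ lam := by
    rw [hlamdef, le_div_iff₀ hlogN0]
    have := Real.log_le_log hN0 hNt
    rw [Real.log_pow] at this; push_cast at this; linarith
  have hlamL : lam ≤ L / Xtriv L := by
    rw [hlamdef]
    exact div_le_div₀ (by linarith [h.pos.1]) hlogt (by linarith) hlogN
  have hbig := (h.hbig hlam hlamL rfl).trans hN
  have hsum : ∀ M, N ≤ M → M ≤ N' → ‖∑ m ∈ Ioc N M, ee (-(t * Real.log m))‖ ≤
      5 * (N : ℝ) ^ (1 - 1 / 100000000 / lam ^ 2) := fun M h1 h2 =>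
    zeta_sum_le hlam ht rfl hbig h1 (h2.trans hN')
  clear hbig
  have e : ∑ m ∈ Ioc N N', (m : ℂ) ^ (-((σ : ℂ) + t * Complex.I)) =
      ∑ m ∈ Ioc N N', (((m : ℝ) ^ (-σ) : ℝ) : ℂ) * ee (-(t * Real.log m)) :=
    Finset.sum_congr rfl fun m hm => natCast_cpow_eq (by have := (Finset.mem_Ioc.1 hm).1; omega) σ t
  rw [e]
  refine (abel_sum_le (fun m => ee (-(t * Real.log m))) (fun m => (m : ℝ) ^ (-σ)) N N' _ hNN
    (fun m _ => by positivity) (fun m hm => ?_) hsum).trans ?_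
  · have : (0 : ℝ) < m := by exact_mod_cast lt_of_lt_of_le hNn hm
    exact Real.rpow_le_rpow_of_nonpos this (by push_cast; linarith) (by linarith)
  · have hll : theta L ≤ 1 / 100000000 / lam ^ 2 := by
      have h1 : lam ^ 2 ≤ (L / Xtriv L) ^ 2 := pow_le_pow_left₀ (by linarith) hlamL 2
      have h2 : theta L = 1 / 100000000 / (L / Xtriv L) ^ 2 := by
        obtain ⟨h0, -, -⟩ := h.pos
        have h1 : 0 < Real.log L := by linarith [h.1]
        rw [h.div_X, theta, ← Real.rpow_mul_natCast (by positivity), ← inv_div L (Real.log L),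
          Real.inv_rpow (by positivity)]
        norm_num [div_eq_mul_inv]
      rw [h2]
      apply div_le_div_of_nonneg_left (by norm_num) (by positivity) h1
    calc (N : ℝ) ^ (-σ) * (5 * (N : ℝ) ^ (1 - 1 / 100000000 / lam ^ 2))
        = 5 * ((N : ℝ) ^ (-σ) * (N : ℝ) ^ (1 - 1 / 100000000 / lam ^ 2)) := by ring
      _ = 5 * (N : ℝ) ^ (-σ + (1 - 1 / 100000000 / lam ^ 2)) := by rw [← Real.rpow_add hN0]
      _ ≤ 5 * 1 := by
        gcongr
        exact Real.rpow_le_one_of_one_le_of_nonpos hN1.le (by linarith)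
      _ = 5 := by norm_num

lemma trivial_sum_le {L σ t : ℝ} {M : ℕ} (h : Big L) (hσ : 1 - theta L ≤ σ)
    (hM : M ≤ ⌈Real.exp (Xtriv L)⌉₊) :
    ‖∑ m ∈ Ioc 0 M, (m : ℂ) ^ (-((σ : ℂ) + t * Complex.I))‖ ≤ 3 * L ^ 2 := by
  obtain ⟨hX1, hXL⟩ := h.X_bounds
  obtain ⟨hth0, hth1⟩ := h.theta_bounds
  obtain ⟨hL0, hL54, -⟩ := h.pos
  have hMX : (M : ℝ) ≤ Real.exp (2 * Xtriv L) := by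
    have h1 : (M : ℝ) ≤ ⌈Real.exp (Xtriv L)⌉₊ := by exact_mod_cast hM
    have h2 := Nat.ceil_lt_add_one (Real.exp_pos (Xtriv L)).le
    have h3 : Real.exp (2 * Xtriv L) = Real.exp (Xtriv L) * Real.exp (Xtriv L) := by
      rw [← Real.exp_add]; ring_nf
    have h4 := Real.add_one_le_exp (Xtriv L)
    nlinarith
  refine (norm_sum_le _ _).trans ?_
  have h1 : ∀ m ∈ Ioc 0 M, ‖(m : ℂ) ^ (-((σ : ℂ) + t * Complex.I))‖ ≤ L * ((m : ℝ))⁻¹ := by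
    intro m hm
    rw [Finset.mem_Ioc] at hm
    have hm0 : (0 : ℝ) < m := by exact_mod_cast hm.1
    have hm1 : (1 : ℝ) ≤ m := by exact_mod_cast hm.1
    rw [natCast_cpow_eq hm.1, norm_mul, norm_ee, mul_one, Complex.norm_real, Real.norm_eq_abs,
      abs_of_pos (by positivity)]
    calc (m : ℝ) ^ (-σ) ≤ (m : ℝ) ^ (theta L + -1) :=
          Real.rpow_le_rpow_of_exponent_le hm1 (by linarith)
      _ = (m : ℝ) ^ (theta L) * (m : ℝ)⁻¹ := by rw [Real.rpow_add hm0, Real.rpow_neg_one]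
      _ ≤ _ := by
        gcongr
        have hmM : (m : ℝ) ≤ M := by exact_mod_cast hm.2
        calc (m : ℝ) ^ (theta L) ≤ Real.exp (2 * Xtriv L) ^ theta L :=
              Real.rpow_le_rpow hm0.le (hmM.trans hMX) hth0.le
          _ = Real.exp (2 * (theta L * Xtriv L)) := by rw [← Real.exp_mul]; ring_nf
          _ ≤ Real.exp (Real.log L) := by
              rw [h.theta_mul_X]; gcongr; linarith [h.1]
          _ = L := Real.exp_log hL0
  refine (Finset.sum_le_sum h1).trans ?_
  rw [← Finset.mul_sum]
  have h2 : ∑ m ∈ Ioc 0 M, ((m : ℝ))⁻¹ ≤ 1 + Real.log M := by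
    have := harmonic_le_one_add_log M
    rw [harmonic_eq_sum_Icc] at this
    push_cast at this
    exact this
  have h3 : Real.log M ≤ 2 * Xtriv L := by
    rcases Nat.eq_zero_or_pos M with rfl | hM0
    · simp; linarith
    · exact (Real.log_le_iff_le_exp (by exact_mod_cast hM0)).2 hMX
  calc L * ∑ m ∈ Ioc 0 M, ((m : ℝ))⁻¹ ≤ L * (3 * L) := by
        gcongr; linarith
    _ = _ := by ring

lemma partial_sum_le {L σ t : ℝ} (h : Big L) (ht1 : 1 ≤ t) (htL : t ≤ Real.exp L)
    (hσ : 1 - theta L ≤ σ) (k M : ℕ) (hM : M ≤ 2 ^ k * ⌈Real.exp (Xtriv L)⌉₊) (hMt : (M : ℝ) ≤ t ^ 2) :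
    ‖∑ m ∈ Ioc 0 M, (m : ℂ) ^ (-((σ : ℂ) + t * Complex.I))‖ ≤ 3 * L ^ 2 + 5 * k := by
  induction k generalizing M with
  | zero => simpa using trivial_sum_le h hσ (by simpa using hM)
  | succ k ih =>
    set N1 := ⌈Real.exp (Xtriv L)⌉₊ with hN1
    rcases le_or_gt M N1 with hle | hgt
    · refine (trivial_sum_le h hσ hle).trans ?_
      push_cast; have : (0 : ℝ) ≤ k := Nat.cast_nonneg _
      linarith
    · set N := max N1 ((M + 1) / 2) with hN
      have hNM : N ≤ M := max_le hgt.le (by omega)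
      have hM2 : M ≤ 2 * N := by
        have : (M + 1) / 2 ≤ N := le_max_right _ _
        omega
      have hNk : N ≤ 2 ^ k * N1 := by
        apply max_le
        · exact Nat.le_mul_of_pos_left _ (by positivity)
        · have : 2 ^ (k + 1) * N1 = 2 * (2 ^ k * N1) := by ring
          omega
      have hNt : (N : ℝ) ≤ t ^ 2 := le_trans (by exact_mod_cast hNM) hMt
      have hNX : Real.exp (Xtriv L) ≤ N :=
        (Nat.le_ceil _).trans (by exact_mod_cast le_max_left _ _)
      have h1 := ih N hNk hNt
      have h2 := block_le h ht1 htL hσ hNX hNt hNM hM2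
      rw [← Finset.sum_Ioc_consecutive _ (Nat.zero_le N) hNM]
      refine (norm_add_le _ _).trans ?_
      push_cast
      linarith

lemma zeta_bound_pos {L σ t : ℝ} (h : Big L) (ht1 : 1 ≤ t) (htL : t ≤ Real.exp L)
    (hσ : 1 - theta L ≤ σ) (hσ3 : σ ≤ 3) :
    ‖riemannZeta ((σ : ℂ) + t * Complex.I)‖ ≤ 5 * L ^ 2 := by
  obtain ⟨hX1, hXL⟩ := h.X_bounds
  obtain ⟨hth0, hth1⟩ := h.theta_bounds
  obtain ⟨hL0, hL54, -⟩ := h.pos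
  have hL54' : (10 : ℝ) ^ 3 ≤ L := le_trans (by norm_num) hL54
  set s : ℂ := (σ : ℂ) + t * Complex.I with hs
  have hre : s.re = σ := by simp [hs]
  have him : s.im = t := by simp [hs]
  set M := ⌊t ^ 2⌋₊ with hM
  have ht2 : 1 ≤ t ^ 2 := one_le_pow₀ ht1
  have hM1 : 1 ≤ M := Nat.le_floor (by exact_mod_cast ht2)
  have hMt : (M : ℝ) ≤ t ^ 2 := Nat.floor_le (by positivity)
  have hMt2 : t ^ 2 / 4 ≤ M := by
    have h1 := Nat.lt_floor_add_one (t ^ 2)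
    rw [← hM] at h1
    have : (1 : ℝ) ≤ M := by exact_mod_cast hM1
    linarith
  have hM0 : (0 : ℝ) < M := by exact_mod_cast hM1
  have hs1 : s ≠ 1 := by
    intro h'; rw [h'] at him; simp at him; linarith
  have hts1 : t ≤ ‖s - 1‖ := by
    have := Complex.abs_im_le_norm (s - 1)
    simp only [Complex.sub_im, him, Complex.one_im, sub_zero] at this
    exact (le_abs_self t).trans this
  have hts : ‖s‖ ≤ 4 * t := by
    have h1 : ‖s‖ ≤ |σ| + |t| := by
      have := Complex.norm_le_abs_re_add_abs_im s
      rwa [hre, him] at this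
    rw [abs_of_pos (by linarith : 0 < σ), abs_of_pos (by linarith : 0 < t)] at h1
    linarith
  have hs10 : 0 < ‖s - 1‖ := by linarith
  have happ := norm_zeta_sub_le (M - 1) (s := s) (by rw [hre]; linarith)
  have hcast : ((M - 1 : ℕ) : ℝ) + 1 = M := by exact_mod_cast Nat.sub_add_cancel hM1
  have hcastC : ((M - 1 : ℕ) : ℂ) + 1 = M := by exact_mod_cast Nat.sub_add_cancel hM1
  have hz : zapp (M - 1) s = (s - 1) * ∑ m ∈ Ioc 0 M, (m : ℂ) ^ (-s) + (M : ℂ) ^ (1 - s) := by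
    unfold zapp
    rw [hcastC, Nat.sub_add_cancel hM1]
    congr 2
    have e : Ioc 0 M = Ico 1 (M + 1) := by
      ext x; rw [Finset.mem_Ioc, Finset.mem_Ico]; omega
    rw [e, Finset.sum_Ico_eq_sum_range]
    refine Finset.sum_congr (by simp) fun k _ => ?_
    push_cast; rw [add_comm]
  rw [hcast, riemannZeta₁_eq s hs1, hz] at happ
  have hsqrt : t / 2 ≤ Real.sqrt M := by
    apply Real.le_sqrt_of_sq_le; linarith [hMt2, div_pow t 2 2]
  have herr : 4 * ‖s‖ * ‖s - 1‖ / Real.sqrt M ≤ 32 * ‖s - 1‖ := by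
    rw [div_le_iff₀ (by linarith)]
    have : 4 * ‖s‖ ≤ 32 * Real.sqrt M := by linarith
    nlinarith
  have hpow : ‖(M : ℂ) ^ (1 - s)‖ ≤ t := by
    have e : (M : ℂ) = ((M : ℝ) : ℂ) := by push_cast; rfl
    rw [e, Complex.norm_cpow_eq_rpow_re_of_pos hM0]
    simp only [Complex.sub_re, Complex.one_re, hre]
    have hM1' : (1 : ℝ) ≤ M := by exact_mod_cast hM1
    calc (M : ℝ) ^ (1 - σ) ≤ (M : ℝ) ^ (1 / 2 : ℝ) :=
          Real.rpow_le_rpow_of_exponent_le hM1' (by linarith)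
      _ ≤ (t ^ 2) ^ (1 / 2 : ℝ) := Real.rpow_le_rpow hM0.le hMt (by norm_num)
      _ = t := by rw [← Real.sqrt_eq_rpow, Real.sqrt_sq (by linarith)]
  have hk : M ≤ 2 ^ ⌈4 * L⌉₊ * ⌈Real.exp (Xtriv L)⌉₊ := by
    have h1 : (M : ℝ) ≤ 2 ^ ⌈4 * L⌉₊ := by
      calc (M : ℝ) ≤ t ^ 2 := hMt
        _ ≤ Real.exp L ^ 2 := pow_le_pow_left₀ (by linarith) htL 2
        _ = Real.exp (2 * L) := by rw [← Real.exp_nat_mul]; norm_num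
        _ ≤ Real.exp (Real.log 2 * (4 * L)) := by
          apply Real.exp_le_exp.2; nlinarith [Real.log_two_gt_d9]
        _ = (2 : ℝ) ^ (4 * L) := by rw [Real.rpow_def_of_pos (by norm_num)]
        _ ≤ (2 : ℝ) ^ ((⌈4 * L⌉₊ : ℕ) : ℝ) :=
          Real.rpow_le_rpow_of_exponent_le (by norm_num) (Nat.le_ceil _)
        _ = _ := Real.rpow_natCast _ _
    have h2 : M ≤ 2 ^ ⌈4 * L⌉₊ := by exact_mod_cast h1
    exact h2.trans (Nat.le_mul_of_pos_right _ (Nat.ceil_pos.2 (Real.exp_pos _)))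
  have hS := partial_sum_le h ht1 htL hσ ⌈4 * L⌉₊ M hk hMt
  rw [← hs] at hS
  have hceil := Nat.ceil_lt_add_one (show 0 ≤ 4 * L by linarith)
  set S := ∑ m ∈ Ioc 0 M, (m : ℂ) ^ (-s)
  have hS' : ‖S‖ ≤ 4 * L ^ 2 := by nlinarith
  have hfin : ‖s - 1‖ * ‖riemannZeta s‖ ≤ ‖s - 1‖ * (5 * L ^ 2) := by
    rw [← norm_mul]
    calc ‖(s - 1) * riemannZeta s‖ = ‖((s - 1) * riemannZeta s - ((s - 1) * S + (M : ℂ) ^ (1 - s))) +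
          ((s - 1) * S + (M : ℂ) ^ (1 - s))‖ := by congr 1; ring
      _ ≤ 32 * ‖s - 1‖ + (‖s - 1‖ * (4 * L ^ 2) + ‖s - 1‖) := by
        refine (norm_add_le _ _).trans (add_le_add (happ.trans herr) ((norm_add_le _ _).trans
          (add_le_add ?_ (hpow.trans hts1))))
        rw [norm_mul]; gcongr
      _ = ‖s - 1‖ * (4 * L ^ 2 + 33) := by ring
      _ ≤ _ := by gcongr; nlinarith
  exact le_of_mul_le_mul_left hfin hs10

/-- Richert-type bound for zeta near the line `σ = 1`. -/
theorem zeta_bound {L : ℝ} {s : ℂ} (h : Big L) (ht1 : 1 ≤ |s.im|) (htL : |s.im| ≤ Real.exp L)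
    (hσ : 1 - theta L ≤ s.re) (hσ3 : s.re ≤ 3) : ‖riemannZeta s‖ ≤ 5 * L ^ 2 := by
  rcases le_or_gt 0 s.im with h0 | h0
  · rw [abs_of_nonneg h0] at ht1 htL
    have := zeta_bound_pos h ht1 htL hσ hσ3
    rwa [Complex.re_add_im] at this
  · rw [abs_of_neg h0] at ht1 htL
    have := zeta_bound_pos h ht1 htL hσ hσ3
    have e : ((s.re : ℂ) + ((-s.im : ℝ) : ℂ) * Complex.I) = (starRingEnd ℂ) s := by
      apply Complex.ext <;> simp
    rwa [e, riemannZeta_conj, RCLike.norm_conj] at this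

open Metric in
/-- A holomorphic logarithm on a disc. -/
theorem exists_log_on_ball {f : ℂ → ℂ} {r : ℝ} (hr : 0 < r) (hf : DifferentiableOn ℂ f (ball 0 r))
    (h0 : ∀ z ∈ ball (0 : ℂ) r, f z ≠ 0) :
    ∃ F : ℂ → ℂ, F 0 = 0 ∧ (∀ z ∈ ball (0 : ℂ) r, HasDerivAt F (deriv f z / f z) z) ∧
      ∀ z ∈ ball (0 : ℂ) r, f z = f 0 * Complex.exp (F z) := by
  have hd : DifferentiableOn ℂ (fun z => deriv f z / f z) (ball 0 r) :=
    (hf.deriv isOpen_ball).div hf h0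
  obtain ⟨F, hF0, hF⟩ := hd.isExactOn_ball.with_val_at 0 0
  refine ⟨F, hF0, hF, ?_⟩
  have key : ∀ z ∈ ball (0 : ℂ) r, HasDerivAt (fun z => f z * Complex.exp (-F z)) 0 z := by
    intro z hz
    have h1 : HasDerivAt f (deriv f z) z :=
      (hf.differentiableAt (isOpen_ball.mem_nhds hz)).hasDerivAt
    have h2 := h1.mul (hF z hz).neg.cexp
    have h3 : f z * (deriv f z / f z) = deriv f z := mul_div_cancel₀ _ (h0 z hz)
    exact h2.congr_deriv (by linear_combination (-Complex.exp (-F z)) * h3)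
  intro z hz
  have hc : f z * Complex.exp (-F z) = f 0 * Complex.exp (-F 0) := by
    have := (convex_ball (0 : ℂ) r).is_const_of_fderivWithin_eq_zero (𝕜 := ℂ)
      (f := fun z => f z * Complex.exp (-F z))
      (fun w hw => (key w hw).differentiableAt.differentiableWithinAt)
      (fun w hw => by
        rw [fderivWithin_of_isOpen isOpen_ball hw]
        have := (key w hw).hasFDerivAt.fderiv
        rw [this]; ext; simp)
      hz (mem_ball_self hr)
    exact this
  rw [hF0, neg_zero, Complex.exp_zero, mul_one] at hc
  rw [← hc, mul_assoc, ← Complex.exp_add]; simp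

open Metric in
/-- Borel–Carathéodory for the logarithm of a zero-free function. -/
theorem log_bound_of_ne_zero {f : ℂ → ℂ} {r M A : ℝ} (hr : 0 < r)
    (hf : DifferentiableOn ℂ f (ball 0 r)) (h0 : ∀ z ∈ ball (0 : ℂ) r, f z ≠ 0)
    (hM : ∀ z ∈ ball (0 : ℂ) r, ‖f z‖ ≤ M) (hA : 0 < A) (hA' : Real.log (M / ‖f 0‖) ≤ A) :
    ‖deriv f 0 / f 0‖ ≤ 4 * A / r ∧
      ∀ z ∈ ball (0 : ℂ) r, ‖f 0‖ * Real.exp (-(2 * A * ‖z‖ / (r - ‖z‖))) ≤ ‖f z‖ := by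
  obtain ⟨F, hF0, hF, hexp⟩ := exists_log_on_ball hr hf h0
  have hFd : DifferentiableOn ℂ F (ball 0 r) := fun z hz =>
    (hF z hz).differentiableAt.differentiableWithinAt
  have hpos : 0 < ‖f 0‖ := norm_pos_iff.2 (h0 0 (mem_ball_self hr))
  have hM0 : 0 < M := hpos.trans_le (hM 0 (mem_ball_self hr))
  have hre : Set.MapsTo F (ball 0 r) {z | z.re ≤ A} := by
    intro z hz
    rw [Set.mem_ofPred_eq]
    have h1 := hM z hz
    rw [hexp z hz, norm_mul, Complex.norm_exp] at h1
    have h2 : Real.exp (F z).re ≤ M / ‖f 0‖ := by rw [le_div_iff₀ hpos]; linarith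
    have h3 := Real.log_le_log (Real.exp_pos _) h2
    rw [Real.log_exp] at h3
    linarith
  have hBC : ∀ z ∈ ball (0 : ℂ) r, ‖F z‖ ≤ 2 * A * ‖z‖ / (r - ‖z‖) := fun z hz =>
    Complex.borelCaratheodory_zero hA hFd hre hr hz hF0
  constructor
  · have hd : deriv F 0 = deriv f 0 / f 0 := (hF 0 (mem_ball_self hr)).deriv
    rw [← hd]
    have := Complex.norm_deriv_le_of_forall_mem_sphere_norm_le (f := F) (c := 0) (R := r / 2)
      (C := 2 * A) (by positivity) ?_ ?_
    · refine this.trans (le_of_eq ?_); field_simp; ring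
    · refine DifferentiableOn.diffContOnCl ?_
      rw [closure_ball _ (by positivity)]
      exact hFd.mono (closedBall_subset_ball (by linarith))
    · intro z hz
      have hz' : ‖z‖ = r / 2 := by simpa using hz
      refine (hBC z (by simp [hz']; linarith)).trans (le_of_eq ?_)
      rw [hz']; field_simp; ring
  · intro z hz
    rw [hexp z hz, norm_mul, Complex.norm_exp]
    have h1 := hBC z hz
    have h2 := (abs_le.1 ((Complex.abs_re_le_norm (F z)))).1
    gcongr
    linarith

open Metric in
/-- Removing one zero with a Blaschke factor. -/
theorem remove_zero {f : ℂ → ℂ} {R R' M : ℝ} {ρ : ℂ} (hR : 0 < R) (hRR : R < R')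
    (hf : DifferentiableOn ℂ f (ball 0 R')) (hM : ∀ z ∈ sphere (0 : ℂ) R, ‖f z‖ ≤ M)
    (h0 : f 0 ≠ 0) (hρ : ‖ρ‖ < R) (hfρ : f ρ = 0) :
    ∃ h : ℂ → ℂ, DifferentiableOn ℂ h (ball 0 R') ∧ (∀ z ∈ sphere (0 : ℂ) R, ‖h z‖ ≤ M) ∧
      ‖h 0‖ = ‖f 0‖ * (R / ‖ρ‖) ∧ (∀ z ∈ ball (0 : ℂ) R, h z = 0 → f z = 0) ∧
      (deriv f 0 / f 0).re = (deriv h 0 / h 0).re - ρ.re * (1 / ‖ρ‖ ^ 2 - 1 / R ^ 2) := by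
  have hρ0 : ρ ≠ 0 := fun h => h0 (h ▸ hfρ)
  have hρn : 0 < ‖ρ‖ := norm_pos_iff.2 hρ0
  have hRc : (R : ℂ) ≠ 0 := by exact_mod_cast hR.ne'
  set g := dslope f ρ with hg
  have hgd : DifferentiableOn ℂ g (ball 0 R') :=
    (Complex.differentiableOn_dslope (isOpen_ball.mem_nhds (by simpa using hρ.trans hRR))).2 hf
  have hfg : ∀ z, f z = (z - ρ) * g z := fun z => by
    have := sub_smul_dslope f ρ z
    rw [hfρ, sub_zero, smul_eq_mul] at this
    exact this.symm
  set b : ℂ → ℂ := fun z => (R ^ 2 - (starRingEnd ℂ) ρ * z) / R with hb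
  have hbd : Differentiable ℂ b := by fun_prop
  have hg0 : g 0 ≠ 0 := fun h => h0 (by rw [hfg, h, mul_zero])
  have hb0 : b 0 = R := by simp [hb]; field_simp
  have h0R' : (0 : ℂ) ∈ ball (0 : ℂ) R' := mem_ball_self (hR.trans hRR)
  refine ⟨fun z => g z * b z, hgd.mul hbd.differentiableOn, ?_, ?_, ?_, ?_⟩
  · intro z hz
    have hz' : ‖z‖ = R := by simpa using hz
    have hne : z - ρ ≠ 0 := fun h => by
      rw [sub_eq_zero] at h; rw [h] at hz'; linarith
    have hbz : ‖b z‖ = ‖z - ρ‖ := by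
      have h1 : (R : ℂ) ^ 2 = z * (starRingEnd ℂ) z := by
        rw [Complex.mul_conj, Complex.normSq_eq_norm_sq, hz']; norm_cast
      have h2 : b z = z * (starRingEnd ℂ) (z - ρ) / R := by
        simp only [hb]; rw [h1, map_sub]; ring
      rw [h2, norm_div, norm_mul, hz', RCLike.norm_conj, Complex.norm_real, Real.norm_eq_abs,
        abs_of_pos hR]
      field_simp
    have := hM z hz
    rw [hfg, norm_mul] at this
    rw [norm_mul, hbz]; linarith
  · rw [norm_mul, hb0, hfg 0, norm_mul, zero_sub, norm_neg, Complex.norm_real, Real.norm_eq_abs,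
      abs_of_pos hR]
    field_simp
  · intro z hz hh
    rcases mul_eq_zero.1 hh with h | h
    · rw [hfg, h, mul_zero]
    · exfalso
      have h1 : (R : ℂ) ^ 2 = (starRingEnd ℂ) ρ * z := by
        simp only [hb, div_eq_zero_iff, hRc, or_false] at h
        exact sub_eq_zero.1 h
      have h2 : R ^ 2 = ‖ρ‖ * ‖z‖ := by
        have := congrArg norm h1
        rw [norm_mul, RCLike.norm_conj, norm_pow, Complex.norm_real, Real.norm_eq_abs,
          abs_of_pos hR] at this
        exact this
      have hz' : ‖z‖ < R := by simpa using hz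
      nlinarith [norm_nonneg z]
  · have hgda : DifferentiableAt ℂ g 0 := hgd.differentiableAt (isOpen_ball.mem_nhds h0R')
    have hf' : deriv f 0 = g 0 + (0 - ρ) * deriv g 0 := by
      have h1 : HasDerivAt (fun z => (z - ρ) * g z) (1 * g 0 + (0 - ρ) * deriv g 0) 0 :=
        ((hasDerivAt_id (0 : ℂ)).sub_const ρ).mul hgda.hasDerivAt
      rw [show f = fun z => (z - ρ) * g z from funext hfg, h1.deriv, one_mul]
    have hb' : HasDerivAt b (-(starRingEnd ℂ) ρ / R) 0 := by
      have h1 := (((hasDerivAt_id (0 : ℂ)).const_mul ((starRingEnd ℂ) ρ)).const_sub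
        ((R : ℂ) ^ 2)).div_const (R : ℂ)
      simpa using h1
    have hh' : deriv (fun z => g z * b z) 0 = deriv g 0 * b 0 + g 0 * (-(starRingEnd ℂ) ρ / R) :=
      (hgda.hasDerivAt.mul hb').deriv
    have e : deriv f 0 / f 0 = deriv (fun z => g z * b z) 0 / (g 0 * b 0)
        - (1 / ρ - (starRingEnd ℂ) ρ / R ^ 2) := by
      rw [hh', hf', hfg 0, hb0]
      field_simp
      ring
    rw [e, Complex.sub_re, Complex.sub_re]
    congr 1
    have h1 : (1 / ρ).re = ρ.re / ‖ρ‖ ^ 2 := by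
      rw [one_div, Complex.inv_re, Complex.normSq_eq_norm_sq]
    have h2 : ((starRingEnd ℂ) ρ / (R : ℂ) ^ 2).re = ρ.re / R ^ 2 := by
      rw [← Complex.ofReal_pow, Complex.div_ofReal_re, Complex.conj_re]
    rw [h1, h2]; ring

open Metric in
theorem neg_logDeriv_le {R R' r M : ℝ} (hr : 0 < r) (hrR : r < R) (hRR : R < R') (N : ℕ) :
    ∀ {f : ℂ → ℂ} {A : ℝ}, DifferentiableOn ℂ f (ball 0 R') →
    (∀ z ∈ sphere (0 : ℂ) R, ‖f z‖ ≤ M) → f 0 ≠ 0 → (∀ ρ ∈ ball (0 : ℂ) R, f ρ = 0 → ρ.re ≤ 0) →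
    0 < A → Real.log (M / ‖f 0‖) ≤ A → M < ‖f 0‖ * (R / r) ^ N →
    -(deriv f 0 / f 0).re ≤ 4 * A / r := by
  have hR : 0 < R := hr.trans hrR
  have hmax : ∀ {f : ℂ → ℂ}, DifferentiableOn ℂ f (ball 0 R') →
    (∀ z ∈ sphere (0 : ℂ) R, ‖f z‖ ≤ M) → ∀ z ∈ closedBall (0 : ℂ) R, ‖f z‖ ≤ M := by
    intro f hf hM z hz
    refine Complex.norm_le_of_forall_mem_frontier_norm_le (U := ball 0 R) isBounded_ball
      (DifferentiableOn.diffContOnCl ?_) ?_ ?_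
    · rw [closure_ball _ hR.ne']; exact hf.mono (closedBall_subset_ball hRR)
    · rw [frontier_ball _ hR.ne']; exact hM
    · rwa [closure_ball _ hR.ne']
  induction N with
  | zero =>
    intro f A hf hM h0 _ _ _ hlt
    have := hmax hf hM 0 (mem_closedBall_self hR.le)
    rw [pow_zero, mul_one] at hlt
    linarith
  | succ N ih =>
    intro f A hf hM h0 hz hA hA' hlt
    by_cases hex : ∃ ρ ∈ ball (0 : ℂ) r, f ρ = 0
    · obtain ⟨ρ, hρ, hfρ⟩ := hex
      have hρr : ‖ρ‖ < r := by simpa using hρ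
      have hρ0 : 0 < ‖ρ‖ := norm_pos_iff.2 fun h => h0 (h ▸ hfρ)
      obtain ⟨h, hd, hMh, hh0, hhz, hre⟩ := remove_zero hR hRR hf hM h0 (hρr.trans hrR) hfρ
      have hf0 : 0 < ‖f 0‖ := norm_pos_iff.2 h0
      have hM0 : 0 < M := hf0.trans_le (hmax hf hM 0 (mem_closedBall_self hR.le))
      have hge : ‖f 0‖ * (R / r) ≤ ‖h 0‖ := by rw [hh0]; gcongr
      have hge1 : ‖f 0‖ ≤ ‖h 0‖ :=
        le_trans (le_mul_of_one_le_right hf0.le ((one_le_div hr).2 hrR.le)) hge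
      have hpos : 0 < ‖h 0‖ := hf0.trans_le hge1
      have := ih hd hMh (norm_pos_iff.1 hpos) (fun w hw hw0 => hz w hw (hhz w hw hw0)) hA
        ((Real.log_le_log (by positivity) (by gcongr)).trans hA') (by
          refine hlt.trans_le ?_
          calc ‖f 0‖ * (R / r) ^ (N + 1) = (‖f 0‖ * (R / r)) * (R / r) ^ N := by ring
            _ ≤ _ := by gcongr)
      rw [hre]
      have h1 : ρ.re ≤ 0 := hz ρ (by simp; linarith) hfρ
      have h2 : 0 ≤ 1 / ‖ρ‖ ^ 2 - 1 / R ^ 2 := by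
        rw [sub_nonneg]
        gcongr
        linarith
      nlinarith
    · push Not at hex
      have := (log_bound_of_ne_zero hr (hf.mono (ball_subset_ball (by linarith))) hex
        (fun z hz => hmax hf hM z ?_) hA hA').1
      · have h2 := (abs_le.1 ((Complex.abs_re_le_norm (deriv f 0 / f 0)))).1
        linarith
      · have : ‖z‖ < r := by simpa using hz
        simp; linarith

open Metric in
/-- Landau's local inequality for `-Re f'/f` at the centre of a disc. -/
theorem landau_le {f : ℂ → ℂ} {R R' M A : ℝ} (hR : 0 < R) (hRR : R < R')
    (hf : DifferentiableOn ℂ f (ball 0 R')) (hM : ∀ z ∈ sphere (0 : ℂ) R, ‖f z‖ ≤ M) (h0 : f 0 ≠ 0)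
    (hz : ∀ ρ ∈ ball (0 : ℂ) R, f ρ = 0 → ρ.re ≤ 0) (hA : 0 < A)
    (hA' : Real.log (M / ‖f 0‖) ≤ A) :
    -(deriv f 0 / f 0).re ≤ 8 * A / R ∧ ∀ ρ ∈ ball (0 : ℂ) R, f ρ = 0 →
      -(deriv f 0 / f 0).re ≤ 8 * A / R + ρ.re * (1 / ‖ρ‖ ^ 2 - 1 / R ^ 2) := by
  have gen : ∀ h : ℂ → ℂ, DifferentiableOn ℂ h (ball 0 R') → (∀ z ∈ sphere (0 : ℂ) R, ‖h z‖ ≤ M) →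
      h 0 ≠ 0 → (∀ ρ ∈ ball (0 : ℂ) R, h ρ = 0 → ρ.re ≤ 0) → Real.log (M / ‖h 0‖) ≤ A →
      -(deriv h 0 / h 0).re ≤ 8 * A / R := by
    intro h hd hMh hh0 hhz hhA
    have hpos : 0 < ‖h 0‖ := norm_pos_iff.2 hh0
    obtain ⟨N, hN⟩ := pow_unbounded_of_one_lt (M / ‖h 0‖) (one_lt_two)
    have := neg_logDeriv_le (r := R / 2) (by positivity) (by linarith) hRR N hd hMh hh0 hhz hA hhA (by
      rw [div_lt_iff₀ hpos] at hN
      rw [show R / (R / 2) = 2 by field_simp]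
      linarith)
    refine this.trans (le_of_eq ?_)
    field_simp; ring
  refine ⟨gen f hf hM h0 hz hA', fun ρ hρ hfρ => ?_⟩
  have hρR : ‖ρ‖ < R := by simpa using hρ
  have hρ0 : 0 < ‖ρ‖ := norm_pos_iff.2 fun h => h0 (h ▸ hfρ)
  obtain ⟨h, hd, hMh, hh0, hhz, hre⟩ := remove_zero hR hRR hf hM h0 hρR hfρ
  have hf0 : 0 < ‖f 0‖ := norm_pos_iff.2 h0
  have hge1 : ‖f 0‖ ≤ ‖h 0‖ := by
    rw [hh0]; exact le_mul_of_one_le_right hf0.le ((one_le_div hρ0).2 hρR.le)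
  have hpos : 0 < ‖h 0‖ := hf0.trans_le hge1
  have hA2 : Real.log (M / ‖h 0‖) ≤ A := by
    rcases le_or_gt M 0 with hM0 | hM0
    · have hRs : (R : ℂ) ∈ sphere (0 : ℂ) R := by simp [hR.le]
      have hM0' : M = 0 := le_antisymm hM0 ((norm_nonneg _).trans (hM _ hRs))
      rw [hM0']; simp [hA.le]
    · exact (Real.log_le_log (by positivity) (by gcongr)).trans hA'
  have := gen h hd hMh (norm_pos_iff.1 hpos) (fun w hw hw0 => hz w hw (hhz w hw hw0)) hA2
  rw [hre]; linarith

open ArithmeticFunction in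
theorem three_four_one {σ : ℝ} (hσ : 1 < σ) (t : ℝ) :
    0 ≤ 3 * (-deriv riemannZeta σ / riemannZeta σ).re +
      4 * (-deriv riemannZeta (σ + t * Complex.I) / riemannZeta (σ + t * Complex.I)).re +
      (-deriv riemannZeta (σ + (2 * t : ℝ) * Complex.I) /
        riemannZeta (σ + (2 * t : ℝ) * Complex.I)).re := by
  have key : ∀ u : ℝ, HasSum (fun n : ℕ => Λ n * (n : ℝ) ^ (-σ) * Real.cos (u * Real.log n))
      (-deriv riemannZeta (σ + u * Complex.I) / riemannZeta (σ + u * Complex.I)).re := by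
    intro u
    have hre : 1 < (σ + u * Complex.I : ℂ).re := by simpa using hσ
    rw [← LSeries_vonMangoldt_eq_deriv_riemannZeta_div hre]
    have h1 := Complex.hasSum_re (LSeriesSummable_vonMangoldt hre).LSeriesHasSum
    refine h1.congr_fun ?_
    intro n
    rcases Nat.eq_zero_or_pos n with rfl | hn
    · simp
    · rw [LSeries.term_of_ne_zero hn.ne', div_eq_mul_inv, ← Complex.cpow_neg,
        natCast_cpow_eq hn, ← mul_assoc, ← Complex.ofReal_mul, Complex.re_ofReal_mul]
      congr 1
      rw [ee, Complex.exp_ofReal_mul_I_re, Real.cos_neg]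
  have h := ((key 0).mul_left 3).add ((key t).mul_left 4) |>.add (key (2 * t))
  simp only [Complex.ofReal_zero, zero_mul, add_zero] at h
  refine h.nonneg fun n => ?_
  have h1 : 0 ≤ Λ n * (n : ℝ) ^ (-σ) := mul_nonneg vonMangoldt_nonneg (by positivity)
  have h2 : Real.cos (2 * t * Real.log n) = 2 * Real.cos (t * Real.log n) ^ 2 - 1 := by
    rw [← Real.cos_two_mul]; ring_nf
  rw [h2, Real.cos_zero]
  nlinarith [mul_nonneg h1 (sq_nonneg (Real.cos (t * Real.log n) + 1))]

/-- Compactness constants for zeta on `(1, 2]`. -/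
theorem exists_zeta_real_bound : ∃ K : ℝ, 1 ≤ K ∧ ∀ σ : ℝ, 1 < σ → σ ≤ 2 →
    ‖riemannZeta σ‖ ≤ K / (σ - 1) ∧
    (-deriv riemannZeta σ / riemannZeta σ).re ≤ 1 / (σ - 1) + K := by
  have hne : ∀ σ ∈ Set.Icc (1 : ℝ) 2, riemannZeta₁ σ ≠ 0 := by
    intro σ hσ
    rcases eq_or_lt_of_le hσ.1 with h | h
    · rw [← h]; simp
    · have h1 : (σ : ℂ) ≠ 1 := by exact_mod_cast h.ne'
      rw [riemannZeta₁_eq _ h1]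
      exact mul_ne_zero (sub_ne_zero.2 h1) (riemannZeta_ne_zero_of_one_le_re (by simpa using hσ.1))
  have hd := differentiable_riemannZeta₁
  have hc1 : Continuous (fun σ : ℝ => riemannZeta₁ σ) := hd.continuous.comp Complex.continuous_ofReal
  have hc2 : Continuous (fun σ : ℝ => deriv riemannZeta₁ σ) :=
    (hd.contDiff.continuous_deriv le_top).comp Complex.continuous_ofReal
  obtain ⟨K1, hK1⟩ := isCompact_Icc.exists_bound_of_continuousOn (hc1.continuousOn (s := Set.Icc 1 2))
  obtain ⟨K2, hK2⟩ := isCompact_Icc.exists_bound_of_continuousOn (s := Set.Icc 1 2)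
    (f := fun σ : ℝ => deriv riemannZeta₁ σ / riemannZeta₁ σ)
    (hc2.continuousOn.div hc1.continuousOn hne)
  refine ⟨max 1 (max K1 K2), le_max_left _ _, fun σ h1 h2 => ?_⟩
  have hmem : σ ∈ Set.Icc (1 : ℝ) 2 := ⟨h1.le, h2⟩
  have hpos : 0 < σ - 1 := by linarith
  have hs1 : (σ : ℂ) ≠ 1 := by exact_mod_cast h1.ne'
  have hs2 : (σ : ℂ) - 1 ≠ 0 := sub_ne_zero.2 hs1
  have e : ∀ s : ℂ, s ≠ 1 → riemannZeta s = riemannZeta₁ s / (s - 1) := fun s hs => by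
    rw [riemannZeta₁_eq _ hs, mul_div_cancel_left₀ _ (sub_ne_zero.2 hs)]
  have hn1 : ‖(σ : ℂ) - 1‖ = σ - 1 := by
    rw [← Complex.ofReal_one, ← Complex.ofReal_sub, Complex.norm_real, Real.norm_eq_abs,
      abs_of_pos hpos]
  constructor
  · rw [e _ hs1, norm_div, hn1]
    gcongr
    exact (hK1 σ hmem).trans ((le_max_left _ _).trans (le_max_right _ _))
  · have hev : riemannZeta =ᶠ[nhds (σ : ℂ)] fun s => riemannZeta₁ s / (s - 1) := by
      filter_upwards [isOpen_ne.mem_nhds hs1] with s hs using e s hs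
    have hder : deriv riemannZeta σ = (deriv riemannZeta₁ σ * ((σ : ℂ) - 1) - riemannZeta₁ σ * 1) /
        ((σ : ℂ) - 1) ^ 2 := by
      rw [hev.deriv_eq]
      exact ((hd _).hasDerivAt.div ((hasDerivAt_id _).sub_const 1) hs2).deriv
    have hz := hne σ hmem
    have : -deriv riemannZeta σ / riemannZeta σ =
        ((1 / (σ - 1) : ℝ) : ℂ) - deriv riemannZeta₁ σ / riemannZeta₁ σ := by
      rw [hder, e _ hs1]; push_cast; field_simp; ring
    rw [this, Complex.sub_re, Complex.ofReal_re]
    have h3 := (abs_le.1 ((Complex.abs_re_le_norm (deriv riemannZeta₁ σ / riemannZeta₁ σ)))).1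
    have h4 := (hK2 σ hmem).trans ((le_max_right _ _).trans (le_max_right 1 (max K1 K2)))
    linarith

open ArithmeticFunction in
/-- `|1/ζ(s)| ≤ ζ(Re s)` for `Re s > 1`. -/
theorem one_div_zeta_le {s : ℂ} (hs : 1 < s.re) : 1 ≤ ‖riemannZeta s‖ * ‖riemannZeta s.re‖ := by
  have h1 : riemannZeta s * LSeries (fun n => ((moebius n : ℤ) : ℂ)) s = 1 := by
    rw [← LSeries_zeta_eq_riemannZeta hs]; exact LSeries_zeta_mul_Lseries_moebius hs
  have hs' : 1 < (s.re : ℂ).re := by simpa using hs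
  have h2 : ‖LSeries (fun n => ((moebius n : ℤ) : ℂ)) s‖ ≤ ‖riemannZeta s.re‖ := by
    have hsum := (LSeriesSummable_moebius_iff.2 hs).norm
    have hz := (LSeriesSummable_zeta_iff.2 hs').norm
    have hle : ∀ n, ‖LSeries.term (fun n => ((moebius n : ℤ) : ℂ)) s n‖ ≤
        ‖LSeries.term (fun n => ((ArithmeticFunction.zeta n : ℕ) : ℂ)) s.re n‖ := by
      intro n
      rcases Nat.eq_zero_or_pos n with rfl | hn
      · simp
      · rw [LSeries.norm_term_eq, LSeries.norm_term_eq, if_neg hn.ne', if_neg hn.ne',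
          Complex.ofReal_re]
        gcongr
        rw [zeta_apply_ne hn.ne']
        simp only [Complex.norm_intCast, Nat.cast_one, norm_one]
        exact_mod_cast abs_moebius_le_one
    refine (norm_tsum_le_tsum_norm hsum).trans ((hsum.tsum_le_tsum hle hz).trans ?_)
    have e1 : ∀ n, ‖LSeries.term (fun n => ((ArithmeticFunction.zeta n : ℕ) : ℂ)) s.re n‖ =
        (LSeries.term (fun n => ((ArithmeticFunction.zeta n : ℕ) : ℂ)) s.re n).re := by
      intro n
      rcases Nat.eq_zero_or_pos n with rfl | hn
      · simp
      · rw [LSeries.norm_term_eq, LSeries.term_of_ne_zero hn.ne', if_neg hn.ne',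
          Complex.ofReal_re, zeta_apply_ne hn.ne']
        have : ((n : ℂ) ^ (s.re : ℂ)) = (((n : ℝ) ^ s.re : ℝ) : ℂ) := by
          rw [Complex.ofReal_cpow (by positivity)]; simp
        rw [this]
        simp [← Complex.ofReal_inv]
    simp_rw [e1]
    have h3 := (Complex.hasSum_re (LSeriesSummable_zeta_iff.2 hs').LSeriesHasSum).tsum_eq
    rw [h3, LSeries_zeta_eq_riemannZeta hs']
    exact Complex.re_le_norm _
  calc (1 : ℝ) = ‖riemannZeta s‖ * ‖LSeries (fun n => ((moebius n : ℤ) : ℂ)) s‖ := by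
        rw [← norm_mul, h1, norm_one]
    _ ≤ _ := by gcongr

/-- The width of the zero-free region. -/
noncomputable def zfw (L : ℝ) : ℝ := theta L / (10000 * Real.log L)

/-- A constant for zeta to the right of `1`. -/
def ZC (K : ℝ) : Prop := 1 ≤ K ∧ ∀ σ : ℝ, 1 < σ → σ ≤ 2 →
    ‖riemannZeta σ‖ ≤ K / (σ - 1) ∧
    (-deriv riemannZeta σ / riemannZeta σ).re ≤ 1 / (σ - 1) + K

lemma Big.zfw_bounds {L : ℝ} (h : Big L) : 0 < zfw L ∧ zfw L ≤ theta L / 10000 ∧ 1 / L ^ 2 ≤ zfw L := by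
  obtain ⟨h0, hb, hl⟩ := h.pos
  obtain ⟨ht, ht2⟩ := h.theta_bounds
  have h1 := h.1
  refine ⟨by unfold zfw; positivity, ?_, ?_⟩
  · unfold zfw; gcongr; linarith
  · have h2 : 1 / L ≤ (Real.log L / L) ^ (2 / 3 : ℝ) := by
      calc 1 / L = (1 / L) ^ (1 : ℝ) := (Real.rpow_one _).symm
        _ ≤ (1 / L) ^ (2 / 3 : ℝ) := by
            apply Real.rpow_le_rpow_of_exponent_ge (by positivity) _ (by norm_num)
            rw [div_le_one h0]; linarith
        _ ≤ _ := by gcongr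
    have h3 : (10 : ℝ) ^ 54 * Real.log L ≤ L := by
      have := h.2; rwa [le_div_iff₀ (by linarith)] at this
    unfold zfw theta
    rw [le_div_iff₀ (by positivity)]
    calc 1 / L ^ 2 * (10000 * Real.log L) ≤ 1 / L ^ 2 * (1 / 100000000 * L) :=
          mul_le_mul_of_nonneg_left (by linarith) (by positivity)
      _ = 1 / 100000000 * (1 / L) := by field_simp
      _ ≤ _ := by gcongr

lemma log_quot_le {K L x : ℝ} (hL : 10 ≤ L) (hK : 5 * K ≤ L) (hK1 : 1 ≤ K)
    (hx : 1 / (L ^ 2 * K) ≤ x) : Real.log (5 * L ^ 2 / x) ≤ 6 * Real.log L := by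
  have hL0 : 0 < L := by linarith
  have h1 : 0 < 1 / (L ^ 2 * K) := by positivity
  have hx0 : 0 < x := h1.trans_le hx
  have : 6 * Real.log L = Real.log (L ^ 6) := by rw [Real.log_pow]; norm_num
  rw [this]
  apply Real.log_le_log (by positivity)
  rw [div_le_iff₀ hx0]
  calc 5 * L ^ 2 = 5 * K * L ^ 4 * (1 / (L ^ 2 * K)) := by field_simp
    _ ≤ L * L ^ 4 * x := by gcongr
    _ ≤ L ^ 6 * x := by
        have : L * L ^ 4 ≤ L ^ 6 := by
          calc L * L ^ 4 = L ^ 5 := by ring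
            _ ≤ L ^ 6 := pow_le_pow_right₀ (by linarith) (by norm_num)
        gcongr

lemma ZC.lower {K : ℝ} (hK : ZC K) {s : ℂ} (hs : 1 < s.re) (hs2 : s.re ≤ 2) :
    (s.re - 1) / K ≤ ‖riemannZeta s‖ := by
  have h1 := one_div_zeta_le hs
  have h2 := (hK.2 s.re hs hs2).1
  have h3 : 0 < s.re - 1 := by linarith
  have h4 : 0 < K := by linarith [hK.1]
  rw [div_le_iff₀ h4]
  have : 1 ≤ ‖riemannZeta s‖ * (K / (s.re - 1)) := h1.trans (by gcongr)
  rw [mul_div_assoc', le_div_iff₀ h3] at this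
  linarith

open Metric in
theorem zeta_translate_diff {s₀ : ℂ} {R : ℝ} (hR : R ≤ |s₀.im|) :
    DifferentiableOn ℂ (fun z => riemannZeta (s₀ + z)) (ball 0 R) := by
  intro z hz
  have hz' : ‖z‖ < R := by simpa using hz
  have : s₀ + z ≠ 1 := by
    intro h
    have := congrArg Complex.im h
    simp at this
    have h2 := Complex.abs_im_le_norm z
    have : s₀.im = -z.im := by linarith
    rw [this, abs_neg] at hR
    linarith
  exact ((differentiableAt_riemannZeta this).comp z
    ((differentiableAt_const _).add differentiableAt_id)).differentiableWithinAt

open Metric in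
/-- Landau's inequality for zeta near the line `Re s = 1`. -/
theorem zeta_landau {L K δ t : ℝ} (h : Big L) (hK : ZC K) (hKL : 5 * K ≤ L)
    (hδ : 0 < δ) (hδ1 : δ ≤ 1 / 2) (hδL : 1 / L ^ 2 ≤ δ) (ht : 2 ≤ |t|)
    (htL : |t| + 1 ≤ Real.exp L) :
    (-deriv riemannZeta ((1 + δ : ℝ) + t * Complex.I) / riemannZeta ((1 + δ : ℝ) + t * Complex.I)).re
        ≤ 48 * Real.log L / theta L ∧
      ∀ a : ℝ, δ ≤ a → a < theta L → riemannZeta ((1 + δ - a : ℝ) + t * Complex.I) = 0 →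
      (-deriv riemannZeta ((1 + δ : ℝ) + t * Complex.I) / riemannZeta ((1 + δ : ℝ) + t * Complex.I)).re
        ≤ 48 * Real.log L / theta L - 1 / a + a / theta L ^ 2 := by
  obtain ⟨h0, hb, hl⟩ := h.pos
  obtain ⟨hθ, hθ2⟩ := h.theta_bounds
  have hlog := h.1
  set s₀ : ℂ := (1 + δ : ℝ) + t * Complex.I with hs₀
  have hre : s₀.re = 1 + δ := by simp [hs₀]
  have him : s₀.im = t := by simp [hs₀]
  set f : ℂ → ℂ := fun z => riemannZeta (s₀ + z) with hf
  have hL10 : 10 ≤ L := by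
    have : (10 : ℝ) ≤ 10 ^ 54 := by norm_num
    linarith
  have hf0 : f 0 = riemannZeta s₀ := by simp [hf]
  have hne : f 0 ≠ 0 := by
    rw [hf0]; exact riemannZeta_ne_zero_of_one_le_re (by rw [hre]; linarith)
  have hd : DifferentiableOn ℂ f (ball 0 1) := zeta_translate_diff (by rw [him]; linarith)
  have hder : deriv f 0 = deriv riemannZeta s₀ := by
    have := deriv_comp_const_add riemannZeta s₀ 0
    rw [add_zero] at this; exact this
  have hbd : ∀ z ∈ sphere (0 : ℂ) (theta L), ‖f z‖ ≤ 5 * L ^ 2 := by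
    intro z hz
    have hz' : ‖z‖ = theta L := by simpa using hz
    have h1 := abs_le.1 (Complex.abs_re_le_norm z)
    have h2 := abs_le.1 (Complex.abs_im_le_norm z)
    have h3 : (s₀ + z).im = t + z.im := by simp [him]
    have h4 : (s₀ + z).re = 1 + δ + z.re := by simp [hre]
    have h5 : |z.im| ≤ 1 := (Complex.abs_im_le_norm z).trans (by linarith)
    refine zeta_bound h ?_ ?_ ?_ ?_
    · rw [h3]
      have := abs_sub_abs_le_abs_sub t (-z.im)
      rw [abs_neg, sub_neg_eq_add] at this
      linarith
    · rw [h3]; exact (abs_add_le _ _).trans (by linarith)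
    · rw [h4]; linarith [h1.1]
    · rw [h4]; linarith [h1.2]
  have hK1 := hK.1
  have hlow : 1 / (L ^ 2 * K) ≤ ‖f 0‖ := by
    rw [hf0]
    refine le_trans ?_ (hK.lower (by rw [hre]; linarith) (by rw [hre]; linarith))
    rw [hre, ← div_div]; gcongr; linarith
  have hA := log_quot_le hL10 hKL hK1 hlow
  have hz : ∀ ρ ∈ ball (0 : ℂ) (theta L), f ρ = 0 → ρ.re ≤ 0 := by
    intro ρ _ hρ
    by_contra hcon
    push Not at hcon
    exact riemannZeta_ne_zero_of_one_le_re (s := s₀ + ρ)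
      (by rw [Complex.add_re, hre]; linarith) hρ
  obtain ⟨l1, l2⟩ := landau_le hθ (show theta L < 1 by linarith) hd hbd hne hz
    (by positivity : 0 < 6 * Real.log L) hA
  have e : (-deriv riemannZeta s₀ / riemannZeta s₀).re = -(deriv f 0 / f 0).re := by
    rw [hder, hf0, neg_div, Complex.neg_re]
  have e2 : 8 * (6 * Real.log L) / theta L = 48 * Real.log L / theta L := by ring
  rw [e2] at l1 l2
  refine ⟨by rw [e]; exact l1, fun a ha ha2 hza => ?_⟩
  have ha0 : 0 < a := hδ.trans_le ha
  have hna : ‖((-a : ℝ) : ℂ)‖ = a := by rw [Complex.norm_real, Real.norm_eq_abs, abs_neg, abs_of_pos ha0]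
  have := l2 ((-a : ℝ) : ℂ) (by simpa [abs_of_pos ha0] using ha2) (by
    simp only [hf]
    rw [← hza]; congr 1; rw [hs₀]; push_cast; ring)
  rw [hna, Complex.ofReal_re] at this
  rw [e]
  refine this.trans (le_of_eq ?_)
  field_simp; ring

theorem zeta_ne_zero_region {L K : ℝ} (h : Big L) (hK : ZC K) (hKL : 5 * K ≤ L)
    (hKθ : 30 * K * theta L ≤ 1) {s : ℂ}
    (hs : 1 - zfw L < s.re) (h2 : 2 ≤ |s.im|) (h3 : 2 * |s.im| + 1 ≤ Real.exp L) :
    riemannZeta s ≠ 0 := by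
  intro hzero
  obtain ⟨h0, hb, hl⟩ := h.pos
  obtain ⟨hθ, hθ2⟩ := h.theta_bounds
  obtain ⟨he, he2, he3⟩ := h.zfw_bounds
  have hlog := h.1
  have hK1 := hK.1
  set δ := 10 * zfw L with hδ
  have hδθ : 1000 * Real.log L * δ = theta L := by
    rw [hδ, zfw]; field_simp; norm_num
  have hlt : s.re < 1 := by
    by_contra hcon
    exact riemannZeta_ne_zero_of_one_le_re (not_lt.1 hcon) hzero
  have hδ0 : 0 < δ := by positivity
  set a := 1 + δ - s.re with ha
  have haδ : δ ≤ a := by linarith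
  have haδ2 : a ≤ 1.1 * δ := by linarith
  have haθ : a < theta L := by nlinarith
  have hδhalf : δ ≤ 1 / 2 := by linarith
  have hδL : 1 / L ^ 2 ≤ δ := by linarith
  have l1 := (zeta_landau h hK hKL hδ0 hδhalf hδL h2 (by linarith [abs_nonneg s.im])).2 a haδ haθ (by
    rw [← hzero]; congr 1
    apply Complex.ext <;> simp [ha])
  have l2 := (zeta_landau (t := 2 * s.im) h hK hKL hδ0 hδhalf hδL
    (by rw [abs_mul, abs_two]; linarith) (by rw [abs_mul, abs_two]; linarith)).1
  have l3 := (hK.2 (1 + δ) (by linarith) (by linarith)).2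
  have l0 := three_four_one (show 1 < 1 + δ by linarith) s.im
  rw [add_sub_cancel_left] at l3
  have e1 : 48 * Real.log L / theta L = 0.048 / δ := by
    rw [← hδθ]; field_simp; norm_num
  have e2 : 3.6 / δ ≤ 4 / a := by
    rw [div_le_div_iff₀ hδ0 (by linarith)]; nlinarith
  have e3 : a / theta L ^ 2 ≤ 0.01 / δ := by
    rw [div_le_div_iff₀ (by positivity) hδ0, ← hδθ]
    have : (1 : ℝ) ≤ Real.log L ^ 2 := one_le_pow₀ hlog
    nlinarith [mul_pos hδ0 hδ0]
  have e4 : 3 * K ≤ 0.1 / δ := by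
    rw [le_div_iff₀ hδ0]
    have : δ ≤ theta L := by nlinarith
    nlinarith
  have e5 : 4 * (1 / a) = 4 / a := by ring
  have e6 : 3 * (1 / δ) = 3 / δ := by ring
  have e7 : 3 / δ + 0.1 / δ + 5 * (0.048 / δ) + 4 * (0.01 / δ) - 3.6 / δ = -0.22 / δ := by ring
  have e8 : -0.22 / δ < 0 := div_neg_of_neg_of_pos (by norm_num) hδ0
  linarith

theorem exists_zeta₁_compact : ∃ δ K : ℝ, 0 < δ ∧ 1 ≤ K ∧ ∀ s : ℂ, 1 - δ ≤ s.re → s.re ≤ 2 →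
    |s.im| ≤ 3 → riemannZeta₁ s ≠ 0 ∧ ‖riemannZeta₁ s‖⁻¹ ≤ K := by
  have hcont : Continuous riemannZeta₁ := differentiable_riemannZeta₁.continuous
  set S : Set ℂ := Set.Icc (1 : ℝ) 2 ×ℂ Set.Icc (-3 : ℝ) 3 with hS
  have hSc : IsCompact S := isCompact_Icc.reProdIm isCompact_Icc
  have hU : IsOpen {s : ℂ | riemannZeta₁ s ≠ 0} := isOpen_ne.preimage hcont
  have hSU : S ⊆ {s : ℂ | riemannZeta₁ s ≠ 0} := by
    intro s hs
    rw [Set.mem_ofPred_eq]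
    rcases eq_or_ne s 1 with rfl | h
    · simp
    · rw [riemannZeta₁_eq _ h]
      exact mul_ne_zero (sub_ne_zero.2 h) (riemannZeta_ne_zero_of_one_le_re hs.1.1)
  obtain ⟨δ, hδ, hsub⟩ := hSc.exists_cthickening_subset_open hU hSU
  have hne : ∀ s : ℂ, 1 - δ ≤ s.re → s.re ≤ 2 → |s.im| ≤ 3 → riemannZeta₁ s ≠ 0 := by
    intro s h1 h2 h3
    rcases le_or_gt 1 s.re with h | h
    · exact hSU ⟨⟨h, h2⟩, abs_le.1 h3⟩
    · refine hsub (Metric.mem_cthickening_of_dist_le s (1 + s.im * Complex.I) δ S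
        ⟨⟨by simp, by norm_num⟩, by simpa using abs_le.1 h3⟩ ?_)
      rw [Complex.dist_eq]
      have : s - (1 + s.im * Complex.I) = ((s.re - 1 : ℝ) : ℂ) := by
        apply Complex.ext <;> simp
      rw [this, Complex.norm_real, Real.norm_eq_abs, abs_le]
      constructor <;> linarith
  set S' : Set ℂ := Set.Icc (1 - δ : ℝ) 2 ×ℂ Set.Icc (-3 : ℝ) 3 with hS'
  have hSc' : IsCompact S' := isCompact_Icc.reProdIm isCompact_Icc
  obtain ⟨K, hK⟩ := hSc'.exists_bound_of_continuousOn (f := fun s => (riemannZeta₁ s)⁻¹)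
    (hcont.continuousOn.inv₀ fun s hs => hne s hs.1.1 hs.1.2 (abs_le.2 hs.2))
  refine ⟨δ, max 1 K, hδ, le_max_left _ _, fun s h1 h2 h3 => ⟨hne s h1 h2 h3, ?_⟩⟩
  have := hK s ⟨⟨h1, h2⟩, abs_le.1 h3⟩
  rw [norm_inv] at this
  exact this.trans (le_max_right _ _)

open Metric in
theorem zeta_lower {L K : ℝ} (h : Big L) (hK : ZC K) (hKL : 5 * K ≤ L) (hKθ : 30 * K * theta L ≤ 1)
    {s : ℂ} (hs : 1 - zfw L / 2 ≤ s.re) (hs2 : s.re ≤ 2) (h3 : 3 ≤ |s.im|)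
    (him : 2 * |s.im| + 3 ≤ Real.exp L) : 1 / L ^ 39 ≤ ‖riemannZeta s‖ := by
  obtain ⟨h0, hb, hl⟩ := h.pos
  obtain ⟨hθ, hθ2⟩ := h.theta_bounds
  obtain ⟨he, he2, he3⟩ := h.zfw_bounds
  have hlog := h.1
  have hK1 := hK.1
  have hL10 : 10 ≤ L := by
    have : (10 : ℝ) ≤ 10 ^ 54 := by norm_num
    linarith
  have hlow : ∀ w : ℂ, 1 + zfw L ≤ w.re → w.re ≤ 2 → 1 / (L ^ 2 * K) ≤ ‖riemannZeta w‖ := by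
    intro w hw1 hw2
    refine le_trans ?_ (hK.lower (by linarith) hw2)
    rw [← div_div]; gcongr; linarith
  have hL3 : 1 / L ^ 3 ≤ 1 / (L ^ 2 * K) := by
    apply one_div_le_one_div_of_le (by positivity)
    calc L ^ 2 * K ≤ L ^ 2 * L := by gcongr; linarith
      _ = L ^ 3 := by ring
  rcases le_or_gt (1 + zfw L) s.re with hc | hc
  · refine le_trans ?_ (hL3.trans (hlow s hc hs2))
    exact one_div_le_one_div_of_le (by positivity) (pow_le_pow_right₀ (by linarith) (by norm_num))
  · set e := zfw L with hedef
    set s₀ : ℂ := (1 + e : ℝ) + s.im * Complex.I with hs₀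
    have hre : s₀.re = 1 + e := by simp [hs₀]
    have him0 : s₀.im = s.im := by simp [hs₀]
    have hd : DifferentiableOn ℂ (fun z => riemannZeta (s₀ + z)) (ball 0 (2 * e)) :=
      zeta_translate_diff (by rw [him0]; linarith)
    have hfacts : ∀ z ∈ ball (0 : ℂ) (2 * e), 1 - e < (s₀ + z).re ∧ (s₀ + z).re ≤ 3 ∧
        2 ≤ |(s₀ + z).im| ∧ |(s₀ + z).im| ≤ |s.im| + 1 := by
      intro z hz
      have hz' : ‖z‖ < 2 * e := by simpa using hz
      have h1 := abs_le.1 (Complex.abs_re_le_norm z)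
      have h3 : (s₀ + z).im = s.im + z.im := by simp [him0]
      have h4 : (s₀ + z).re = 1 + e + z.re := by simp [hre]
      have h5 : |z.im| ≤ 1 := (Complex.abs_im_le_norm z).trans (by linarith)
      refine ⟨by rw [h4]; linarith, by rw [h4]; linarith, ?_, ?_⟩
      · rw [h3]
        have := abs_sub_abs_le_abs_sub s.im (-z.im)
        rw [abs_neg, sub_neg_eq_add] at this
        linarith
      · rw [h3]; exact (abs_add_le _ _).trans (by linarith)
    have hne : ∀ z ∈ ball (0 : ℂ) (2 * e), riemannZeta (s₀ + z) ≠ 0 := by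
      intro z hz
      obtain ⟨f1, f2, f3, f4⟩ := hfacts z hz
      exact zeta_ne_zero_region h hK hKL hKθ f1 f3 (by linarith)
    have hM : ∀ z ∈ ball (0 : ℂ) (2 * e), ‖riemannZeta (s₀ + z)‖ ≤ 5 * L ^ 2 := by
      intro z hz
      obtain ⟨f1, f2, f3, f4⟩ := hfacts z hz
      exact zeta_bound h (by linarith) (by linarith [abs_nonneg s.im]) (by linarith) f2
    have hs0low : 1 / (L ^ 2 * K) ≤ ‖riemannZeta (s₀ + 0)‖ := by
      rw [add_zero]; exact hlow s₀ (by rw [hre]) (by rw [hre]; linarith)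
    have hA := log_quot_le hL10 hKL hK1 hs0low
    have hr : 0 < 2 * e := by positivity
    obtain ⟨-, hfin⟩ := log_bound_of_ne_zero hr hd hne hM (by positivity : 0 < 6 * Real.log L) hA
    set x := 1 + e - s.re with hx
    have hx0 : 0 < x := by linarith
    have hx1 : x ≤ 3 / 2 * e := by linarith
    have hnz : ‖((-x : ℝ) : ℂ)‖ = x := by
      rw [Complex.norm_real, Real.norm_eq_abs, abs_neg, abs_of_pos hx0]
    have := hfin ((-x : ℝ) : ℂ) (by rw [mem_ball_zero_iff, hnz]; linarith)
    have hss : s₀ + ((-x : ℝ) : ℂ) = s := by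
      apply Complex.ext <;> simp [hs₀, hx]
    rw [hss, hnz] at this
    refine le_trans ?_ this
    have h36 : 1 / L ^ 36 ≤ Real.exp (-(2 * (6 * Real.log L) * x / (2 * e - x))) := by
      rw [one_div, ← Real.exp_log (show 0 < (L ^ 36)⁻¹ by positivity), Real.log_inv, Real.log_pow]
      apply Real.exp_le_exp.2
      apply neg_le_neg
      rw [div_le_iff₀ (by linarith)]
      have : 0 ≤ Real.log L * (3 / 2 * e - x) := mul_nonneg (by linarith) (by linarith)
      push_cast
      nlinarith
    calc 1 / L ^ 39 = 1 / L ^ 3 * (1 / L ^ 36) := by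
          rw [div_mul_div_comm, one_mul, ← pow_add]
      _ ≤ _ := mul_le_mul (hL3.trans hs0low) h36 (by positivity) (norm_nonneg _)

lemma tendsto_log_div : Tendsto (fun L : ℝ => Real.log L / L) atTop (nhds 0) := by
  have := Real.isLittleO_log_id_atTop.tendsto_div_nhds_zero
  simpa using this

lemma tendsto_theta : Tendsto theta atTop (nhds 0) := by
  have h := (tendsto_log_div.rpow_const (p := 2 / 3) (by norm_num)).const_mul (1 / 100000000 : ℝ)
  rw [Real.zero_rpow (by norm_num), mul_zero] at h
  exact h

lemma eventually_big : ∀ᶠ L in atTop, Big L := by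
  have h1 := Real.tendsto_log_atTop.eventually_ge_atTop 1
  have h2 := tendsto_log_div.eventually_lt_const (show (0 : ℝ) < 1 / 10 ^ 54 by positivity)
  filter_upwards [h1, h2, eventually_gt_atTop 0] with L h1 h2 h3
  refine ⟨h1, ?_⟩
  rw [le_div_iff₀ (by linarith)]
  rw [div_lt_div_iff₀ h3 (by positivity)] at h2
  linarith

/-- The main bound for `1/ζ`. -/
theorem exists_inv_zeta_bound : ∃ L₀ K : ℝ, 1 ≤ K ∧ ∀ L, L₀ ≤ L → Big L ∧
    ∀ s : ℂ, 1 - zfw L / 2 ≤ s.re → s.re ≤ 2 → |s.im| ≤ Real.exp L / 3 →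
      riemannZeta₁ s ≠ 0 ∧ ‖riemannZeta₁ s‖⁻¹ ≤ K * L ^ 39 / (1 + |s.im|) := by
  obtain ⟨K, hK1, hKz⟩ := exists_zeta_real_bound
  obtain ⟨δ, K', hδ, hK', hc⟩ := exists_zeta₁_compact
  have hev : ∀ᶠ L in atTop, Big L ∧ 5 * K ≤ L ∧ 30 * K * theta L ≤ 1 ∧ theta L ≤ δ := by
    have h1 := (tendsto_theta.const_mul (30 * K)).eventually_le_const (show 30 * K * 0 < 1 by norm_num)
    filter_upwards [eventually_big, eventually_ge_atTop (5 * K), h1,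
      tendsto_theta.eventually_le_const hδ] with L h1 h2 h3 h4 using ⟨h1, h2, h3, h4⟩
  obtain ⟨L₀, hL₀⟩ := eventually_atTop.1 hev
  refine ⟨L₀, 4 * K', by linarith, fun L hL => ?_⟩
  obtain ⟨hB, h5, h30, hth⟩ := hL₀ L hL
  refine ⟨hB, fun s h1 h2 h3 => ?_⟩
  obtain ⟨h0, hb, hl⟩ := hB.pos
  obtain ⟨hθ, hθ2⟩ := hB.theta_bounds
  obtain ⟨he, he2, he3⟩ := hB.zfw_bounds
  have hL10 : 10 ≤ L := by
    have : (10 : ℝ) ≤ 10 ^ 54 := by norm_num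
    linarith
  have hL39 : (1 : ℝ) ≤ L ^ 39 := one_le_pow₀ (by linarith)
  rcases le_or_gt |s.im| 3 with him | him
  · obtain ⟨g1, g2⟩ := hc s (by linarith) h2 him
    refine ⟨g1, g2.trans ?_⟩
    rw [le_div_iff₀ (by positivity)]
    have : K' * (1 + |s.im|) ≤ K' * 4 := by gcongr; linarith
    nlinarith
  · have hexp : 10 ≤ Real.exp L := by linarith [Real.add_one_le_exp L]
    have hlow := zeta_lower hB ⟨hK1, hKz⟩ h5 h30 h1 h2 him.le (by linarith)
    have hne1 : s ≠ 1 := by rintro rfl; simp at him; linarith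
    have hn : |s.im| ≤ ‖s - 1‖ := by simpa using Complex.abs_im_le_norm (s - 1)
    have hge : |s.im| * (1 / L ^ 39) ≤ ‖riemannZeta₁ s‖ := by
      rw [riemannZeta₁_eq s hne1, norm_mul]; gcongr
    have hpos : 0 < |s.im| * (1 / L ^ 39) := by
      have : 0 < |s.im| := by linarith
      positivity
    refine ⟨norm_pos_iff.1 (hpos.trans_le hge), ?_⟩
    calc ‖riemannZeta₁ s‖⁻¹ ≤ (|s.im| * (1 / L ^ 39))⁻¹ := inv_anti₀ hpos hge
      _ = L ^ 39 / |s.im| := by field_simp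
      _ ≤ 4 * K' * L ^ 39 / (1 + |s.im|) := by
          rw [div_le_div_iff₀ (by linarith) (by positivity)]
          have : 1 + |s.im| ≤ 4 * K' * |s.im| := by nlinarith
          nlinarith

/-- The Perron-type kernel with quadratic decay. -/
theorem norm_kernel_le {c : ℝ} (hc : 0 < c) (y : ℝ) :
    ‖1 / (((c : ℂ) + y * Complex.I) * ((c : ℂ) + y * Complex.I + 1))‖ ≤
      (1 + 1 / c ^ 2) * (1 + y ^ 2)⁻¹ := by
  set s : ℂ := (c : ℂ) + y * Complex.I with hs
  have h1 : ‖s‖ ^ 2 = c ^ 2 + y ^ 2 := by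
    rw [← Complex.normSq_eq_norm_sq, Complex.normSq_apply]; simp [hs]; ring
  have h2 : ‖s + 1‖ ^ 2 = (c + 1) ^ 2 + y ^ 2 := by
    rw [← Complex.normSq_eq_norm_sq, Complex.normSq_apply]; simp [hs]; ring
  have h3 : ‖s‖ ≤ ‖s + 1‖ := by
    apply le_of_sq_le_sq _ (norm_nonneg _); rw [h1, h2]; nlinarith
  have h4 : c ^ 2 + y ^ 2 ≤ ‖s‖ * ‖s + 1‖ := by
    rw [← h1, sq]; gcongr
  rw [norm_div, norm_one, norm_mul]
  calc 1 / (‖s‖ * ‖s + 1‖) ≤ 1 / (c ^ 2 + y ^ 2) := by gcongr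
    _ ≤ _ := by
      rw [← div_eq_mul_inv, div_le_div_iff₀ (by positivity) (by positivity)]
      have : (1 + 1 / c ^ 2) * (c ^ 2 + y ^ 2) = c ^ 2 + y ^ 2 + 1 + y ^ 2 / c ^ 2 := by
        field_simp; ring
      rw [this]
      have : 0 ≤ y ^ 2 / c ^ 2 := by positivity
      nlinarith

theorem integrable_kernel {c : ℝ} (hc : 0 < c) :
    Integrable fun y : ℝ => 1 / (((c : ℂ) + y * Complex.I) * ((c : ℂ) + y * Complex.I + 1)) := by
  refine (integrable_inv_one_add_sq.const_mul (1 + 1 / c ^ 2)).mono' ?_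
    (Eventually.of_forall fun y => norm_kernel_le hc y)
  apply Continuous.aestronglyMeasurable
  refine continuous_const.div (by fun_prop) fun y => mul_ne_zero ?_ ?_
  · intro h; have := congrArg Complex.re h; simp at this; linarith
  · intro h; have := congrArg Complex.re h; simp at this; linarith

theorem perron_kernel {c u : ℝ} (hc : 0 < c) (hu : 0 < u) :
    ∫ y : ℝ, (u : ℂ) ^ (-((c : ℂ) + y * Complex.I)) *
      (1 / (((c : ℂ) + y * Complex.I) * ((c : ℂ) + y * Complex.I + 1))) =
    2 * Real.pi * ((max (1 - u) 0 : ℝ) : ℂ) := by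
  set k : ℝ → ℂ := fun t => Set.indicator (Set.Ioc 0 1) (fun _ => 1 : ℝ → ℂ) t -
    Set.indicator (Set.Ioc 0 1) (fun t => (t : ℂ) ^ (1 : ℂ) : ℝ → ℂ) t with hk
  have hM : ∀ s : ℂ, 0 < s.re → HasMellin k s (1 / (s * (s + 1))) := by
    intro s hs
    have h1 := hasMellin_one_Ioc hs
    have h2 := hasMellin_cpow_Ioc 1 (s := s) (by simp; linarith)
    have h3 := hasMellin_sub h1.1 h2.1
    rw [h1.2, h2.2] at h3
    have hs0 : s ≠ 0 := by rintro rfl; simp at hs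
    have hs1 : s + 1 ≠ 0 := by
      intro h; have := congrArg Complex.re h; simp at this; linarith
    rw [show 1 / (s * (s + 1)) = 1 / s - 1 / (s + 1) by field_simp; ring]
    exact h3
  have hre : ∀ y : ℝ, 0 < ((c : ℂ) + y * Complex.I).re := fun y => by simpa using hc
  have hkv : ∀ t : ℝ, 0 < t → k t = ((max (1 - t) 0 : ℝ) : ℂ) := by
    intro t ht
    by_cases h : t ≤ 1
    · have : t ∈ Set.Ioc (0 : ℝ) 1 := ⟨ht, h⟩
      simp [hk, this, h]
    · have : t ∉ Set.Ioc (0 : ℝ) 1 := fun h' => h h'.2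
      simp only [hk, Set.indicator_of_notMem this]
      rw [max_eq_right (by linarith)]; simp
  have hcont : ContinuousAt k u := by
    have h1 : ContinuousAt (fun t : ℝ => ((max (1 - t) 0 : ℝ) : ℂ)) u := by fun_prop
    exact h1.congr (by filter_upwards [lt_mem_nhds hu] with t ht using (hkv t ht).symm)
  have hV : Complex.VerticalIntegrable (mellin k) c := by
    refine (integrable_kernel hc).congr (Eventually.of_forall fun y => ?_)
    exact ((hM _ (hre y)).2).symm
  have := mellinInv_mellin_eq c k hu (hM c (by simpa using hc)).1 hV hcont
  rw [mellinInv, hkv u hu] at this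
  rw [← this]
  have e : ∀ y : ℝ, mellin k ((c : ℂ) + y * Complex.I) =
      1 / (((c : ℂ) + y * Complex.I) * ((c : ℂ) + y * Complex.I + 1)) := fun y => (hM _ (hre y)).2
  simp only [e, smul_eq_mul]
  rw [Complex.real_smul]
  have hpi : (Real.pi : ℂ) ≠ 0 := by exact_mod_cast Real.pi_ne_zero
  rw [show ((1 / (2 * Real.pi) : ℝ) : ℂ) = 1 / (2 * (Real.pi : ℂ)) by push_cast; rfl,
    ← mul_assoc, mul_one_div_cancel (by simp), one_mul]

/-- The integrand `x^s / ((s+1) (s ζ(1+s)))`. -/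
noncomputable def Gx (x : ℝ) (s : ℂ) : ℂ := (x : ℂ) ^ s / ((s + 1) * riemannZeta₁ (1 + s))

open ArithmeticFunction in
/-- The smoothed sum. -/
noncomputable def S1 (x : ℝ) : ℝ := ∑ n ∈ Icc 1 ⌊x⌋₊, (moebius n : ℝ) / n * (1 - n / x)

open ArithmeticFunction in
theorem perron_sum {x c : ℝ} (hx : 0 < x) (hc : 0 < c) :
    ∫ y : ℝ, Gx x ((c : ℂ) + y * Complex.I) = 2 * Real.pi * (S1 x : ℂ) := by
  set kr : ℝ → ℂ := fun y => 1 / (((c : ℂ) + y * Complex.I) * ((c : ℂ) + y * Complex.I + 1)) with hkr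
  set F : ℕ → ℝ → ℂ := fun n y => LSeries.term (fun n => ((moebius n : ℤ) : ℂ))
    (1 + ((c : ℂ) + y * Complex.I)) n * ((x : ℂ) ^ ((c : ℂ) + y * Complex.I) * kr y) with hF
  have hxc : (x : ℂ) ≠ 0 := by exact_mod_cast hx.ne'
  have hF1 : ∀ n : ℕ, 0 < n → ∀ y : ℝ, F n y = ((moebius n : ℝ) / n : ℝ) *
      (((n / x : ℝ) : ℂ) ^ (-((c : ℂ) + y * Complex.I)) * kr y) := by
    intro n hn y
    have hn0 : (n : ℂ) ≠ 0 := by exact_mod_cast hn.ne'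
    simp only [hF]
    rw [LSeries.term_of_ne_zero hn.ne', Complex.cpow_add _ _ hn0, Complex.cpow_one]
    have e : ((n / x : ℝ) : ℂ) ^ (-((c : ℂ) + y * Complex.I)) =
        (x : ℂ) ^ ((c : ℂ) + y * Complex.I) / (n : ℂ) ^ ((c : ℂ) + y * Complex.I) := by
      rw [Complex.cpow_neg, Complex.ofReal_div, Complex.div_cpow_ofReal_nonneg (by positivity) hx.le]
      rw [inv_div]; simp
    rw [e]; push_cast
    have : (n : ℂ) ^ ((c : ℂ) + y * Complex.I) ≠ 0 := by
      rw [Complex.cpow_ne_zero_iff]; left; exact hn0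
    field_simp
  have hnorm : ∀ n : ℕ, ∀ y : ℝ, ‖F n y‖ = ‖LSeries.term (fun n => ((moebius n : ℤ) : ℂ))
      (1 + (c : ℂ)) n‖ * (x ^ c * ‖kr y‖) := by
    intro n y
    simp only [hF]
    rw [norm_mul, norm_mul, LSeries.norm_term_eq, LSeries.norm_term_eq,
      Complex.norm_cpow_eq_rpow_re_of_pos hx]
    simp
  have hFint : ∀ n, Integrable (F n) := by
    intro n
    have hk := integrable_kernel hc
    rcases Nat.eq_zero_or_pos n with rfl | hn
    · simp [hF]
    · refine Integrable.mono' ((hk.norm.const_mul (x ^ c)).const_mul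
        ‖LSeries.term (fun n => ((moebius n : ℤ) : ℂ)) (1 + (c : ℂ)) n‖) ?_
        (Eventually.of_forall fun y => (hnorm n y).le)
      have : F n = fun y : ℝ => ((moebius n : ℝ) / n : ℝ) *
        (((n / x : ℝ) : ℂ) ^ (-((c : ℂ) + y * Complex.I)) * kr y) := funext (hF1 n hn)
      rw [this]
      refine (Continuous.aestronglyMeasurable ?_).mul
        ((Continuous.aestronglyMeasurable ?_).mul hk.aestronglyMeasurable)
      · fun_prop
      · refine Continuous.const_cpow (by fun_prop) (Or.inl ?_)
        have : 0 < (n : ℝ) / x := by positivity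
        exact_mod_cast this.ne'
  have hre1 : 1 < (1 + (c : ℂ)).re := by simpa using hc
  have hsum : Summable fun n => ∫ y, ‖F n y‖ := by
    simp_rw [hnorm, integral_const_mul]
    exact (LSeriesSummable_moebius_iff.2 hre1).norm.mul_right _
  have h := hasSum_integral_of_summable_integral_norm hFint hsum
  have hval : ∀ n : ℕ, ∫ y, F n y = if n ∈ Icc 1 ⌊x⌋₊ then
      2 * (Real.pi : ℂ) * (((moebius n : ℝ) / n * (1 - n / x) : ℝ) : ℂ) else 0 := by
    intro n
    rcases Nat.eq_zero_or_pos n with rfl | hn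
    · simp [hF]
    · have hnx : (0 : ℝ) < n / x := by positivity
      simp_rw [hF1 n hn]
      rw [integral_const_mul, perron_kernel hc hnx]
      split_ifs with hmem
      · have : (n : ℝ) ≤ x := (Nat.le_floor_iff hx.le).1 (Finset.mem_Icc.1 hmem).2
        rw [max_eq_left (by rw [sub_nonneg, div_le_one hx]; exact this)]
        push_cast; ring
      · have : x < n := by
          rw [Finset.mem_Icc, not_and] at hmem
          exact (Nat.floor_lt hx.le).1 (not_le.1 (hmem hn))
        rw [max_eq_right (by rw [sub_nonpos, one_le_div hx]; exact this.le)]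
        simp
  have hfin : ∑' n, ∫ y, F n y = 2 * Real.pi * (S1 x : ℂ) := by
    simp_rw [hval]
    rw [tsum_eq_sum (s := Icc 1 ⌊x⌋₊) (fun n hn => if_neg hn), S1, Complex.ofReal_sum,
      Finset.mul_sum]
    exact Finset.sum_congr rfl fun n hn => if_pos hn
  rw [← hfin, h.tsum_eq]
  congr 1; ext y
  simp only [hF]
  rw [tsum_mul_right]
  set s : ℂ := (c : ℂ) + y * Complex.I with hs
  have hsre : s.re = c := by simp [hs]
  have h1s : 1 < (1 + s).re := by rw [Complex.add_re, hsre]; simpa using hc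
  have hs0 : s ≠ 0 := by intro h; rw [h] at hsre; simp at hsre; linarith
  have hs1 : s + 1 ≠ 0 := by
    intro h; have := congrArg Complex.re h; simp [hsre] at this; linarith
  have e1 : riemannZeta (1 + s) * ∑' n, LSeries.term (fun n => ((moebius n : ℤ) : ℂ)) (1 + s) n = 1 := by
    rw [← LSeries_zeta_eq_riemannZeta h1s]; exact LSeries_zeta_mul_Lseries_moebius h1s
  have e2 : riemannZeta₁ (1 + s) = s * riemannZeta (1 + s) := by
    rw [riemannZeta₁_eq _ (by intro h; apply hs0; simpa using h)]; ring
  have hz : riemannZeta (1 + s) ≠ 0 := left_ne_zero_of_mul_eq_one e1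
  have e3 : ∑' n, LSeries.term (fun n => ((moebius n : ℤ) : ℂ)) (1 + s) n =
      1 / riemannZeta (1 + s) := eq_div_of_mul_eq hz (by rw [mul_comm]; exact e1)
  rw [e3, Gx, e2]
  simp only [hkr, ← hs]
  rw [one_div_mul_eq_div, mul_one_div, div_div]
  congr 1; ring

theorem norm_setIntegral_Ioi_le {f : ℝ → ℂ} {H B : ℝ} (hH : 0 < H)
    (hb : ∀ y, H ≤ y → ‖f y‖ ≤ B / y ^ 2) : ‖∫ y in Set.Ioi H, f y‖ ≤ B / H := by
  have h1 : IntegrableOn (fun y : ℝ => B * y ^ (-2 : ℝ)) (Set.Ioi H) :=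
    (integrableOn_Ioi_rpow_of_lt (by norm_num) hH).const_mul B
  have h2 := norm_integral_le_of_norm_le (f := f) h1 ((ae_restrict_iff' measurableSet_Ioi).2
    (Eventually.of_forall fun y hy => by
      have hy' : H < y := hy
      have := hb y hy'.le
      rwa [Real.rpow_neg (by linarith), Real.rpow_two, ← div_eq_mul_inv]))
  rw [integral_const_mul, integral_Ioi_rpow_of_lt (by norm_num) hH] at h2
  refine h2.trans (le_of_eq ?_)
  norm_num
  rw [Real.rpow_neg_one, div_eq_mul_inv]

theorem norm_integral_sub_le_of_tail {f : ℝ → ℂ} {H B : ℝ} (hH : 0 < H) (hf : Integrable f)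
    (hb : ∀ y, H ≤ |y| → ‖f y‖ ≤ B / y ^ 2) :
    ‖(∫ y, f y) - ∫ y in (-H)..H, f y‖ ≤ 2 * B / H := by
  have e : ∫ y, f y = (∫ y in Set.Iic (-H), f y) + (∫ y in (-H)..H, f y) + ∫ y in Set.Ioi H, f y := by
    rw [intervalIntegral.integral_of_le (by linarith), ← setIntegral_union _ measurableSet_Ioc
      hf.integrableOn hf.integrableOn, Set.Iic_union_Ioc_eq_Iic (by linarith),
      intervalIntegral.integral_Iic_add_Ioi hf.integrableOn hf.integrableOn]
    rw [Set.disjoint_left]; intro y h1 h2; exact absurd h2.1 (not_lt.2 h1)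
  have h1 : ‖∫ y in Set.Ioi H, f y‖ ≤ B / H :=
    norm_setIntegral_Ioi_le hH fun y hy => hb y (hy.trans (le_abs_self y))
  have h2 : ‖∫ y in Set.Iic (-H), f y‖ ≤ B / H := by
    rw [← integral_comp_neg_Ioi]
    refine norm_setIntegral_Ioi_le hH fun y hy => ?_
    have := hb (-y) (by rw [abs_neg]; exact hy.trans (le_abs_self y))
    rwa [neg_sq] at this
  rw [e, show ∀ a b c : ℂ, a + b + c - b = a + c by intros; ring]
  calc _ ≤ _ := norm_add_le _ _
    _ ≤ B / H + B / H := by gcongr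
    _ = _ := by ring

theorem norm_Gx_eq {x : ℝ} (hx : 0 < x) (s : ℂ) :
    ‖Gx x s‖ = x ^ s.re * (‖s + 1‖⁻¹ * ‖riemannZeta₁ (1 + s)‖⁻¹) := by
  rw [Gx, norm_div, norm_mul, Complex.norm_cpow_eq_rpow_re_of_pos hx, div_eq_mul_inv, mul_inv]

theorem norm_Gx_right {x c K : ℝ} (hx : 0 < x) (hc : 0 < c) (hc1 : c ≤ 1) (hK : ZC K) (y : ℝ) :
    ‖Gx x ((c : ℂ) + y * Complex.I)‖ ≤ x ^ c * (K / c) / (c ^ 2 + y ^ 2) := by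
  set s : ℂ := (c : ℂ) + y * Complex.I with hs
  have hre : s.re = c := by simp [hs]
  have hs0 : s ≠ 0 := by intro h; rw [h] at hre; simp at hre; linarith
  have hsn : 0 < ‖s‖ := norm_pos_iff.2 hs0
  have h1 : ‖s‖ ^ 2 = c ^ 2 + y ^ 2 := by
    rw [← Complex.normSq_eq_norm_sq, Complex.normSq_apply]; simp [hs]; ring
  have h2 : ‖s + 1‖ ^ 2 = (c + 1) ^ 2 + y ^ 2 := by
    rw [← Complex.normSq_eq_norm_sq, Complex.normSq_apply]; simp [hs]; ring
  have h3 : ‖s‖ ≤ ‖s + 1‖ := by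
    apply le_of_sq_le_sq _ (norm_nonneg _); rw [h1, h2]; nlinarith
  have hK0 : 0 < K := by linarith [hK.1]
  have h4 : c / K ≤ ‖riemannZeta (1 + s)‖ := by
    have := hK.lower (s := 1 + s) (by simp [hre, hc]) (by simp [hre]; linarith)
    simpa [hre] using this
  have h5 : ‖s‖ * (c / K) ≤ ‖riemannZeta₁ (1 + s)‖ := by
    rw [riemannZeta₁_eq _ (by intro h; apply hs0; simpa using h), norm_mul, add_sub_cancel_left]
    gcongr
  rw [norm_Gx_eq hx, hre, ← h1, mul_div_assoc]
  have : 0 < ‖s‖ * (c / K) := by positivity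
  refine mul_le_mul_of_nonneg_left ?_ (by positivity)
  calc ‖s + 1‖⁻¹ * ‖riemannZeta₁ (1 + s)‖⁻¹ ≤ ‖s‖⁻¹ * (‖s‖ * (c / K))⁻¹ := by gcongr
    _ = _ := by field_simp

theorem integrable_Gx {x c K : ℝ} (hx : 0 < x) (hc : 0 < c) (hc1 : c ≤ 1) (hK : ZC K) :
    Integrable fun y : ℝ => Gx x ((c : ℂ) + y * Complex.I) := by
  have hK0 : 0 < K := by linarith [hK.1]
  refine (integrable_inv_one_add_sq.const_mul (x ^ c * (K / c) / c ^ 2)).mono' ?_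
    (Eventually.of_forall fun y => (norm_Gx_right hx hc hc1 hK y).trans ?_)
  · apply Continuous.aestronglyMeasurable
    have hx0 : (x : ℂ) ≠ 0 := by exact_mod_cast hx.ne'
    refine Continuous.div (Continuous.const_cpow (by fun_prop) (Or.inl hx0)) ?_ fun y => ?_
    · have := differentiable_riemannZeta₁.continuous
      fun_prop
    · set s : ℂ := (c : ℂ) + y * Complex.I with hs
      have hre : s.re = c := by simp [hs]
      refine mul_ne_zero ?_ ?_
      · intro h; have := congrArg Complex.re h; simp [hre] at this; linarith
      · rw [riemannZeta₁_eq _ (by intro h; have := congrArg Complex.re h; simp [hre] at this; linarith)]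
        refine mul_ne_zero ?_ (riemannZeta_ne_zero_of_one_le_re (by simp [hre, hc.le]))
        intro h; have := congrArg Complex.re h; simp [hre] at this; linarith
  · rw [div_eq_mul_inv (x ^ c * (K / c)), div_eq_mul_inv (x ^ c * (K / c)), mul_assoc _ _ (1 + y ^ 2)⁻¹]
    refine mul_le_mul_of_nonneg_left ?_ (by positivity)
    rw [← mul_inv]
    gcongr
    nlinarith [mul_le_one₀ hc1 hc.le hc1, sq_nonneg y]

/-- Shifting the contour into the zero-free region. -/
theorem norm_S1_le {x c η H M K : ℝ} (hx : 1 ≤ x) (hc : 0 < c) (hc1 : c ≤ 1) (hη : 0 < η)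
    (hη1 : η ≤ 1 / 2) (hH : 0 < H) (hM : 0 ≤ M) (hK : ZC K)
    (hz : ∀ s : ℂ, 1 - η ≤ s.re → s.re ≤ 2 → |s.im| ≤ H →
      riemannZeta₁ s ≠ 0 ∧ ‖riemannZeta₁ s‖⁻¹ ≤ M / (1 + |s.im|)) :
    |S1 x| ≤ 2 * (x ^ c * (K / c)) / H + 4 * x ^ c * M / H ^ 2 + 3 * Real.pi * M * x ^ (-η) := by
  have hx0 : 0 < x := by linarith
  have hK0 : 0 < K := by linarith [hK.1]
  have hxc : (x : ℂ) ≠ 0 := by exact_mod_cast hx0.ne'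
  have hp := perron_sum hx0 hc
  have htail := norm_integral_sub_le_of_tail hH (integrable_Gx hx0 hc hc1 hK)
    (B := x ^ c * (K / c)) (fun y hy => (norm_Gx_right hx0 hc hc1 hK y).trans (by
      have : 0 < y ^ 2 := by rw [← sq_abs]; nlinarith
      gcongr; nlinarith))
  have hrect := Complex.integral_boundary_rect_eq_zero_of_differentiableOn (Gx x)
    (((-η : ℝ) : ℂ) + ((-H : ℝ) : ℂ) * Complex.I) ((c : ℂ) + (H : ℂ) * Complex.I) ?_
  swap
  · intro s hs
    apply DifferentiableAt.differentiableWithinAt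
    rw [Complex.mem_reProdIm] at hs
    simp only [Complex.add_re, Complex.ofReal_re, Complex.mul_re, Complex.I_re, mul_zero, Complex.ofReal_im,
      Complex.I_im, mul_one, sub_self, add_zero, Complex.add_im, Complex.mul_im, zero_add] at hs
    rw [Set.uIcc_of_le (by linarith), Set.uIcc_of_le (by linarith)] at hs
    obtain ⟨⟨h1, h2⟩, h3, h4⟩ := hs
    have hz1 := (hz (1 + s) (by simp; linarith) (by simp; linarith) (by simp [abs_le]; exact ⟨h3, h4⟩)).1
    refine DifferentiableAt.div ?_ ?_ (mul_ne_zero ?_ hz1)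
    · exact (differentiableAt_id).const_cpow (Or.inl hxc)
    · have := differentiable_riemannZeta₁
      fun_prop
    · intro h; have := congrArg Complex.re h; simp at this; linarith
  simp only [Complex.add_re, Complex.ofReal_re, Complex.mul_re, Complex.I_re, mul_zero, Complex.ofReal_im,
      Complex.I_im, mul_one, sub_self, add_zero, Complex.add_im, Complex.mul_im, zero_add] at hrect
  have hzb : ∀ s : ℂ, -η ≤ s.re → s.re ≤ 1 → |s.im| ≤ H →
      ‖riemannZeta₁ (1 + s)‖⁻¹ ≤ M / (1 + |s.im|) := by
    intro s h1 h2 h3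
    have := (hz (1 + s) (by simp; linarith) (by simp; linarith) (by simpa using h3)).2
    simpa using this
  have hhor : ∀ v : ℝ, |v| = H → ‖∫ u in (-η)..c, Gx x ((u : ℂ) + (v : ℂ) * Complex.I)‖ ≤
      2 * (x ^ c * M / H ^ 2) := by
    intro v hv
    have := intervalIntegral.norm_integral_le_of_norm_le_const (a := -η) (b := c)
      (f := fun u : ℝ => Gx x ((u : ℂ) + (v : ℂ) * Complex.I)) (C := x ^ c * M / H ^ 2) ?_
    · refine this.trans ?_
      rw [mul_comm]
      have h2 : |c - -η| ≤ 2 := by rw [abs_of_pos (by linarith)]; linarith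
      gcongr
    · intro u hu
      rw [Set.uIoc_of_le (by linarith)] at hu
      have h := hzb ((u : ℂ) + (v : ℂ) * Complex.I) (by simp; linarith [hu.1])
        (by simp; linarith [hu.2]) (by simp [hv])
      rw [norm_Gx_eq hx0]
      have him : H ≤ ‖(u : ℂ) + (v : ℂ) * Complex.I + 1‖ := by
        have := Complex.abs_im_le_norm ((u : ℂ) + (v : ℂ) * Complex.I + 1)
        simpa [hv] using this
      have h' : ‖riemannZeta₁ (1 + ((u : ℂ) + (v : ℂ) * Complex.I))‖⁻¹ ≤ M / H := by
        refine h.trans ?_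
        have : |((u : ℂ) + (v : ℂ) * Complex.I).im| = H := by simp [hv]
        rw [this]; gcongr; linarith
      have hre : ((u : ℂ) + (v : ℂ) * Complex.I).re ≤ c := by simpa using hu.2
      calc _ ≤ x ^ c * (H⁻¹ * (M / H)) := by
            gcongr
        _ = _ := by field_simp
  have hleft : ‖∫ y in (-H)..H, Gx x (((-η : ℝ) : ℂ) + (y : ℂ) * Complex.I)‖ ≤
      3 * Real.pi * M * x ^ (-η) := by
    have hi : Integrable (fun y : ℝ => 3 * M * x ^ (-η) * (1 + y ^ 2)⁻¹) :=
      integrable_inv_one_add_sq.const_mul _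
    have := intervalIntegral.norm_integral_le_of_norm_le (a := -H) (b := H) (by linarith)
      (f := fun y : ℝ => Gx x (((-η : ℝ) : ℂ) + (y : ℂ) * Complex.I))
      (g := fun y : ℝ => 3 * M * x ^ (-η) * (1 + y ^ 2)⁻¹) (μ := volume)
      (Eventually.of_forall fun y hy => ?_) hi.intervalIntegrable
    · refine this.trans ?_
      rw [intervalIntegral.integral_of_le (by linarith)]
      refine (setIntegral_le_integral hi (Eventually.of_forall fun y => by positivity)).trans ?_
      rw [integral_const_mul, integral_univ_inv_one_add_sq]
      apply le_of_eq; ring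
    · have h := hzb (((-η : ℝ) : ℂ) + (y : ℂ) * Complex.I) (by simp)
        (by simp; linarith) (by simp [abs_le]; exact ⟨hy.1.le, hy.2⟩)
      have him : ((((-η : ℝ) : ℂ) + (y : ℂ) * Complex.I)).im = y := by simp
      have hre : ((((-η : ℝ) : ℂ) + (y : ℂ) * Complex.I)).re = -η := by simp
      rw [him] at h
      rw [norm_Gx_eq hx0, hre]
      have h1 : (1 + |y|) / 3 ≤ ‖((-η : ℝ) : ℂ) + (y : ℂ) * Complex.I + 1‖ := by
        have a1 := Complex.abs_im_le_norm (((-η : ℝ) : ℂ) + (y : ℂ) * Complex.I + 1)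
        have a2 := Complex.abs_re_le_norm (((-η : ℝ) : ℂ) + (y : ℂ) * Complex.I + 1)
        rw [Complex.add_im, him, Complex.one_im, add_zero] at a1
        rw [Complex.add_re, hre, Complex.one_re, abs_of_pos (by linarith)] at a2
        linarith
      have hay := abs_nonneg y
      calc _ ≤ x ^ (-η) * (((1 + |y|) / 3)⁻¹ * (M / (1 + |y|))) := by gcongr
        _ = 3 * M * x ^ (-η) * ((1 + |y|) ^ 2)⁻¹ := by field_simp
        _ ≤ _ := by
          gcongr
          rw [← sq_abs]; nlinarith
  have h1 := hhor (-H) (by rw [abs_neg, abs_of_pos hH])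
  have h2 := hhor H (abs_of_pos hH)
  have e : ∫ y in (-H)..H, Gx x ((c : ℂ) + (y : ℂ) * Complex.I) =
      (∫ y in (-H)..H, Gx x (((-η : ℝ) : ℂ) + (y : ℂ) * Complex.I)) +
      Complex.I * ((∫ u in (-η)..c, Gx x ((u : ℂ) + ((-H : ℝ) : ℂ) * Complex.I)) -
        ∫ u in (-η)..c, Gx x ((u : ℂ) + (H : ℂ) * Complex.I)) := by
    simp only [smul_eq_mul] at hrect
    linear_combination (-Complex.I) * hrect + (((∫ y in (-H)..H, Gx x ((c : ℂ) + (y : ℂ) * Complex.I)) -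
      ∫ y in (-H)..H, Gx x (((-η : ℝ) : ℂ) + (y : ℂ) * Complex.I)) * Complex.I_sq)
  have hmid : ‖∫ y in (-H)..H, Gx x ((c : ℂ) + (y : ℂ) * Complex.I)‖ ≤
      3 * Real.pi * M * x ^ (-η) + (2 * (x ^ c * M / H ^ 2) + 2 * (x ^ c * M / H ^ 2)) := by
    rw [e]
    refine (norm_add_le _ _).trans (add_le_add hleft ?_)
    rw [norm_mul, Complex.norm_I, one_mul]
    exact (norm_sub_le _ _).trans (add_le_add h1 h2)
  have htot : ‖(2 * Real.pi * (S1 x : ℂ))‖ ≤ 2 * (x ^ c * (K / c)) / H +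
      (3 * Real.pi * M * x ^ (-η) + (2 * (x ^ c * M / H ^ 2) + 2 * (x ^ c * M / H ^ 2))) := by
    rw [← hp]
    have := norm_le_norm_sub_add (∫ y : ℝ, Gx x ((c : ℂ) + (y : ℂ) * Complex.I))
      (∫ y in (-H)..H, Gx x ((c : ℂ) + (y : ℂ) * Complex.I))
    linarith
  have hn : ‖(2 * Real.pi * (S1 x : ℂ))‖ = 2 * Real.pi * |S1 x| := by
    simp [abs_of_pos Real.pi_pos]
  rw [hn] at htot
  have := abs_nonneg (S1 x)
  have hpi := Real.pi_gt_three
  have : |S1 x| ≤ 2 * Real.pi * |S1 x| := by nlinarith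
  have e4 : 4 * x ^ c * M / H ^ 2 = 2 * (x ^ c * M / H ^ 2) + 2 * (x ^ c * M / H ^ 2) := by ring
  linarith

/-- The exponent `ℓ^{3/5} / (log ℓ)^{1/5}`. -/
noncomputable def vkExp (l : ℝ) : ℝ := l ^ ((3 : ℝ) / 5) / Real.log l ^ ((1 : ℝ) / 5)

/-- `vkExp`, frozen to the left of `e`. -/
noncomputable def vkE (l : ℝ) : ℝ := vkExp (max l (Real.exp 1))

lemma one_le_log_of_exp_le {l : ℝ} (h : Real.exp 1 ≤ l) : 1 ≤ Real.log l := by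
  rw [Real.le_log_iff_exp_le ((Real.exp_pos 1).trans_le h)]; exact h

lemma one_lt_exp_one : (1 : ℝ) < Real.exp 1 := Real.one_lt_exp_iff.2 one_pos

theorem vkExp_pos {l : ℝ} (h : Real.exp 1 ≤ l) : 0 < vkExp l := by
  have := one_le_log_of_exp_le h
  have : 0 < l := (Real.exp_pos 1).trans_le h
  unfold vkExp; positivity

theorem vkExp_mono {l₁ l₂ : ℝ} (h1 : Real.exp 1 ≤ l₁) (h : l₁ ≤ l₂) : vkExp l₁ ≤ vkExp l₂ := by
  have a1 := one_le_log_of_exp_le h1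
  have a2 := one_le_log_of_exp_le (h1.trans h)
  have p1 : 0 < l₁ := (Real.exp_pos 1).trans_le h1
  have p2 : 0 < l₂ := p1.trans_le h
  have b1 : 0 < Real.log l₁ := by linarith
  have b2 : 0 < Real.log l₂ := by linarith
  set r := l₂ / l₁ with hr
  have hr1 : 1 ≤ r := (one_le_div p1).2 h
  have key : Real.log l₂ ≤ r ^ 3 * Real.log l₁ := by
    have e : Real.log l₂ = Real.log l₁ + Real.log r := by
      rw [hr, Real.log_div p2.ne' p1.ne']; ring
    have c1 : Real.log r ≤ r - 1 := Real.log_le_sub_one_of_pos (by linarith)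
    have c2 : r ≤ r ^ 3 := by nlinarith [mul_le_mul hr1 hr1 zero_le_one (by linarith)]
    rw [e]; nlinarith
  unfold vkExp
  rw [div_le_div_iff₀ (by positivity) (by positivity)]
  have e2 : l₂ = r * l₁ := by rw [hr]; field_simp
  have k2 : Real.log l₂ ^ ((1 : ℝ) / 5) ≤ r ^ ((3 : ℝ) / 5) * Real.log l₁ ^ ((1 : ℝ) / 5) := by
    calc _ ≤ (r ^ 3 * Real.log l₁) ^ ((1 : ℝ) / 5) := by gcongr
      _ = _ := by
        rw [Real.mul_rpow (by positivity) b1.le, ← Real.rpow_natCast, ← Real.rpow_mul (by linarith)]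
        norm_num
  calc _ ≤ l₁ ^ ((3 : ℝ) / 5) * (r ^ ((3 : ℝ) / 5) * Real.log l₁ ^ ((1 : ℝ) / 5)) := by gcongr
    _ = (r * l₁) ^ ((3 : ℝ) / 5) * Real.log l₁ ^ ((1 : ℝ) / 5) := by
      rw [Real.mul_rpow (by linarith) p1.le]; ring
    _ = _ := by rw [← e2]

theorem vkExp_le_self {l : ℝ} (h : Real.exp 1 ≤ l) : vkExp l ≤ l := by
  have a1 := one_le_log_of_exp_le h
  have hl : 1 ≤ l := one_lt_exp_one.le.trans h
  unfold vkExp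
  rw [div_le_iff₀ (by positivity)]
  calc l ^ ((3 : ℝ) / 5) ≤ l ^ (1 : ℝ) := Real.rpow_le_rpow_of_exponent_le hl (by norm_num)
    _ = l * 1 := by rw [Real.rpow_one, mul_one]
    _ ≤ _ := by
      gcongr
      exact Real.one_le_rpow a1 (by norm_num)

theorem vkExp_sub_le {l₁ l₂ : ℝ} (h1 : Real.exp 1 ≤ l₁) (h : l₁ ≤ l₂) :
    vkExp l₂ - vkExp l₁ ≤ l₂ - l₁ := by
  have a1 := one_le_log_of_exp_le h1
  have p1 : 0 < l₁ := (Real.exp_pos 1).trans_le h1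
  have p2 : 0 < l₂ := p1.trans_le h
  have hr1 : 1 ≤ l₂ / l₁ := (one_le_div p1).2 h
  have key : vkExp l₂ ≤ vkExp l₁ * (l₂ / l₁) := by
    have hlog : Real.log l₁ ≤ Real.log l₂ := Real.log_le_log p1 h
    have b1 : 0 < Real.log l₁ := by linarith
    calc vkExp l₂ ≤ l₂ ^ ((3 : ℝ) / 5) / Real.log l₁ ^ ((1 : ℝ) / 5) := by
          unfold vkExp; gcongr
      _ = (l₂ / l₁) ^ ((3 : ℝ) / 5) * vkExp l₁ := by
          unfold vkExp; rw [Real.div_rpow p2.le p1.le]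
          have : 0 < l₁ ^ ((3 : ℝ) / 5) := by positivity
          field_simp
      _ ≤ (l₂ / l₁) ^ (1 : ℝ) * vkExp l₁ := by
          have := vkExp_pos h1
          gcongr
          norm_num
      _ = _ := by rw [Real.rpow_one, mul_comm]
  have h2 := vkExp_le_self h1
  have e : l₂ - l₁ = l₁ * (l₂ / l₁ - 1) := by field_simp
  rw [e]
  have : vkExp l₁ * (l₂ / l₁ - 1) ≤ l₁ * (l₂ / l₁ - 1) :=
    mul_le_mul_of_nonneg_right h2 (by linarith)
  linarith

theorem vkE_pos (l : ℝ) : 0 < vkE l := vkExp_pos (le_max_right _ _)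

theorem vkE_mono {l₁ l₂ : ℝ} (h : l₁ ≤ l₂) : vkE l₁ ≤ vkE l₂ :=
  vkExp_mono (le_max_right _ _) (max_le_max_right _ h)

theorem vkE_sub_le {l₁ l₂ : ℝ} (h : l₁ ≤ l₂) : vkE l₂ - vkE l₁ ≤ l₂ - l₁ := by
  refine (vkExp_sub_le (le_max_right _ _) (max_le_max_right _ h)).trans ?_
  have := max_sub_max_le_max l₂ (Real.exp 1) l₁ (Real.exp 1)
  rw [sub_self, max_eq_left (a := l₂ - l₁) (by linarith)] at this
  exact this

theorem vkE_le {l : ℝ} (hl : 0 ≤ l) : vkE l ≤ l + 3 := by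
  have h1 := vkE_sub_le hl
  have h2 : vkE 0 ≤ Real.exp 1 := by
    unfold vkE; rw [max_eq_right (Real.exp_pos 1).le]; exact vkExp_le_self le_rfl
  have h3 := Real.exp_one_lt_d9
  linarith

theorem zfw_mul_ge {l : ℝ} (h : Real.exp 1 ≤ l) (hL : Big (vkExp l)) :
    vkExp l / 10 ^ 12 ≤ zfw (vkExp l) * l := by
  have a1 := one_le_log_of_exp_le h
  have p1 : 0 < l := (Real.exp_pos 1).trans_le h
  have b1 : 0 < Real.log l := by linarith
  set L := vkExp l with hLdef
  obtain ⟨q1, q2⟩ := hL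
  have hL0 : 0 < L := vkExp_pos h
  have hlL : 0 < Real.log L := by linarith
  have hle : Real.log L ≤ Real.log l := Real.log_le_log hL0 (vkExp_le_self h)
  have e1 : L ^ ((5 : ℝ) / 3) * Real.log l ^ ((1 : ℝ) / 3) = l := by
    rw [hLdef, vkExp, Real.div_rpow (by positivity) (by positivity), ← Real.rpow_mul p1.le,
      ← Real.rpow_mul b1.le]
    norm_num
    field_simp
  have e2 : L * (Real.log L ^ ((1 : ℝ) / 3) * L ^ ((2 : ℝ) / 3)) ≤ l := by
    calc _ = L ^ ((5 : ℝ) / 3) * Real.log L ^ ((1 : ℝ) / 3) := by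
          rw [show (5 : ℝ) / 3 = 1 + 2 / 3 by norm_num, Real.rpow_add hL0, Real.rpow_one]; ring
      _ ≤ L ^ ((5 : ℝ) / 3) * Real.log l ^ ((1 : ℝ) / 3) := by gcongr
      _ = l := e1
  have e3 : Real.log L = Real.log L ^ ((1 : ℝ) / 3) * Real.log L ^ ((2 : ℝ) / 3) := by
    rw [← Real.rpow_add hlL]; norm_num
  have p3 : 0 < Real.log L ^ ((1 : ℝ) / 3) := by positivity
  have p4 : 0 < Real.log L ^ ((2 : ℝ) / 3) := by positivity
  have p5 : 0 < L ^ ((2 : ℝ) / 3) := by positivity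
  have e4 : zfw L = 1 / 10 ^ 12 / (Real.log L ^ ((1 : ℝ) / 3) * L ^ ((2 : ℝ) / 3)) := by
    rw [zfw, theta, Real.div_rpow hlL.le hL0.le]
    nth_rw 2 [e3]
    field_simp
    norm_num
  rw [e4, div_mul_eq_mul_div, le_div_iff₀ (by positivity)]
  calc _ = 1 / 10 ^ 12 * (L * (Real.log L ^ ((1 : ℝ) / 3) * L ^ ((2 : ℝ) / 3))) := by ring
    _ ≤ _ := by gcongr

theorem vkExp_sq_ge {l : ℝ} (h : Real.exp 1 ≤ l) (h2 : Real.log l ^ 2 ≤ l) : l ≤ vkExp l ^ 2 := by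
  have a1 := one_le_log_of_exp_le h
  have p1 : 0 < l := (Real.exp_pos 1).trans_le h
  have b1 : 0 < Real.log l := by linarith
  have e1 : (Real.log l ^ ((1 : ℝ) / 5)) ^ 2 ≤ l ^ ((1 : ℝ) / 5) := by
    calc _ = (Real.log l ^ 2) ^ ((1 : ℝ) / 5) := by
          rw [← Real.rpow_natCast, ← Real.rpow_mul b1.le, ← Real.rpow_natCast, ← Real.rpow_mul b1.le]
          norm_num
      _ ≤ _ := by gcongr
  have e2 : (l ^ ((3 : ℝ) / 5)) ^ 2 = l * l ^ ((1 : ℝ) / 5) := by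
    rw [← Real.rpow_natCast, ← Real.rpow_mul p1.le]
    nth_rw 2 [← Real.rpow_one l]
    rw [← Real.rpow_add p1]; norm_num
  rw [vkExp, div_pow, le_div_iff₀ (by positivity), e2]
  gcongr

lemma eventually_log_sq_le : ∀ᶠ l : ℝ in atTop, Real.log l ^ 2 ≤ l := by
  have := (isLittleO_log_rpow_atTop (show (0 : ℝ) < 1 / 2 by norm_num)).bound (one_pos)
  filter_upwards [this, eventually_ge_atTop 1] with l hl hl1
  rw [Real.norm_of_nonneg (Real.log_nonneg hl1), Real.norm_of_nonneg (by positivity), one_mul] at hl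
  have h0 := Real.log_nonneg hl1
  calc _ ≤ (l ^ ((1 : ℝ) / 2)) ^ 2 := by gcongr
    _ = l := by rw [← Real.rpow_natCast, ← Real.rpow_mul (by linarith)]; norm_num

theorem tendsto_vkExp : Tendsto vkExp atTop atTop := by
  have h1 := eventually_log_sq_le
  have h2 : Tendsto (fun l : ℝ => Real.sqrt l) atTop atTop := Real.tendsto_sqrt_atTop
  refine tendsto_atTop_mono' _ ?_ h2
  filter_upwards [h1, eventually_ge_atTop (Real.exp 1)] with l a b
  exact Real.sqrt_le_iff.2 ⟨(vkExp_pos b).le, vkExp_sq_ge b a⟩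

lemma exists_pow_le_exp (n : ℕ) {a : ℝ} (ha : 0 < a) :
    ∃ C : ℝ, 0 < C ∧ ∀ L : ℝ, 0 ≤ L → L ^ n ≤ C * Real.exp (a * L) := by
  refine ⟨n.factorial / a ^ n, by positivity, fun L hL => ?_⟩
  have := Real.pow_div_factorial_le_exp (a * L) (by positivity) n
  rw [div_le_iff₀ (by positivity), mul_pow] at this
  rw [div_mul_eq_mul_div, le_div_iff₀ (by positivity)]
  linarith

open ArithmeticFunction in
lemma abs_moebius_div_le (n : ℕ) : |(moebius n : ℝ) / n| ≤ 1 / n := by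
  rw [abs_div, Nat.abs_cast]
  have : |(moebius n : ℝ)| ≤ 1 := by exact_mod_cast abs_moebius_le_one
  gcongr

theorem abs_S1_le {x : ℝ} (hx : 0 < x) : |S1 x| ≤ x := by
  unfold S1
  calc _ ≤ ∑ n ∈ Icc 1 ⌊x⌋₊, |(ArithmeticFunction.moebius n : ℝ) / n * (1 - n / x)| :=
        Finset.abs_sum_le_sum_abs _ _
    _ ≤ ∑ n ∈ Icc 1 ⌊x⌋₊, (1 : ℝ) := by
        refine Finset.sum_le_sum fun n hn => ?_
        rw [Finset.mem_Icc] at hn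
        have hnx : (n : ℝ) ≤ x := (Nat.le_floor_iff hx.le).1 hn.2
        have h1 : (1 : ℝ) ≤ n := by exact_mod_cast hn.1
        rw [abs_mul]
        refine mul_le_one₀ ((abs_moebius_div_le n).trans ?_) (abs_nonneg _) ?_
        · rw [div_le_one (by linarith)]; exact h1
        · have : (n : ℝ) / x ≤ 1 := (div_le_one hx).2 hnx
          have : 0 ≤ (n : ℝ) / x := by positivity
          rw [abs_le]; constructor <;> linarith
    _ = (⌊x⌋₊ : ℝ) := by simp
    _ ≤ x := Nat.floor_le hx.le

theorem exists_S1_bound : ∃ c C : ℝ, 0 < c ∧ c ≤ 1 ∧ 0 < C ∧ ∀ x : ℝ, 1 ≤ x →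
    |S1 x| ≤ C * Real.exp (-(c * vkE (Real.log x))) := by
  obtain ⟨K', hK'⟩ := exists_zeta_real_bound
  have hK' : ZC K' := hK'
  obtain ⟨L₀, K, hK, hB⟩ := exists_inv_zeta_bound
  obtain ⟨C₁, hC₁, hP⟩ := exists_pow_le_exp 39 (a := 1 / 10 ^ 13) (by positivity)
  have hev : ∀ᶠ l in atTop, Real.exp 1 ≤ l ∧ Real.log l ^ 2 ≤ l ∧ L₀ ≤ vkExp l := by
    filter_upwards [eventually_ge_atTop (Real.exp 1), eventually_log_sq_le,
      tendsto_vkExp.eventually_ge_atTop L₀] with l h1 h2 h3 using ⟨h1, h2, h3⟩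
  obtain ⟨l₀, hl₀⟩ := eventually_atTop.1 hev
  have hK'0 : 0 < K' := by linarith [hK'.1]
  set C₂ : ℝ := 18 * K' + 216 * K + 12 * K with hC₂
  have hC₂0 : 0 < C₂ := by positivity
  refine ⟨1 / 10 ^ 13, C₂ * C₁ + Real.exp (|l₀| + (|l₀| + 3)), by positivity, by norm_num,
    by positivity, fun x hx => ?_⟩
  have hx0 : 0 < x := by linarith
  have hlx : 0 ≤ Real.log x := Real.log_nonneg hx
  have hxe : x = Real.exp (Real.log x) := (Real.exp_log hx0).symm
  rcases le_or_gt l₀ (Real.log x) with h | h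
  · set l := Real.log x with hl
    obtain ⟨h1, h2, h3⟩ := hl₀ l h
    have hvE : vkE l = vkExp l := by rw [vkE, max_eq_left h1]
    rw [hvE]
    set L := vkExp l with hL
    obtain ⟨hBig, hz⟩ := hB L h3
    obtain ⟨hLp, hL54, _⟩ := hBig.pos
    have hL1 : 1 ≤ L := le_trans (by norm_num) hL54
    have hzb := hBig.zfw_bounds
    have htb := hBig.theta_bounds
    have hlpos : 0 < l := (Real.exp_pos 1).trans_le h1
    have hl1 : 1 ≤ l := one_lt_exp_one.le.trans h1
    have hkey := norm_S1_le (x := x) (c := 1 / l) (η := zfw L / 2) (H := Real.exp L / 3)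
      (M := K * L ^ 39) (K := K') hx (by positivity) ((div_le_one hlpos).2 hl1) (by linarith [hzb.1])
      (by linarith [hzb.2.1, htb.2]) (by positivity) (by positivity) hK' hz
    have hxc : x ^ (1 / l) = Real.exp 1 := by
      rw [Real.rpow_def_of_pos hx0, ← hl, mul_one_div_cancel hlpos.ne']
    have he3 : Real.exp 1 ≤ 3 := by linarith [Real.exp_one_lt_d9]
    have hxη : x ^ (-(zfw L / 2)) ≤ Real.exp (-(L / 10 ^ 12 / 2)) := by
      rw [Real.rpow_def_of_pos hx0, ← hl]
      apply Real.exp_le_exp.2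
      have := zfw_mul_ge h1 hBig
      rw [← hL] at this
      linarith
    have hlL : l ≤ L ^ 39 := (vkExp_sq_ge h1 h2).trans (pow_le_pow_right₀ hL1 (by norm_num))
    have hexpL : Real.exp (-L) ≤ Real.exp (-(L / 10 ^ 12 / 2)) := by
      apply Real.exp_le_exp.2; linarith [show L / 10 ^ 12 / 2 ≤ L by
        rw [div_div]; exact div_le_self hLp.le (by norm_num)]
    set W := Real.exp (-(L / 10 ^ 12 / 2)) with hW
    have hWpos : 0 < W := Real.exp_pos _
    have t1 : 2 * (Real.exp 1 * (K' / (1 / l))) / (Real.exp L / 3) ≤ 18 * K' * L ^ 39 * W := by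
      have : 2 * (Real.exp 1 * (K' / (1 / l))) / (Real.exp L / 3) =
          6 * K' * (Real.exp 1 * l * Real.exp (-L)) := by
        rw [Real.exp_neg]; field_simp; norm_num
      rw [this]
      calc _ ≤ 6 * K' * (3 * L ^ 39 * W) := by gcongr
        _ = _ := by ring
    have t2 : 4 * Real.exp 1 * (K * L ^ 39) / (Real.exp L / 3) ^ 2 ≤ 216 * K * L ^ 39 * W := by
      have : 4 * Real.exp 1 * (K * L ^ 39) / (Real.exp L / 3) ^ 2 =
          36 * K * L ^ 39 * (Real.exp 1 * (Real.exp (-L) * Real.exp (-L))) := by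
        rw [Real.exp_neg]; field_simp; norm_num
      rw [this]
      have h1' : Real.exp (-L) ≤ 1 := Real.exp_le_one_iff.2 (by linarith)
      calc _ ≤ 36 * K * L ^ 39 * (3 * (W * 1)) := by gcongr
        _ ≤ _ := by
          have : 0 ≤ K * L ^ 39 * W := by positivity
          linarith
    have t3 : 3 * Real.pi * (K * L ^ 39) * x ^ (-(zfw L / 2)) ≤ 12 * K * L ^ 39 * W := by
      calc _ ≤ 3 * 4 * (K * L ^ 39) * W := by
            gcongr
            exact Real.pi_le_four
        _ = _ := by ring
    rw [hxc] at hkey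
    have hW2 : Real.exp (1 / 10 ^ 13 * L) * W ≤ Real.exp (-(1 / 10 ^ 13 * L)) := by
      rw [hW, ← Real.exp_add]
      apply Real.exp_le_exp.2
      have : L / 10 ^ 12 / 2 = 5 * (1 / 10 ^ 13 * L) := by ring
      rw [this]
      have : 0 < 1 / 10 ^ 13 * L := by positivity
      linarith
    calc |S1 x| ≤ C₂ * (L ^ 39 * W) := by rw [hC₂]; linarith
      _ ≤ C₂ * (C₁ * Real.exp (1 / 10 ^ 13 * L) * W) := by
          have := hP L hLp.le
          gcongr
      _ = C₂ * C₁ * (Real.exp (1 / 10 ^ 13 * L) * W) := by ring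
      _ ≤ C₂ * C₁ * Real.exp (-(1 / 10 ^ 13 * L)) := by gcongr
      _ ≤ _ := by
          gcongr
          linarith [Real.exp_pos (|l₀| + (|l₀| + 3))]
  · have h1 : |S1 x| ≤ Real.exp |l₀| := (abs_S1_le hx0).trans (by
      rw [hxe]; exact Real.exp_le_exp.2 (h.le.trans (le_abs_self _)))
    have h2 : vkE (Real.log x) ≤ |l₀| + 3 := (vkE_le hlx).trans (by linarith [le_abs_self l₀])
    have h3 := vkE_pos (Real.log x)
    calc |S1 x| ≤ Real.exp (|l₀| + (|l₀| + 3)) * Real.exp (-(1 / 10 ^ 13 * vkE (Real.log x))) := by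
          rw [← Real.exp_add]
          refine h1.trans (Real.exp_le_exp.2 ?_)
          linarith
      _ ≤ _ := by
        gcongr
        have : 0 < C₂ * C₁ := by positivity
        linarith

open ArithmeticFunction in
/-- Partial sums of `μ(n)/n`. -/
noncomputable def M1 (x : ℝ) : ℝ := ∑ n ∈ Icc 1 ⌊x⌋₊, (moebius n : ℝ) / n

open ArithmeticFunction in
theorem S1_diff {x h : ℝ} (hx : 0 < x) (hh : 0 < h) :
    |h * M1 x| ≤ |(x + h) * S1 (x + h)| + |x * S1 x| + (h + 1) * (h / x) := by
  have hS : ∀ z : ℝ, 0 < z → z * S1 z = ∑ n ∈ Icc 1 ⌊z⌋₊, (moebius n : ℝ) / n * (z - n) := by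
    intro z hz
    rw [S1, Finset.mul_sum]
    refine Finset.sum_congr rfl fun n _ => ?_
    field_simp
  have hfl : ⌊x⌋₊ ≤ ⌊x + h⌋₊ := Nat.floor_mono (by linarith)
  have hsplit : ∀ f : ℕ → ℝ, ∑ n ∈ Icc 1 ⌊x + h⌋₊, f n =
      ∑ n ∈ Icc 1 ⌊x⌋₊, f n + ∑ n ∈ Ioc ⌊x⌋₊ ⌊x + h⌋₊, f n := by
    intro f
    rw [← Finset.sum_union]
    · congr 1; ext n; simp only [Finset.mem_Icc, Finset.mem_union, Finset.mem_Ioc]; omega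
    · rw [Finset.disjoint_left]; intro n; simp only [Finset.mem_Icc, Finset.mem_Ioc]; omega
  have e : (x + h) * S1 (x + h) = x * S1 x + h * M1 x +
      ∑ n ∈ Ioc ⌊x⌋₊ ⌊x + h⌋₊, (moebius n : ℝ) / n * (x + h - n) := by
    rw [hS _ (by linarith), hS _ hx, hsplit, M1, Finset.mul_sum, ← Finset.sum_add_distrib]
    congr 1
    exact Finset.sum_congr rfl fun n _ => by ring
  have hb : |∑ n ∈ Ioc ⌊x⌋₊ ⌊x + h⌋₊, (moebius n : ℝ) / n * (x + h - n)| ≤ (h + 1) * (h / x) := by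
    calc _ ≤ ∑ n ∈ Ioc ⌊x⌋₊ ⌊x + h⌋₊, |(moebius n : ℝ) / n * (x + h - n)| :=
          Finset.abs_sum_le_sum_abs _ _
      _ ≤ ∑ n ∈ Ioc ⌊x⌋₊ ⌊x + h⌋₊, h / x := by
          refine Finset.sum_le_sum fun n hn => ?_
          rw [Finset.mem_Ioc] at hn
          have h1 : x < n := (Nat.floor_lt hx.le).1 hn.1
          have h2 : (n : ℝ) ≤ x + h := (Nat.le_floor_iff (by linarith)).1 hn.2
          rw [abs_mul, div_eq_mul_one_div h x, mul_comm]
          refine mul_le_mul ?_ ((abs_moebius_div_le n).trans ?_) (abs_nonneg _) hh.le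
          · rw [abs_of_nonneg (by linarith)]; linarith
          · gcongr
      _ = ((⌊x + h⌋₊ - ⌊x⌋₊ : ℕ) : ℝ) * (h / x) := by simp
      _ ≤ _ := by
          gcongr
          rw [Nat.cast_sub hfl]
          have := Nat.floor_le (show 0 ≤ x + h by linarith)
          have := Nat.lt_floor_add_one x
          linarith
  have : h * M1 x = (x + h) * S1 (x + h) - x * S1 x -
      ∑ n ∈ Ioc ⌊x⌋₊ ⌊x + h⌋₊, (moebius n : ℝ) / n * (x + h - n) := by rw [e]; ring
  rw [this]
  refine (abs_sub _ _).trans (add_le_add (abs_sub _ _) hb)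

theorem exists_M1_bound : ∃ c C : ℝ, 0 < c ∧ c ≤ 1 ∧ 0 < C ∧ ∀ x : ℝ, 1 ≤ x →
    |M1 x| ≤ C * Real.exp (-(c * vkE (Real.log x))) := by
  obtain ⟨c, C, hc, hc1, hC, hS⟩ := exists_S1_bound
  refine ⟨c / 2, 3 * C + 1 + Real.exp 3, by positivity, by linarith, by positivity, fun x hx => ?_⟩
  have hx0 : 0 < x := by linarith
  have hlx : 0 ≤ Real.log x := Real.log_nonneg hx
  set E := vkE (Real.log x) with hE
  have hE0 : 0 < E := vkE_pos _
  set ε := Real.exp (-(c / 2 * E)) with hε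
  have hε0 : 0 < ε := Real.exp_pos _
  have hε1 : ε ≤ 1 := Real.exp_le_one_iff.2 (by have : 0 < c / 2 * E := by positivity
                                                linarith)
  have hεε : Real.exp (-(c * E)) = ε * ε := by rw [hε, ← Real.exp_add]; congr 1; ring
  have hd := S1_diff hx0 (show 0 < x * ε by positivity)
  have h1 : |x * S1 x| ≤ x * (C * (ε * ε)) := by
    rw [abs_mul, abs_of_pos hx0, ← hεε]; gcongr; exact hS x hx
  have h2 : |(x + x * ε) * S1 (x + x * ε)| ≤ 2 * x * (C * (ε * ε)) := by
    rw [abs_mul, abs_of_pos (by positivity), ← hεε]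
    have a : x + x * ε ≤ 2 * x := by nlinarith
    have b := hS (x + x * ε) (by nlinarith)
    have c' : E ≤ vkE (Real.log (x + x * ε)) :=
      vkE_mono (Real.log_le_log hx0 (by nlinarith))
    gcongr
    refine b.trans ?_
    gcongr
  have h3 : 1 / x ≤ Real.exp 3 * ε := by
    rw [hε, ← Real.exp_add, ← Real.exp_log hx0, one_div, ← Real.exp_neg]
    apply Real.exp_le_exp.2
    have := vkE_le hlx
    rw [← hE] at this
    nlinarith
  rw [abs_mul, abs_of_pos (by positivity : 0 < x * ε)] at hd
  have h4 : (x * ε + 1) * (x * ε / x) = x * ε * (ε + 1 / x) := by field_simp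
  rw [h4] at hd
  have h5 : x * ε * |M1 x| ≤ x * ε * (3 * C * ε + ε + 1 / x) := by
    linarith [show 2 * x * (C * (ε * ε)) + x * (C * (ε * ε)) + x * ε * (ε + 1 / x) =
      x * ε * (3 * C * ε + ε + 1 / x) by ring]
  have h6 := le_of_mul_le_mul_left h5 (by positivity)
  linarith

theorem sum_le_prod_primesBelow {f F : ℕ → ℝ} (h0 : ∀ n, 0 ≤ f n) (h1 : f 1 = 1)
    (hmul : ∀ {m n : ℕ}, Nat.Coprime m n → f (m * n) = f m * f n)
    (hs : ∀ {p : ℕ}, p.Prime → Summable fun k => f (p ^ k))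
    (hF : ∀ {p : ℕ}, p.Prime → ∑' k, f (p ^ k) ≤ F p) (N : ℕ) :
    ∑ n ∈ Icc 1 N, f n ≤ ∏ p ∈ (N + 1).primesBelow, F p := by
  have h := EulerProduct.summable_and_hasSum_smoothNumbers_prod_primesBelow_tsum h1 hmul
    (fun {p} hp => by simpa [Real.norm_of_nonneg (h0 _)] using hs hp) (N + 1)
  have hsum : Summable fun n => ((N + 1).smoothNumbers.indicator f) n :=
    summable_subtype_iff_indicator.1 h.2.summable
  have h2 : ∑ n ∈ Icc 1 N, f n ≤ ∑' n, ((N + 1).smoothNumbers.indicator f) n := by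
    refine le_trans (le_of_eq ?_) (hsum.sum_le_tsum (Icc 1 N) fun n _ =>
      Set.indicator_nonneg (fun n _ => h0 n) n)
    refine Finset.sum_congr rfl fun n hn => ?_
    rw [Finset.mem_Icc] at hn
    rw [Set.indicator_of_mem]
    exact Nat.mem_smoothNumbers_of_lt hn.1 (by omega)
  rw [← _root_.tsum_subtype, h.2.tsum_eq] at h2
  refine h2.trans (Finset.prod_le_prod (fun p _ => tsum_nonneg fun k => h0 _) fun p hp =>
    hF (Nat.prime_of_mem_primesBelow hp))

theorem prod_ite_mem_le {P S : Finset ℕ} {α : ℕ → ℝ} (h : ∀ p ∈ S, 1 ≤ α p) :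
    ∏ p ∈ P, (if p ∈ S then α p else 1) ≤ ∏ p ∈ S, α p := by
  rw [Finset.prod_ite_mem, Finset.inter_comm, ← Finset.prod_ite_mem]
  refine Finset.prod_le_prod (fun p hp => ?_) fun p hp => ?_
  · split_ifs
    · linarith [h p hp]
    · exact zero_le_one
  · split_ifs
    · exact le_rfl
    · exact h p hp

theorem exists_euler_const : ∃ K : ℝ, 1 ≤ K ∧ ∀ P : Finset ℕ,
    ∏ p ∈ P, (1 + 15 * (p : ℝ) ^ (-(3 / 2) : ℝ)) ≤ K := by
  have hs : Summable fun n : ℕ => 15 * (n : ℝ) ^ (-(3 / 2) : ℝ) :=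
    (Real.summable_nat_rpow.2 (by norm_num)).mul_left _
  refine ⟨Real.exp (∑' n : ℕ, 15 * (n : ℝ) ^ (-(3 / 2) : ℝ)), ?_, fun P => ?_⟩
  · exact Real.one_le_exp (tsum_nonneg fun n => by positivity)
  · calc _ ≤ ∏ p ∈ P, Real.exp (15 * (p : ℝ) ^ (-(3 / 2) : ℝ)) :=
          Finset.prod_le_prod (fun p _ => by positivity) fun p _ => by
            rw [add_comm]; exact Real.add_one_le_exp _
      _ = Real.exp (∑ p ∈ P, 15 * (p : ℝ) ^ (-(3 / 2) : ℝ)) := (Real.exp_sum _ _).symm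
      _ ≤ _ := Real.exp_le_exp.2 (hs.sum_le_tsum _ fun n _ => by positivity)

/-- Bounded products over the primes dividing `m` whose factors are eventually below one. -/
theorem exists_prod_primeFactors_le {C θ : ℝ} (hC : 1 ≤ C) (hθ : 0 < θ) :
    ∃ K : ℝ, 1 ≤ K ∧ ∀ m : ℕ, ∏ p ∈ m.primeFactors, (C * (p : ℝ) ^ (-θ)) ≤ K := by
  have hev : ∀ᶠ n : ℕ in atTop, C * (n : ℝ) ^ (-θ) ≤ 1 := by
    have := ((tendsto_rpow_neg_atTop hθ).comp tendsto_natCast_atTop_atTop).const_mul C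
    rw [mul_zero] at this
    filter_upwards [this.eventually_le_const zero_lt_one] with n hn using hn
  obtain ⟨N, hN⟩ := eventually_atTop.1 hev
  refine ⟨C ^ N, one_le_pow₀ hC, fun m => ?_⟩
  calc _ ≤ ∏ p ∈ m.primeFactors, (if p ∈ Finset.range N then C else 1) := by
        refine Finset.prod_le_prod (fun p _ => by positivity) fun p hp => ?_
        have hp1 : (1 : ℝ) ≤ p := by exact_mod_cast (Nat.prime_of_mem_primeFactors hp).one_lt.le
        split_ifs with h
        · exact mul_le_of_le_one_right (by linarith)
            (Real.rpow_le_one_of_one_le_of_nonpos hp1 (by linarith))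
        · exact hN p (by simpa using h)
    _ ≤ ∏ p ∈ Finset.range N, C := prod_ite_mem_le fun p _ => hC
    _ = C ^ N := by simp

/-- Local factor from a geometric majorant. -/
theorem tsum_local_le {w : ℕ → ℝ} {p : ℕ} (hp : p.Prime) {B : ℝ} (hB : 0 ≤ B) (h0 : ∀ k, 0 ≤ w k)
    (h1 : w 0 = 1) (hw : ∀ k, w (k + 1) ≤ B * ((p : ℝ) ^ (-(7 / 8) : ℝ)) ^ (k + 1)) :
    Summable w ∧ ∑' k, w k ≤ 1 + 3 * B * (p : ℝ) ^ (-(7 / 8) : ℝ) := by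
  set q := (p : ℝ) ^ (-(7 / 8) : ℝ) with hq
  have hp2 : (2 : ℝ) ≤ p := by exact_mod_cast hp.two_le
  have hq0 : 0 < q := by positivity
  have hq1 : q ≤ 2 / 3 := by
    calc q ≤ (2 : ℝ) ^ (-(7 / 8) : ℝ) := Real.rpow_le_rpow_of_nonpos (by norm_num) hp2 (by norm_num)
      _ ≤ 2 / 3 := by
        rw [Real.rpow_neg (by norm_num), show (2 : ℝ) / 3 = (3 / 2)⁻¹ by norm_num]
        apply inv_anti₀ (by norm_num)
        have : (3 / 2 : ℝ) = ((3 / 2 : ℝ) ^ (8 : ℕ)) ^ ((1 : ℝ) / 8) := by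
          rw [← Real.rpow_natCast, ← Real.rpow_mul (by norm_num)]; norm_num
        rw [this, show (2 : ℝ) ^ (7 / 8 : ℝ) = ((2 : ℝ) ^ (7 : ℕ)) ^ ((1 : ℝ) / 8) by
          rw [← Real.rpow_natCast, ← Real.rpow_mul (by norm_num)]; norm_num]
        gcongr
        norm_num
  have hg : Summable fun k : ℕ => B * q ^ (k + 1) := by
    simp_rw [pow_succ]
    exact ((summable_geometric_of_lt_one hq0.le (by linarith)).mul_right q).mul_left B
  have hs1 : Summable fun k => w (k + 1) := Summable.of_nonneg_of_le (fun k => h0 _) hw hg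
  have hs : Summable w := (summable_nat_add_iff 1).1 hs1
  refine ⟨hs, ?_⟩
  rw [hs.tsum_eq_zero_add, h1]
  have h2 : ∑' k, w (k + 1) ≤ ∑' k : ℕ, B * q ^ (k + 1) := hs1.tsum_le_tsum hw hg
  have h3 : ∑' k : ℕ, B * q ^ (k + 1) = B * ((1 - q)⁻¹ * q) := by
    simp_rw [pow_succ]
    rw [tsum_mul_left, tsum_mul_right, tsum_geometric_of_lt_one hq0.le (by linarith)]
  have h4 : (1 - q)⁻¹ ≤ 3 := by
    rw [inv_le_comm₀ (by linarith) (by norm_num)]; linarith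
  have h5 : B * ((1 - q)⁻¹ * q) ≤ B * (3 * q) := by gcongr
  linarith

theorem psiM_mul_of_coprime (m : ℕ) {a b : ℕ} (h : Nat.Coprime a b) :
    psiM m (a * b) = psiM m a * psiM m b := by
  rw [psiM, psiM, psiM, h.primeFactors_mul, Finset.filter_union, Finset.prod_union]
  exact Finset.disjoint_filter_filter h.disjoint_primeFactors

theorem psiM_pos (m n : ℕ) : 0 < psiM m n := Finset.prod_pos fun p _ => Nat.succ_pos p

open ArithmeticFunction in
/-- `μ(e)/ψ_m(e)` restricted to `e` coprime to `δ`. -/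
noncomputable def cofun (δ m : ℕ) : ArithmeticFunction ℝ where
  toFun n := if n ≠ 0 ∧ Nat.Coprime n δ then (moebius n : ℝ) / psiM m n else 0
  map_zero' := by simp

open ArithmeticFunction in
theorem cofun_apply (δ m n : ℕ) :
    cofun δ m n = if n ≠ 0 ∧ Nat.Coprime n δ then (moebius n : ℝ) / psiM m n else 0 := rfl

open ArithmeticFunction in
theorem cofun_mult (δ m : ℕ) : (cofun δ m).IsMultiplicative := by
  rw [IsMultiplicative.iff_ne_zero]
  refine ⟨by simp [cofun_apply, psiM], fun {a b} ha hb hab => ?_⟩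
  simp only [cofun_apply, ne_eq, ha, hb, mul_eq_zero, or_self, not_false_eq_true, true_and,
    Nat.coprime_mul_iff_left]
  by_cases h1 : Nat.Coprime a δ <;> by_cases h2 : Nat.Coprime b δ <;> simp [h1, h2]
  rw [isMultiplicative_moebius.map_mul_of_coprime hab, psiM_mul_of_coprime m hab]
  push_cast
  rw [mul_div_mul_comm]
  rw [if_pos ⟨h1, h2⟩, if_pos h2, if_pos h1]

/-- The function `1/n`. -/
noncomputable def invfun : ArithmeticFunction ℝ where
  toFun n := 1 / (n : ℝ)
  map_zero' := by simp

theorem invfun_apply (n : ℕ) : invfun n = 1 / (n : ℝ) := rfl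

open ArithmeticFunction in
theorem invfun_mult : invfun.IsMultiplicative := by
  rw [IsMultiplicative.iff_ne_zero]
  refine ⟨by simp [invfun_apply], fun {a b} _ _ _ => ?_⟩
  simp only [invfun_apply]; push_cast; rw [one_div_mul_one_div]

open ArithmeticFunction in
/-- The function `μ(n)/n`. -/
noncomputable def muinv : ArithmeticFunction ℝ where
  toFun n := (moebius n : ℝ) / (n : ℝ)
  map_zero' := by simp

open ArithmeticFunction in
theorem muinv_apply (n : ℕ) : muinv n = (moebius n : ℝ) / (n : ℝ) := rfl

open ArithmeticFunction in
theorem muinv_mult : muinv.IsMultiplicative := by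
  rw [IsMultiplicative.iff_ne_zero]
  refine ⟨by simp [muinv_apply], fun {a b} _ _ hab => ?_⟩
  simp only [muinv_apply]
  rw [isMultiplicative_moebius.map_mul_of_coprime hab]
  push_cast; rw [mul_div_mul_comm]

theorem mul_apply_prime_pow (f g : ArithmeticFunction ℝ) {p : ℕ} (hp : p.Prime) (k : ℕ) :
    (f * g) (p ^ k) = ∑ i ∈ Finset.range (k + 1), f (p ^ i) * g (p ^ (k - i)) := by
  rw [ArithmeticFunction.mul_apply, Nat.sum_divisorsAntidiagonal (fun a b => f a * g b),
    Nat.sum_divisors_prime_pow hp]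
  refine Finset.sum_congr rfl fun i hi => ?_
  rw [Finset.mem_range] at hi
  rw [Nat.pow_div (by omega) hp.pos]

open ArithmeticFunction in
theorem invfun_mul_muinv : invfun * muinv = 1 := by
  ext n
  rw [mul_apply]
  have : ∀ x ∈ n.divisorsAntidiagonal, invfun x.1 * muinv x.2 =
      1 / (n : ℝ) * ((ArithmeticFunction.zeta x.1 : ℤ) * moebius x.2 : ℤ) := by
    intro x hx
    rw [Nat.mem_divisorsAntidiagonal] at hx
    have h1 : x.1 ≠ 0 := left_ne_zero_of_mul (hx.1 ▸ hx.2)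
    have h2 : x.2 ≠ 0 := right_ne_zero_of_mul (hx.1 ▸ hx.2)
    rw [invfun_apply, muinv_apply, ← hx.1, ArithmeticFunction.zeta_apply, if_neg h1]
    push_cast
    have : (x.1 : ℝ) ≠ 0 := by exact_mod_cast h1
    have : (x.2 : ℝ) ≠ 0 := by exact_mod_cast h2
    field_simp
  rw [Finset.sum_congr rfl this, ← Finset.mul_sum, ← Int.cast_sum]
  have h := congrArg (fun f : ArithmeticFunction ℤ => f n) (coe_zeta_mul_moebius)
  simp only [mul_apply, natCoe_apply] at h
  rw [h]
  by_cases hn : n = 1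
  · simp [hn]
  · simp [one_apply_ne hn]

/-- The cofactor of `cofun` with respect to `μ(n)/n`. -/
noncomputable def gfun (δ m : ℕ) : ArithmeticFunction ℝ := cofun δ m * invfun

theorem gfun_mul_muinv (δ m : ℕ) : gfun δ m * muinv = cofun δ m := by
  rw [gfun, mul_assoc, invfun_mul_muinv, mul_one]

open ArithmeticFunction in
theorem gfun_prime_pow (δ m : ℕ) {p : ℕ} (hp : p.Prime) (k : ℕ) :
    gfun δ m (p ^ (k + 1)) = (1 + cofun δ m p * p) / (p : ℝ) ^ (k + 1) := by
  rw [gfun, mul_apply_prime_pow _ _ hp, Finset.sum_range_succ', Finset.sum_range_succ']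
  have h0 : ∑ i ∈ Finset.range k, cofun δ m (p ^ (i + 1 + 1)) * invfun (p ^ (k + 1 - (i + 1 + 1))) = 0 := by
    refine Finset.sum_eq_zero fun i _ => ?_
    rw [cofun_apply, moebius_apply_prime_pow hp (by omega)]
    simp
  have hp0 : (p : ℝ) ≠ 0 := by exact_mod_cast hp.ne_zero
  rw [h0]
  simp only [invfun_apply, pow_zero, (cofun_mult δ m).map_one]
  push_cast
  norm_num
  rw [pow_succ]
  field_simp
  ring

open ArithmeticFunction in
theorem cofun_prime (δ m : ℕ) {p : ℕ} (hp : p.Prime) :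
    cofun δ m p = if p ∣ δ then 0 else if p ∣ m then -1 else -(1 / ((p : ℝ) + 1)) := by
  rw [cofun_apply, moebius_apply_prime hp]
  simp only [hp.coprime_iff_not_dvd]
  by_cases h : p ∣ δ
  · simp [h]
  · simp only [h, ne_eq, hp.ne_zero, not_false_eq_true, and_self, if_true, if_false]
    rw [psiM, hp.primeFactors, Finset.filter_singleton]
    by_cases hm : p ∣ m <;> simp [hm]
    rw [div_eq_mul_inv]; ring

/-- Local weight of `gfun`. -/
theorem gfun_local (δ m : ℕ) {p : ℕ} (hp : p.Prime) :
    |1 + cofun δ m p * p| ≤ if p ∣ δ then 1 else if p ∣ m then (p : ℝ) else 1 / p := by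
  have hp2 : (2 : ℝ) ≤ p := by exact_mod_cast hp.two_le
  rw [cofun_prime δ m hp]
  split_ifs
  · simp
  · rw [abs_le]; constructor <;> linarith
  · have : 1 + -(1 / ((p : ℝ) + 1)) * p = 1 / (p + 1) := by field_simp; ring
    rw [this, abs_of_pos (by positivity)]
    gcongr; linarith

/-- The factor at primes dividing `δ`. -/
noncomputable def Rfac (δ : ℕ) : ℝ := ∏ p ∈ δ.primeFactors, (1 + 3 * (p : ℝ) ^ (-(1 / 2) : ℝ))

/-- The factor at primes dividing `m`. -/
noncomputable def Qfac (m : ℕ) : ℝ := ∏ p ∈ m.primeFactors, (4 * (p : ℝ) ^ (1 / 8 : ℝ))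

open ArithmeticFunction in
theorem exists_gfun_sum : ∃ K : ℝ, 1 ≤ K ∧ ∀ δ m N : ℕ, δ ≠ 0 → m ≠ 0 →
    ∑ n ∈ Icc 1 N, |gfun δ m n| * (n : ℝ) ^ (1 / 8 : ℝ) ≤ K * Qfac m * Rfac δ := by
  obtain ⟨K, hK1, hK⟩ := exists_euler_const
  refine ⟨K, hK1, fun δ m N hδ hm => ?_⟩
  have hgm : (gfun δ m).IsMultiplicative := (cofun_mult δ m).mul invfun_mult
  set F : ℕ → ℝ := fun p => (if p ∈ m.primeFactors then 4 * (p : ℝ) ^ (1 / 8 : ℝ) else 1) *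
    (if p ∈ δ.primeFactors then 1 + 3 * (p : ℝ) ^ (-(1 / 2) : ℝ) else 1) *
    (1 + 15 * (p : ℝ) ^ (-(3 / 2) : ℝ)) with hF
  have hQ : ∀ p ∈ m.primeFactors, 1 ≤ 4 * (p : ℝ) ^ (1 / 8 : ℝ) := fun p hp => by
    have hp1 : (1 : ℝ) ≤ p := by exact_mod_cast (Nat.prime_of_mem_primeFactors hp).one_lt.le
    linarith [Real.one_le_rpow hp1 (show (0 : ℝ) ≤ 1 / 8 by norm_num)]
  have hR : ∀ p ∈ δ.primeFactors, 1 ≤ 1 + 3 * (p : ℝ) ^ (-(1 / 2) : ℝ) := fun p hp => by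
    have : 0 ≤ (p : ℝ) ^ (-(1 / 2) : ℝ) := by positivity
    linarith
  have hloc : ∀ {p : ℕ}, p.Prime →
      (Summable fun k : ℕ => |gfun δ m (p ^ k)| * ((p ^ k : ℕ) : ℝ) ^ (1 / 8 : ℝ)) ∧
      ∑' k : ℕ, |gfun δ m (p ^ k)| * ((p ^ k : ℕ) : ℝ) ^ (1 / 8 : ℝ) ≤ F p := by
    intro p hp
    have hp2 : (2 : ℝ) ≤ p := by exact_mod_cast hp.two_le
    have hp0 : (0 : ℝ) < p := by linarith
    set B : ℝ := if p ∣ δ then 1 else if p ∣ m then (p : ℝ) else 1 / p with hB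
    have hB0 : 0 ≤ B := by rw [hB]; split_ifs <;> positivity
    have h := tsum_local_le (w := fun k : ℕ => |gfun δ m (p ^ k)| * ((p ^ k : ℕ) : ℝ) ^ (1 / 8 : ℝ))
      hp hB0 (fun k => by positivity) (by simp [hgm.map_one]) (fun k => by
        rw [gfun_prime_pow δ m hp, abs_div, abs_of_pos (by positivity : (0 : ℝ) < (p : ℝ) ^ (k + 1))]
        have e : ((p : ℝ) ^ (-(7 / 8) : ℝ)) ^ (k + 1) =
            ((p : ℝ) ^ (k + 1))⁻¹ * ((p ^ (k + 1) : ℕ) : ℝ) ^ (1 / 8 : ℝ) := by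
          rw [← Real.rpow_natCast, ← Real.rpow_mul hp0.le]
          push_cast
          rw [← Real.rpow_natCast, ← Real.rpow_neg hp0.le, ← Real.rpow_mul hp0.le,
            ← Real.rpow_add hp0]
          congr 1; push_cast; ring
        rw [e, div_eq_mul_inv, mul_assoc]
        gcongr
        exact gfun_local δ m hp)
    refine ⟨h.1, h.2.trans ?_⟩
    have hz : 1 ≤ 1 + 15 * (p : ℝ) ^ (-(3 / 2) : ℝ) := by
      have : 0 ≤ (p : ℝ) ^ (-(3 / 2) : ℝ) := by positivity
      linarith
    simp only [hF, Nat.mem_primeFactors, hp, true_and, ne_eq, hδ, hm, not_false_eq_true, and_true]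
    have hpe : (1 : ℝ) ≤ (p : ℝ) ^ (1 / 8 : ℝ) := Real.one_le_rpow (by linarith) (by norm_num)
    by_cases h1 : p ∣ δ
    · simp only [hB, h1, if_true]
      have a1 : (p : ℝ) ^ (-(7 / 8) : ℝ) ≤ (p : ℝ) ^ (-(1 / 2) : ℝ) :=
        Real.rpow_le_rpow_of_exponent_le (by linarith) (by norm_num)
      have a2 : 1 + 3 * 1 * (p : ℝ) ^ (-(7 / 8) : ℝ) ≤ 1 * (1 + 3 * (p : ℝ) ^ (-(1 / 2) : ℝ)) * 1 := by
        linarith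
      refine a2.trans ?_
      gcongr
      split_ifs <;> linarith
    · by_cases h2 : p ∣ m
      · simp only [hB, h1, h2, if_true, if_false]
        have a1 : (p : ℝ) * (p : ℝ) ^ (-(7 / 8) : ℝ) = (p : ℝ) ^ (1 / 8 : ℝ) := by
          nth_rw 1 [← Real.rpow_one (p : ℝ)]
          rw [← Real.rpow_add hp0]; norm_num
        have a2 : 1 + 3 * p * (p : ℝ) ^ (-(7 / 8) : ℝ) ≤ 4 * (p : ℝ) ^ (1 / 8 : ℝ) * 1 * 1 := by
          rw [mul_assoc, a1]; linarith
        refine a2.trans ?_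
        gcongr
      · simp only [hB, h1, h2, if_false, one_mul]
        have a1 : 1 / (p : ℝ) * (p : ℝ) ^ (-(7 / 8) : ℝ) ≤ (p : ℝ) ^ (-(3 / 2) : ℝ) := by
          rw [one_div, ← Real.rpow_neg_one, ← Real.rpow_add hp0]
          exact Real.rpow_le_rpow_of_exponent_le (by linarith) (by norm_num)
        have : 0 ≤ (p : ℝ) ^ (-(3 / 2) : ℝ) := by positivity
        linarith
  have h := sum_le_prod_primesBelow (f := fun n : ℕ => |gfun δ m n| * (n : ℝ) ^ (1 / 8 : ℝ)) (F := F)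
    (fun n => by positivity) (by simp [hgm.map_one])
    (fun {a b} hab => by
      rw [hgm.map_mul_of_coprime hab, abs_mul]
      push_cast
      rw [Real.mul_rpow (by positivity) (by positivity)]; ring)
    (fun {p} hp => (hloc hp).1) (fun {p} hp => (hloc hp).2) N
  refine h.trans ?_
  simp only [hF]
  rw [Finset.prod_mul_distrib, Finset.prod_mul_distrib]
  have b1 := prod_ite_mem_le (P := (N + 1).primesBelow) hQ
  have b2 := prod_ite_mem_le (P := (N + 1).primesBelow) hR
  have b3 := hK (N + 1).primesBelow
  rw [Qfac, Rfac]
  have n2 : 0 ≤ ∏ p ∈ (N + 1).primesBelow,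
      (if p ∈ δ.primeFactors then 1 + 3 * (p : ℝ) ^ (-(1 / 2) : ℝ) else 1) :=
    Finset.prod_nonneg fun p _ => by split_ifs <;> positivity
  have n1 : 0 ≤ ∏ p ∈ (N + 1).primesBelow,
      (if p ∈ m.primeFactors then 4 * (p : ℝ) ^ (1 / 8 : ℝ) else 1) :=
    Finset.prod_nonneg fun p _ => by split_ifs <;> positivity
  have n3 : 0 ≤ ∏ p ∈ (N + 1).primesBelow, (1 + 15 * (p : ℝ) ^ (-(3 / 2) : ℝ)) :=
    Finset.prod_nonneg fun p _ => by positivity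
  have q1 : 0 ≤ ∏ p ∈ m.primeFactors, (4 * (p : ℝ) ^ (1 / 8 : ℝ)) :=
    Finset.prod_nonneg fun p _ => by positivity
  have q2 : 0 ≤ ∏ p ∈ δ.primeFactors, (1 + 3 * (p : ℝ) ^ (-(1 / 2) : ℝ)) :=
    Finset.prod_nonneg fun p _ => by positivity
  exact (mul_le_mul (mul_le_mul b1 b2 n2 q1) b3 n3 (mul_nonneg q1 q2)).trans (le_of_eq (by ring))

/-- `∑_{e ≤ u, (e, δ) = 1} μ(e)/ψ_m(e)`. -/
noncomputable def Asum (δ m : ℕ) (u : ℝ) : ℝ := ∑ e ∈ Icc 1 ⌊u⌋₊, cofun δ m e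

theorem Asum_eq (δ m : ℕ) (u : ℝ) :
    Asum δ m u = ∑ k ∈ Icc 1 ⌊u⌋₊, gfun δ m k * M1 (u / k) := by
  have h := ArithmeticFunction.sum_Ioc_mul_eq_sum_sum (gfun δ m) muinv ⌊u⌋₊
  rw [gfun_mul_muinv] at h
  have e : ∀ N : ℕ, Finset.Ioc 0 N = Finset.Icc 1 N := fun N => rfl
  rw [Asum, ← e, h]
  refine Finset.sum_congr rfl fun k _ => ?_
  rw [M1, Nat.floor_div_natCast, e]
  rfl

theorem exists_Asum_bound : ∃ c C : ℝ, 0 < c ∧ c ≤ 1 / 8 ∧ 0 < C ∧ ∀ δ m : ℕ, δ ≠ 0 → m ≠ 0 →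
    ∀ u : ℝ, 1 ≤ u → |Asum δ m u| ≤ C * Qfac m * Rfac δ * Real.exp (-(c * vkE (Real.log u))) := by
  obtain ⟨c₀, C, hc, hc1, hC, hM⟩ := exists_M1_bound
  obtain ⟨K, hK1, hK⟩ := exists_gfun_sum
  set c := min c₀ (1 / 8) with hcdef
  have hc0 : 0 < c := lt_min hc (by norm_num)
  refine ⟨c, C * K, hc0, min_le_right _ _, by positivity, fun δ m hδ hm u hu => ?_⟩
  rw [Asum_eq]
  have hu0 : 0 < u := by linarith
  have hterm : ∀ k ∈ Icc 1 ⌊u⌋₊, |gfun δ m k * M1 (u / k)| ≤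
      |gfun δ m k| * (k : ℝ) ^ (1 / 8 : ℝ) * (C * Real.exp (-(c * vkE (Real.log u)))) := by
    intro k hk
    rw [Finset.mem_Icc] at hk
    have hk1 : (1 : ℝ) ≤ k := by exact_mod_cast hk.1
    have hku : (k : ℝ) ≤ u := (Nat.le_floor_iff hu0.le).1 hk.2
    have h1 := hM (u / k) ((one_le_div (by linarith)).2 hku)
    have hlk : 0 ≤ Real.log k := Real.log_nonneg hk1
    have h2 : vkE (Real.log u) - vkE (Real.log (u / k)) ≤ Real.log k := by
      rw [Real.log_div hu0.ne' (by linarith)]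
      have := vkE_sub_le (show Real.log u - Real.log k ≤ Real.log u by linarith)
      linarith
    have h3 : Real.exp (-(c₀ * vkE (Real.log (u / k)))) ≤
        (k : ℝ) ^ (1 / 8 : ℝ) * Real.exp (-(c * vkE (Real.log u))) := by
      rw [Real.rpow_def_of_pos (by linarith), ← Real.exp_add]
      apply Real.exp_le_exp.2
      have hv := vkE_pos (Real.log (u / k))
      have a1 : c * vkE (Real.log (u / k)) ≤ c₀ * vkE (Real.log (u / k)) := by
        gcongr; exact min_le_left _ _
      have a2 : c * (vkE (Real.log u) - vkE (Real.log (u / k))) ≤ c * Real.log k := by gcongr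
      have a3 : c * Real.log k ≤ 1 / 8 * Real.log k := by
        gcongr; exact min_le_right _ _
      linarith
    rw [abs_mul, mul_assoc]
    refine mul_le_mul_of_nonneg_left (h1.trans ?_) (abs_nonneg _)
    calc _ ≤ C * ((k : ℝ) ^ (1 / 8 : ℝ) * Real.exp (-(c * vkE (Real.log u)))) := by gcongr
      _ = _ := by ring
  calc _ ≤ ∑ k ∈ Icc 1 ⌊u⌋₊, |gfun δ m k * M1 (u / k)| := Finset.abs_sum_le_sum_abs _ _
    _ ≤ _ := Finset.sum_le_sum hterm
    _ = (∑ k ∈ Icc 1 ⌊u⌋₊, |gfun δ m k| * (k : ℝ) ^ (1 / 8 : ℝ)) *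
        (C * Real.exp (-(c * vkE (Real.log u)))) := by rw [Finset.sum_mul]
    _ ≤ (K * Qfac m * Rfac δ) * (C * Real.exp (-(c * vkE (Real.log u)))) := by
        gcongr; exact hK δ m _ hδ hm
    _ = _ := by ring

theorem psi_mul_of_coprime {a b : ℕ} (h : Nat.Coprime a b) : psi (a * b) = psi a * psi b := by
  rw [psi, psi, psi, h.primeFactors_mul, Finset.prod_union h.disjoint_primeFactors]

theorem psi_pos (n : ℕ) : 0 < psi n := Finset.prod_pos fun p _ => Nat.succ_pos p

open ArithmeticFunction in
/-- `μ(n)² n/ψ(n)²` restricted to `n` coprime to `q`. -/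
noncomputable def wfun (q : ℕ) : ArithmeticFunction ℝ where
  toFun n := if n ≠ 0 ∧ Nat.Coprime n q then (moebius n : ℝ) ^ 2 * n / (psi n : ℝ) ^ 2 else 0
  map_zero' := by simp

open ArithmeticFunction in
theorem wfun_apply (q n : ℕ) : wfun q n =
    if n ≠ 0 ∧ Nat.Coprime n q then (moebius n : ℝ) ^ 2 * n / (psi n : ℝ) ^ 2 else 0 := rfl

theorem wfun_nonneg (q n : ℕ) : 0 ≤ wfun q n := by
  rw [wfun_apply]; split_ifs <;> positivity

open ArithmeticFunction in
theorem wfun_mult (q : ℕ) : (wfun q).IsMultiplicative := by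
  rw [IsMultiplicative.iff_ne_zero]
  refine ⟨by simp [wfun_apply, psi], fun {a b} ha hb hab => ?_⟩
  simp only [wfun_apply, ne_eq, ha, hb, mul_eq_zero, or_self, not_false_eq_true, true_and,
    Nat.coprime_mul_iff_left]
  by_cases h1 : Nat.Coprime a q <;> by_cases h2 : Nat.Coprime b q <;> simp [h1, h2]
  rw [isMultiplicative_moebius.map_mul_of_coprime hab, psi_mul_of_coprime hab]
  rw [if_pos ⟨h1, h2⟩, if_pos h2, if_pos h1]
  push_cast
  rw [← mul_div_mul_comm]
  ring

open ArithmeticFunction in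
theorem wfun_prime (q : ℕ) {p : ℕ} (hp : p.Prime) :
    wfun q p = if p ∣ q then 0 else (p : ℝ) / ((p : ℝ) + 1) ^ 2 := by
  rw [wfun_apply, moebius_apply_prime hp]
  simp only [hp.coprime_iff_not_dvd]
  by_cases h : p ∣ q
  · simp [h]
  · simp [h, hp.ne_zero, psi, hp.primeFactors]

open ArithmeticFunction in
theorem wfun_prime_pow (q : ℕ) {p : ℕ} (hp : p.Prime) (k : ℕ) : wfun q (p ^ (k + 2)) = 0 := by
  rw [wfun_apply, moebius_apply_prime_pow hp (by omega)]
  simp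

/-- The cofactor of `wfun` with respect to `1/n`. -/
noncomputable def hfun (q : ℕ) : ArithmeticFunction ℝ := wfun q * muinv

theorem hfun_mul_invfun (q : ℕ) : hfun q * invfun = wfun q := by
  rw [hfun, mul_assoc, mul_comm muinv, invfun_mul_muinv, mul_one]

open ArithmeticFunction in
theorem muinv_prime_pow {p : ℕ} (hp : p.Prime) (k : ℕ) : muinv (p ^ (k + 2)) = 0 := by
  rw [muinv_apply, moebius_apply_prime_pow hp (by omega)]
  simp

open ArithmeticFunction in
theorem muinv_prime {p : ℕ} (hp : p.Prime) : muinv p = -(1 / (p : ℝ)) := by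
  rw [muinv_apply, moebius_apply_prime hp]
  push_cast; ring

theorem hfun_prime (q : ℕ) {p : ℕ} (hp : p.Prime) : hfun q p = wfun q p - 1 / (p : ℝ) := by
  have h := mul_apply_prime_pow (wfun q) muinv hp 1
  rw [Finset.sum_range_succ, Finset.sum_range_one] at h
  simp only [pow_zero, pow_one, Nat.sub_self, Nat.sub_zero, (wfun_mult q).map_one,
    muinv_mult.map_one, muinv_prime hp] at h
  rw [hfun, h]; ring

theorem hfun_prime_sq (q : ℕ) {p : ℕ} (hp : p.Prime) : hfun q (p ^ 2) = -(wfun q p / (p : ℝ)) := by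
  have h := mul_apply_prime_pow (wfun q) muinv hp 2
  rw [Finset.sum_range_succ, Finset.sum_range_succ, Finset.sum_range_one] at h
  have e1 := muinv_prime_pow hp 0
  have e2 := wfun_prime_pow q hp 0
  simp only [zero_add] at e1 e2
  simp only [pow_zero, pow_one, Nat.sub_self, Nat.sub_zero, (wfun_mult q).map_one,
    muinv_mult.map_one, e1, e2, show 2 - 1 = 1 from rfl, muinv_prime hp] at h
  rw [hfun, h]; ring

theorem hfun_prime_pow (q : ℕ) {p : ℕ} (hp : p.Prime) (k : ℕ) : hfun q (p ^ (k + 3)) = 0 := by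
  rw [hfun, mul_apply_prime_pow _ _ hp]
  refine Finset.sum_eq_zero fun i hi => ?_
  rw [Finset.mem_range] at hi
  by_cases h : i < 2
  · rw [show k + 3 - i = k + 3 - i - 2 + 2 by omega, muinv_prime_pow hp, mul_zero]
  · rw [show i = i - 2 + 2 by omega, wfun_prime_pow q hp, zero_mul]

theorem hfun_local (q : ℕ) {p : ℕ} (hp : p.Prime) :
    (Summable fun k : ℕ => |hfun q (p ^ k)| * ((p ^ k : ℕ) : ℝ) ^ (1 / 4 : ℝ)) ∧
    ∑' k : ℕ, |hfun q (p ^ k)| * ((p ^ k : ℕ) : ℝ) ^ (1 / 4 : ℝ) ≤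
      if p ∣ q then 2 else 1 + 15 * (p : ℝ) ^ (-(3 / 2) : ℝ) := by
  have hz : ∀ k ∉ Finset.range 3, |hfun q (p ^ k)| * ((p ^ k : ℕ) : ℝ) ^ (1 / 4 : ℝ) = 0 := by
    intro k hk
    rw [Finset.mem_range, not_lt] at hk
    rw [show k = k - 3 + 3 by omega, hfun_prime_pow q hp]; simp
  refine ⟨summable_of_ne_finset_zero hz, ?_⟩
  rw [tsum_eq_sum hz, Finset.sum_range_succ, Finset.sum_range_succ, Finset.sum_range_one, pow_zero,
    pow_one, hfun_prime_sq q hp, hfun_prime q hp, wfun_prime q hp]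
  have h1 : hfun q 1 = 1 := ((wfun_mult q).mul muinv_mult).map_one
  rw [h1]
  have hp2 : (2 : ℝ) ≤ p := by exact_mod_cast hp.two_le
  have hp0 : (0 : ℝ) < p := by linarith
  have b1 : 1 / (p : ℝ) * (p : ℝ) ^ (1 / 4 : ℝ) ≤ 1 := by
    rw [one_div_mul_eq_div, div_le_one hp0]
    nth_rw 2 [← Real.rpow_one (p : ℝ)]
    exact Real.rpow_le_rpow_of_exponent_le (by linarith) (by norm_num)
  split_ifs
  · simp only [zero_sub, abs_neg, abs_of_pos (show 0 < 1 / (p : ℝ) by positivity)]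
    simp only [zero_div, abs_zero, zero_mul, add_zero, Nat.cast_one, Real.one_rpow,
      abs_one, one_mul]
    linarith
  · have e1 : |(p : ℝ) / ((p : ℝ) + 1) ^ 2 - 1 / p| ≤ 2 / (p : ℝ) ^ 2 := by
      have : (p : ℝ) / ((p : ℝ) + 1) ^ 2 - 1 / p = -((2 * p + 1) / (p * (p + 1) ^ 2)) := by
        field_simp; ring
      rw [this, abs_neg, abs_of_pos (by positivity), div_le_div_iff₀ (by positivity) (by positivity)]
      nlinarith [mul_pos hp0 hp0]
    have e2 : |-((p : ℝ) / ((p : ℝ) + 1) ^ 2 / p)| ≤ 1 / (p : ℝ) ^ 2 := by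
      have : (p : ℝ) / ((p : ℝ) + 1) ^ 2 / p = 1 / (p + 1) ^ 2 := by field_simp
      rw [this, abs_neg, abs_of_pos (by positivity)]
      gcongr; linarith
    have s : ∀ a : ℝ, a ≤ 1 / 2 → 1 / (p : ℝ) ^ 2 * (p : ℝ) ^ a ≤ (p : ℝ) ^ (-(3 / 2) : ℝ) := by
      intro a ha
      rw [one_div, ← Real.rpow_natCast, ← Real.rpow_neg hp0.le, ← Real.rpow_add hp0]
      refine Real.rpow_le_rpow_of_exponent_le (by linarith) ?_
      push_cast; linarith
    have s1 := s (1 / 4) (by norm_num)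
    have s2 : |-((p : ℝ) / ((p : ℝ) + 1) ^ 2 / p)| * ((p ^ 2 : ℕ) : ℝ) ^ (1 / 4 : ℝ) ≤
        (p : ℝ) ^ (-(3 / 2) : ℝ) := by
      refine le_trans ?_ (s (1 / 2) le_rfl)
      have : ((p ^ 2 : ℕ) : ℝ) ^ (1 / 4 : ℝ) = (p : ℝ) ^ (1 / 2 : ℝ) := by
        push_cast
        rw [← Real.rpow_natCast, ← Real.rpow_mul hp0.le]; norm_num
      rw [this]
      gcongr
    have s3 : |(p : ℝ) / ((p : ℝ) + 1) ^ 2 - 1 / p| * (p : ℝ) ^ (1 / 4 : ℝ) ≤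
        2 * (p : ℝ) ^ (-(3 / 2) : ℝ) := by
      calc _ ≤ 2 / (p : ℝ) ^ 2 * (p : ℝ) ^ (1 / 4 : ℝ) := by gcongr
        _ = 2 * (1 / (p : ℝ) ^ 2 * (p : ℝ) ^ (1 / 4 : ℝ)) := by ring
        _ ≤ _ := by gcongr
    have : 0 ≤ (p : ℝ) ^ (-(3 / 2) : ℝ) := by positivity
    simp only [Nat.cast_one, Real.one_rpow, abs_one, one_mul]
    linarith

theorem exists_hfun_sum : ∃ K : ℝ, 1 ≤ K ∧ ∀ q N : ℕ, q ≠ 0 →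
    ∑ n ∈ Icc 1 N, |hfun q n| * (n : ℝ) ^ (1 / 4 : ℝ) ≤ K * 2 ^ q.primeFactors.card := by
  obtain ⟨K, hK1, hK⟩ := exists_euler_const
  refine ⟨K, hK1, fun q N hq => ?_⟩
  have hm : (hfun q).IsMultiplicative := (wfun_mult q).mul muinv_mult
  set F : ℕ → ℝ := fun p => (if p ∈ q.primeFactors then 2 else 1) *
    (1 + 15 * (p : ℝ) ^ (-(3 / 2) : ℝ)) with hF
  have h := sum_le_prod_primesBelow (f := fun n : ℕ => |hfun q n| * (n : ℝ) ^ (1 / 4 : ℝ)) (F := F)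
    (fun n => by positivity) (by simp [hm.map_one])
    (fun {a b} hab => by
      rw [hm.map_mul_of_coprime hab, abs_mul]
      push_cast
      rw [Real.mul_rpow (by positivity) (by positivity)]; ring)
    (fun {p} hp => (hfun_local q hp).1) (fun {p} hp => (hfun_local q hp).2.trans (by
      have : 0 ≤ (p : ℝ) ^ (-(3 / 2) : ℝ) := by positivity
      simp only [hF, Nat.mem_primeFactors, hp, true_and, ne_eq, hq, not_false_eq_true, and_true]
      split_ifs <;> linarith)) N
  refine h.trans ?_
  simp only [hF]
  rw [Finset.prod_mul_distrib, mul_comm]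
  refine mul_le_mul (hK _) ?_ (Finset.prod_nonneg fun p _ => by split_ifs <;> norm_num) (by linarith)
  exact (prod_ite_mem_le fun p _ => by norm_num).trans (le_of_eq (by simp))

/-- The harmonic sum. -/
noncomputable def Hsum (x : ℝ) : ℝ := ∑ n ∈ Icc 1 ⌊x⌋₊, invfun n

theorem Hsum_eq (x : ℝ) : Hsum x = harmonic ⌊x⌋₊ := by
  rw [Hsum, harmonic_eq_sum_Icc]
  push_cast
  exact Finset.sum_congr rfl fun n _ => by rw [invfun_apply, one_div]

theorem Hsum_nonneg (x : ℝ) : 0 ≤ Hsum x :=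
  Finset.sum_nonneg fun n _ => by rw [invfun_apply]; positivity

theorem Hsum_le {x : ℝ} (hx : 1 ≤ x) : Hsum x ≤ 1 + Real.log x := by
  rw [Hsum_eq]; exact harmonic_floor_le_one_add_log x hx

theorem Hsum_eq_zero {x : ℝ} (hx : x < 1) : Hsum x = 0 := by
  rw [Hsum, Nat.floor_eq_zero.2 hx]; simp

theorem abs_Hsum_sub_log {x : ℝ} (hx : 1 ≤ x) :
    |Hsum x - Real.log x - Real.eulerMascheroniConstant| ≤ 2 / x := by
  set n := ⌊x⌋₊ with hn
  have hn1 : 1 ≤ n := Nat.le_floor (by exact_mod_cast hx)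
  have hn1' : (1 : ℝ) ≤ n := by exact_mod_cast hn1
  have hnx : (n : ℝ) ≤ x := Nat.floor_le (by linarith)
  have hxn : x < n + 1 := Nat.lt_floor_add_one x
  have h1 := Real.eulerMascheroniSeq_lt_eulerMascheroniConstant n
  have h2 := Real.eulerMascheroniConstant_lt_eulerMascheroniSeq' n
  rw [Real.eulerMascheroniSeq] at h1
  rw [Real.eulerMascheroniSeq', if_neg (by omega)] at h2
  have h3 : Real.log (n + 1) - Real.log n ≤ 1 / n := by
    rw [← Real.log_div (by positivity) (by positivity)]
    refine (Real.log_le_sub_one_of_pos (by positivity)).trans (le_of_eq ?_)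
    field_simp; ring
  have h4 : 1 / (n : ℝ) ≤ 2 / x := by
    rw [div_le_div_iff₀ (by linarith) (by linarith)]; linarith
  have h5 : Real.log n ≤ Real.log x := Real.log_le_log (by linarith) hnx
  have h6 : Real.log x ≤ Real.log (n + 1) := Real.log_le_log (by linarith) hxn.le
  rw [Hsum_eq, abs_le]
  constructor <;> linarith

theorem abs_Hsum_mul_sub {z α : ℝ} (hz : 0 < z) (hα : 1 ≤ α) :
    |Hsum (α * z) - Hsum z - Real.log α| ≤ 4 * (1 + Real.log α) * z ^ (-(1 / 4) : ℝ) := by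
  have hl : 0 ≤ Real.log α := Real.log_nonneg hα
  by_cases h : 1 ≤ z
  · have hαz : z ≤ α * z := by nlinarith
    have h1 := abs_Hsum_sub_log h
    have h2 := abs_Hsum_sub_log (h.trans hαz)
    rw [Real.log_mul (by linarith) hz.ne'] at h2
    have h3 : 2 / (α * z) ≤ 2 / z := by gcongr
    have h4 : 1 / z ≤ z ^ (-(1 / 4) : ℝ) := by
      rw [one_div, ← Real.rpow_neg_one]
      exact Real.rpow_le_rpow_of_exponent_le h (by norm_num)
    have h5 : 0 ≤ Real.log α * z ^ (-(1 / 4) : ℝ) := by positivity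
    rw [abs_le] at h1 h2 ⊢
    have : 2 / z = 2 * (1 / z) := by ring
    constructor <;> linarith
  · push Not at h
    have h1 : 1 ≤ z ^ (-(1 / 4) : ℝ) :=
      Real.one_le_rpow_of_pos_of_le_one_of_nonpos hz h.le (by norm_num)
    have h2 : Hsum (α * z) ≤ 1 + Real.log α := by
      by_cases h3 : 1 ≤ α * z
      · refine (Hsum_le h3).trans ?_
        gcongr; nlinarith
      · rw [Hsum_eq_zero (by linarith)]; linarith
    have h3 := Hsum_nonneg (α * z)
    rw [Hsum_eq_zero h, sub_zero]
    have h4 : 1 + Real.log α ≤ (1 + Real.log α) * z ^ (-(1 / 4) : ℝ) :=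
      le_mul_of_one_le_right (by linarith) h1
    rw [abs_le]
    constructor <;> linarith

/-- The summatory function of `wfun`. -/
noncomputable def Wsum (q : ℕ) (x : ℝ) : ℝ := ∑ n ∈ Icc 1 ⌊x⌋₊, wfun q n

theorem Wsum_eq (q : ℕ) {x y : ℝ} (hy : x ≤ y) :
    Wsum q x = ∑ k ∈ Icc 1 ⌊y⌋₊, hfun q k * Hsum (x / k) := by
  have h := ArithmeticFunction.sum_Ioc_mul_eq_sum_sum (hfun q) invfun ⌊x⌋₊
  rw [hfun_mul_invfun] at h
  have e : ∀ N : ℕ, Finset.Ioc 0 N = Finset.Icc 1 N := fun N => rfl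
  have h2 : Wsum q x = ∑ k ∈ Icc 1 ⌊x⌋₊, hfun q k * Hsum (x / k) := by
    rw [Wsum, ← e, h]
    refine Finset.sum_congr rfl fun k _ => ?_
    rw [Hsum, Nat.floor_div_natCast, e]
  rw [h2]
  refine Finset.sum_subset (Finset.Icc_subset_Icc_right (Nat.floor_le_floor hy)) fun k hk hk' => ?_
  rw [Finset.mem_Icc] at hk hk'
  have hk1 : (1 : ℝ) ≤ k := by exact_mod_cast hk.1
  have : x < k := by
    by_contra hc
    push Not at hc
    exact hk' ⟨hk.1, Nat.le_floor hc⟩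
  rw [Hsum_eq_zero ((div_lt_one (by linarith)).2 this), mul_zero]

theorem exists_Wsum_diff : ∃ K : ℝ, 1 ≤ K ∧ ∀ q : ℕ, q ≠ 0 → ∀ α X Y : ℝ, 1 ≤ α → 0 < X → X ≤ Y →
    |(Wsum q (α * X) - Wsum q X) - (Wsum q (α * Y) - Wsum q Y)| ≤
      K * 2 ^ q.primeFactors.card * (1 + Real.log α) * X ^ (-(1 / 4) : ℝ) := by
  obtain ⟨K, hK1, hK⟩ := exists_hfun_sum
  refine ⟨8 * K, by linarith, fun q hq α X Y hα hX hXY => ?_⟩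
  have hY : 0 < Y := hX.trans_le hXY
  have hl : 0 ≤ Real.log α := Real.log_nonneg hα
  rw [Wsum_eq q (show α * X ≤ α * Y by gcongr), Wsum_eq q (show X ≤ α * Y by nlinarith),
    Wsum_eq q (le_refl (α * Y)), Wsum_eq q (show Y ≤ α * Y by nlinarith),
    ← Finset.sum_sub_distrib, ← Finset.sum_sub_distrib, ← Finset.sum_sub_distrib]
  refine (Finset.abs_sum_le_sum_abs _ _).trans ?_
  have hterm : ∀ k ∈ Icc 1 ⌊α * Y⌋₊, |hfun q k * Hsum (α * X / k) - hfun q k * Hsum (X / k) -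
      (hfun q k * Hsum (α * Y / k) - hfun q k * Hsum (Y / k))| ≤
      |hfun q k| * (k : ℝ) ^ (1 / 4 : ℝ) * (8 * (1 + Real.log α) * X ^ (-(1 / 4) : ℝ)) := by
    intro k hk
    rw [Finset.mem_Icc] at hk
    have hk0 : (0 : ℝ) < k := by exact_mod_cast hk.1
    have a1 := abs_Hsum_mul_sub (show 0 < X / k by positivity) hα
    have a2 := abs_Hsum_mul_sub (show 0 < Y / k by positivity) hα
    have a3 : (Y / k) ^ (-(1 / 4) : ℝ) ≤ (X / k) ^ (-(1 / 4) : ℝ) :=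
      Real.rpow_le_rpow_of_nonpos (by positivity) (by gcongr) (by norm_num)
    have a4 : (X / k) ^ (-(1 / 4) : ℝ) = (k : ℝ) ^ (1 / 4 : ℝ) * X ^ (-(1 / 4) : ℝ) := by
      rw [Real.div_rpow hX.le hk0.le, Real.rpow_neg hk0.le, div_inv_eq_mul, mul_comm]
    have e : hfun q k * Hsum (α * X / k) - hfun q k * Hsum (X / k) -
      (hfun q k * Hsum (α * Y / k) - hfun q k * Hsum (Y / k)) = hfun q k *
        ((Hsum (α * (X / k)) - Hsum (X / k) - Real.log α) -
          (Hsum (α * (Y / k)) - Hsum (Y / k) - Real.log α)) := by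
      rw [mul_div_assoc, mul_div_assoc]; ring
    rw [e, abs_mul, mul_assoc]
    refine mul_le_mul_of_nonneg_left ?_ (abs_nonneg _)
    refine (abs_sub _ _).trans ?_
    have a5 : 4 * (1 + Real.log α) * (Y / k) ^ (-(1 / 4) : ℝ) ≤
      4 * (1 + Real.log α) * (X / k) ^ (-(1 / 4) : ℝ) := by gcongr
    rw [a4] at a1 a5
    linarith
  refine (Finset.sum_le_sum hterm).trans ?_
  rw [← Finset.sum_mul]
  calc _ ≤ (K * 2 ^ q.primeFactors.card) * (8 * (1 + Real.log α) * X ^ (-(1 / 4) : ℝ)) := by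
        gcongr; exact hK q _ hq
    _ = _ := by ring

open ArithmeticFunction in
/-- `μ(n)²/n · ∏_{p ∣ n} 15 p^{-1/2}`. -/
noncomputable def rhofun : ArithmeticFunction ℝ where
  toFun n := (moebius n : ℝ) ^ 2 * (∏ p ∈ n.primeFactors, (15 * (p : ℝ) ^ (-(1 / 2) : ℝ))) / n
  map_zero' := by simp

open ArithmeticFunction in
theorem rhofun_apply (n : ℕ) : rhofun n =
    (moebius n : ℝ) ^ 2 * (∏ p ∈ n.primeFactors, (15 * (p : ℝ) ^ (-(1 / 2) : ℝ))) / n := rfl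

theorem rhofun_nonneg (n : ℕ) : 0 ≤ rhofun n := by
  rw [rhofun_apply]
  have : 0 ≤ ∏ p ∈ n.primeFactors, (15 * (p : ℝ) ^ (-(1 / 2) : ℝ)) :=
    Finset.prod_nonneg fun p _ => by positivity
  positivity

open ArithmeticFunction in
theorem rhofun_mult : rhofun.IsMultiplicative := by
  rw [IsMultiplicative.iff_ne_zero]
  refine ⟨by simp [rhofun_apply], fun {a b} ha hb hab => ?_⟩
  simp only [rhofun_apply]
  rw [isMultiplicative_moebius.map_mul_of_coprime hab, hab.primeFactors_mul,
    Finset.prod_union hab.disjoint_primeFactors]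
  push_cast
  rw [← mul_div_mul_comm]
  ring

open ArithmeticFunction in
theorem exists_rhofun_sum : ∃ K : ℝ, 1 ≤ K ∧ ∀ N : ℕ, ∑ n ∈ Icc 1 N, rhofun n ≤ K := by
  obtain ⟨K, hK1, hK⟩ := exists_euler_const
  refine ⟨K, hK1, fun N => ?_⟩
  have hz : ∀ {p : ℕ}, p.Prime → ∀ k ∉ Finset.range 2, rhofun (p ^ k) = 0 := by
    intro p hp k hk
    rw [Finset.mem_range, not_lt] at hk
    rw [rhofun_apply, moebius_apply_prime_pow hp (by omega), if_neg (by omega)]; simp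
  refine (sum_le_prod_primesBelow rhofun_nonneg rhofun_mult.map_one
    (fun {a b} hab => rhofun_mult.map_mul_of_coprime hab)
    (fun {p} hp => summable_of_ne_finset_zero (hz hp)) (fun {p} hp => ?_) N).trans
    (hK (N + 1).primesBelow)
  rw [tsum_eq_sum (hz hp), Finset.sum_range_succ, Finset.sum_range_one, pow_zero, pow_one,
    rhofun_mult.map_one, rhofun_apply, moebius_apply_prime hp, hp.primeFactors, Finset.prod_singleton]
  have hp0 : (0 : ℝ) < p := by exact_mod_cast hp.pos
  have : (p : ℝ) ^ (-(1 / 2) : ℝ) / p = (p : ℝ) ^ (-(3 / 2) : ℝ) := by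
    rw [div_eq_mul_inv, ← Real.rpow_neg_one, ← Real.rpow_add hp0]; norm_num
  rw [mul_div_assoc, mul_div_assoc, this]
  push_cast
  linarith

open ArithmeticFunction in
theorem wfun_mul_Rfac_sq_le (q n : ℕ) : wfun q n * Rfac n ^ 2 ≤ (rhofun * invfun) n := by
  have hnn : 0 ≤ (rhofun * invfun) n := by
    rw [mul_apply]
    exact Finset.sum_nonneg fun x _ => mul_nonneg (rhofun_nonneg _)
      (by rw [invfun_apply]; positivity)
  by_cases hn : n = 0
  · simp [hn]
  by_cases hsq : Squarefree n
  swap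
  · rw [wfun_apply, moebius_eq_zero_of_not_squarefree hsq]; simpa using hnn
  have hn0 : (0 : ℝ) < n := by exact_mod_cast Nat.pos_of_ne_zero hn
  have h1 : wfun q n ≤ 1 / n := by
    have hpsi : (n : ℝ) ≤ psi n := by
      have : ∏ p ∈ n.primeFactors, p ≤ psi n :=
        Finset.prod_le_prod' fun p _ => Nat.le_succ p
      rw [Nat.prod_primeFactors_of_squarefree hsq] at this
      exact_mod_cast this
    rw [wfun_apply]
    split_ifs
    · have h2 : (moebius n : ℝ) ^ 2 = 1 := by
        have := moebius_sq (n := n)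
        rw [if_pos hsq] at this
        exact_mod_cast this
      have hpp : (0 : ℝ) < psi n := by exact_mod_cast psi_pos n
      rw [h2, one_mul, div_le_div_iff₀ (by positivity) hn0]
      nlinarith
    · positivity
  set r : ArithmeticFunction ℝ :=
    prodPrimeFactors fun p => 15 * (p : ℝ) ^ (-(1 / 2) : ℝ) with hr
  have hrm : r.IsMultiplicative := IsMultiplicative.prodPrimeFactors _
  have hrp : ∀ p ∈ n.primeFactors, r p = 15 * (p : ℝ) ^ (-(1 / 2) : ℝ) := fun p hp => by
    have hp' := Nat.prime_of_mem_primeFactors hp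
    rw [hr, prodPrimeFactors_apply hp'.ne_zero, hp'.primeFactors, Finset.prod_singleton]
  have h2 : Rfac n ^ 2 ≤ ∑ d ∈ n.divisors, r d := by
    rw [← hrm.prodPrimeFactors_one_add_of_squarefree hsq, Rfac, ← Finset.prod_pow]
    refine Finset.prod_le_prod (fun p _ => by positivity) fun p hp => ?_
    rw [hrp p hp]
    have hp1 : (1 : ℝ) ≤ p := by exact_mod_cast (Nat.prime_of_mem_primeFactors hp).one_lt.le
    have a1 : (p : ℝ) ^ (-(1 / 2) : ℝ) ≤ 1 :=
      Real.rpow_le_one_of_one_le_of_nonpos hp1 (by norm_num)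
    have a0 : 0 ≤ (p : ℝ) ^ (-(1 / 2) : ℝ) := by positivity
    nlinarith
  have h3 : (rhofun * invfun) n = 1 / n * ∑ d ∈ n.divisors, r d := by
    rw [mul_apply, Nat.sum_divisorsAntidiagonal (fun a b => rhofun a * invfun b), Finset.mul_sum]
    refine Finset.sum_congr rfl fun d hd => ?_
    have hdn := Nat.dvd_of_mem_divisors hd
    have hd0 : d ≠ 0 := fun h => hn (by rw [h] at hdn; exact Nat.eq_zero_of_zero_dvd hdn)
    have hd0' : (d : ℝ) ≠ 0 := by exact_mod_cast hd0
    have hdsq : Squarefree d := hsq.squarefree_of_dvd hdn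
    have hm : (moebius d : ℝ) ^ 2 = 1 := by
      have := moebius_sq (n := d)
      rw [if_pos hdsq] at this
      exact_mod_cast this
    rw [rhofun_apply, hm, invfun_apply, Nat.cast_div hdn hd0', hr, prodPrimeFactors_apply hd0]
    field_simp
  rw [h3]
  exact mul_le_mul h1 h2 (by positivity) (by positivity)

theorem exists_wfun_Rfac_sum : ∃ K : ℝ, 1 ≤ K ∧ ∀ q : ℕ, ∀ y : ℝ, 1 ≤ y →
    ∑ n ∈ Icc 1 ⌊y⌋₊, wfun q n * Rfac n ^ 2 ≤ K * (1 + Real.log y) := by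
  obtain ⟨K, hK1, hK⟩ := exists_rhofun_sum
  refine ⟨K, hK1, fun q y hy => ?_⟩
  have e : ∀ N : ℕ, Finset.Ioc 0 N = Finset.Icc 1 N := fun N => rfl
  have h := ArithmeticFunction.sum_Ioc_mul_eq_sum_sum rhofun invfun ⌊y⌋₊
  simp only [e] at h
  refine (Finset.sum_le_sum fun n _ => wfun_mul_Rfac_sq_le q n).trans ?_
  rw [h]
  calc _ ≤ ∑ n ∈ Icc 1 ⌊y⌋₊, rhofun n * (1 + Real.log y) := by
        refine Finset.sum_le_sum fun n hn => mul_le_mul_of_nonneg_left ?_ (rhofun_nonneg n)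
        refine le_trans ?_ (Hsum_le hy)
        exact Finset.sum_le_sum_of_subset_of_nonneg
          (Finset.Icc_subset_Icc_right (Nat.div_le_self _ _)) fun i _ _ => by
            rw [invfun_apply]; positivity
    _ = (∑ n ∈ Icc 1 ⌊y⌋₊, rhofun n) * (1 + Real.log y) := by rw [Finset.sum_mul]
    _ ≤ _ := by
        have := Real.log_nonneg hy
        gcongr
        exact hK _

theorem primeFactors_lcm {a b : ℕ} (ha : a ≠ 0) (hb : b ≠ 0) :
    (Nat.lcm a b).primeFactors = a.primeFactors ∪ b.primeFactors := by
  ext p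
  simp only [Finset.mem_union, Nat.mem_primeFactors, ne_eq, Nat.lcm_eq_zero_iff, ha, hb, or_self,
    not_false_eq_true, and_true]
  constructor
  · rintro ⟨hp, h⟩
    exact (hp.prime.dvd_or_dvd (h.trans (Nat.lcm_dvd_mul a b))).imp (⟨hp, ·⟩) (⟨hp, ·⟩)
  · rintro (⟨hp, h⟩ | ⟨hp, h⟩)
    · exact ⟨hp, h.trans (Nat.dvd_lcm_left a b)⟩
    · exact ⟨hp, h.trans (Nat.dvd_lcm_right a b)⟩

theorem psi_lcm_right {x m : ℕ} (hx : x ≠ 0) (hm : m ≠ 0) :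
    psi (Nat.lcm x m) = psi m * psiM m x := by
  have e : (Nat.lcm x m).primeFactors =
      m.primeFactors ∪ x.primeFactors.filter fun p => ¬ p ∣ m := by
    ext p
    simp only [primeFactors_lcm hx hm, Finset.mem_union, Finset.mem_filter,
      Nat.mem_primeFactors]
    tauto
  rw [psi, e, Finset.prod_union, psi, psiM]
  rw [Finset.disjoint_left]
  intro p hp hp'
  exact (Finset.mem_filter.1 hp').2 (Nat.dvd_of_mem_primeFactors hp)

theorem psiM_lcm_mul_gcd (m : ℕ) {d t : ℕ} (hd : d ≠ 0) (ht : t ≠ 0) :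
    psiM m (Nat.lcm d t) * psiM m (Nat.gcd d t) = psiM m d * psiM m t := by
  rw [psiM, psiM, psiM, psiM, primeFactors_lcm hd ht, Nat.primeFactors_gcd hd ht,
    Finset.filter_union, Finset.filter_inter_distrib, Finset.prod_union_inter]

theorem psiM_eq_psi {m n : ℕ} (h : Nat.Coprime n m) : psiM m n = psi n := by
  rw [psiM, psi, Finset.filter_true_of_mem]
  intro p hp hpm
  have hpp := Nat.prime_of_mem_primeFactors hp
  exact hpp.one_lt.ne' (Nat.eq_one_of_dvd_coprimes h (Nat.dvd_of_mem_primeFactors hp) hpm)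

/-- The identity function restricted to integers coprime to `m`. -/
noncomputable def copId (m : ℕ) : ArithmeticFunction ℝ where
  toFun n := if Nat.Coprime n m then (n : ℝ) else 0
  map_zero' := by simp

theorem copId_apply (m n : ℕ) : copId m n = if Nat.Coprime n m then (n : ℝ) else 0 := rfl

open ArithmeticFunction in
theorem copId_mult (m : ℕ) : (copId m).IsMultiplicative := by
  rw [IsMultiplicative.iff_ne_zero]
  refine ⟨by simp [copId_apply], fun {a b} ha hb hab => ?_⟩
  simp only [copId_apply, Nat.coprime_mul_iff_left]
  by_cases h1 : Nat.Coprime a m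
  · by_cases h2 : Nat.Coprime b m
    · rw [if_pos ⟨h1, h2⟩, if_pos h1, if_pos h2]; push_cast; rfl
    · rw [if_neg fun h => h2 h.2, if_neg h2, mul_zero]
  · rw [if_neg fun h => h1 h.1, if_neg h1, zero_mul]

theorem sum_copId_divisors (m : ℕ) {g : ℕ} (hg : Squarefree g) :
    ∑ δ ∈ g.divisors, copId m δ = psiM m g := by
  rw [← (copId_mult m).prodPrimeFactors_one_add_of_squarefree hg, psiM, Finset.prod_filter]
  push_cast
  refine Finset.prod_congr rfl fun p hp => ?_
  rw [copId_apply]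
  simp only [(Nat.prime_of_mem_primeFactors hp).coprime_iff_not_dvd]
  split_ifs <;> ring

open ArithmeticFunction in
theorem moebius_div_psi_lcm {d t m : ℕ} (hd : d ≠ 0) (ht : t ≠ 0) (hm : m ≠ 0) :
    (moebius d : ℝ) * moebius t / psi (Nat.lcm (Nat.lcm d t) m) =
      1 / psi m * ∑ δ ∈ (Nat.gcd d t).divisors, copId m δ *
        ((moebius d : ℝ) / psiM m d * ((moebius t : ℝ) / psiM m t)) := by
  by_cases hs : Squarefree d
  swap
  · rw [moebius_eq_zero_of_not_squarefree hs]; simp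
  have hg : Squarefree (Nat.gcd d t) := hs.squarefree_of_dvd (Nat.gcd_dvd_left d t)
  rw [← Finset.sum_mul, sum_copId_divisors m hg, psi_lcm_right (Nat.lcm_ne_zero hd ht) hm]
  have h := psiM_lcm_mul_gcd m hd ht
  have h' : (psiM m (Nat.lcm d t) : ℝ) * psiM m (Nat.gcd d t) = psiM m d * psiM m t := by
    exact_mod_cast h
  have p1 : (psiM m (Nat.lcm d t) : ℝ) ≠ 0 := by exact_mod_cast (psiM_pos _ _).ne'
  have p2 : (psiM m d : ℝ) ≠ 0 := by exact_mod_cast (psiM_pos _ _).ne'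
  have p3 : (psiM m t : ℝ) ≠ 0 := by exact_mod_cast (psiM_pos _ _).ne'
  have p4 : (psi m : ℝ) ≠ 0 := by exact_mod_cast (psi_pos _).ne'
  push_cast
  field_simp
  linear_combination (-(moebius t : ℝ)) * h'

open ArithmeticFunction in
theorem moebius_div_psiM_mul (m : ℕ) {δ e : ℕ} (he : e ≠ 0) :
    (moebius (δ * e) : ℝ) / psiM m (δ * e) = (moebius δ : ℝ) / psiM m δ * cofun δ m e := by
  rw [cofun_apply]
  by_cases h : Nat.Coprime e δ
  · rw [if_pos ⟨he, h⟩, isMultiplicative_moebius.map_mul_of_coprime h.symm,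
      psiM_mul_of_coprime m h.symm]
    push_cast
    rw [mul_div_mul_comm]
  · rw [if_neg fun h' => h h'.2, mul_zero, moebius_eq_zero_of_not_squarefree]
    · simp
    · exact fun hs => h (Nat.coprime_of_squarefree_mul hs).symm

open ArithmeticFunction in
theorem sum_multiples (m : ℕ) {δ : ℕ} (hδ : δ ≠ 0) (y : ℝ) :
    ∑ d ∈ (Icc 1 ⌊y⌋₊).filter (fun d => δ ∣ d), (moebius d : ℝ) / psiM m d =
      (moebius δ : ℝ) / psiM m δ * Asum δ m (y / δ) := by
  rw [Asum, Nat.floor_div_natCast, Finset.mul_sum]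
  have hδ0 : 0 < δ := Nat.pos_of_ne_zero hδ
  refine Finset.sum_nbij' (fun d => d / δ) (fun e => δ * e) ?_ ?_ ?_ ?_ ?_
  · intro d hd
    simp only [Finset.mem_filter, Finset.mem_Icc] at hd ⊢
    exact ⟨Nat.div_pos (Nat.le_of_dvd (by omega) hd.2) hδ0, Nat.div_le_div_right hd.1.2⟩
  · intro e he
    simp only [Finset.mem_filter, Finset.mem_Icc] at he ⊢
    refine ⟨⟨Nat.mul_pos hδ0 he.1, ?_⟩, dvd_mul_right _ _⟩
    rw [mul_comm]
    exact (Nat.le_div_iff_mul_le hδ0).1 he.2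
  · intro d hd
    exact Nat.mul_div_cancel' (Finset.mem_filter.1 hd).2
  · intro e _
    exact Nat.mul_div_cancel_left e hδ0
  · intro d hd
    simp only [Finset.mem_filter, Finset.mem_Icc] at hd
    have hd' := Nat.mul_div_cancel' hd.2
    have : d / δ ≠ 0 := fun h => by rw [h] at hd'; omega
    rw [← moebius_div_psiM_mul m this, hd']

theorem T_eq (y : ℝ) {m : ℕ} (hm : m ≠ 0) :
    T y m = 6 / Real.pi ^ 2 / psi m * ∑ δ ∈ Icc 1 ⌊y⌋₊, wfun m δ * Asum δ m (y / δ) ^ 2 := by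
  have key : ∀ δ ∈ Icc 1 ⌊y⌋₊, wfun m δ * Asum δ m (y / δ) ^ 2 = copId m δ *
      (∑ d ∈ (Icc 1 ⌊y⌋₊).filter (fun d => δ ∣ d),
        (ArithmeticFunction.moebius d : ℝ) / psiM m d) ^ 2 := by
    intro δ hδ
    rw [Finset.mem_Icc] at hδ
    have hδ0 : δ ≠ 0 := by omega
    rw [sum_multiples m hδ0, wfun_apply, copId_apply]
    by_cases h : Nat.Coprime δ m
    · rw [if_pos ⟨hδ0, h⟩, if_pos h, psiM_eq_psi h]; ring
    · rw [if_neg fun h' => h h'.2, if_neg h, zero_mul, zero_mul]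
  rw [T, Finset.sum_congr rfl key, div_eq_mul_one_div (6 / Real.pi ^ 2) (psi m : ℝ), mul_assoc]
  congr 1
  have e1 : ∀ d ∈ Icc 1 ⌊y⌋₊, ∀ t ∈ Icc 1 ⌊y⌋₊,
      (ArithmeticFunction.moebius d : ℝ) * ArithmeticFunction.moebius t /
        psi (Nat.lcm (Nat.lcm d t) m) = 1 / psi m * ∑ δ ∈ Icc 1 ⌊y⌋₊, if δ ∣ d ∧ δ ∣ t then
          copId m δ * ((ArithmeticFunction.moebius d : ℝ) / psiM m d *
            ((ArithmeticFunction.moebius t : ℝ) / psiM m t)) else 0 := by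
    intro d hd t ht
    rw [Finset.mem_Icc] at hd ht
    rw [moebius_div_psi_lcm (by omega) (by omega) hm, ← Finset.sum_filter]
    congr 2
    ext δ
    simp only [Nat.mem_divisors, Finset.mem_filter, Finset.mem_Icc, Nat.dvd_gcd_iff]
    constructor
    · rintro ⟨⟨h1, h2⟩, _⟩
      have := Nat.le_of_dvd (by omega) h1
      have := Nat.pos_of_dvd_of_pos h1 (by omega)
      exact ⟨⟨by omega, by omega⟩, h1, h2⟩
    · rintro ⟨_, h⟩
      exact ⟨h, Nat.gcd_ne_zero_left (by omega)⟩
  rw [Finset.sum_congr rfl fun d hd => Finset.sum_congr rfl fun t ht => e1 d hd t ht]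
  simp_rw [← Finset.mul_sum]
  congr 1
  rw [Finset.sum_congr rfl fun d _ => Finset.sum_comm, Finset.sum_comm]
  refine Finset.sum_congr rfl fun δ _ => ?_
  rw [sq, Finset.sum_mul_sum, Finset.sum_filter, Finset.mul_sum]
  refine Finset.sum_congr rfl fun d _ => ?_
  by_cases hd : δ ∣ d
  · simp only [hd, true_and, if_true]
    rw [Finset.sum_filter, Finset.mul_sum]
    exact Finset.sum_congr rfl fun t _ => by split_ifs <;> simp
  · simp [hd]

theorem Wsum_sub (q : ℕ) {x z : ℝ} (h : x ≤ z) :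
    ∑ n ∈ Ioc ⌊x⌋₊ ⌊z⌋₊, wfun q n = Wsum q z - Wsum q x := by
  have e : ∀ N : ℕ, Finset.Icc 1 N = Finset.Ioc 0 N := fun N => rfl
  rw [Wsum, Wsum, e, e, ← Finset.sum_Ioc_consecutive _ (Nat.zero_le _) (Nat.floor_le_floor h)]
  ring

open ArithmeticFunction in
theorem wfun_mul_cofun_mul_cofun (m δ : ℕ) {a b : ℕ} (ha : a ≠ 0) (hb : b ≠ 0) :
    wfun m δ * (cofun δ m a * cofun δ m b) =
      (moebius a : ℝ) / psiM m a * ((moebius b : ℝ) / psiM m b) * wfun (m * a * b) δ := by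
  simp only [wfun_apply, cofun_apply, ne_eq, ha, hb, not_false_eq_true, true_and,
    Nat.coprime_mul_iff_right]
  by_cases h0 : δ = 0
  · simp [h0]
  by_cases h1 : Nat.Coprime δ m
  swap
  · rw [if_neg (c := ¬δ = 0 ∧ Nat.Coprime δ m) fun h => h1 h.2,
      if_neg (c := ¬δ = 0 ∧ (Nat.Coprime δ m ∧ Nat.Coprime δ a) ∧ Nat.Coprime δ b) fun h => h1 h.2.1.1]
    ring
  by_cases h2 : Nat.Coprime δ a
  swap
  · rw [if_neg (c := Nat.Coprime a δ) fun h => h2 h.symm,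
      if_neg (c := ¬δ = 0 ∧ (Nat.Coprime δ m ∧ Nat.Coprime δ a) ∧ Nat.Coprime δ b) fun h => h2 h.2.1.2]
    ring
  by_cases h3 : Nat.Coprime δ b
  swap
  · rw [if_neg (c := Nat.Coprime b δ) fun h => h3 h.symm,
      if_neg (c := ¬δ = 0 ∧ (Nat.Coprime δ m ∧ Nat.Coprime δ a) ∧ Nat.Coprime δ b) fun h => h3 h.2.2]
    ring
  rw [if_pos ⟨h0, h1⟩, if_pos h2.symm, if_pos h3.symm, if_pos ⟨h0, ⟨h1, h2⟩, h3⟩]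
  ring

open ArithmeticFunction in
theorem sum_large_eq (m : ℕ) {y U : ℝ} (hU : 1 ≤ U) (hy : U ≤ y) :
    ∑ δ ∈ Ioc ⌊y / U⌋₊ ⌊y⌋₊, wfun m δ * Asum δ m (y / δ) ^ 2 =
      ∑ a ∈ Icc 1 ⌊U⌋₊, ∑ b ∈ Icc 1 ⌊U⌋₊, (moebius a : ℝ) / psiM m a *
        ((moebius b : ℝ) / psiM m b) *
        (Wsum (m * a * b) (U / max (a : ℝ) b * (y / U)) - Wsum (m * a * b) (y / U)) := by
  have hU0 : 0 < U := by linarith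
  have hy0 : 0 < y := by linarith
  have e1 : ∀ δ ∈ Ioc ⌊y / U⌋₊ ⌊y⌋₊, wfun m δ * Asum δ m (y / δ) ^ 2 =
      ∑ a ∈ Icc 1 ⌊U⌋₊, ∑ b ∈ Icc 1 ⌊U⌋₊,
        if δ ≤ ⌊U / max (a : ℝ) b * (y / U)⌋₊ then (moebius a : ℝ) / psiM m a *
        ((moebius b : ℝ) / psiM m b) * wfun (m * a * b) δ else 0 := by
    intro δ hδ
    rw [Finset.mem_Ioc] at hδ
    have hd : y / U < δ := (Nat.floor_lt (by positivity)).1 hδ.1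
    have hd0 : (0 : ℝ) < δ := (by positivity : 0 < y / U).trans hd
    have hyd : y / δ < U := by
      rw [div_lt_iff₀ hU0] at hd
      rw [div_lt_iff₀ hd0]; linarith
    have hA : Asum δ m (y / δ) =
        ∑ a ∈ Icc 1 ⌊U⌋₊, if (a : ℝ) ≤ y / δ then cofun δ m a else 0 := by
      rw [Asum, ← Finset.sum_filter]
      congr 1
      ext a
      simp only [Finset.mem_filter, Finset.mem_Icc]
      rw [Nat.le_floor_iff (by positivity), Nat.le_floor_iff hU0.le]
      constructor
      · rintro ⟨h1, h2⟩; exact ⟨⟨h1, by linarith⟩, h2⟩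
      · rintro ⟨⟨h1, _⟩, h2⟩; exact ⟨h1, h2⟩
    rw [hA, sq, Finset.sum_mul_sum, Finset.mul_sum]
    refine Finset.sum_congr rfl fun a ha => ?_
    rw [Finset.mul_sum]
    refine Finset.sum_congr rfl fun b hb => ?_
    rw [Finset.mem_Icc] at ha hb
    have ha0 : (0 : ℝ) < a := by exact_mod_cast ha.1
    have hb0 : (0 : ℝ) < b := by exact_mod_cast hb.1
    have hm0 : 0 < max (a : ℝ) b := lt_max_of_lt_left ha0
    have e2 : U / max (a : ℝ) b * (y / U) = y / max (a : ℝ) b := by field_simp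
    have hiff : δ ≤ ⌊U / max (a : ℝ) b * (y / U)⌋₊ ↔ (a : ℝ) ≤ y / δ ∧ (b : ℝ) ≤ y / δ := by
      rw [e2, Nat.le_floor_iff (by positivity), le_div_iff₀ hm0, le_div_iff₀ hd0, le_div_iff₀ hd0,
        mul_max_of_nonneg _ _ hd0.le, max_le_iff, mul_comm (a : ℝ), mul_comm (b : ℝ)]
    rw [← wfun_mul_cofun_mul_cofun m δ (by omega) (by omega)]
    by_cases h1 : (a : ℝ) ≤ y / δ
    · by_cases h2 : (b : ℝ) ≤ y / δ
      · rw [if_pos h1, if_pos h2, if_pos (hiff.2 ⟨h1, h2⟩)]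
      · rw [if_neg h2, if_neg fun h => h2 (hiff.1 h).2]; ring
    · rw [if_neg h1, if_neg fun h => h1 (hiff.1 h).1]; ring
  rw [Finset.sum_congr rfl e1, Finset.sum_comm]
  refine Finset.sum_congr rfl fun a ha => ?_
  rw [Finset.sum_comm]
  refine Finset.sum_congr rfl fun b hb => ?_
  rw [Finset.mem_Icc] at ha hb
  have ha1 : (1 : ℝ) ≤ a := by exact_mod_cast ha.1
  have haU : (a : ℝ) ≤ U := (Nat.le_floor_iff hU0.le).1 ha.2
  have hbU : (b : ℝ) ≤ U := (Nat.le_floor_iff hU0.le).1 hb.2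
  have hm1 : 1 ≤ max (a : ℝ) b := le_max_of_le_left ha1
  have hmU : max (a : ℝ) b ≤ U := max_le haU hbU
  have l1 : y / U ≤ U / max (a : ℝ) b * (y / U) :=
    le_mul_of_one_le_left (by positivity) ((one_le_div (by linarith)).2 hmU)
  have l2 : U / max (a : ℝ) b * (y / U) ≤ y := by
    have e2 : U / max (a : ℝ) b * (y / U) = y / max (a : ℝ) b := by field_simp
    rw [e2]; exact div_le_self hy0.le hm1
  rw [← Wsum_sub _ l1, Finset.mul_sum, ← Finset.sum_filter]
  refine Finset.sum_congr ?_ fun _ _ => rfl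
  ext δ
  simp only [Finset.mem_filter, Finset.mem_Ioc]
  have := Nat.floor_le_floor l2
  constructor
  · rintro ⟨⟨h1, _⟩, h3⟩; exact ⟨h1, h3⟩
  · rintro ⟨h1, h3⟩; exact ⟨⟨h1, h3.trans this⟩, h3⟩

theorem two_pow_card_primeFactors_le {n : ℕ} (hn : n ≠ 0) : 2 ^ n.primeFactors.card ≤ n :=
  calc 2 ^ n.primeFactors.card ≤ ∏ p ∈ n.primeFactors, p :=
        Finset.pow_card_le_prod _ _ _ fun _ hp => (Nat.prime_of_mem_primeFactors hp).two_le
    _ ≤ n := Nat.le_of_dvd (Nat.pos_of_ne_zero hn) (Nat.prod_primeFactors_dvd n)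

theorem card_primeFactors_mul_le (a b : ℕ) :
    (a * b).primeFactors.card ≤ a.primeFactors.card + b.primeFactors.card := by
  by_cases ha : a = 0
  · simp [ha]
  by_cases hb : b = 0
  · simp [hb]
  rw [Nat.primeFactors_mul ha hb]
  exact Finset.card_union_le _ _

open ArithmeticFunction in
theorem abs_moebius_div_psiM_le (m n : ℕ) : |(moebius n : ℝ) / psiM m n| ≤ 1 := by
  have h1 : |(moebius n : ℝ)| ≤ 1 := by exact_mod_cast abs_moebius_le_one
  have h2 : (1 : ℝ) ≤ psiM m n := by exact_mod_cast psiM_pos m n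
  rw [abs_div, abs_of_pos (by linarith : (0 : ℝ) < psiM m n)]
  exact div_le_one_of_le₀ (h1.trans h2) (by linarith)

theorem exists_large_diff : ∃ K : ℝ, 1 ≤ K ∧ ∀ m : ℕ, m ≠ 0 → ∀ U y z : ℝ, 1 ≤ U → U ≤ y → y ≤ z →
    |∑ δ ∈ Ioc ⌊y / U⌋₊ ⌊y⌋₊, wfun m δ * Asum δ m (y / δ) ^ 2 -
      ∑ δ ∈ Ioc ⌊z / U⌋₊ ⌊z⌋₊, wfun m δ * Asum δ m (z / δ) ^ 2| ≤
      K * 2 ^ m.primeFactors.card * U ^ 5 * (y / U) ^ (-(1 / 4) : ℝ) := by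
  obtain ⟨K, hK1, hK⟩ := exists_Wsum_diff
  refine ⟨K, hK1, fun m hm U y z hU hy hz => ?_⟩
  have hU0 : 0 < U := by linarith
  have hy0 : 0 < y := by linarith
  rw [sum_large_eq m hU hy, sum_large_eq m hU (hy.trans hz), ← Finset.sum_sub_distrib]
  have hterm : ∀ a ∈ Icc 1 ⌊U⌋₊, ∀ b ∈ Icc 1 ⌊U⌋₊,
      |(ArithmeticFunction.moebius a : ℝ) / psiM m a *
        ((ArithmeticFunction.moebius b : ℝ) / psiM m b) *
        (Wsum (m * a * b) (U / max (a : ℝ) b * (y / U)) - Wsum (m * a * b) (y / U)) -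
      (ArithmeticFunction.moebius a : ℝ) / psiM m a *
        ((ArithmeticFunction.moebius b : ℝ) / psiM m b) *
        (Wsum (m * a * b) (U / max (a : ℝ) b * (z / U)) - Wsum (m * a * b) (z / U))| ≤
      K * 2 ^ m.primeFactors.card * U ^ 3 * (y / U) ^ (-(1 / 4) : ℝ) := by
    intro a ha b hb
    rw [Finset.mem_Icc] at ha hb
    have ha1 : (1 : ℝ) ≤ a := by exact_mod_cast ha.1
    have haU : (a : ℝ) ≤ U := (Nat.le_floor_iff hU0.le).1 ha.2
    have hbU : (b : ℝ) ≤ U := (Nat.le_floor_iff hU0.le).1 hb.2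
    have hm1 : 1 ≤ max (a : ℝ) b := le_max_of_le_left ha1
    have hmU : max (a : ℝ) b ≤ U := max_le haU hbU
    have hα : 1 ≤ U / max (a : ℝ) b := (one_le_div (by linarith)).2 hmU
    have hα' : U / max (a : ℝ) b ≤ U := div_le_self hU0.le hm1
    have hab : m * a * b ≠ 0 := by
      simp only [ne_eq, mul_eq_zero, not_or]; omega
    have h := hK (m * a * b) hab (U / max (a : ℝ) b) (y / U) (z / U) hα (by positivity) (by gcongr)
    rw [← mul_sub, abs_mul, abs_mul]
    have hω : (2 : ℝ) ^ (m * a * b).primeFactors.card ≤ 2 ^ m.primeFactors.card * (U * U) := by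
      have h1 := card_primeFactors_mul_le (m * a) b
      have h2 := card_primeFactors_mul_le m a
      have ha2 : (2 : ℝ) ^ a.primeFactors.card ≤ U :=
        le_trans (by exact_mod_cast two_pow_card_primeFactors_le (by omega)) haU
      have hb2 : (2 : ℝ) ^ b.primeFactors.card ≤ U :=
        le_trans (by exact_mod_cast two_pow_card_primeFactors_le (by omega)) hbU
      calc (2 : ℝ) ^ (m * a * b).primeFactors.card
          ≤ 2 ^ (m.primeFactors.card + (a.primeFactors.card + b.primeFactors.card)) :=
            pow_le_pow_right₀ one_le_two (by omega)
        _ = 2 ^ m.primeFactors.card * (2 ^ a.primeFactors.card * 2 ^ b.primeFactors.card) := by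
            rw [pow_add, pow_add]
        _ ≤ _ := by gcongr
    have hlog : 1 + Real.log (U / max (a : ℝ) b) ≤ U := by
      have := Real.log_le_sub_one_of_pos (by linarith : 0 < U / max (a : ℝ) b)
      linarith
    have hlog0 := Real.log_nonneg hα
    have hb := mul_le_mul (abs_moebius_div_psiM_le m a) (abs_moebius_div_psiM_le m b)
      (abs_nonneg _) zero_le_one
    rw [one_mul] at hb
    refine (mul_le_of_le_one_left (abs_nonneg _) hb).trans (h.trans ?_)
    calc _ ≤ K * (2 ^ m.primeFactors.card * (U * U)) * U * (y / U) ^ (-(1 / 4) : ℝ) := by gcongr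
      _ = _ := by ring
  refine (Finset.abs_sum_le_sum_abs _ _).trans ?_
  have hN : ((Icc 1 ⌊U⌋₊).card : ℝ) ≤ U := by
    rw [Nat.card_Icc]; simpa using Nat.floor_le hU0.le
  set E := K * 2 ^ m.primeFactors.card * U ^ 3 * (y / U) ^ (-(1 / 4) : ℝ) with hE
  have hE0 : 0 ≤ E := by positivity
  have hin : ∀ a ∈ Icc 1 ⌊U⌋₊, |∑ b ∈ Icc 1 ⌊U⌋₊, (ArithmeticFunction.moebius a : ℝ) / psiM m a *
        ((ArithmeticFunction.moebius b : ℝ) / psiM m b) *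
        (Wsum (m * a * b) (U / max (a : ℝ) b * (y / U)) - Wsum (m * a * b) (y / U)) -
      ∑ b ∈ Icc 1 ⌊U⌋₊, (ArithmeticFunction.moebius a : ℝ) / psiM m a *
        ((ArithmeticFunction.moebius b : ℝ) / psiM m b) *
        (Wsum (m * a * b) (U / max (a : ℝ) b * (z / U)) - Wsum (m * a * b) (z / U))| ≤ U * E := by
    intro a ha
    rw [← Finset.sum_sub_distrib]
    refine (Finset.abs_sum_le_sum_abs _ _).trans ((Finset.sum_le_card_nsmul _ _ _ (hterm a ha)).trans ?_)
    rw [nsmul_eq_mul]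
    gcongr
  refine (Finset.sum_le_card_nsmul _ _ _ hin).trans ?_
  rw [nsmul_eq_mul]
  calc _ ≤ U * (U * E) := by gcongr
    _ = _ := by rw [hE]; ring

theorem exists_small_bound : ∃ c K : ℝ, 0 < c ∧ c ≤ 1 / 8 ∧ 0 < K ∧ ∀ m : ℕ, m ≠ 0 →
    ∀ U y : ℝ, 1 ≤ U → U ≤ y →
    |∑ δ ∈ Icc 1 ⌊y / U⌋₊, wfun m δ * Asum δ m (y / δ) ^ 2| ≤
      K * Qfac m ^ 2 * (1 + Real.log y) * Real.exp (-(2 * c * vkE (Real.log U))) := by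
  obtain ⟨c, C, hc, hc8, hC, hA⟩ := exists_Asum_bound
  obtain ⟨K, hK1, hK⟩ := exists_wfun_Rfac_sum
  refine ⟨c, C ^ 2 * K, hc, hc8, by positivity, fun m hm U y hU hy => ?_⟩
  have hU0 : 0 < U := by linarith
  have hy0 : 0 < y := by linarith
  set E := C * Qfac m * Real.exp (-(c * vkE (Real.log U))) with hE
  have hterm : ∀ δ ∈ Icc 1 ⌊y / U⌋₊, |wfun m δ * Asum δ m (y / δ) ^ 2| ≤
      wfun m δ * Rfac δ ^ 2 * E ^ 2 := by
    intro δ hδ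
    rw [Finset.mem_Icc] at hδ
    have hd0 : (0 : ℝ) < δ := by exact_mod_cast hδ.1
    have hd : (δ : ℝ) ≤ y / U := (Nat.le_floor_iff (by positivity)).1 hδ.2
    have hUd : U ≤ y / δ := by
      rw [le_div_iff₀ hU0] at hd
      rw [le_div_iff₀ hd0]; linarith
    have h := hA δ m (by omega) hm (y / δ) (hU.trans hUd)
    have hv : vkE (Real.log U) ≤ vkE (Real.log (y / δ)) := vkE_mono (Real.log_le_log hU0 hUd)
    have hR : 0 ≤ Rfac δ := Finset.prod_nonneg fun p _ => by positivity
    have hQ : 0 ≤ Qfac m := Finset.prod_nonneg fun p _ => by positivity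
    have h2 : |Asum δ m (y / δ)| ≤ Rfac δ * E := by
      calc _ ≤ _ := h
        _ ≤ C * Qfac m * Rfac δ * Real.exp (-(c * vkE (Real.log U))) := by gcongr
        _ = _ := by rw [hE]; ring
    rw [abs_mul, abs_of_nonneg (wfun_nonneg m δ), abs_pow, mul_assoc, ← mul_pow]
    exact mul_le_mul_of_nonneg_left (pow_le_pow_left₀ (abs_nonneg _) h2 2) (wfun_nonneg m δ)
  refine (Finset.abs_sum_le_sum_abs _ _).trans ((Finset.sum_le_sum hterm).trans ?_)
  rw [← Finset.sum_mul]
  have h1 := hK m (y / U) ((one_le_div hU0).2 hy)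
  have h2 : Real.log (y / U) ≤ Real.log y :=
    Real.log_le_log (by positivity) (div_le_self hy0.le hU)
  calc _ ≤ K * (1 + Real.log y) * E ^ 2 := by
        refine mul_le_mul_of_nonneg_right (h1.trans ?_) (sq_nonneg _)
        gcongr
    _ = _ := by
        have : Real.exp (-(2 * c * vkE (Real.log U))) =
            Real.exp (-(c * vkE (Real.log U))) ^ 2 := by
          rw [← Real.exp_nat_mul]; congr 1; push_cast; ring
        rw [hE, this]; ring

theorem vkExp_mul_le {k a : ℝ} (hk : 1 ≤ k) (ha : Real.exp 1 ≤ a) :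
    vkExp (k * a) ≤ k * vkExp a := by
  have ha0 : 0 < a := (Real.exp_pos 1).trans_le ha
  have l1 := one_le_log_of_exp_le ha
  have l2 : Real.log a ≤ Real.log (k * a) := Real.log_le_log ha0 (by nlinarith)
  have hk1 : k ^ ((3 : ℝ) / 5) ≤ k := by
    nth_rw 2 [← Real.rpow_one k]
    exact Real.rpow_le_rpow_of_exponent_le hk (by norm_num)
  unfold vkExp
  rw [Real.mul_rpow (by linarith) ha0.le, mul_div_assoc]
  have l3 : 0 ≤ Real.log (k * a) := by linarith
  gcongr

theorem vkE_le_mul {k : ℝ} (hk : 1 ≤ k) (l : ℝ) : vkE l ≤ k * vkE (l / k) := by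
  have hk0 : 0 < k := by linarith
  have h : max l (Real.exp 1) ≤ k * max (l / k) (Real.exp 1) := by
    have h1 : l = k * (l / k) := by field_simp
    have h2 := Real.exp_pos 1
    refine max_le ?_ ?_
    · nth_rw 1 [h1]; gcongr; exact le_max_left _ _
    · have := le_max_right (l / k) (Real.exp 1)
      nlinarith
  exact (vkExp_mono (le_max_right _ _) h).trans (vkExp_mul_le hk (le_max_right _ _))

theorem exists_le_exp_vkE {a : ℝ} (ha : 0 < a) :
    ∃ C > (0 : ℝ), ∀ l : ℝ, l ≤ C * Real.exp (a * vkE l) := by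
  obtain ⟨C, hC, h⟩ := exists_pow_le_exp 2 ha
  obtain ⟨L, hL⟩ := eventually_atTop.1 eventually_log_sq_le
  set L₀ := max L (Real.exp 1) with hL0
  have hLp : 0 < L₀ := (Real.exp_pos 1).trans_le (le_max_right _ _)
  refine ⟨L₀ + C, by positivity, fun l => ?_⟩
  have hv := vkE_pos l
  have he : 1 ≤ Real.exp (a * vkE l) := Real.one_le_exp (by positivity)
  have h1 := h (vkE l) hv.le
  by_cases hl : L₀ ≤ l
  · have hle : Real.exp 1 ≤ l := (le_max_right _ _).trans hl
    have h2 := vkExp_sq_ge hle (hL l ((le_max_left _ _).trans hl))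
    have h3 : vkExp l = vkE l := by rw [vkE, max_eq_left hle]
    rw [h3] at h2
    nlinarith
  · push Not at hl
    nlinarith

theorem Qfac_sq_le : ∃ K : ℝ, 1 ≤ K ∧ ∀ m : ℕ, Qfac m ^ 2 ≤ K * Real.sqrt (psi m) := by
  obtain ⟨K, hK1, hK⟩ := exists_prod_primeFactors_le (show (1 : ℝ) ≤ 16 by norm_num)
    (show (0 : ℝ) < 1 / 4 by norm_num)
  refine ⟨K, hK1, fun m => ?_⟩
  have e : Qfac m ^ 2 = (∏ p ∈ m.primeFactors, (16 * (p : ℝ) ^ (-(1 / 4) : ℝ))) *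
      ∏ p ∈ m.primeFactors, (p : ℝ) ^ (1 / 2 : ℝ) := by
    rw [Qfac, ← Finset.prod_pow, ← Finset.prod_mul_distrib]
    refine Finset.prod_congr rfl fun p hp => ?_
    have hp0 : (0 : ℝ) < p := by exact_mod_cast (Nat.prime_of_mem_primeFactors hp).pos
    have e2 : ((p : ℝ) ^ (1 / 8 : ℝ)) ^ 2 = (p : ℝ) ^ (1 / 4 : ℝ) := by
      rw [← Real.rpow_natCast, ← Real.rpow_mul hp0.le]
      norm_num
    rw [mul_pow, mul_assoc, ← Real.rpow_add hp0, e2]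
    norm_num
  have h2 : ∏ p ∈ m.primeFactors, (p : ℝ) ^ (1 / 2 : ℝ) ≤ Real.sqrt (psi m) := by
    rw [Real.finsetProd_rpow _ _ (fun p _ => by positivity), Real.sqrt_eq_rpow]
    refine Real.rpow_le_rpow (Finset.prod_nonneg fun p _ => by positivity) ?_ (by norm_num)
    have : ∏ p ∈ m.primeFactors, p ≤ psi m := Finset.prod_le_prod' fun p _ => Nat.le_succ p
    rw [← Nat.cast_prod]
    exact_mod_cast this
  rw [e]
  exact mul_le_mul (hK m) h2 (Finset.prod_nonneg fun p _ => by positivity) (by linarith)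

theorem two_pow_card_le_Qfac_sq (m : ℕ) : (2 : ℝ) ^ m.primeFactors.card ≤ Qfac m ^ 2 := by
  rw [Qfac, ← Finset.prod_pow, ← Finset.prod_const]
  refine Finset.prod_le_prod (fun _ _ => by norm_num) fun p hp => ?_
  have hp1 : (1 : ℝ) ≤ p := by exact_mod_cast (Nat.prime_of_mem_primeFactors hp).one_lt.le
  nlinarith [Real.one_le_rpow hp1 (show (0 : ℝ) ≤ 1 / 8 by norm_num)]

/-- Comparison of `T` at `y` and `z` for `y ≤ z ≤ y²`. -/
theorem exists_T_step : ∃ c B : ℝ, 0 < c ∧ 0 < B ∧ ∀ m : ℕ, m ≠ 0 → ∀ l l' : ℝ, 1 ≤ l → l ≤ l' →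
    l' ≤ 2 * l → |T (Real.exp l') m - T (Real.exp l) m| ≤
      B / Real.sqrt (psi m) * Real.exp (-(c * vkE l)) := by
  obtain ⟨c, K₁, hc, hc8, hK₁, hsmall⟩ := exists_small_bound
  obtain ⟨K₂, hK₂, hlarge⟩ := exists_large_diff
  obtain ⟨K₃, hK₃, hQ⟩ := Qfac_sq_le
  obtain ⟨K₄, hK₄, hl⟩ := exists_le_exp_vkE (show 0 < c / 42 by positivity)
  refine ⟨c / 42, 6 / Real.pi ^ 2 * ((6 * K₁ * K₄ + K₂ * Real.exp 3) * K₃), by positivity,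
    by positivity, fun m hm l l' h1 hll hl2 => ?_⟩
  set U := Real.exp (l / 42) with hU
  set y := Real.exp l with hy
  set z := Real.exp l' with hz
  set v := vkE l with hv
  have hv0 : 0 < v := vkE_pos l
  have hU1 : 1 ≤ U := Real.one_le_exp (by linarith)
  have hUy : U ≤ y := Real.exp_le_exp.2 (by linarith)
  have hyz : y ≤ z := Real.exp_le_exp.2 hll
  have hψ : (0 : ℝ) < psi m := by exact_mod_cast psi_pos m
  set ε := Real.exp (-(c / 42 * v)) with hε
  have hεl : l * Real.exp (-(2 * c * vkE (Real.log U))) ≤ K₄ * ε := by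
    rw [hU, Real.log_exp]
    have a1 := vkE_le_mul (show (1 : ℝ) ≤ 42 by norm_num) l
    have a2 := hl l
    calc _ ≤ K₄ * Real.exp (c / 42 * v) * Real.exp (-(2 * c * vkE (l / 42))) := by gcongr
      _ = K₄ * Real.exp (c / 42 * v - 2 * c * vkE (l / 42)) := by
          rw [mul_assoc, ← Real.exp_add]; rfl
      _ ≤ _ := by
          rw [hε]
          refine mul_le_mul_of_nonneg_left (Real.exp_le_exp.2 ?_) hK₄.le
          have : c * v ≤ c * (42 * vkE (l / 42)) := by gcongr
          linarith
  have hεU : U ^ 5 * (y / U) ^ (-(1 / 4) : ℝ) ≤ Real.exp 3 * ε := by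
    rw [hU, hy, ← Real.exp_sub, ← Real.exp_mul, ← Real.exp_nat_mul, ← Real.exp_add, hε,
      ← Real.exp_add]
    apply Real.exp_le_exp.2
    have := vkE_le (show 0 ≤ l by linarith)
    rw [← hv] at this
    push_cast
    nlinarith
  have hs : ∀ x, y ≤ x → x ≤ z → |∑ δ ∈ Icc 1 ⌊x / U⌋₊, wfun m δ * Asum δ m (x / δ) ^ 2| ≤
      Qfac m ^ 2 * (3 * K₁ * K₄ * ε) := by
    intro x hx hxz
    refine (hsmall m hm U x hU1 (hUy.trans hx)).trans ?_
    have hlx : Real.log x ≤ 2 * l := by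
      rw [Real.log_le_iff_le_exp (by linarith)]
      exact hxz.trans (Real.exp_le_exp.2 hl2)
    calc _ ≤ K₁ * Qfac m ^ 2 * (3 * l) * Real.exp (-(2 * c * vkE (Real.log U))) := by
          gcongr; linarith
      _ = 3 * K₁ * Qfac m ^ 2 * (l * Real.exp (-(2 * c * vkE (Real.log U)))) := by ring
      _ ≤ 3 * K₁ * Qfac m ^ 2 * (K₄ * ε) := by gcongr
      _ = _ := by ring
  have hlg := hlarge m hm U y z hU1 hUy hyz
  have hlg' : K₂ * 2 ^ m.primeFactors.card * U ^ 5 * (y / U) ^ (-(1 / 4) : ℝ) ≤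
      Qfac m ^ 2 * (K₂ * Real.exp 3 * ε) := by
    calc _ = K₂ * 2 ^ m.primeFactors.card * (U ^ 5 * (y / U) ^ (-(1 / 4) : ℝ)) := by ring
      _ ≤ K₂ * Qfac m ^ 2 * (Real.exp 3 * ε) := by
          gcongr; exact two_pow_card_le_Qfac_sq m
      _ = _ := by ring
  have hsplit : ∀ x, U ≤ x → T x m = 6 / Real.pi ^ 2 / psi m *
      (∑ δ ∈ Icc 1 ⌊x / U⌋₊, wfun m δ * Asum δ m (x / δ) ^ 2 +
        ∑ δ ∈ Ioc ⌊x / U⌋₊ ⌊x⌋₊, wfun m δ * Asum δ m (x / δ) ^ 2) := by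
    intro x hx
    have e : ∀ N : ℕ, Finset.Icc 1 N = Finset.Ioc 0 N := fun N => rfl
    rw [T_eq x hm, e, e, Finset.sum_Ioc_consecutive _ (Nat.zero_le _)
      (Nat.floor_le_floor (div_le_self (by linarith) hU1))]
  have hsy := hs y le_rfl hyz
  have hsz := hs z hyz le_rfl
  have hmain : |T z m - T y m| ≤ 6 / Real.pi ^ 2 / psi m *
      (Qfac m ^ 2 * ((6 * K₁ * K₄ + K₂ * Real.exp 3) * ε)) := by
    rw [hsplit z (hUy.trans hyz), hsplit y hUy, ← mul_sub, abs_mul,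
      abs_of_pos (by positivity : 0 < 6 / Real.pi ^ 2 / (psi m : ℝ))]
    refine mul_le_mul_of_nonneg_left ?_ (by positivity)
    have := hlg.trans hlg'
    rw [abs_le] at hsy hsz this ⊢
    constructor <;> linarith
  refine hmain.trans ?_
  have hsq : Real.sqrt (psi m) * Real.sqrt (psi m) = psi m := Real.mul_self_sqrt hψ.le
  have hsq0 : 0 < Real.sqrt (psi m) := Real.sqrt_pos.2 hψ
  calc _ ≤ 6 / Real.pi ^ 2 / psi m *
      (K₃ * Real.sqrt (psi m) * ((6 * K₁ * K₄ + K₂ * Real.exp 3) * ε)) := by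
        gcongr; exact hQ m
    _ = _ := by
        nth_rw 1 [← hsq]
        field_simp

theorem exists_sum_vkE {c : ℝ} (hc : 0 < c) : ∃ K > (0 : ℝ), ∀ l : ℝ, 1 ≤ l → ∀ k : ℕ,
    ∑ j ∈ Finset.range k, Real.exp (-(c * vkE (2 ^ j * l))) ≤ K * Real.exp (-(c / 2 * vkE l)) := by
  obtain ⟨C, hC, h⟩ := exists_le_exp_vkE (show 0 < c / 2 by positivity)
  refine ⟨C * 2, by positivity, fun l hl k => ?_⟩
  have hterm : ∀ j ∈ Finset.range k, Real.exp (-(c * vkE (2 ^ j * l))) ≤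
      (1 / 2 : ℝ) ^ j * (C * Real.exp (-(c / 2 * vkE l))) := by
    intro j _
    have h2 : (1 : ℝ) ≤ 2 ^ j := one_le_pow₀ one_le_two
    have v1 : vkE l ≤ vkE (2 ^ j * l) := vkE_mono (by nlinarith)
    have v2 : vkE (2 ^ j) ≤ vkE (2 ^ j * l) := vkE_mono (by nlinarith)
    have h3 : Real.exp (-(c / 2 * vkE (2 ^ j))) ≤ (1 / 2 : ℝ) ^ j * C := by
      rw [Real.exp_neg, inv_le_comm₀ (Real.exp_pos _) (by positivity), one_div, inv_pow,
        mul_inv, inv_inv, ← div_eq_mul_inv, div_le_iff₀ hC, mul_comm]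
      exact h _
    calc _ ≤ Real.exp (-(c / 2 * vkE (2 ^ j))) * Real.exp (-(c / 2 * vkE l)) := by
          rw [← Real.exp_add]
          apply Real.exp_le_exp.2
          nlinarith
      _ ≤ (1 / 2 : ℝ) ^ j * C * Real.exp (-(c / 2 * vkE l)) := by gcongr
      _ = _ := by ring
  refine (Finset.sum_le_sum hterm).trans ?_
  rw [← Finset.sum_mul]
  calc _ ≤ 2 * (C * Real.exp (-(c / 2 * vkE l))) := by
        gcongr; exact sum_geometric_two_le k
    _ = _ := by ring

theorem abs_sub_le_sum_of_step {t : ℝ → ℝ} {B c : ℝ} (hB : 0 ≤ B)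
    (h : ∀ l l' : ℝ, 1 ≤ l → l ≤ l' → l' ≤ 2 * l → |t l' - t l| ≤ B * Real.exp (-(c * vkE l)))
    (k : ℕ) : ∀ l l' : ℝ, 1 ≤ l → l ≤ l' → l' ≤ 2 ^ k * l →
      |t l' - t l| ≤ B * ∑ j ∈ Finset.range k, Real.exp (-(c * vkE (2 ^ j * l))) := by
  induction k with
  | zero =>
    intro l l' _ h2 h3
    have : l' = l := le_antisymm (by simpa using h3) h2
    simp [this]
  | succ k ih =>
    intro l l' h1 h2 h3
    rw [Finset.sum_range_succ', mul_add, pow_zero, one_mul]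
    by_cases hl : l' ≤ 2 * l
    · refine (h l l' h1 h2 hl).trans (le_add_of_nonneg_left ?_)
      exact mul_nonneg hB (Finset.sum_nonneg fun j _ => (Real.exp_pos _).le)
    · push Not at hl
      have a1 := ih (2 * l) l' (by linarith) hl.le (by rw [pow_succ] at h3; linarith)
      have a2 := h l (2 * l) h1 (by linarith) le_rfl
      have e : ∀ j ∈ Finset.range k, Real.exp (-(c * vkE (2 ^ j * (2 * l)))) =
          Real.exp (-(c * vkE (2 ^ (j + 1) * l))) := fun j _ => by
        rw [pow_succ, mul_assoc]
      rw [Finset.sum_congr rfl e] at a1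
      calc |t l' - t l| ≤ |t l' - t (2 * l)| + |t (2 * l) - t l| := abs_sub_le _ _ _
        _ ≤ _ := add_le_add a1 a2

theorem exists_limit_of_step {c : ℝ} (hc : 0 < c) : ∃ K > (0 : ℝ), ∀ (t : ℝ → ℝ) (B : ℝ), 0 ≤ B →
    (∀ l l' : ℝ, 1 ≤ l → l ≤ l' → l' ≤ 2 * l → |t l' - t l| ≤ B * Real.exp (-(c * vkE l))) →
    ∃ L : ℝ, Tendsto t atTop (nhds L) ∧
      ∀ l : ℝ, 1 ≤ l → |t l - L| ≤ K * B * Real.exp (-(c / 2 * vkE l)) := by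
  obtain ⟨K, hK, hsum⟩ := exists_sum_vkE hc
  refine ⟨K, hK, fun t B hB h => ?_⟩
  have key : ∀ l l' : ℝ, 1 ≤ l → l ≤ l' → |t l' - t l| ≤ K * B * Real.exp (-(c / 2 * vkE l)) := by
    intro l l' h1 h2
    obtain ⟨k, hk⟩ := pow_unbounded_of_one_lt l' (one_lt_two (α := ℝ))
    have h3 : l' ≤ 2 ^ k * l := hk.le.trans (le_mul_of_one_le_right (by positivity) h1)
    refine (abs_sub_le_sum_of_step hB h k l l' h1 h2 h3).trans ?_
    calc _ ≤ B * (K * Real.exp (-(c / 2 * vkE l))) := by gcongr; exact hsum l h1 k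
      _ = _ := by ring
  have hdecay : Tendsto (fun l : ℝ => K * B * Real.exp (-(c / 2 * vkE l))) atTop (nhds 0) := by
    have hv : Tendsto vkE atTop atTop := by
      refine tendsto_vkExp.congr' ?_
      filter_upwards [eventually_ge_atTop (Real.exp 1)] with l hl
      rw [vkE, max_eq_left hl]
    have := (Real.tendsto_exp_neg_atTop_nhds_zero.comp
      (hv.const_mul_atTop (show 0 < c / 2 by positivity))).const_mul (K * B)
    rw [mul_zero] at this
    exact this
  have hcauchy : CauchySeq t := by
    rw [Metric.cauchySeq_iff']
    intro ε hε
    obtain ⟨N, hN⟩ := eventually_atTop.1 (hdecay.eventually_lt_const hε)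
    refine ⟨max N 1, fun n hn => ?_⟩
    rw [Real.dist_eq]
    exact (key (max N 1) n (le_max_right _ _) hn).trans_lt (hN _ (le_max_left _ _))
  obtain ⟨L, hL⟩ := cauchySeq_tendsto_of_complete hcauchy
  refine ⟨L, hL, fun l hl => ?_⟩
  have h1 : Tendsto (fun l' => |t l - t l'|) atTop (nhds |t l - L|) := (hL.const_sub (t l)).abs
  refine le_of_tendsto h1 ?_
  filter_upwards [eventually_ge_atTop l] with l' hl'
  rw [abs_sub_comm]
  exact key l l' hl hl'

theorem exists_vkExp_le_vkE : ∃ b : ℝ, ∀ l : ℝ, Real.log 3 ≤ l → vkExp l ≤ vkE l + b := by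
  have h3 : 1 < Real.log 3 := by
    rw [Real.lt_log_iff_exp_lt (by norm_num)]
    linarith [Real.exp_one_lt_d9]
  have hll : 0 < Real.log (Real.log 3) := Real.log_pos h3
  refine ⟨Real.exp 1 ^ ((3 : ℝ) / 5) / Real.log (Real.log 3) ^ ((1 : ℝ) / 5), fun l hl => ?_⟩
  by_cases h : Real.exp 1 ≤ l
  · rw [vkE, max_eq_left h]
    have : 0 ≤ Real.exp 1 ^ ((3 : ℝ) / 5) / Real.log (Real.log 3) ^ ((1 : ℝ) / 5) := by positivity
    linarith
  · push Not at h
    have h2 : Real.log (Real.log 3) ≤ Real.log l := Real.log_le_log (by linarith) hl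
    have h4 : vkExp l ≤ Real.exp 1 ^ ((3 : ℝ) / 5) / Real.log (Real.log 3) ^ ((1 : ℝ) / 5) := by
      unfold vkExp
      gcongr
      linarith
    linarith [vkE_pos l]

end VK

theorem stmt10 :
    ∃ Tlim : ℕ → ℝ,
      (∀ m : ℕ, 1 ≤ m → Tendsto (fun y : ℝ => T y m) atTop (nhds (Tlim m))) ∧
      ∃ c > (0 : ℝ), ∃ C > (0 : ℝ), ∀ m : ℕ, 1 ≤ m → ∀ y : ℝ, 3 ≤ y →
        |T y m - Tlim m| ≤ C / ((curlyL y) ^ c * Real.sqrt (psi m)) := by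
  obtain ⟨c, B, hc, hB, hstep⟩ := VK.exists_T_step
  obtain ⟨K, hK, hlim⟩ := VK.exists_limit_of_step hc
  obtain ⟨b, hb⟩ := VK.exists_vkExp_le_vkE
  have hex : ∀ m : ℕ, ∃ L : ℝ, 1 ≤ m → Tendsto (fun l => T (Real.exp l) m) atTop (nhds L) ∧
      ∀ l : ℝ, 1 ≤ l → |T (Real.exp l) m - L| ≤
        K * (B / Real.sqrt (psi m)) * Real.exp (-(c / 2 * VK.vkE l)) := by
    intro m
    by_cases hm : 1 ≤ m
    · obtain ⟨L, hL⟩ := hlim (fun l => T (Real.exp l) m) (B / Real.sqrt (psi m)) (by positivity)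
        (hstep m (by omega))
      exact ⟨L, fun _ => hL⟩
    · exact ⟨0, fun h => absurd h hm⟩
  choose L hL using hex
  refine ⟨L, fun m hm => ?_, c / 2, by positivity, K * B * Real.exp (c / 2 * b), by positivity,
    fun m hm y hy => ?_⟩
  · refine ((hL m hm).1.comp Real.tendsto_log_atTop).congr' ?_
    filter_upwards [eventually_gt_atTop 0] with y hy
    simp only [Function.comp_apply, Real.exp_log hy]
  · have hy0 : 0 < y := by linarith
    have hl3 : Real.log 3 ≤ Real.log y := Real.log_le_log (by norm_num) hy
    have hl1 : 1 ≤ Real.log y := by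
      rw [Real.le_log_iff_exp_le hy0]
      linarith [Real.exp_one_lt_d9]
    have h := (hL m hm).2 (Real.log y) hl1
    rw [Real.exp_log hy0] at h
    refine h.trans ?_
    have hψ : (0 : ℝ) < psi m := by exact_mod_cast VK.psi_pos m
    have hs0 : 0 < Real.sqrt (psi m) := Real.sqrt_pos.2 hψ
    have e : curlyL y ^ (c / 2) = Real.exp (c / 2 * VK.vkExp (Real.log y)) := by
      rw [curlyL, ← Real.exp_mul, mul_comm]; rfl
    rw [e]
    have h2 : Real.exp (-(c / 2 * VK.vkE (Real.log y))) ≤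
        Real.exp (c / 2 * b) / Real.exp (c / 2 * VK.vkExp (Real.log y)) := by
      rw [← Real.exp_sub]
      apply Real.exp_le_exp.2
      have : c / 2 * VK.vkExp (Real.log y) ≤ c / 2 * (VK.vkE (Real.log y) + b) := by
        gcongr; exact hb _ hl3
      linarith
    calc _ ≤ K * (B / Real.sqrt (psi m)) *
          (Real.exp (c / 2 * b) / Real.exp (c / 2 * VK.vkExp (Real.log y))) := by gcongr
      _ = _ := by field_simp
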